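/- Let N ≥ 4 be an integer and let p > (N+1)/(N−3). Then there exists a constant C* > 0, depending only on N and p, such that for every smooth vector field a : ℝ^N → ℝ^N satisfying |a(x)| ≤ C*/(|x|+1) for all x ∈ ℝ^N, the equation −Δu + a(x)·∇u = u^p admits a positive classical solution u on ℝ^N. -/

import Mathlib

open MeasureTheory Real Filter
open scoped InnerProductSpace ENNReal Topology

noncomputable section

/-- Euclidean space ℝ^N. -/
abbrev Euc (N : ℕ) := EuclideanSpace ℝ (Fin N)

/-- The Laplacian of a real-valued function on ℝ^N, as the sum of
the second partial derivatives in the coordinate directions. -/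
def lap {N : ℕ} (u : Euc N → ℝ) (x : Euc N) : ℝ :=
  ∑ i : Fin N,
    fderiv ℝ (fun y => fderiv ℝ u y (EuclideanSpace.single i 1)) x
      (EuclideanSpace.single i 1)

/-- The divergence of a vector field on ℝ^N. -/
def divg {N : ℕ} (a : Euc N → Euc N) (x : Euc N) : ℝ :=
  ∑ i : Fin N, fderiv ℝ a x (EuclideanSpace.single i 1) i

/-- The advection term `a(x) · ∇u(x)`. -/
def adv {N : ℕ} (a : Euc N → Euc N) (u : Euc N → ℝ) (x : Euc N) : ℝ :=
  ⟪a x, gradient u x⟫_ℝ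

/-- `u` is a positive smooth solution of `-Δu + a(x)·∇u = u^p` in the open set `Ω`. -/
def IsSolution {N : ℕ} (a : Euc N → Euc N) (p : ℝ) (Ω : Set (Euc N))
    (u : Euc N → ℝ) : Prop :=
  ContDiffOn ℝ (⊤ : ℕ∞) u Ω ∧ (∀ x ∈ Ω, 0 < u x) ∧
    ∀ x ∈ Ω, -lap u x + adv a u x = u x ^ p

/-- `u` is a stable solution of `-Δu + a(x)·∇u = u^p` in `Ω`: it is a positive smooth
solution and there is a smooth positive `E` with `-ΔE + a(x)·∇E ≥ p u^(p-1) E` in `Ω`. -/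
def IsStableSolution {N : ℕ} (a : Euc N → Euc N) (p : ℝ) (Ω : Set (Euc N))
    (u : Euc N → ℝ) : Prop :=
  IsSolution a p Ω u ∧
    ∃ E : Euc N → ℝ, ContDiffOn ℝ (⊤ : ℕ∞) E Ω ∧ (∀ x ∈ Ω, 0 < E x) ∧
      ∀ x ∈ Ω, p * u x ^ (p - 1) * E x ≤ -lap E x + adv a E x

/-- The Joseph–Lundgren exponent for `N ≥ 11`. -/
def pJL (N : ℕ) : ℝ :=
  (((N : ℝ) - 2) ^ 2 - 4 * N + 8 * Real.sqrt ((N : ℝ) - 1)) /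
    (((N : ℝ) - 2) * ((N : ℝ) - 10))

set_option autoImplicit false
set_option linter.all false

namespace PS

open Set Metric
open scoped Pointwise

variable {N : ℕ} [hN4 : Fact (4 ≤ N)]

lemma N4 (N : ℕ) [h : Fact (4 ≤ N)] : 4 ≤ N := h.out
lemma N4r (N : ℕ) [h : Fact (4 ≤ N)] : (4 : ℝ) ≤ N := by exact_mod_cast h.out

instance : Nontrivial (Euc N) := by
  apply Module.nontrivial_of_finrank_pos (R := ℝ)
  rw [finrank_euclideanSpace_fin]; have := N4 N; omega

/-- unit sphere -/
abbrev Sph (N : ℕ) := sphere (0 : Euc N) 1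

/-- total area of the sphere -/
def area (N : ℕ) : ℝ := ((volume : Measure (Euc N)).toSphere).real univ

/-- normalised measure on the sphere -/
def mu (N : ℕ) : Measure (Sph N) :=
  ((volume : Measure (Euc N)).toSphere univ)⁻¹ • (volume : Measure (Euc N)).toSphere

lemma toSph_ne : (volume : Measure (Euc N)).toSphere univ ≠ 0 := by
  rw [Ne, Measure.measure_univ_eq_zero]; exact Measure.toSphere_ne_zero _

lemma area_pos : 0 < area N := by
  unfold area Measure.real
  exact ENNReal.toReal_pos toSph_ne (measure_ne_top _ _)

instance : IsProbabilityMeasure (mu N) := ⟨by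
  simp only [mu, Measure.smul_apply, smul_eq_mul]
  exact ENNReal.inv_mul_cancel toSph_ne (measure_ne_top _ _)⟩

lemma toSphere_eq : (volume : Measure (Euc N)).toSphere = (ENNReal.ofReal (area N)) • mu N := by
  rw [area, Measure.real, ENNReal.ofReal_toReal (measure_ne_top _ _), mu, smul_smul,
    ENNReal.mul_inv_cancel toSph_ne (measure_ne_top _ _), one_smul]

lemma sph_norm (ω : Sph N) : ‖(ω : Euc N)‖ = 1 := by simpa using ω.2

/-- polar coordinates -/
lemma polar_aux {F : Euc N → ℝ} (hF : Integrable F) :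
    Integrable (fun q : Sph N × Ioi (0:ℝ) => F (q.2.1 • q.1.1))
      ((volume : Measure (Euc N)).toSphere.prod (.volumeIoiPow (N - 1))) ∧
    ∫ x, F x = ∫ q : Sph N × Ioi (0:ℝ), F (q.2.1 • q.1.1)
      ∂((volume : Measure (Euc N)).toSphere.prod (.volumeIoiPow (N - 1))) := by
  have mp := (volume : Measure (Euc N)).measurePreserving_homeomorphUnitSphereProd
  rw [finrank_euclideanSpace_fin] at mp
  have me := (homeomorphUnitSphereProd (Euc N)).measurableEmbedding
  have key : ∀ x : ({(0)}ᶜ : Set (Euc N)), F (((homeomorphUnitSphereProd (Euc N)) x).2.1 •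
      ((homeomorphUnitSphereProd (Euc N)) x).1.1) = F x := by
    intro x
    rw [← homeomorphUnitSphereProd_symm_apply_coe, Homeomorph.symm_apply_apply]
  constructor
  · rw [← mp.integrable_comp_emb me]
    have : ((fun q : Sph N × Ioi (0:ℝ) => F (q.2.1 • q.1.1)) ∘ (homeomorphUnitSphereProd (Euc N)))
      = F ∘ Subtype.val := by
      ext x; exact key x
    rw [this, ← integrableOn_iff_comap_subtypeVal (measurableSet_singleton _).compl]
    exact hF.integrableOn
  · rw [← mp.integral_comp me]
    simp only [key]
    rw [integral_subtype_comap (measurableSet_singleton _).compl F, restrict_compl_singleton]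

lemma polar {F : Euc N → ℝ} (hF : Integrable F) :
    IntegrableOn (fun s => s ^ (N - 1) * ∫ ω : Sph N, F (s • (ω : Euc N)) ∂(mu N)) (Ioi (0:ℝ)) ∧
    ∫ x, F x = area N * ∫ s in Ioi (0:ℝ), s ^ (N - 1) *
      ∫ ω : Sph N, F (s • (ω : Euc N)) ∂(mu N) := by
  obtain ⟨h1, h2⟩ := polar_aux hF
  have h3 : ∫ x, F x = ∫ s : Ioi (0:ℝ), (∫ ω : Sph N, F (s.1 • (ω : Euc N))
      ∂(volume : Measure (Euc N)).toSphere) ∂(.volumeIoiPow (N - 1)) := by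
    rw [h2]; exact integral_prod_symm _ h1
  have h4 := h1.integral_prod_right
  have e : ∀ s : ℝ, ∫ ω : Sph N, F (s • (ω : Euc N)) ∂(volume : Measure (Euc N)).toSphere
      = area N * ∫ ω : Sph N, F (s • (ω : Euc N)) ∂(mu N) := by
    intro s
    rw [toSphere_eq, integral_smul_measure, ENNReal.toReal_ofReal area_pos.le, smul_eq_mul]
  simp only [e] at h3 h4
  constructor
  · rw [Measure.volumeIoiPow, integrable_withDensity_iff_integrable_smul' (by fun_prop) (by simp)]
      at h4
    have h5 := h4.const_mul (area N)⁻¹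
    rw [integrableOn_iff_comap_subtypeVal measurableSet_Ioi]
    refine h5.congr (.of_forall ?_)
    rintro ⟨s, hs⟩
    have hs' : (0:ℝ) < s := hs
    have := area_pos (N := N)
    simp (disch := positivity) only [smul_eq_mul, Function.comp, ENNReal.toReal_ofReal]
    field_simp
  · rw [h3]
    simp only [Measure.volumeIoiPow, ENNReal.ofReal]
    rw [integral_withDensity_eq_integral_smul,
        integral_subtype_comap measurableSet_Ioi fun a : ℝ ↦ Real.toNNReal (a ^ (N - 1)) •
          (area N * ∫ ω : Sph N, F (a • (ω : Euc N)) ∂(mu N)), ← integral_const_mul,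
        setIntegral_congr_fun measurableSet_Ioi fun x hx ↦ ?_]
    · rw [NNReal.smul_def, Real.coe_toNNReal _ (pow_nonneg hx.out.le _), smul_eq_mul]; ring
    · exact (measurable_subtype_coe.pow_const _).real_toNNReal

lemma radial_integrable {f : ℝ → ℝ} : Integrable (fun x : Euc N => f ‖x‖) ↔
    IntegrableOn (fun s => s ^ (N - 1) * f s) (Ioi (0:ℝ)) := by
  have := integrable_fun_norm_addHaar (E := Euc N) volume (f := f)
  rw [finrank_euclideanSpace_fin] at this
  simpa using this

/-- sphere map of an isometry -/
def sphMap (L : Euc N ≃ₗᵢ[ℝ] Euc N) (ω : Sph N) : Sph N := ⟨L ω, by simp⟩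

lemma sphMap_cont (L : Euc N ≃ₗᵢ[ℝ] Euc N) : Continuous (sphMap L) := by
  unfold sphMap; fun_prop

lemma sphMap_toSphere (L : Euc N ≃ₗᵢ[ℝ] Euc N) :
    MeasurePreserving (sphMap L) (volume : Measure (Euc N)).toSphere
      (volume : Measure (Euc N)).toSphere := by
  refine ⟨(sphMap_cont L).measurable, ?_⟩
  ext s hs
  rw [Measure.map_apply (sphMap_cont L).measurable hs, Measure.toSphere_apply' _ hs,
    Measure.toSphere_apply' _ ((sphMap_cont L).measurable hs)]
  congr 1
  have : (Ioo (0:ℝ) 1 • (Subtype.val '' (sphMap L ⁻¹' s)) : Set (Euc N)) =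
      L ⁻¹' (Ioo (0:ℝ) 1 • (Subtype.val '' s)) := by
    ext x
    simp only [Set.mem_smul, mem_preimage, mem_image, Subtype.exists]
    constructor
    · rintro ⟨c, hc, y, ⟨z, hz, hz2, rfl⟩, rfl⟩
      exact ⟨c, hc, L z, ⟨L z, by simpa using hz, hz2, rfl⟩, by simp⟩
    · rintro ⟨c, hc, y, ⟨z, hz, hz2, rfl⟩, h⟩
      refine ⟨c, hc, L.symm z, ⟨L.symm z, by simpa using hz, ?_, rfl⟩, ?_⟩
      · simpa [sphMap] using hz2
      · apply L.injective; simpa using h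
  rw [this]
  exact L.measurePreserving.measure_preimage_equiv (f := L.toMeasurableEquiv) _

lemma sphMap_mu (L : Euc N ≃ₗᵢ[ℝ] Euc N) : MeasurePreserving (sphMap L) (mu N) (mu N) := by
  have := sphMap_toSphere L
  refine ⟨this.1, ?_⟩
  rw [mu, Measure.map_smul, this.2]

lemma mu_inv (L : Euc N ≃ₗᵢ[ℝ] Euc N) (f : Euc N → ℝ) :
    ∫ ω : Sph N, f (L ω) ∂(mu N) = ∫ ω : Sph N, f ω ∂(mu N) := by
  have e : MeasurableEmbedding (sphMap L) := by
    apply MeasurableEmbedding.of_measurable_inverse (g := sphMap L.symm)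
      (sphMap_cont L).measurable ?_ (sphMap_cont L.symm).measurable ?_
    · have : range (sphMap L) = univ := by
        apply Function.Surjective.range_eq
        intro x; exact ⟨sphMap L.symm x, by simp [sphMap]⟩
      rw [this]; exact MeasurableSet.univ
    · intro x; simp [sphMap]
  exact (sphMap_mu L).integral_comp e (fun ω => f ω)

lemma exists_rot {x y : Euc N} (h : ‖x‖ = ‖y‖) : ∃ L : Euc N ≃ₗᵢ[ℝ] Euc N, L x = y :=
  ⟨_, Submodule.reflection_sub h⟩

lemma mu_integrable {f : Euc N → ℝ} (hf : ContinuousOn f (sphere 0 1)) :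
    Integrable (fun ω : Sph N => f ω) (mu N) := by
  have : Continuous (fun ω : Sph N => f ω) := continuousOn_iff_continuous_domRestrict.1 hf
  exact this.integrable_of_hasCompactSupport (HasCompactSupport.of_compactSpace _)

lemma mu_integrable' {f : Sph N → ℝ} (hf : Continuous f) : Integrable f (mu N) :=
  hf.integrable_of_hasCompactSupport (HasCompactSupport.of_compactSpace _)

lemma mu_odd (v : Euc N) : ∫ ω : Sph N, ⟪(ω : Euc N), v⟫_ℝ ∂(mu N) = 0 := by
  have := mu_inv (N := N) (LinearIsometryEquiv.neg ℝ) (fun x => ⟪x, v⟫_ℝ)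
  simp only [LinearIsometryEquiv.coe_neg, inner_neg_left, integral_neg] at this
  linarith

lemma mu_sq_const : ∃ c : ℝ, ∀ v : Euc N, ∫ ω : Sph N, ⟪(ω : Euc N), v⟫_ℝ ^ 2 ∂(mu N) = c * ‖v‖ ^ 2 := by
  obtain ⟨e, he⟩ := exists_norm_eq (Euc N) (zero_le_one (α := ℝ))
  refine ⟨∫ ω : Sph N, ⟪(ω : Euc N), e⟫_ℝ ^ 2 ∂(mu N), fun v => ?_⟩
  obtain ⟨L, hL⟩ := exists_rot (x := v) (y := ‖v‖ • e) (by simp [norm_smul, he])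
  have h1 := mu_inv L (fun x => ⟪x, ‖v‖ • e⟫_ℝ ^ 2)
  simp only [← hL, LinearIsometryEquiv.inner_map_map] at h1
  rw [h1, hL]
  simp only [inner_smul_right, mul_pow]
  rw [integral_const_mul]; ring

lemma mu_inner_mul (v w : Euc N) :
    ∫ ω : Sph N, ⟪(ω : Euc N), v⟫_ℝ * ⟪(ω : Euc N), w⟫_ℝ ∂(mu N) = ⟪v, w⟫_ℝ / N := by
  obtain ⟨c, hc⟩ := mu_sq_const (N := N)
  have hcN : c = 1 / N := by
    have h1 : ∑ i : Fin N, ∫ ω : Sph N, ⟪(ω : Euc N), EuclideanSpace.single i (1:ℝ)⟫_ℝ ^ 2 ∂(mu N) = 1 := by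
      rw [← integral_finsetSum]
      · have : ∀ ω : Sph N, ∑ i, ⟪(ω : Euc N), EuclideanSpace.single i (1:ℝ)⟫_ℝ ^ 2 = 1 := by
          intro ω
          have := EuclideanSpace.norm_sq_eq (ω : Euc N)
          rw [sph_norm] at this
          simp only [one_pow, Real.norm_eq_abs, sq_abs] at this
          simp [EuclideanSpace.inner_single_right, ← this]
        simp [this]
      · intro i _
        apply mu_integrable (f := fun x => ⟪x, EuclideanSpace.single i (1:ℝ)⟫_ℝ ^ 2)
        fun_prop
    simp only [hc] at h1
    simp at h1
    have := N4r N
    field_simp; linarith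
  have key : ∀ ω : Sph N, ⟪(ω : Euc N), v⟫_ℝ * ⟪(ω : Euc N), w⟫_ℝ =
      (⟪(ω : Euc N), v + w⟫_ℝ ^ 2 - ⟪(ω : Euc N), v - w⟫_ℝ ^ 2) / 4 := by
    intro ω; rw [inner_add_right, inner_sub_right]; ring
  simp only [key]
  rw [integral_div, integral_sub, hc, hc, hcN, norm_add_sq_real, norm_sub_sq_real]
  · have := N4r N
    field_simp
    ring
  · apply mu_integrable (f := fun x => ⟪x, v + w⟫_ℝ ^ 2); fun_prop
  · apply mu_integrable (f := fun x => ⟪x, v - w⟫_ℝ ^ 2); fun_prop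

end PS

namespace PS

open Set Metric

variable {N : ℕ} [hN4 : Fact (4 ≤ N)]

/-- differentiation under the integral over a compact space -/
lemma dui {X : Type*} [TopologicalSpace X] [CompactSpace X] [MeasurableSpace X]
    [OpensMeasurableSpace X] [SecondCountableTopology X] (ν : Measure X) [IsFiniteMeasure ν]
    {a b t0 : ℝ} (ht0 : t0 ∈ Ioo a b) {K K' : ℝ → X → ℝ}
    (hK : ContinuousOn (fun q : ℝ × X => K q.1 q.2) (Ioo a b ×ˢ univ))
    (hK' : ContinuousOn (fun q : ℝ × X => K' q.1 q.2) (Ioo a b ×ˢ univ))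
    (hd : ∀ t ∈ Ioo a b, ∀ x, HasDerivAt (fun s => K s x) (K' t x) t) :
    HasDerivAt (fun s => ∫ x, K s x ∂ν) (∫ x, K' t0 x ∂ν) t0 := by
  have cs : ∀ {G : ℝ → X → ℝ}, ContinuousOn (fun q : ℝ × X => G q.1 q.2) (Ioo a b ×ˢ univ) →
      ∀ t ∈ Ioo a b, Continuous (G t) := by
    intro G hG t ht
    rw [← continuousOn_univ]
    exact hG.comp (f := fun x => (t, x)) (by fun_prop) (fun x _ => ⟨ht, mem_univ _⟩)
  have ci : ∀ {G : X → ℝ}, Continuous G → Integrable G ν := fun hG =>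
    hG.integrable_of_hasCompactSupport (HasCompactSupport.of_compactSpace _)
  obtain ⟨r, hr, hrs⟩ := Metric.nhds_basis_closedBall.mem_iff.1 (Ioo_mem_nhds ht0.1 ht0.2)
  have hcomp : IsCompact (closedBall t0 r ×ˢ (univ : Set X)) :=
    (isCompact_closedBall _ _).prod isCompact_univ
  obtain ⟨C, hC⟩ := hcomp.exists_bound_of_continuousOn (hK'.mono (prod_mono hrs subset_rfl))
  refine (hasDerivAt_integral_of_dominated_loc_of_deriv_le (bound := fun _ => C) (s := ball t0 r)
    (ball_mem_nhds _ hr) ?_ (ci (cs hK t0 ht0)) (cs hK' t0 ht0).aestronglyMeasurable ?_ ?_ ?_).2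
  · filter_upwards [Ioo_mem_nhds ht0.1 ht0.2] with t ht
    exact (cs hK t ht).aestronglyMeasurable
  · exact .of_forall fun x t ht => hC (t, x) ⟨ball_subset_closedBall ht, mem_univ _⟩
  · exact integrable_const _
  · exact .of_forall fun x t ht => hd t (hrs (ball_subset_closedBall ht)) x

/-- continuity of an integral over a compact space -/
lemma cui {X Y : Type*} [TopologicalSpace X] [CompactSpace X] [MeasurableSpace X]
    [OpensMeasurableSpace X] [SecondCountableTopology X] (ν : Measure X) [IsFiniteMeasure ν]
    [TopologicalSpace Y] [FirstCountableTopology Y] [LocallyCompactSpace Y] {K : Y → X → ℝ}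
    (hK : Continuous (fun q : Y × X => K q.1 q.2)) : Continuous (fun y => ∫ x, K y x ∂ν) := by
  have := continuous_parametric_integral_of_continuous (μ := ν) (f := K) hK (isCompact_univ (X := X))
  simpa using this

/-- coordinate vector -/
abbrev ei (i : Fin N) : Euc N := EuclideanSpace.single i 1

lemma sum_inner_ei (x y : Euc N) : ∑ i, ⟪x, ei i⟫_ℝ * ⟪y, ei i⟫_ℝ = ⟪x, y⟫_ℝ := by
  simp [ei, EuclideanSpace.inner_single_right, PiLp.inner_apply, mul_comm]

lemma norm_ei (i : Fin N) : ‖(ei i : Euc N)‖ = 1 := by simp [ei]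

/-- a pointwise notion of harmonicity -/
def Harm (D : Euc N → ℝ) (x : Euc N) : Prop :=
  ∃ D1 : Fin N → ℝ → ℝ, ∃ D2 : Fin N → ℝ,
    (∀ i, ∀ᶠ t in 𝓝 (0:ℝ), HasDerivAt (fun s => D (x + s • ei i)) (D1 i t) t) ∧
    (∀ i, HasDerivAt (D1 i) (D2 i) 0) ∧ ∑ i, D2 i = 0

lemma Harm.add {f g : Euc N → ℝ} {x : Euc N} (hf : Harm f x) (hg : Harm g x) :
    Harm (fun y => f y + g y) x := by
  obtain ⟨a1, a2, h1, h2, h3⟩ := hf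
  obtain ⟨b1, b2, k1, k2, k3⟩ := hg
  refine ⟨fun i t => a1 i t + b1 i t, fun i => a2 i + b2 i, fun i => ?_, fun i => (h2 i).add (k2 i), ?_⟩
  · filter_upwards [h1 i, k1 i] with t u v using u.add v
  · simp [Finset.sum_add_distrib, h3, k3]

lemma Harm.smul {f : Euc N → ℝ} {x : Euc N} (c : ℝ) (hf : Harm f x) :
    Harm (fun y => c * f y) x := by
  obtain ⟨a1, a2, h1, h2, h3⟩ := hf
  refine ⟨fun i t => c * a1 i t, fun i => c * a2 i, fun i => ?_, fun i => (h2 i).const_mul c, ?_⟩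
  · filter_upwards [h1 i] with t u using u.const_mul c
  · simp [← Finset.mul_sum, h3]

lemma Harm.sub {f g : Euc N → ℝ} {x : Euc N} (hf : Harm f x) (hg : Harm g x) :
    Harm (fun y => f y - g y) x := by
  have := hf.add (hg.smul (-1))
  simpa [sub_eq_add_neg] using this

lemma Harm.neg {f : Euc N → ℝ} {x : Euc N} (hf : Harm f x) : Harm (fun y => - f y) x := by
  have := hf.smul (-1)
  simpa using this

lemma Harm.const (c : ℝ) (x : Euc N) : Harm (fun _ => c) x :=
  ⟨fun _ _ => 0, fun _ => 0, fun _ => .of_forall fun t => hasDerivAt_const t c,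
    fun _ => hasDerivAt_const _ _, by simp⟩

lemma Harm.inner (v : Euc N) (x : Euc N) : Harm (fun y => ⟪y, v⟫_ℝ) x := by
  refine ⟨fun i _ => ⟪ei i, v⟫_ℝ, fun _ => 0, fun i => .of_forall fun t => ?_,
    fun _ => hasDerivAt_const _ _, by simp⟩
  simp only [inner_add_left, real_inner_smul_left]
  simpa using (((hasDerivAt_id t).mul_const ⟪ei i, v⟫_ℝ).const_add ⟪x, v⟫_ℝ)

lemma Harm.scale {f : Euc N → ℝ} {x : Euc N} {σ : ℝ} (hf : Harm f (σ • x)) :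
    Harm (fun y => f (σ • y)) x := by
  obtain ⟨a1, a2, h1, h2, h3⟩ := hf
  refine ⟨fun i t => a1 i (σ * t) * σ, fun i => a2 i * σ * σ, fun i => ?_, fun i => ?_, ?_⟩
  · have hc : Tendsto (fun t : ℝ => σ * t) (𝓝 0) (𝓝 0) := by
      have : Continuous (fun t : ℝ => σ * t) := by fun_prop
      simpa using this.tendsto 0
    filter_upwards [hc.eventually (h1 i)] with t ht
    have h := HasDerivAt.comp t ht ((hasDerivAt_id t).const_mul σ)
    simp only [mul_one] at h
    refine h.congr_of_eventuallyEq (.of_forall fun s => ?_)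
    simp [smul_smul, smul_add]
  · have h := HasDerivAt.comp (h₂ := a1 i) (h := fun t : ℝ => σ * t) (0:ℝ) (by simpa using h2 i)
      ((hasDerivAt_id (0:ℝ)).const_mul σ)
    simp only [mul_one] at h
    exact h.mul_const σ
  · rw [← Finset.sum_mul, ← Finset.sum_mul, h3]; simp

lemma second_deriv_test {g g1 : ℝ → ℝ} {c : ℝ} (h1 : ∀ᶠ t in 𝓝 (0:ℝ), HasDerivAt g (g1 t) t)
    (h2 : HasDerivAt g1 c 0) (hm : IsLocalMax g 0) : c ≤ 0 := by
  by_contra! hc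
  have e : deriv g =ᶠ[𝓝 0] g1 := h1.mono fun t ht => ht.deriv
  have hdd : deriv (deriv g) 0 = c := by rw [e.deriv_eq]; exact h2.deriv
  have hmin := isLocalMin_of_deriv_deriv_pos (f := g) (x₀ := 0) (by rw [hdd]; exact hc) hm.deriv_eq_zero
    h1.self_of_nhds.continuousAt
  have hconst : g =ᶠ[𝓝 0] fun _ => g 0 := by
    filter_upwards [hm, hmin] with t a b using le_antisymm a b
  have : deriv (deriv g) 0 = 0 := by
    rw [hconst.deriv.deriv_eq]; simp
  linarith

lemma hasDerivAt_nsq (x e : Euc N) (t : ℝ) :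
    HasDerivAt (fun s : ℝ => ‖x + s • e‖ ^ 2) (2 * ⟪x + t • e, e⟫_ℝ) t := by
  have h : HasDerivAt (fun s : ℝ => x + s • e) e t := by
    simpa using ((hasDerivAt_id t).smul_const e).const_add x
  exact h.norm_sq

lemma max_princ {D : Euc N → ℝ} {τ M : ℝ} (hc : ContinuousOn D (closedBall 0 τ))
    (hh : ∀ x ∈ ball (0 : Euc N) τ, Harm D x) (hM : ∀ x ∈ sphere (0 : Euc N) τ, D x ≤ M) :
    ∀ x ∈ closedBall (0 : Euc N) τ, D x ≤ M := by
  intro x hx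
  by_contra! hlt
  have hτ : 0 ≤ τ := by
    have := mem_closedBall_zero_iff.1 hx; exact (norm_nonneg _).trans this
  obtain ⟨ε, hε, hε2⟩ : ∃ ε : ℝ, 0 < ε ∧ ε * τ ^ 2 < D x - M := by
    refine ⟨(D x - M) / (τ ^ 2 + 1), div_pos (by linarith) (by positivity), ?_⟩
    rw [div_mul_eq_mul_div, div_lt_iff₀ (by positivity)]; nlinarith
  obtain ⟨z, hz, hzm⟩ := (isCompact_closedBall (0 : Euc N) τ).exists_isMaxOn ⟨x, hx⟩
    (f := fun y => D y + ε * ‖y‖ ^ 2) (hc.add (by fun_prop))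
  have hzx : D x + ε * ‖x‖ ^ 2 ≤ D z + ε * ‖z‖ ^ 2 := hzm hx
  rcases (mem_closedBall_zero_iff.1 hz).lt_or_eq with h | h
  · have hzb : z ∈ ball (0 : Euc N) τ := mem_ball_zero_iff.2 h
    obtain ⟨a1, a2, h1, h2, h3⟩ := hh z hzb
    have hi : ∀ i, a2 i + 2 * ε ≤ 0 := by
      intro i
      apply second_deriv_test (g := fun t => D (z + t • ei i) + ε * ‖z + t • ei i‖ ^ 2)
        (g1 := fun t => a1 i t + ε * (2 * ⟪z + t • ei i, ei i⟫_ℝ))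
      · filter_upwards [h1 i] with t ht using ht.add ((hasDerivAt_nsq z (ei i) t).const_mul ε)
      · have : HasDerivAt (fun t : ℝ => ⟪z + t • ei i, ei i⟫_ℝ) 1 0 := by
          simp only [inner_add_left, real_inner_smul_left, real_inner_self_eq_norm_sq, norm_ei]
          simpa using ((hasDerivAt_id (0:ℝ)).const_add ⟪z, ei i⟫_ℝ)
        exact ((h2 i).add ((this.const_mul 2).const_mul ε)).congr_deriv (by ring)
      · have hcont : Continuous (fun t : ℝ => z + t • (ei i : Euc N)) := by fun_prop
        have : ∀ᶠ t in 𝓝 (0:ℝ), z + t • (ei i : Euc N) ∈ ball (0 : Euc N) τ := by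
          apply hcont.continuousAt.eventually_mem
          simpa using isOpen_ball.mem_nhds hzb
        filter_upwards [this] with t ht
        simpa using hzm (ball_subset_closedBall ht)
    have : ∑ i, (a2 i + 2 * ε) ≤ 0 := Finset.sum_nonpos fun i _ => hi i
    rw [Finset.sum_add_distrib, h3] at this
    simp at this
    have := N4r N
    nlinarith
  · have := hM z (mem_sphere_zero_iff_norm.2 h)
    rw [h] at hzx
    nlinarith [sq_nonneg ‖x‖, mul_nonneg hε.le (sq_nonneg ‖x‖)]

/-! Poisson kernel -/

def Pk (x η : Euc N) : ℝ := (1 - ‖x‖ ^ 2) * (‖x - η‖ ^ 2) ^ (-((N:ℝ) / 2))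

def Pk1 (e x η : Euc N) : ℝ :=
  -2 * ⟪x, e⟫_ℝ * (‖x - η‖ ^ 2) ^ (-((N:ℝ) / 2))
    - N * (1 - ‖x‖ ^ 2) * ⟪x - η, e⟫_ℝ * (‖x - η‖ ^ 2) ^ (-((N:ℝ) / 2) - 1)

def Pk2 (e x η : Euc N) : ℝ :=
  -2 * ‖e‖ ^ 2 * (‖x - η‖ ^ 2) ^ (-((N:ℝ) / 2))
  + 4 * N * ⟪x, e⟫_ℝ * ⟪x - η, e⟫_ℝ * (‖x - η‖ ^ 2) ^ (-((N:ℝ) / 2) - 1)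
  + (1 - ‖x‖ ^ 2) * (- N * ‖e‖ ^ 2 * (‖x - η‖ ^ 2) ^ (-((N:ℝ) / 2) - 1)
    + N * (N + 2) * ⟪x - η, e⟫_ℝ ^ 2 * (‖x - η‖ ^ 2) ^ (-((N:ℝ) / 2) - 2))

lemma sub_ne {x : Euc N} (hx : ‖x‖ < 1) (η : Sph N) : ‖x - η‖ ^ 2 ≠ 0 := by
  have : x ≠ (η : Euc N) := by
    rintro rfl; rw [sph_norm] at hx; exact lt_irrefl _ hx
  have := norm_pos_iff.2 (sub_ne_zero.2 this)
  positivity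

lemma hasDerivAt_A (x e η : Euc N) (t : ℝ) :
    HasDerivAt (fun s : ℝ => ‖x + s • e - η‖ ^ 2) (2 * ⟪x + t • e - η, e⟫_ℝ) t := by
  have := hasDerivAt_nsq (x - η) e t
  have h : ∀ s : ℝ, x - η + s • e = x + s • e - η := fun s => by abel
  simpa only [h] using this

lemma hasDerivAt_in (x e v : Euc N) (t : ℝ) :
    HasDerivAt (fun s : ℝ => ⟪x + s • e - v, e⟫_ℝ) (‖e‖ ^ 2) t := by
  simp only [inner_sub_left, inner_add_left, real_inner_smul_left, real_inner_self_eq_norm_sq]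
  simpa using ((((hasDerivAt_id t).mul_const (‖e‖ ^ 2)).const_add ⟪x, e⟫_ℝ).sub_const ⟪v, e⟫_ℝ)

lemma hasDerivAt_Pk (e x : Euc N) (η : Sph N) (t : ℝ) (h : ‖x + t • e‖ < 1) :
    HasDerivAt (fun s : ℝ => Pk (x + s • e) η) (Pk1 e (x + t • e) η) t := by
  have h0 := sub_ne h η
  have h1 := ((hasDerivAt_nsq x e t).const_sub 1).mul
    ((hasDerivAt_A x e η t).rpow_const (p := -((N:ℝ)/2)) (Or.inl h0))
  refine h1.congr_deriv ?_
  unfold Pk1; ring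

lemma hasDerivAt_Pk1 (e x : Euc N) (η : Sph N) (t : ℝ) (h : ‖x + t • e‖ < 1) :
    HasDerivAt (fun s : ℝ => Pk1 e (x + s • e) η) (Pk2 e (x + t • e) η) t := by
  have h0 := sub_ne h η
  have i0 := hasDerivAt_in x e 0 t
  simp only [sub_zero] at i0
  have r := fun p : ℝ => (hasDerivAt_A x e η t).rpow_const (p := p) (Or.inl h0)
  have h1 := ((i0.const_mul (-2)).mul (r (-((N:ℝ)/2)))).sub
    (((((hasDerivAt_nsq x e t).const_sub 1).const_mul (N:ℝ)).mul (hasDerivAt_in x e η t)).mul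
      (r (-((N:ℝ)/2) - 1)))
  refine h1.congr_deriv ?_
  have : -((N:ℝ)/2) - 1 - 1 = -((N:ℝ)/2) - 2 := by ring
  simp only [this, Pk2, Pi.mul_apply]; ring

lemma Pk2_sum (x : Euc N) (hx : ‖x‖ < 1) (η : Sph N) : ∑ i, Pk2 (ei i) x η = 0 := by
  have h0 := sub_ne hx η
  have hp : 0 < ‖x - η‖ ^ 2 := lt_of_le_of_ne (by positivity) (Ne.symm h0)
  unfold Pk2
  simp only [norm_ei, Finset.sum_add_distrib, ← Finset.mul_sum, ← Finset.sum_mul, mul_assoc]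
  have s1 := sum_inner_ei x (x - η)
  have s2 := sum_inner_ei (x - (η : Euc N)) (x - (η : Euc N))
  have hne : ‖x - (η : Euc N)‖ ≠ 0 := by intro h; apply h0; rw [h]; simp
  have e1 : (‖x - η‖ ^ 2) ^ (-((N:ℝ) / 2)) = ‖x - η‖ ^ 2 * (‖x - η‖ ^ 2) ^ (-((N:ℝ) / 2) - 1) := by
    rw [Real.rpow_sub_one h0]; field_simp
  have e2 : ‖x - η‖ ^ 2 * (‖x - η‖ ^ 2) ^ (-((N:ℝ) / 2) - 2) = (‖x - η‖ ^ 2) ^ (-((N:ℝ) / 2) - 1) := by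
    rw [show -((N:ℝ) / 2) - 2 = -((N:ℝ) / 2) - 1 - 1 by ring, Real.rpow_sub_one h0 (-((N:ℝ) / 2) - 1)]; field_simp
  have s3 : ∑ i, ⟪x, ei i⟫_ℝ * (⟪x - η, ei i⟫_ℝ * (‖x - η‖ ^ 2) ^ (-((N:ℝ) / 2) - 1)) =
      ⟪x, x - (η : Euc N)⟫_ℝ * (‖x - η‖ ^ 2) ^ (-((N:ℝ) / 2) - 1) := by
    rw [← s1, Finset.sum_mul]; simp only [mul_assoc]
  have s4 : ∑ i, ⟪x - η, ei i⟫_ℝ ^ 2 = ‖x - η‖ ^ 2 := by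
    simp only [sq] at *
    rw [s2, real_inner_self_eq_norm_mul_norm]
  rw [s3, s4, e2, e1]
  simp only [Finset.sum_const, Finset.card_univ, Fintype.card_fin, nsmul_eq_mul]
  rw [norm_sub_sq_real, sph_norm, inner_sub_right, real_inner_self_eq_norm_sq]
  ring

lemma Pk_symm (τ : ℝ) (ω η : Sph N) : Pk (τ • (ω : Euc N)) η = Pk (τ • (η : Euc N)) ω := by
  unfold Pk
  rw [norm_sub_sq_real, norm_sub_sq_real, norm_smul, norm_smul, sph_norm, sph_norm,
    real_inner_smul_left, real_inner_smul_left, real_inner_comm]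

lemma Pk_nonneg {x : Euc N} (hx : ‖x‖ ≤ 1) (η : Euc N) : 0 ≤ Pk x η := by
  unfold Pk
  have : ‖x‖ ^ 2 ≤ 1 := by nlinarith [norm_nonneg x]
  exact mul_nonneg (by linarith) (by positivity)

lemma cont_A (c : ℝ) : ContinuousOn (fun q : Euc N × Sph N => (‖q.1 - q.2‖ ^ 2) ^ c)
    (ball 0 1 ×ˢ univ) := by
  apply ContinuousOn.rpow_const (by fun_prop)
  rintro ⟨x, η⟩ h
  exact Or.inl (sub_ne (by simpa using h.1) η)

lemma cont_Pk : ContinuousOn (fun q : Euc N × Sph N => Pk q.1 q.2) (ball 0 1 ×ˢ univ) := by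
  unfold Pk
  exact ContinuousOn.mul (by fun_prop) (cont_A _)

lemma cont_Pk1 : ContinuousOn (fun q : Euc N × (Euc N × Sph N) => Pk1 q.1 q.2.1 q.2.2)
    (univ ×ˢ (ball 0 1 ×ˢ univ)) := by
  have h : ∀ c : ℝ, ContinuousOn (fun q : Euc N × (Euc N × Sph N) => (‖q.2.1 - q.2.2‖ ^ 2) ^ c)
    (univ ×ˢ (ball 0 1 ×ˢ univ)) := fun c =>
      (cont_A c).comp (f := Prod.snd) (by fun_prop) (fun q hq => hq.2)
  unfold Pk1
  exact (ContinuousOn.mul (by fun_prop) (h _)).sub (ContinuousOn.mul (by fun_prop) (h _))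

lemma cont_Pk2 : ContinuousOn (fun q : Euc N × (Euc N × Sph N) => Pk2 q.1 q.2.1 q.2.2)
    (univ ×ˢ (ball 0 1 ×ˢ univ)) := by
  have h : ∀ c : ℝ, ContinuousOn (fun q : Euc N × (Euc N × Sph N) => (‖q.2.1 - q.2.2‖ ^ 2) ^ c)
    (univ ×ˢ (ball 0 1 ×ˢ univ)) := fun c =>
      (cont_A c).comp (f := Prod.snd) (by fun_prop) (fun q hq => hq.2)
  unfold Pk2
  exact ((ContinuousOn.mul (by fun_prop) (h _)).add (ContinuousOn.mul (by fun_prop) (h _))).add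
    (ContinuousOn.mul (by fun_prop) ((ContinuousOn.mul (by fun_prop) (h _)).add
      (ContinuousOn.mul (by fun_prop) (h _))))

end PS

namespace PS

open Set Metric

variable {N : ℕ} [hN4 : Fact (4 ≤ N)]

/-- Poisson integral -/
def pois (ψ : Sph N → ℝ) (x : Euc N) : ℝ := ∫ η : Sph N, Pk x η * ψ η ∂(mu N)

lemma Pk_cont_right {x : Euc N} (hx : ‖x‖ < 1) : Continuous (fun η : Sph N => Pk x η) := by
  rw [← continuousOn_univ]
  exact cont_Pk.comp (f := fun η : Sph N => (x, η)) (by fun_prop)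
    (fun η _ => ⟨by simpa using hx, mem_univ _⟩)

lemma pois_contOn {ψ : Sph N → ℝ} (hψ : Continuous ψ) : ContinuousOn (pois ψ) (ball 0 1) := by
  rw [continuousOn_iff_continuous_domRestrict]
  haveI : LocallyCompactSpace (ball (0 : Euc N) 1) := isOpen_ball.locallyCompactSpace
  apply cui (Y := ball (0 : Euc N) 1) (X := Sph N) (ν := mu N) (K := fun x η => Pk (x : Euc N) (η : Euc N) * ψ η)
  apply Continuous.mul _ (by fun_prop)
  rw [← continuousOn_univ]
  exact cont_Pk.comp (f := fun q : ball (0 : Euc N) 1 × Sph N => ((q.1 : Euc N), q.2))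
    (by fun_prop) (fun q _ => ⟨q.1.2, mem_univ _⟩)

lemma pois_line {x e : Euc N} {a b t0 : ℝ} (ht0 : t0 ∈ Ioo a b)
    (h : ∀ t ∈ Ioo a b, ‖x + t • e‖ < 1) {ψ : Sph N → ℝ} (hψ : Continuous ψ) :
    HasDerivAt (fun s => pois ψ (x + s • e)) (∫ η : Sph N, Pk1 e (x + t0 • e) η * ψ η ∂(mu N)) t0 ∧
    HasDerivAt (fun s => ∫ η : Sph N, Pk1 e (x + s • e) η * ψ η ∂(mu N))
      (∫ η : Sph N, Pk2 e (x + t0 • e) η * ψ η ∂(mu N)) t0 := by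
  have c0 : ContinuousOn (fun q : ℝ × Sph N => Pk (x + q.1 • e) q.2 * ψ q.2) (Ioo a b ×ˢ univ) := by
    apply ContinuousOn.mul _ (by fun_prop)
    exact cont_Pk.comp (f := fun q : ℝ × Sph N => (x + q.1 • e, q.2)) (by fun_prop)
      (fun q hq => ⟨by simpa using h q.1 hq.1, mem_univ _⟩)
  have c1 : ContinuousOn (fun q : ℝ × Sph N => Pk1 e (x + q.1 • e) q.2 * ψ q.2) (Ioo a b ×ˢ univ) := by
    apply ContinuousOn.mul _ (by fun_prop)
    exact cont_Pk1.comp (f := fun q : ℝ × Sph N => (e, (x + q.1 • e, q.2))) (by fun_prop)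
      (fun q hq => ⟨mem_univ _, by simpa using h q.1 hq.1, mem_univ _⟩)
  have c2 : ContinuousOn (fun q : ℝ × Sph N => Pk2 e (x + q.1 • e) q.2 * ψ q.2) (Ioo a b ×ˢ univ) := by
    apply ContinuousOn.mul _ (by fun_prop)
    exact cont_Pk2.comp (f := fun q : ℝ × Sph N => (e, (x + q.1 • e, q.2))) (by fun_prop)
      (fun q hq => ⟨mem_univ _, by simpa using h q.1 hq.1, mem_univ _⟩)
  exact ⟨dui (mu N) ht0 (K := fun t η => Pk (x + t • e) η * ψ η)
      (K' := fun t η => Pk1 e (x + t • e) η * ψ η) c0 c1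
      (fun t ht η => (hasDerivAt_Pk e x η t (h t ht)).mul_const _),
    dui (mu N) ht0 (K := fun t η => Pk1 e (x + t • e) η * ψ η)
      (K' := fun t η => Pk2 e (x + t • e) η * ψ η) c1 c2
      (fun t ht η => (hasDerivAt_Pk1 e x η t (h t ht)).mul_const _)⟩

lemma Pk2_cont_right (e : Euc N) {x : Euc N} (hx : ‖x‖ < 1) : Continuous (fun η : Sph N => Pk2 e x η) := by
  rw [← continuousOn_univ]
  exact cont_Pk2.comp (f := fun η : Sph N => (e, (x, η))) (by fun_prop)
    (fun η _ => ⟨mem_univ _, by simpa using hx, mem_univ _⟩)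

lemma pois_harm {ψ : Sph N → ℝ} (hψ : Continuous ψ) {x : Euc N} (hx : ‖x‖ < 1) :
    Harm (pois ψ) x := by
  have hr : (0:ℝ) ∈ Ioo (-(1 - ‖x‖)) (1 - ‖x‖) := ⟨by linarith, by linarith⟩
  have h : ∀ i : Fin N, ∀ t ∈ Ioo (-(1 - ‖x‖)) (1 - ‖x‖), ‖x + t • (ei i : Euc N)‖ < 1 := by
    intro i t ht
    calc ‖x + t • (ei i : Euc N)‖ ≤ ‖x‖ + ‖t • (ei i : Euc N)‖ := norm_add_le _ _
      _ = ‖x‖ + |t| := by rw [norm_smul, norm_ei, mul_one, Real.norm_eq_abs]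
      _ < 1 := by have := abs_lt.2 ht; linarith
  refine ⟨fun i t => ∫ η : Sph N, Pk1 (ei i) (x + t • ei i) η * ψ η ∂(mu N),
    fun i => ∫ η : Sph N, Pk2 (ei i) (x + (0:ℝ) • ei i) η * ψ η ∂(mu N), fun i => ?_, fun i => ?_, ?_⟩
  · filter_upwards [Ioo_mem_nhds hr.1 hr.2] with t ht
    exact (pois_line ht (h i) hψ).1
  · exact (pois_line hr (h i) hψ).2
  · simp only [zero_smul, add_zero]
    rw [← integral_finsetSum]
    · simp only [← Finset.sum_mul, Pk2_sum x hx]; simp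
    · intro i _
      exact mu_integrable' ((Pk2_cont_right _ hx).mul hψ)

lemma pois_one_rot (L : Euc N ≃ₗᵢ[ℝ] Euc N) (x : Euc N) :
    pois (fun _ => 1) (L x) = pois (fun _ => 1) x := by
  unfold pois
  have := mu_inv L (fun η => Pk (L x) η * 1)
  rw [← this]
  congr 1
  ext η
  unfold Pk
  rw [← map_sub, L.norm_map, L.norm_map]

lemma pois_zero (ψ : Sph N → ℝ) : pois ψ 0 = ∫ η : Sph N, ψ η ∂(mu N) := by
  unfold pois Pk
  simp

lemma pois_one {x : Euc N} (hx : ‖x‖ < 1) : pois (fun _ => 1) x = 1 := by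
  have h0 : pois (fun _ => 1) (0 : Euc N) = 1 := by rw [pois_zero]; simp
  have hsub : closedBall (0 : Euc N) ‖x‖ ⊆ ball 0 1 := closedBall_subset_ball hx
  have hc := (pois_contOn (N := N) (ψ := fun _ => 1) continuous_const).mono hsub
  have hh : ∀ y ∈ ball (0 : Euc N) ‖x‖, Harm (pois fun _ => 1) y := fun y hy =>
    pois_harm continuous_const (by simpa using (mem_ball_zero_iff.1 hy).trans hx)
  have hs : ∀ y ∈ sphere (0 : Euc N) ‖x‖, pois (fun _ => 1) y = pois (fun _ => 1) x := by
    intro y hy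
    obtain ⟨L, hL⟩ := exists_rot (x := x) (y := y) (by simpa using hy.symm)
    rw [← hL, pois_one_rot]
  have hz : (0 : Euc N) ∈ closedBall (0 : Euc N) ‖x‖ := by simp
  have a := max_princ hc hh (M := pois (fun _ => 1) x) (fun y hy => (hs y hy).le) 0 hz
  have b := max_princ hc.neg (fun y hy => (hh y hy).neg) (M := - pois (fun _ => 1) x)
    (fun y hy => by simp [hs y hy]) 0 hz
  simp only [Pi.neg_apply] at b
  linarith

lemma pois_boundary {ψ : Sph N → ℝ} (hψ : Continuous ψ) {ε : ℝ} (hε : 0 < ε) :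
    ∀ᶠ τ in 𝓝[<] (1:ℝ), ∀ ω : Sph N, |pois ψ (τ • (ω : Euc N)) - ψ ω| ≤ ε := by
  obtain ⟨δ, hδ, hδ2⟩ := Metric.uniformContinuous_iff.1
    (CompactSpace.uniformContinuous_of_continuous hψ) (ε / 2) (by positivity)
  obtain ⟨M, hM⟩ := isCompact_univ.exists_bound_of_continuousOn hψ.continuousOn
  have hM0 : 0 ≤ M := by
    obtain ⟨e, he⟩ := exists_norm_eq (Euc N) (zero_le_one (α := ℝ))
    exact (norm_nonneg _).trans (hM ⟨e, by simpa using he⟩ (mem_univ _))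
  have hNr := N4r N
  have hlim : Tendsto (fun τ : ℝ => 2 * M * ((1 - τ ^ 2) * ((δ / 2) ^ 2) ^ (-((N:ℝ) / 2)))) (𝓝[<] 1) (𝓝 0) := by
    have : Continuous (fun τ : ℝ => 2 * M * ((1 - τ ^ 2) * ((δ / 2) ^ 2) ^ (-((N:ℝ) / 2)))) := by fun_prop
    simpa using (this.tendsto 1).mono_left nhdsWithin_le_nhds
  have e1 : ∀ᶠ τ in 𝓝[<] (1:ℝ), 2 * M * ((1 - τ ^ 2) * ((δ / 2) ^ 2) ^ (-((N:ℝ) / 2))) < ε / 2 :=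
    hlim.eventually_lt_const (by positivity)
  have e2 : ∀ᶠ τ in 𝓝[<] (1:ℝ), τ ∈ Ioo (max 0 (1 - δ / 2)) 1 :=
    Ioo_mem_nhdsLT (max_lt (by norm_num) (by linarith))
  filter_upwards [e1, e2] with τ h1 h2 ω
  have hτ0 : 0 < τ := (le_max_left _ _).trans_lt h2.1
  have hτ1 : 1 - δ / 2 < τ := (le_max_right _ _).trans_lt h2.1
  have hn : ‖τ • (ω : Euc N)‖ = τ := by rw [norm_smul, sph_norm, mul_one, Real.norm_eq_abs, abs_of_pos hτ0]
  have hx : ‖τ • (ω : Euc N)‖ < 1 := by rw [hn]; exact h2.2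
  have hcP := Pk_cont_right (N := N) hx
  have hPi := mu_integrable' hcP
  have e : pois ψ (τ • (ω : Euc N)) - ψ ω = ∫ η : Sph N, Pk (τ • (ω : Euc N)) η * (ψ η - ψ ω) ∂(mu N) := by
    have h3 : ψ ω = ∫ η : Sph N, Pk (τ • (ω : Euc N)) η * ψ ω ∂(mu N) := by
      rw [integral_mul_const]
      have := pois_one (N := N) hx
      unfold pois at this
      simp only [mul_one] at this
      rw [this, one_mul]
    conv_lhs => rw [h3]
    unfold pois
    have hi1 : Integrable (fun η : Sph N => Pk (τ • (ω : Euc N)) η * ψ η) (mu N) := mu_integrable' (hcP.mul hψ)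
    rw [← integral_sub hi1 (hPi.mul_const _)]
    congr 1; ext η; ring
  rw [e]
  have hP1 : ∫ η : Sph N, Pk (τ • (ω : Euc N)) η ∂(mu N) = 1 := by
    have := pois_one (N := N) hx
    unfold pois at this
    simpa using this
  calc |∫ η : Sph N, Pk (τ • (ω : Euc N)) η * (ψ η - ψ ω) ∂(mu N)|
      ≤ ∫ η : Sph N, |Pk (τ • (ω : Euc N)) η * (ψ η - ψ ω)| ∂(mu N) := abs_integral_le_integral_abs
    _ ≤ ∫ η : Sph N, (Pk (τ • (ω : Euc N)) η * (ε / 2) + ε / 2) ∂(mu N) := by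
      apply integral_mono
      · exact (mu_integrable' (hcP.mul (hψ.sub continuous_const))).abs
      · exact (hPi.mul_const _).add (integrable_const _)
      · intro η
        have hP0 := Pk_nonneg hx.le (η : Euc N)
        simp only [abs_mul, abs_of_nonneg hP0]
        rcases lt_or_ge (dist η ω) δ with h | h
        · have := hδ2 h
          rw [Real.dist_eq] at this
          have := mul_le_mul_of_nonneg_left this.le hP0
          linarith
        · have hb : |ψ η - ψ ω| ≤ 2 * M := by
            have a1 := hM η (mem_univ _)
            have a2 := hM ω (mem_univ _)
            have := norm_sub_le (ψ η) (ψ ω)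
            rw [← Real.norm_eq_abs]; linarith
          have hd : δ / 2 ≤ ‖τ • (ω : Euc N) - η‖ := by
            have h5 : ‖(η : Euc N) - ω‖ ≥ δ := by
              rw [← dist_eq_norm]; exact h
            have h6 : ‖(η : Euc N) - ω‖ ≤ ‖(η : Euc N) - τ • (ω : Euc N)‖ + ‖τ • (ω : Euc N) - ω‖ := by
              rw [show (η : Euc N) - ω = ((η : Euc N) - τ • (ω : Euc N)) + (τ • (ω : Euc N) - ω) by abel]
              exact norm_add_le _ _
            have h7 : ‖τ • (ω : Euc N) - ω‖ = 1 - τ := by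
              rw [show τ • (ω : Euc N) - ω = (τ - 1) • (ω : Euc N) by rw [sub_smul, one_smul], norm_smul,
                sph_norm, mul_one, Real.norm_eq_abs, abs_of_neg (by linarith [h2.2])]; ring
            rw [norm_sub_rev]; linarith
          have hPb : Pk (τ • (ω : Euc N)) η ≤ (1 - τ ^ 2) * ((δ / 2) ^ 2) ^ (-((N:ℝ) / 2)) := by
            unfold Pk
            rw [hn]
            have : 0 ≤ 1 - τ ^ 2 := by nlinarith [h2.2]
            apply mul_le_mul_of_nonneg_left _ this
            apply Real.rpow_le_rpow_of_nonpos (by positivity) _ (by linarith)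
            gcongr
          have h8 : Pk (τ • (ω : Euc N)) η * |ψ η - ψ ω| ≤
              ((1 - τ ^ 2) * ((δ / 2) ^ 2) ^ (-((N:ℝ) / 2))) * (2 * M) := by gcongr; exact hP0.trans hPb
          nlinarith
    _ = ε := by
      rw [integral_add (hPi.mul_const _) (integrable_const _), integral_mul_const, hP1]; simp

lemma poisson_formula {f : Euc N → ℝ} (hf : ContinuousOn f (closedBall 0 1))
    (hh : ∀ x ∈ ball (0 : Euc N) 1, Harm f x) {x : Euc N} (hx : ‖x‖ < 1) :
    pois (fun η => f η) x = f x := by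
  have hψ : Continuous (fun η : Sph N => f η) :=
    continuousOn_iff_continuous_domRestrict.1 (hf.mono sphere_subset_closedBall)
  have key : ∀ ε > 0, |pois (fun η => f η) x - f x| ≤ 2 * ε := by
    intro ε hε
    have hu := (isCompact_closedBall (0 : Euc N) 1).uniformContinuousOn_of_continuous hf
    obtain ⟨δ, hδ, hδ2⟩ := Metric.uniformContinuousOn_iff.1 hu ε hε
    have e2 : ∀ᶠ τ in 𝓝[<] (1:ℝ), τ ∈ Ioo (max ‖x‖ (1 - δ)) 1 :=
      Ioo_mem_nhdsLT (max_lt hx (by linarith))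
    obtain ⟨τ, h1, h2⟩ := ((pois_boundary hψ hε).and e2).exists
    have hτx : ‖x‖ < τ := (le_max_left _ _).trans_lt h2.1
    have hτd : 1 - δ < τ := (le_max_right _ _).trans_lt h2.1
    have hτ0 : 0 < τ := (norm_nonneg _).trans_lt hτx
    have hsub : closedBall (0 : Euc N) τ ⊆ ball 0 1 := closedBall_subset_ball h2.2
    have hc : ContinuousOn (fun y => pois (fun η => f η) y - f y) (closedBall 0 τ) :=
      ((pois_contOn hψ).mono hsub).sub (hf.mono (hsub.trans ball_subset_closedBall))
    have hH : ∀ y ∈ ball (0 : Euc N) τ, Harm (fun y => pois (fun η => f η) y - f y) y := fun y hy =>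
      (pois_harm hψ (by simpa using (mem_ball_zero_iff.1 hy).trans h2.2)).sub
        (hh y (ball_subset_ball h2.2.le hy))
    have hs : ∀ y ∈ sphere (0 : Euc N) τ, |pois (fun η => f η) y - f y| ≤ 2 * ε := by
      intro y hy
      have hy' : ‖y‖ = τ := by simpa using hy
      let ω : Sph N := ⟨τ⁻¹ • y, by simp [norm_smul, hy', abs_of_pos hτ0, hτ0.ne']⟩
      have hω : τ • (ω : Euc N) = y := by simp [ω, smul_smul, hτ0.ne']
      have a1 := h1 ω
      rw [hω] at a1
      have a2 := hδ2 (ω : Euc N) (by simp [sph_norm]) y (by simp [hy', h2.2.le]) (by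
        rw [dist_eq_norm, ← hω, show (ω : Euc N) - τ • (ω : Euc N) = (1 - τ) • (ω : Euc N) by
          rw [sub_smul, one_smul], norm_smul, sph_norm, Real.norm_eq_abs, abs_of_pos (by linarith [h2.2])]
        linarith)
      rw [Real.dist_eq] at a2
      have := abs_le.1 a1
      have := abs_lt.1 a2
      rw [abs_le]
      constructor <;> linarith
    have hxm : x ∈ closedBall (0 : Euc N) τ := by simpa using hτx.le
    have a := max_princ hc hH (M := 2 * ε) (fun y hy => (abs_le.1 (hs y hy)).2) x hxm
    have b := max_princ hc.neg (fun y hy => (hH y hy).neg) (M := 2 * ε)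
      (fun y hy => by have := (abs_le.1 (hs y hy)).1; simp only [Pi.neg_apply]; linarith) x hxm
    simp only [Pi.neg_apply] at b
    rw [abs_le]; constructor <;> linarith
  have : |pois (fun η => f η) x - f x| ≤ 0 := by
    apply le_of_forall_pos_le_add
    intro ε hε
    have := key (ε / 2) (by positivity)
    linarith
  have := abs_nonpos_iff.1 this
  linarith

end PS

namespace PS

open Set Metric

variable {N : ℕ} [hN4 : Fact (4 ≤ N)]

/-- Poisson operator on the sphere -/
def PT (τ : ℝ) (ψ : Sph N → ℝ) : Sph N → ℝ := fun ω => pois ψ (τ • (ω : Euc N))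

lemma nsm {τ : ℝ} (h0 : 0 ≤ τ) (ω : Sph N) : ‖τ • (ω : Euc N)‖ = τ := by
  rw [norm_smul, sph_norm, mul_one, Real.norm_eq_abs, abs_of_nonneg h0]

lemma PT_cont {τ : ℝ} (h0 : 0 ≤ τ) (h1 : τ < 1) {ψ : Sph N → ℝ} (hψ : Continuous ψ) :
    Continuous (PT τ ψ) := by
  rw [← continuousOn_univ]
  exact (pois_contOn hψ).comp (f := fun ω : Sph N => τ • (ω : Euc N)) (by fun_prop)
    (fun ω _ => by simpa [nsm h0] using h1)

lemma PT_semi {τ σ : ℝ} (h0 : 0 ≤ τ) (h1 : τ < 1) (k0 : 0 ≤ σ) (k1 : σ < 1) {ψ : Sph N → ℝ}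
    (hψ : Continuous ψ) : PT τ (PT σ ψ) = PT (σ * τ) ψ := by
  ext ω
  have := poisson_formula (f := fun y => pois ψ (σ • y)) ?_ ?_ (x := τ • (ω : Euc N))
    (by rw [nsm h0]; exact h1)
  · unfold PT
    rw [this, smul_smul]
  · apply (pois_contOn hψ).comp (by fun_prop)
    intro y hy
    simp only [mem_closedBall, dist_zero_right, mem_ball, norm_smul, Real.norm_eq_abs, abs_of_nonneg k0] at hy ⊢
    nlinarith
  · intro y hy
    apply Harm.scale (f := pois ψ)
    apply pois_harm hψ
    simp only [dist_zero_right, mem_ball, norm_smul, Real.norm_eq_abs, abs_of_nonneg k0] at hy ⊢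
    nlinarith [norm_nonneg y]

lemma pois_inner (v : Euc N) {x : Euc N} (hx : ‖x‖ < 1) :
    pois (fun η : Sph N => ⟪(η : Euc N), v⟫_ℝ) x = ⟪x, v⟫_ℝ :=
  poisson_formula (f := fun y => ⟪y, v⟫_ℝ) (by fun_prop) (fun y _ => Harm.inner v y) hx

/-- L2 norm on the sphere -/
def nrm (ψ : Sph N → ℝ) : ℝ := √(∫ ω, ψ ω ^ 2 ∂(mu N))

lemma nrm_nonneg (ψ : Sph N → ℝ) : 0 ≤ nrm ψ := Real.sqrt_nonneg _

lemma nrm_sq (ψ : Sph N → ℝ) : nrm ψ ^ 2 = ∫ ω, ψ ω ^ 2 ∂(mu N) :=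
  Real.sq_sqrt (integral_nonneg fun _ => sq_nonneg _)

lemma cs_sph {ψ χ : Sph N → ℝ} (hψ : Continuous ψ) (hχ : Continuous χ) :
    ∫ ω, ψ ω * χ ω ∂(mu N) ≤ nrm ψ * nrm χ := by
  have key : ∀ t : ℝ, 0 ≤ nrm ψ ^ 2 * (t * t) + (-2 * ∫ ω, ψ ω * χ ω ∂(mu N)) * t + nrm χ ^ 2 := by
    intro t
    have h : 0 ≤ ∫ ω, (t * ψ ω - χ ω) ^ 2 ∂(mu N) := integral_nonneg fun _ => sq_nonneg _
    have i1 : Integrable (fun ω => ψ ω ^ 2) (mu N) := mu_integrable' (by fun_prop)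
    have i2 : Integrable (fun ω => ψ ω * χ ω) (mu N) := mu_integrable' (by fun_prop)
    have i3 : Integrable (fun ω => χ ω ^ 2) (mu N) := mu_integrable' (by fun_prop)
    have e : ∀ ω, (t * ψ ω - χ ω) ^ 2 = (t * t) * ψ ω ^ 2 + (-2 * t) * (ψ ω * χ ω) + χ ω ^ 2 := fun ω => by ring
    simp only [e] at h
    rw [integral_add ((i1.const_mul _).fun_add (i2.const_mul _)) i3, integral_add (i1.const_mul _) (i2.const_mul _),
      integral_const_mul, integral_const_mul, ← nrm_sq, ← nrm_sq] at h
    linarith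
  have := discrim_le_zero key
  unfold discrim at this
  have h2 : (∫ ω, ψ ω * χ ω ∂(mu N)) ^ 2 ≤ (nrm ψ * nrm χ) ^ 2 := by nlinarith
  exact le_of_abs_le (abs_le_of_sq_le_sq h2 (mul_nonneg (nrm_nonneg _) (nrm_nonneg _)))

lemma nrm_neg (ψ : Sph N → ℝ) : nrm (fun ω => - ψ ω) = nrm ψ := by simp [nrm]

lemma cs_sph_abs {ψ χ : Sph N → ℝ} (hψ : Continuous ψ) (hχ : Continuous χ) :
    |∫ ω, ψ ω * χ ω ∂(mu N)| ≤ nrm ψ * nrm χ := by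
  rw [abs_le]
  refine ⟨?_, cs_sph hψ hχ⟩
  have := cs_sph hψ.neg hχ
  rw [show (-ψ) = fun ω => - ψ ω from rfl, nrm_neg] at this
  simp only [neg_mul, integral_neg] at this
  linarith

lemma L1_le {ψ : Sph N → ℝ} (hψ : Continuous ψ) : ∫ ω, |ψ ω| ∂(mu N) ≤ nrm ψ := by
  have := cs_sph (N := N) hψ.abs (continuous_const (y := (1:ℝ)))
  simpa [nrm] using this

lemma nrm_le_of_bound {ψ : Sph N → ℝ} {C : ℝ} (hC : 0 ≤ C) (hψ : Continuous ψ) (h : ∀ ω, |ψ ω| ≤ C) : nrm ψ ≤ C := by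
  unfold nrm
  apply Real.sqrt_le_iff.2 ⟨hC, ?_⟩
  calc ∫ ω, ψ ω ^ 2 ∂(mu N) ≤ ∫ ω, C ^ 2 ∂(mu N) := by
        apply integral_mono (mu_integrable' (by fun_prop)) (integrable_const _)
        intro ω
        exact sq_le_sq' (abs_le.1 (h ω)).1 (abs_le.1 (h ω)).2
    _ = C ^ 2 := by simp

lemma Pk_cont2 {τ : ℝ} (h0 : 0 ≤ τ) (h1 : τ < 1) :
    Continuous (fun q : Sph N × Sph N => Pk (τ • (q.1 : Euc N)) q.2) := by
  rw [← continuousOn_univ]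
  exact cont_Pk.comp (f := fun q : Sph N × Sph N => (τ • (q.1 : Euc N), q.2)) (by fun_prop)
    (fun q _ => ⟨by simpa [nsm h0] using h1, mem_univ _⟩)

lemma cint {f : Sph N × Sph N → ℝ} (hf : Continuous f) : Integrable f ((mu N).prod (mu N)) :=
  hf.integrable_of_hasCompactSupport (HasCompactSupport.of_compactSpace _)

lemma PT_pair {τ : ℝ} (h0 : 0 ≤ τ) (h1 : τ < 1) {ψ χ : Sph N → ℝ}
    (hψ : Continuous ψ) (hχ : Continuous χ) :
    ∫ ω, PT τ ψ ω * χ ω ∂(mu N) = ∫ q : Sph N × Sph N, Pk (τ • (q.1 : Euc N)) q.2 * (ψ q.2 * χ q.1)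
      ∂((mu N).prod (mu N)) := by
  rw [integral_prod _ (cint (by have := Pk_cont2 (N := N) h0 h1; fun_prop))]
  congr 1; ext ω
  rw [PT, pois, ← integral_mul_const]
  congr 1; ext η; ring

lemma PT_symm {τ : ℝ} (h0 : 0 ≤ τ) (h1 : τ < 1) {ψ χ : Sph N → ℝ}
    (hψ : Continuous ψ) (hχ : Continuous χ) :
    ∫ ω, PT τ ψ ω * χ ω ∂(mu N) = ∫ ω, ψ ω * PT τ χ ω ∂(mu N) := by
  have : ∫ ω, ψ ω * PT τ χ ω ∂(mu N) = ∫ ω, PT τ χ ω * ψ ω ∂(mu N) := by simp only [mul_comm]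
  rw [this, PT_pair h0 h1 hψ hχ, PT_pair h0 h1 hχ hψ, ← integral_prod_swap]
  congr 1; ext q
  simp only [Prod.fst_swap, Prod.snd_swap]
  rw [Pk_symm, mul_comm (ψ _)]

lemma PT_sq {τ : ℝ} (h0 : 0 ≤ τ) (h1 : τ < 1) {ψ : Sph N → ℝ} (hψ : Continuous ψ) :
    nrm (PT τ ψ) ^ 2 ≤ nrm ψ * nrm (PT (τ ^ 2) ψ) := by
  have c := PT_cont h0 h1 hψ
  have t2 : τ ^ 2 < 1 := by nlinarith
  rw [nrm_sq]
  have : ∫ ω, PT τ ψ ω ^ 2 ∂(mu N) = ∫ ω, ψ ω * PT (τ ^ 2) ψ ω ∂(mu N) := by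
    rw [show τ ^ 2 = τ * τ by ring, ← PT_semi h0 h1 h0 h1 hψ, ← PT_symm h0 h1 hψ c]
    simp only [sq]
  rw [this]
  exact cs_sph hψ (PT_cont (by positivity) t2 hψ)

/-- orthogonality to low modes -/
def Hi (ψ : Sph N → ℝ) : Prop := ∫ ω, ψ ω ∂(mu N) = 0 ∧
  ∀ v : Euc N, ∫ ω : Sph N, ψ ω * ⟪(ω : Euc N), v⟫_ℝ ∂(mu N) = 0

lemma quad_bound {g g1 g2 : ℝ → ℝ} {C τ : ℝ} (hτ : 0 ≤ τ) (hC : 0 ≤ C)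
    (d0 : ∀ s ∈ Icc (0:ℝ) τ, HasDerivAt g (g1 s) s) (d1 : ∀ s ∈ Icc (0:ℝ) τ, HasDerivAt g1 (g2 s) s)
    (b : ∀ s ∈ Icc (0:ℝ) τ, |g2 s| ≤ C) : |g τ - g 0 - τ * g1 0| ≤ C * τ ^ 2 := by
  have b1 : ∀ s ∈ Icc (0:ℝ) τ, ‖g1 s - g1 0‖ ≤ C * τ := by
    intro s hs
    have := Convex.norm_image_sub_le_of_norm_hasDerivWithin_le
      (f := g1) (s := Icc 0 τ) (C := C) (fun s hs => (d1 s hs).hasDerivWithinAt) b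
      (convex_Icc _ _) (left_mem_Icc.2 hτ) hs
    refine this.trans ?_
    rw [sub_zero, Real.norm_eq_abs, abs_of_nonneg hs.1]
    exact mul_le_mul_of_nonneg_left hs.2 hC
  have := Convex.norm_image_sub_le_of_norm_hasDerivWithin_le
      (f := fun s : ℝ => g s - s * g1 0) (s := Icc 0 τ) (C := C * τ) (f' := fun s => g1 s - 1 * g1 0)
      (fun s hs => ((d0 s hs).sub ((hasDerivAt_id s).mul_const (g1 0))).hasDerivWithinAt)
      (fun s hs => by rw [one_mul]; exact b1 s hs)
      (convex_Icc _ _) (left_mem_Icc.2 hτ) (right_mem_Icc.2 hτ)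
  rw [sub_zero, Real.norm_eq_abs, Real.norm_eq_abs, abs_of_nonneg hτ] at this
  calc _ = |g τ - τ * g1 0 - (g 0 - 0 * g1 0)| := by congr 1; ring
    _ ≤ C * τ * τ := this
    _ = _ := by ring

lemma Pk2_bd : ∃ C : ℝ, ∀ e x : Euc N, ‖e‖ = 1 → ‖x‖ ≤ 1/2 → ∀ η : Sph N, |Pk2 e x η| ≤ C := by
  have hcomp : IsCompact (sphere (0 : Euc N) 1 ×ˢ (closedBall (0 : Euc N) (1/2) ×ˢ (univ : Set (Sph N)))) :=
    (isCompact_sphere _ _).prod ((isCompact_closedBall _ _).prod isCompact_univ)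
  obtain ⟨C, hC⟩ := hcomp.exists_bound_of_continuousOn (cont_Pk2.mono
    (prod_mono (subset_univ _) (prod_mono (closedBall_subset_ball (by norm_num)) subset_rfl)))
  refine ⟨C, fun e x he hx η => ?_⟩
  exact hC (e, (x, η)) ⟨by simpa using he, by simpa using hx, mem_univ _⟩

lemma Pk1_zero (ω η : Sph N) : Pk1 (ω : Euc N) 0 η = N * ⟪(ω : Euc N), (η : Euc N)⟫_ℝ := by
  unfold Pk1; simp [sph_norm, real_inner_comm]

lemma Pk_zero (η : Sph N) : Pk (0 : Euc N) η = 1 := by unfold Pk; simp [sph_norm]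

lemma Pk_quad : ∃ C : ℝ, 0 ≤ C ∧ ∀ τ ∈ Icc (0:ℝ) (1/2), ∀ ω η : Sph N,
    |Pk (τ • (ω : Euc N)) η - 1 - N * τ * ⟪(ω : Euc N), (η : Euc N)⟫_ℝ| ≤ C * τ ^ 2 := by
  obtain ⟨C, hC⟩ := Pk2_bd (N := N)
  refine ⟨max C 0, le_max_right _ _, fun τ hτ ω η => ?_⟩
  have hn : ∀ s ∈ Icc (0:ℝ) τ, ‖(0 : Euc N) + s • (ω : Euc N)‖ ≤ 1 / 2 := by
    intro s hs; rw [zero_add, nsm hs.1]; exact hs.2.trans hτ.2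
  have hn1 : ∀ s ∈ Icc (0:ℝ) τ, ‖(0 : Euc N) + s • (ω : Euc N)‖ < 1 := fun s hs => (hn s hs).trans_lt (by norm_num)
  have b2 : ∀ s ∈ Icc (0:ℝ) τ, |Pk2 (ω : Euc N) (0 + s • (ω : Euc N)) η| ≤ max C 0 := fun s hs =>
    (hC _ _ (sph_norm ω) (hn s hs) η).trans (le_max_left _ _)
  obtain ⟨g, hg⟩ : ∃ g : ℝ → ℝ, g = fun s => Pk (0 + s • (ω : Euc N)) η := ⟨_, rfl⟩
  obtain ⟨g1, hg1⟩ : ∃ g : ℝ → ℝ, g = fun s => Pk1 (ω : Euc N) (0 + s • (ω : Euc N)) η := ⟨_, rfl⟩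
  obtain ⟨g2, hg2⟩ : ∃ g : ℝ → ℝ, g = fun s => Pk2 (ω : Euc N) (0 + s • (ω : Euc N)) η := ⟨_, rfl⟩
  have d0 : ∀ s ∈ Icc (0:ℝ) τ, HasDerivAt g (g1 s) s := by
    intro s hs; rw [hg, hg1]; exact hasDerivAt_Pk (ω : Euc N) 0 η s (hn1 s hs)
  have d1 : ∀ s ∈ Icc (0:ℝ) τ, HasDerivAt g1 (g2 s) s := by
    intro s hs; rw [hg1, hg2]; exact hasDerivAt_Pk1 (ω : Euc N) 0 η s (hn1 s hs)
  have b2' : ∀ s ∈ Icc (0:ℝ) τ, |g2 s| ≤ max C 0 := by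
    intro s hs; rw [hg2]; exact b2 s hs
  have := quad_bound hτ.1 (le_max_right C 0) d0 d1 b2'
  rw [hg, hg1] at this
  simp only [zero_add, zero_smul, Pk_zero, Pk1_zero] at this
  refine le_trans (le_of_eq ?_) this
  congr 1; ring

lemma PT_small : ∃ C : ℝ, 0 ≤ C ∧ ∀ τ ∈ Icc (0:ℝ) (1/2), ∀ ψ : Sph N → ℝ, Continuous ψ → Hi ψ →
    nrm (PT τ ψ) ≤ C * τ ^ 2 * nrm ψ := by
  obtain ⟨C, hC0, hC⟩ := Pk_quad (N := N)
  refine ⟨C, hC0, fun τ hτ ψ hψ hi => ?_⟩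
  have h1 : τ < 1 := hτ.2.trans_lt (by norm_num)
  apply nrm_le_of_bound (by have := nrm_nonneg ψ; positivity) (PT_cont hτ.1 h1 hψ)
  intro ω
  have hcP := Pk_cont_right (N := N) (x := τ • (ω : Euc N)) (by rw [nsm hτ.1]; exact h1)
  have e : PT τ ψ ω = ∫ η : Sph N, (Pk (τ • (ω : Euc N)) η - 1 - N * τ * ⟪(ω : Euc N), (η : Euc N)⟫_ℝ) * ψ η ∂(mu N) := by
    have i1 : Integrable (fun η : Sph N => Pk (τ • (ω : Euc N)) η * ψ η) (mu N) := mu_integrable' (hcP.mul hψ)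
    have i2 : Integrable (fun η : Sph N => ψ η) (mu N) := mu_integrable' hψ
    have i3 : Integrable (fun η : Sph N => ψ η * ⟪(η : Euc N), (ω : Euc N)⟫_ℝ) (mu N) := mu_integrable' (by fun_prop)
    have e' : ∀ η : Sph N, (Pk (τ • (ω : Euc N)) η - 1 - N * τ * ⟪(ω : Euc N), (η : Euc N)⟫_ℝ) * ψ η =
      Pk (τ • (ω : Euc N)) η * ψ η - ψ η - (N * τ) * (ψ η * ⟪(η : Euc N), (ω : Euc N)⟫_ℝ) := by
      intro η; rw [real_inner_comm]; ring
    simp only [e']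
    have i12 : Integrable (fun η : Sph N => Pk (τ • (ω : Euc N)) η * ψ η - ψ η) (mu N) := i1.sub i2
    rw [integral_sub i12 (i3.const_mul _), integral_sub i1 i2, integral_const_mul, hi.1, hi.2]
    simp [PT, pois]
  rw [e]
  calc _ ≤ ∫ η : Sph N, |(Pk (τ • (ω : Euc N)) η - 1 - N * τ * ⟪(ω : Euc N), (η : Euc N)⟫_ℝ) * ψ η| ∂(mu N) :=
        abs_integral_le_integral_abs
    _ ≤ ∫ η : Sph N, C * τ ^ 2 * |ψ η| ∂(mu N) := by
      apply integral_mono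
      · exact (mu_integrable' (((hcP.sub continuous_const).sub (by fun_prop)).mul hψ)).abs
      · exact (mu_integrable' hψ).abs.const_mul _
      · intro η
        simp only [abs_mul]
        exact mul_le_mul_of_nonneg_right (hC τ hτ ω η) (abs_nonneg _)
    _ = C * τ ^ 2 * ∫ η : Sph N, |ψ η| ∂(mu N) := by rw [integral_const_mul]
    _ ≤ _ := mul_le_mul_of_nonneg_left (L1_le hψ) (by positivity)

lemma PT_decay {τ : ℝ} (h0 : 0 ≤ τ) (h1 : τ < 1) {ψ : Sph N → ℝ} (hψ : Continuous ψ) (hi : Hi ψ) :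
    nrm (PT τ ψ) ≤ τ ^ 2 * nrm ψ := by
  obtain ⟨C, hC0, hC⟩ := PT_small (N := N)
  have hA := nrm_nonneg ψ
  rcases h0.eq_or_lt with rfl | hτ
  · have := hC 0 ⟨le_rfl, by norm_num⟩ ψ hψ hi
    simpa using this
  have it : ∀ n : ℕ, nrm (PT τ ψ) ^ (2 ^ n) * nrm ψ ≤ nrm ψ ^ (2 ^ n) * nrm (PT (τ ^ (2 ^ n)) ψ) := by
    intro n
    induction n with
    | zero => simp [mul_comm]
    | succ n ih =>
      have hs := PT_sq (N := N) (τ := τ ^ (2 ^ n)) (by positivity) (pow_lt_one₀ h0 h1 (by positivity)) hψ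
      rw [← pow_mul, ← pow_succ] at hs
      rcases hA.eq_or_lt with hA0 | hA0
      · rw [← hA0]; simp
      have h3 : (nrm (PT τ ψ) ^ (2 ^ n) * nrm ψ) ^ 2 ≤ (nrm ψ ^ (2 ^ n) * nrm (PT (τ ^ (2 ^ n)) ψ)) ^ 2 := by
        have := nrm_nonneg (PT τ ψ)
        gcongr
      have h4 : (nrm ψ ^ (2 ^ n) * nrm (PT (τ ^ (2 ^ n)) ψ)) ^ 2 ≤
          (nrm ψ ^ (2 ^ n)) ^ 2 * (nrm ψ * nrm (PT (τ ^ (2 ^ (n+1))) ψ)) := by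
        rw [mul_pow]; gcongr
      have h5 := h3.trans h4
      rw [mul_pow, ← pow_mul, ← pow_mul, ← pow_succ] at h5
      nlinarith
  by_contra! hlt
  rcases hA.eq_or_lt with hA0 | hA0
  · have := PT_sq h0 h1 hψ
    rw [← hA0] at this hlt
    simp at this hlt
    rw [this] at hlt
    exact lt_irrefl _ hlt
  have hq : 1 < nrm (PT τ ψ) / (τ ^ 2 * nrm ψ) := by rw [one_lt_div (by positivity)]; exact hlt
  set q := nrm (PT τ ψ) / (τ ^ 2 * nrm ψ) with hqd
  have hqe : nrm (PT τ ψ) = q * (τ ^ 2 * nrm ψ) := by rw [hqd]; field_simp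
  have t2 : Tendsto (fun n : ℕ => 2 ^ n) atTop atTop := tendsto_pow_atTop_atTop_of_one_lt (by norm_num)
  have e1 := (tendsto_pow_atTop_atTop_of_one_lt hq).comp t2
  have e2 := (tendsto_pow_atTop_nhds_zero_of_lt_one h0 h1).comp t2
  obtain ⟨n, hn1, hn2⟩ := ((e1.eventually_gt_atTop C).and (e2.eventually_le_const (show (0:ℝ) < 1/2 by norm_num))).exists
  simp only [Function.comp] at hn1 hn2
  have h6 := it n
  have h7 := hC (τ ^ (2 ^ n)) ⟨by positivity, hn2⟩ ψ hψ hi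
  rw [hqe, mul_pow, mul_pow] at h6
  have h8 : nrm ψ ^ (2 ^ n) * nrm (PT (τ ^ (2 ^ n)) ψ) ≤ nrm ψ ^ (2 ^ n) * (C * (τ ^ (2 ^ n)) ^ 2 * nrm ψ) := by gcongr
  have h9 := h6.trans h8
  have hpos : 0 < (τ ^ 2) ^ (2 ^ n) * nrm ψ ^ (2 ^ n) * nrm ψ := by positivity
  have h10 : q ^ (2 ^ n) * ((τ ^ 2) ^ (2 ^ n) * nrm ψ ^ (2 ^ n) * nrm ψ) ≤ C * ((τ ^ 2) ^ (2 ^ n) * nrm ψ ^ (2 ^ n) * nrm ψ) := by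
    calc _ = q ^ 2 ^ n * ((τ ^ 2) ^ 2 ^ n * nrm ψ ^ 2 ^ n) * nrm ψ := by ring
      _ ≤ _ := h9
      _ = _ := by rw [← pow_mul, ← pow_mul, mul_comm 2 (2 ^ n)]; ring
  have := le_of_mul_le_mul_right h10 hpos
  linarith

end PS

namespace PS

open Set Metric

variable {N : ℕ} [hN4 : Fact (4 ≤ N)]

/-- Newton kernel with pole on the sphere -/
def kk (x η : Euc N) : ℝ := (‖x - η‖ ^ 2) ^ (-((N:ℝ) / 2 - 1))

lemma kk_nonneg (x η : Euc N) : 0 ≤ kk x η := by unfold kk; positivity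

lemma cont_kk : ContinuousOn (fun q : Euc N × Sph N => kk q.1 q.2) (ball 0 1 ×ˢ univ) := by
  unfold kk
  exact cont_A _

/-- radial derivative of `kk` -/
def kk1 (e x η : Euc N) : ℝ := 2 * ⟪x - η, e⟫_ℝ * (-((N:ℝ) / 2 - 1)) * (‖x - η‖ ^ 2) ^ (-((N:ℝ) / 2))

lemma hasDerivAt_kk (e : Euc N) (η : Sph N) (t : ℝ) (h : ‖t • e‖ < 1) :
    HasDerivAt (fun s : ℝ => kk (s • e) (η : Euc N)) (kk1 e (t • e) η) t := by
  have h1 := hasDerivAt_A (0 : Euc N) e (η : Euc N) t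
  have h2 : ‖(0 : Euc N) + t • e - η‖ ^ 2 ≠ 0 := by rw [zero_add]; exact sub_ne h η
  have h3 := h1.rpow_const (p := -((N:ℝ) / 2 - 1)) (Or.inl h2)
  simp only [zero_add] at h3
  unfold kk kk1
  convert h3 using 2
  ring_nf

lemma kk_id {ρ : ℝ} (h : |ρ| < 1) (ω η : Sph N) :
    ((N:ℝ) / 2 - 1) * kk (ρ • (ω : Euc N)) (η : Euc N) + ρ * kk1 (ω : Euc N) (ρ • (ω : Euc N)) η
      = ((N:ℝ) / 2 - 1) * Pk (ρ • (ω : Euc N)) η := by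
  have hn : ‖ρ • (ω : Euc N)‖ = |ρ| := by rw [norm_smul, sph_norm, mul_one, Real.norm_eq_abs]
  have h2 : ‖ρ • (ω : Euc N) - η‖ ^ 2 ≠ 0 := sub_ne (by rw [hn]; exact h) η
  have hp : 0 < ‖ρ • (ω : Euc N) - η‖ ^ 2 := lt_of_le_of_ne (sq_nonneg _) (Ne.symm h2)
  have e1 : (‖ρ • (ω : Euc N) - η‖ ^ 2) ^ (-((N:ℝ) / 2 - 1)) =
      (‖ρ • (ω : Euc N) - η‖ ^ 2) ^ (-((N:ℝ) / 2)) * ‖ρ • (ω : Euc N) - η‖ ^ 2 := by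
    rw [← Real.rpow_add_one h2]; congr 1; ring
  have e2 : ‖ρ • (ω : Euc N) - η‖ ^ 2 = ρ ^ 2 - 2 * ρ * ⟪(ω : Euc N), (η : Euc N)⟫_ℝ + 1 := by
    rw [norm_sub_sq_real, hn, sq_abs, sph_norm, inner_smul_left]; simp; ring
  have e3 : ⟪ρ • (ω : Euc N) - η, (ω : Euc N)⟫_ℝ = ρ - ⟪(ω : Euc N), (η : Euc N)⟫_ℝ := by
    rw [inner_sub_left, inner_smul_left, real_inner_self_eq_norm_sq, sph_norm, real_inner_comm]; simp
  unfold kk kk1 Pk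
  rw [e1, e3, hn, sq_abs]
  generalize (‖ρ • (ω : Euc N) - η‖ ^ 2) ^ (-((N:ℝ) / 2)) = T
  rw [e2]; ring

lemma kk_ode {J J1 : ℝ → ℝ} {l q : ℝ} {j : ℕ} (hl1 : 1 ≤ l)
    (hd' : ∀ t ∈ Ioo (-1:ℝ) 1, HasDerivAt J (J1 t) t)
    (hJ' : ∀ t ∈ Ioo (0:ℝ) 1, l * J t + t * J1 t ≤ l * (q * t ^ j))
    {ρ : ℝ} (hρ : ρ ∈ Ico (0:ℝ) 1) (hρ0 : 0 < ρ) : J ρ ≤ l / (l + j) * q * ρ ^ j := by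
  have hmono : MonotoneOn (fun t : ℝ => l / (l + j) * q * t ^ (l + j) - t ^ l * J t) (Ico 0 1) := by
    apply monotoneOn_of_hasDerivWithinAt_nonneg (f' := fun t : ℝ => l / (l + j) * q * ((l + j) * t ^ (l + j - 1))
      - (l * t ^ (l - 1) * J t + t ^ l * J1 t)) (convex_Ico 0 1)
    · apply ContinuousOn.sub
      · apply ContinuousOn.mul continuousOn_const
        exact (Real.continuous_rpow_const (by positivity)).continuousOn
      · apply ContinuousOn.mul (Real.continuous_rpow_const (by positivity)).continuousOn
        exact fun t ht => (hd' t ⟨by linarith [ht.1], ht.2⟩).continuousAt.continuousWithinAt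
    · rw [interior_Ico]
      intro t ht
      apply HasDerivAt.hasDerivWithinAt
      apply HasDerivAt.sub
      · exact ((Real.hasDerivAt_rpow_const (Or.inl ht.1.ne')).const_mul _)
      · exact (Real.hasDerivAt_rpow_const (Or.inl ht.1.ne')).mul (hd' t ⟨by linarith [ht.1], ht.2⟩)
    · rw [interior_Ico]
      intro t ht
      have h1 := hJ' t ht
      have e1 : t ^ (l + j - 1) = t ^ (l - 1) * t ^ j := by
        rw [← Real.rpow_natCast t j, ← Real.rpow_add ht.1]; congr 1; ring
      have e2 : t ^ l = t ^ (l - 1) * t := by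
        rw [← Real.rpow_add_one ht.1.ne']; congr 1; ring
      have e3 : l / (l + j) * q * ((l + j) * t ^ (l + j - 1)) = l * q * t ^ (l + j - 1) := by
        have : l + j ≠ 0 := by positivity
        field_simp
      rw [e3, e1, e2]
      have : 0 ≤ t ^ (l - 1) * (l * (q * t ^ j) - (l * J t + t * J1 t)) :=
        mul_nonneg (Real.rpow_nonneg ht.1.le _) (by linarith)
      linarith
  have h0 := hmono (left_mem_Ico.2 one_pos) hρ hρ.1
  simp only [Real.zero_rpow (show l + j ≠ 0 by positivity), Real.zero_rpow (show l ≠ 0 by positivity)] at h0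
  have e1 : ρ ^ (l + j) = ρ ^ l * ρ ^ j := by rw [Real.rpow_add hρ0, Real.rpow_natCast]
  rw [e1] at h0
  have hpos : 0 < ρ ^ l := Real.rpow_pos_of_pos hρ0 _
  by_contra! hlt
  have := mul_lt_mul_of_pos_left hlt hpos
  nlinarith

lemma kk_cmp {X : Type*} [TopologicalSpace X] [CompactSpace X] [MeasurableSpace X]
    [OpensMeasurableSpace X] [SecondCountableTopology X] (ν : Measure X) [IsFiniteMeasure ν]
    {a b : X → Sph N} {Ψ : X → ℝ} (ha : Continuous a) (hb : Continuous b) (hΨ : Continuous Ψ)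
    {q : ℝ} {j : ℕ}
    (h : ∀ ρ ∈ Ioo (0:ℝ) 1, ∫ x, Pk (ρ • (a x : Euc N)) (b x) * Ψ x ∂ν ≤ q * ρ ^ j)
    {ρ : ℝ} (hρ : ρ ∈ Ico (0:ℝ) 1) (hρ0 : 0 < ρ) :
    ∫ x, kk (ρ • (a x : Euc N)) (b x) * Ψ x ∂ν ≤ ((N:ℝ) / 2 - 1) / ((N:ℝ) / 2 - 1 + j) * q * ρ ^ j := by
  have hN := N4r N
  obtain ⟨l, hl⟩ : ∃ l : ℝ, l = (N:ℝ) / 2 - 1 := ⟨_, rfl⟩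
  have hl1 : 1 ≤ l := by rw [hl]; linarith
  have hn : ∀ t ∈ Ioo (-1:ℝ) 1, ∀ ω : Sph N, ‖t • (ω : Euc N)‖ < 1 := by
    intro t ht ω
    rw [norm_smul, sph_norm, mul_one, Real.norm_eq_abs]; exact abs_lt.2 ht
  have hmap : MapsTo (fun q : ℝ × X => (q.1 • (a q.2 : Euc N), b q.2)) (Ioo (-1:ℝ) 1 ×ˢ univ)
      (ball (0 : Euc N) 1 ×ˢ univ) := fun q hq => ⟨by simpa using hn q.1 hq.1 (a q.2), mem_univ _⟩
  have hc0 : Continuous (fun q : ℝ × X => (q.1 • (a q.2 : Euc N), b q.2)) := by fun_prop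
  have hcd : ContinuousOn (fun q : ℝ × X => (‖q.1 • (a q.2 : Euc N) - b q.2‖ ^ 2) ^ (-((N:ℝ) / 2)))
      (Ioo (-1:ℝ) 1 ×ˢ univ) := by
    have := (cont_A (N := N) (-((N:ℝ)/2))).comp hc0.continuousOn hmap
    simpa only [Function.comp_def] using this
  have hck : ContinuousOn (fun q : ℝ × X => kk (q.1 • (a q.2 : Euc N)) (b q.2))
      (Ioo (-1:ℝ) 1 ×ˢ univ) := by
    have := (cont_kk (N := N)).comp hc0.continuousOn hmap
    simpa only [Function.comp_def] using this
  have hcP : ContinuousOn (fun q : ℝ × X => Pk (q.1 • (a q.2 : Euc N)) (b q.2))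
      (Ioo (-1:ℝ) 1 ×ˢ univ) := by
    have := (cont_Pk (N := N)).comp hc0.continuousOn hmap
    simpa only [Function.comp_def] using this
  have hck1 : ContinuousOn (fun q : ℝ × X => kk1 (a q.2 : Euc N) (q.1 • (a q.2 : Euc N)) (b q.2))
      (Ioo (-1:ℝ) 1 ×ˢ univ) := by
    unfold kk1
    exact ContinuousOn.mul (by fun_prop) hcd
  have hint : ∀ {K : ℝ → X → ℝ}, ContinuousOn (fun q : ℝ × X => K q.1 q.2) (Ioo (-1:ℝ) 1 ×ˢ univ) →
      ∀ t ∈ Ioo (-1:ℝ) 1, Integrable (fun x => K t x * Ψ x) ν := by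
    intro K hK t ht
    have : Continuous (fun x => K t x) := by
      rw [← continuousOn_univ]
      exact hK.comp (f := fun x : X => (t, x)) (by fun_prop) (fun x _ => ⟨ht, mem_univ _⟩)
    exact (this.mul hΨ).integrable_of_hasCompactSupport (HasCompactSupport.of_compactSpace _)
  have hd : ∀ t ∈ Ioo (-1:ℝ) 1, HasDerivAt (fun s => ∫ x, kk (s • (a x : Euc N)) (b x) * Ψ x ∂ν)
      (∫ x, kk1 (a x : Euc N) (t • (a x : Euc N)) (b x) * Ψ x ∂ν) t := by
    intro t ht
    refine dui ν ht (K := fun s x => kk (s • (a x : Euc N)) (b x) * Ψ x)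
      (K' := fun s x => kk1 (a x : Euc N) (s • (a x : Euc N)) (b x) * Ψ x)
      (hck.mul (by fun_prop)) (hck1.mul (by fun_prop)) ?_
    intro s hs x
    exact (hasDerivAt_kk (a x : Euc N) (b x) s (hn s hs _)).mul_const _
  have hJ : ∀ t ∈ Ioo (-1:ℝ) 1, l * (∫ x, kk (t • (a x : Euc N)) (b x) * Ψ x ∂ν) +
      t * (∫ x, kk1 (a x : Euc N) (t • (a x : Euc N)) (b x) * Ψ x ∂ν) =
      l * (∫ x, Pk (t • (a x : Euc N)) (b x) * Ψ x ∂ν) := by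
    intro t ht
    have i1 : Integrable (fun x => kk (t • (a x : Euc N)) (b x) * Ψ x) ν :=
      hint (K := fun s x => kk (s • (a x : Euc N)) (b x)) hck t ht
    have i2 : Integrable (fun x => kk1 (a x : Euc N) (t • (a x : Euc N)) (b x) * Ψ x) ν :=
      hint (K := fun s x => kk1 (a x : Euc N) (s • (a x : Euc N)) (b x)) hck1 t ht
    rw [← integral_const_mul, ← integral_const_mul, ← integral_const_mul,
      ← integral_add (i1.const_mul _) (i2.const_mul _)]
    congr 1; ext x
    have := kk_id (N := N) (abs_lt.2 ht) (a x) (b x)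
    rw [← hl] at this
    linear_combination Ψ x * this
  rw [← hl]
  refine kk_ode hl1 hd ?_ hρ hρ0
  intro t ht
  rw [hJ t ⟨by linarith [ht.1], ht.2⟩]
  exact mul_le_mul_of_nonneg_left (h t ht) (by linarith)

lemma kk_cmp_eq {X : Type*} [TopologicalSpace X] [CompactSpace X] [MeasurableSpace X]
    [OpensMeasurableSpace X] [SecondCountableTopology X] (ν : Measure X) [IsFiniteMeasure ν]
    {a b : X → Sph N} {Ψ : X → ℝ} (ha : Continuous a) (hb : Continuous b) (hΨ : Continuous Ψ)
    {q : ℝ} {j : ℕ}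
    (h : ∀ ρ ∈ Ioo (0:ℝ) 1, ∫ x, Pk (ρ • (a x : Euc N)) (b x) * Ψ x ∂ν = q * ρ ^ j)
    {ρ : ℝ} (hρ : ρ ∈ Ico (0:ℝ) 1) (hρ0 : 0 < ρ) :
    ∫ x, kk (ρ • (a x : Euc N)) (b x) * Ψ x ∂ν = ((N:ℝ) / 2 - 1) / ((N:ℝ) / 2 - 1 + j) * q * ρ ^ j := by
  apply le_antisymm (kk_cmp ν ha hb hΨ (fun ρ hρ => (h ρ hρ).le) hρ hρ0)
  have := kk_cmp ν ha hb (Ψ := fun x => - Ψ x) hΨ.neg (q := -q) (j := j) ?_ hρ hρ0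
  · simp only [mul_neg, integral_neg, neg_mul] at this
    linarith
  · intro ρ hρ
    simp only [mul_neg, integral_neg, h ρ hρ, neg_mul]; rfl

lemma kk_one {ρ : ℝ} (h0 : 0 < ρ) (h1 : ρ < 1) (ω : Sph N) :
    ∫ η : Sph N, kk (ρ • (ω : Euc N)) η ∂(mu N) = 1 := by
  have := kk_cmp_eq (mu N) (a := fun _ => ω) (b := fun η => η) (Ψ := fun _ => 1) (q := 1) (j := 0)
    continuous_const continuous_id continuous_const ?_ (ρ := ρ) ⟨h0.le, h1⟩ h0
  · have hN := N4r N
    rw [Nat.cast_zero, add_zero, div_self (by linarith)] at this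
    simpa using this
  · intro s hs
    have := pois_one (N := N) (x := s • (ω : Euc N)) (by rw [nsm hs.1.le]; exact hs.2)
    simpa [pois] using this

lemma kk_inner {ρ : ℝ} (h0 : 0 < ρ) (h1 : ρ < 1) (ω : Sph N) (v : Euc N) :
    ∫ η : Sph N, kk (ρ • (ω : Euc N)) η * ⟪(η : Euc N), v⟫_ℝ ∂(mu N) =
      ((N:ℝ) - 2) / N * ρ * ⟪(ω : Euc N), v⟫_ℝ := by
  have := kk_cmp_eq (mu N) (a := fun _ => ω) (b := fun η => η) (Ψ := fun η : Sph N => ⟪(η : Euc N), v⟫_ℝ)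
    (q := ⟪(ω : Euc N), v⟫_ℝ) (j := 1)
    continuous_const continuous_id (by fun_prop) ?_ (ρ := ρ) ⟨h0.le, h1⟩ h0
  · have hN := N4r N
    rw [this]
    rw [show (N:ℝ) / 2 - 1 + (1:ℕ) = N / 2 by push_cast; ring]
    have : (N:ℝ) ≠ 0 := by linarith
    field_simp
  · intro s hs
    have := pois_inner (N := N) v (x := s • (ω : Euc N)) (by rw [nsm hs.1.le]; exact hs.2)
    rw [inner_smul_left] at this
    simp only [pois, conj_trivial] at this
    rw [pow_one, this, mul_comm]

lemma kk_hi {ρ : ℝ} (h0 : 0 < ρ) (h1 : ρ < 1) {ψ χ : Sph N → ℝ} (hψ : Continuous ψ) (hχ : Continuous χ)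
    (hi : Hi ψ) :
    ∫ ω : Sph N, (∫ η : Sph N, kk (ρ • (ω : Euc N)) η * ψ η ∂(mu N)) * χ ω ∂(mu N) ≤
      ((N:ℝ) - 2) / (N + 2) * ρ ^ 2 * (nrm ψ * nrm χ) := by
  have hN := N4r N
  have := kk_cmp ((mu N).prod (mu N)) (a := fun x => x.1) (b := fun x => x.2)
    (Ψ := fun x : Sph N × Sph N => ψ x.2 * χ x.1) (q := nrm ψ * nrm χ) (j := 2)
    continuous_fst continuous_snd (by fun_prop) ?_ (ρ := ρ) ⟨h0.le, h1⟩ h0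
  · have hc : Continuous (fun q : Sph N × Sph N => kk (ρ • (q.1 : Euc N)) q.2) := by
      rw [← continuousOn_univ]
      exact cont_kk.comp (f := fun q : Sph N × Sph N => (ρ • (q.1 : Euc N), q.2)) (by fun_prop)
        (fun q _ => ⟨by simpa [nsm h0.le] using h1, mem_univ _⟩)
    rw [integral_prod _ (cint (by fun_prop))] at this
    have e : ((N:ℝ) / 2 - 1) / ((N:ℝ) / 2 - 1 + (2:ℕ)) * (nrm ψ * nrm χ) * ρ ^ 2 =
      ((N:ℝ) - 2) / (N + 2) * ρ ^ 2 * (nrm ψ * nrm χ) := by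
      rw [show (N:ℝ) / 2 - 1 + (2:ℕ) = (N + 2) / 2 by push_cast; ring]
      have : (N:ℝ) + 2 ≠ 0 := by linarith
      field_simp
    rw [e] at this
    refine le_trans (le_of_eq ?_) this
    congr 1; ext ω
    rw [← integral_mul_const]
    congr 1; ext η
    simp only
    ring
  · intro s hs
    rw [← PT_pair hs.1.le hs.2 hψ hχ]
    refine (cs_sph (PT_cont hs.1.le hs.2 hψ) hχ).trans ?_
    have := mul_le_mul_of_nonneg_right (PT_decay hs.1.le hs.2 hψ hi) (nrm_nonneg χ)
    linarith

end PS

namespace PS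

open Set Metric

variable {N : ℕ} [hN4 : Fact (4 ≤ N)]

/-- weight -/
def wt (σ : ℝ) (x : Euc N) : ℝ := (1 + ‖x‖) ^ (-σ)

lemma wt_pos (σ : ℝ) (x : Euc N) : 0 < wt σ x := Real.rpow_pos_of_pos (by positivity) _

lemma wt_cont (σ : ℝ) : Continuous (wt (N := N) σ) := by
  unfold wt
  have h0 : ∀ x : Euc N, 1 + ‖x‖ ≠ 0 := fun x => by positivity
  exact Continuous.rpow_const (by fun_prop) (fun x => Or.inl (h0 x))

lemma peetre {σ : ℝ} (hσ : 0 ≤ σ) (x z : Euc N) : wt σ (x - z) ≤ (1 + ‖x‖) ^ σ * wt σ z := by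
  unfold wt
  have h1 : (1 + ‖z‖) ≤ (1 + ‖x - z‖) * (1 + ‖x‖) := by
    have : ‖z‖ ≤ ‖x‖ + ‖x - z‖ := by
      have := norm_sub_le x (x - z); simpa using this
    nlinarith [norm_nonneg x, norm_nonneg (x - z)]
  rw [Real.rpow_neg (show 0 ≤ 1 + ‖x - z‖ by positivity), Real.rpow_neg (show 0 ≤ 1 + ‖z‖ by positivity)]
  have h2 := Real.rpow_le_rpow (show 0 ≤ 1 + ‖z‖ by positivity) h1 hσ
  rw [Real.mul_rpow (by positivity) (by positivity)] at h2
  have p1 : 0 < (1 + ‖x - z‖) ^ σ := by positivity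
  have p2 : 0 < (1 + ‖z‖) ^ σ := by positivity
  rw [inv_eq_one_div, div_le_iff₀ p1, ← div_eq_mul_inv, div_mul_eq_mul_div, le_div_iff₀ p2]
  linarith

lemma ker_int {a σ : ℝ} (ha : a < N) (hs : 0 ≤ σ) (has : N < a + σ) :
    Integrable (fun z : Euc N => ‖z‖ ^ (-a) * wt σ z) := by
  have hN := N4 N
  unfold wt
  apply (radial_integrable (N := N) (f := fun s => s ^ (-a) * (1 + s) ^ (-σ))).2
  have e : ∀ s ∈ Ioi (0:ℝ), s ^ (N - 1) * (s ^ (-a) * (1 + s) ^ (-σ)) = s ^ ((N:ℝ) - 1 - a) * (1 + s) ^ (-σ) := by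
    intro s hs
    rw [← Real.rpow_natCast, ← mul_assoc, ← Real.rpow_add hs]
    congr 2; push_cast [Nat.cast_sub (show 1 ≤ N by omega)]; ring
  have mes : Measurable (fun s : ℝ => s ^ ((N:ℝ) - 1 - a) * (1 + s) ^ (-σ)) := by fun_prop
  rw [integrableOn_congr_fun e measurableSet_Ioi, ← Ioc_union_Ioi_eq_Ioi (zero_le_one (α := ℝ))]
  apply IntegrableOn.union
  · have h1 : IntegrableOn (fun s : ℝ => s ^ ((N:ℝ) - 1 - a)) (Ioc 0 1) := by
      have := intervalIntegral.intervalIntegrable_rpow' (a := 0) (b := 1) (r := (N:ℝ) - 1 - a) (by linarith)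
      rwa [intervalIntegrable_iff_integrableOn_Ioc_of_le zero_le_one] at this
    refine Integrable.mono' h1 mes.aestronglyMeasurable ?_
    rw [ae_restrict_iff' measurableSet_Ioc]
    refine Eventually.of_forall fun s hs => ?_
    have h2 : (1 + s) ^ (-σ) ≤ 1 := Real.rpow_le_one_of_one_le_of_nonpos (by linarith [hs.1]) (by linarith)
    have h3 : 0 ≤ s ^ ((N:ℝ) - 1 - a) := Real.rpow_nonneg hs.1.le _
    have h4 : 0 ≤ (1 + s) ^ (-σ) := Real.rpow_nonneg (by linarith [hs.1]) _
    rw [Real.norm_of_nonneg (by positivity)]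
    exact mul_le_of_le_one_right h3 h2
  · have h1 : IntegrableOn (fun s : ℝ => s ^ ((N:ℝ) - 1 - a - σ)) (Ioi 1) :=
      integrableOn_Ioi_rpow_of_lt (by linarith) one_pos
    refine Integrable.mono' h1 mes.aestronglyMeasurable ?_
    rw [ae_restrict_iff' measurableSet_Ioi]
    refine Eventually.of_forall fun s hs => ?_
    have hs0 : (0:ℝ) < s := one_pos.trans hs
    have h2 : (1 + s) ^ (-σ) ≤ s ^ (-σ) := Real.rpow_le_rpow_of_nonpos hs0 (by linarith) (by linarith)
    have h3 : 0 ≤ s ^ ((N:ℝ) - 1 - a) := Real.rpow_nonneg hs0.le _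
    have h4 : 0 ≤ (1 + s) ^ (-σ) := Real.rpow_nonneg (by linarith) _
    rw [Real.norm_of_nonneg (by positivity)]
    calc _ ≤ s ^ ((N:ℝ) - 1 - a) * s ^ (-σ) := mul_le_mul_of_nonneg_left h2 h3
      _ = _ := by rw [← Real.rpow_add hs0]; congr 1

/-- continuous with decay -/
def Dec (σ M : ℝ) (F : Euc N → ℝ) : Prop := Continuous F ∧ ∀ x, |F x| ≤ M * wt σ x

lemma Dec.nonneg {σ M : ℝ} {F : Euc N → ℝ} (h : Dec σ M F) : 0 ≤ M := by
  have := (abs_nonneg _).trans (h.2 0)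
  exact nonneg_of_mul_nonneg_left this (wt_pos _ _)

/-- kernel of size `‖z‖^(-a)` -/
def KB {V : Type*} [NormedAddCommGroup V] (a C : ℝ) (K : Euc N → V) : Prop :=
  StronglyMeasurable K ∧ 0 ≤ C ∧ ∀ z, z ≠ 0 → ‖K z‖ ≤ C * ‖z‖ ^ (-a)

lemma ae_ne : ∀ᵐ z : Euc N, z ≠ 0 := by
  rw [ae_iff]; simp

lemma ae_ne' (x : Euc N) : ∀ᵐ z : Euc N, z ≠ x := by
  rw [ae_iff]; simp

variable {V : Type*} [NormedAddCommGroup V] [NormedSpace ℝ V]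

lemma cv_bound {a C σ M : ℝ} {K : Euc N → V} {F : Euc N → ℝ} (hK : KB a C K) (hF : Dec σ M F)
    (hs : 0 ≤ σ) (x z : Euc N) (hz : z ≠ 0) :
    ‖F (x - z) • K z‖ ≤ (C * M * (1 + ‖x‖) ^ σ) * (‖z‖ ^ (-a) * wt σ z) := by
  have hM := hF.nonneg
  have hC := hK.2.1
  rw [norm_smul, Real.norm_eq_abs]
  calc _ ≤ (M * ((1 + ‖x‖) ^ σ * wt σ z)) * (C * ‖z‖ ^ (-a)) := by
        apply mul_le_mul _ (hK.2.2 z hz) (norm_nonneg _)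
        · have := wt_pos σ z; positivity
        · exact (hF.2 _).trans (mul_le_mul_of_nonneg_left (peetre hs x z) hM)
    _ = _ := by ring

lemma cv_int {a C σ M : ℝ} {K : Euc N → V} {F : Euc N → ℝ} (hK : KB a C K) (hF : Dec σ M F)
    (ha : a < N) (hs : 0 ≤ σ) (has : N < a + σ) (x : Euc N) :
    Integrable (fun z => F (x - z) • K z) := by
  refine Integrable.mono' ((ker_int ha hs has).const_mul (C * M * (1 + ‖x‖) ^ σ)) ?_ ?_
  · exact AEStronglyMeasurable.smul (hF.1.comp (by fun_prop)).aestronglyMeasurable hK.1.aestronglyMeasurable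
  · filter_upwards [ae_ne] with z hz
    exact cv_bound hK hF hs x z hz

lemma cv_int' {a C σ M : ℝ} {K : Euc N → V} {F : Euc N → ℝ} (hK : KB a C K) (hF : Dec σ M F)
    (ha : a < N) (hs : 0 ≤ σ) (has : N < a + σ) (x : Euc N) :
    Integrable (fun y => F y • K (x - y)) := by
  have := (cv_int hK hF ha hs has x).comp_sub_left x
  simpa using this

lemma cv_eq (K : Euc N → V) (F : Euc N → ℝ) (x : Euc N) :
    ∫ y, F y • K (x - y) = ∫ z, F (x - z) • K z := by
  rw [← integral_sub_left_eq_self _ volume x]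
  simp

/-- mollified Newton kernel (not normalised) -/
def Gam (ε : ℝ) (z : Euc N) : ℝ := (‖z‖ ^ 2 + ε) ^ (-((N:ℝ) / 2 - 1))

lemma Gam0 (z : Euc N) : Gam 0 z = (‖z‖ ^ 2) ^ (-((N:ℝ) / 2 - 1)) := by simp [Gam]

lemma q_le {ε c : ℝ} (hε : 0 ≤ ε) (hc : 0 ≤ c) {z : Euc N} (hz : z ≠ 0) :
    (‖z‖ ^ 2 + ε) ^ (-c) ≤ ‖z‖ ^ (-(2 * c)) := by
  have h : 0 < ‖z‖ := norm_pos_iff.2 hz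
  calc _ ≤ (‖z‖ ^ 2) ^ (-c) := Real.rpow_le_rpow_of_nonpos (by positivity) (by linarith) (by linarith)
    _ = _ := by rw [← Real.rpow_natCast, ← Real.rpow_mul h.le]; congr 1; push_cast; ring

lemma Gam_KB {ε : ℝ} (hε : 0 ≤ ε) : KB ((N:ℝ) - 2) 1 (Gam (N := N) ε) := by
  have hN := N4r N
  refine ⟨Measurable.stronglyMeasurable (by unfold Gam; fun_prop), zero_le_one, fun z hz => ?_⟩
  have : 0 ≤ Gam ε z := by unfold Gam; positivity
  rw [Real.norm_of_nonneg this, one_mul, Gam]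
  refine (q_le hε (by linarith) hz).trans (le_of_eq ?_)
  congr 1; ring

/-- normalising constant -/
def cN (N : ℕ) : ℝ := 1 / (((N:ℝ) - 2) * area N)

lemma cN_pos : 0 < cN N := by
  have := N4r N; have := area_pos (N := N)
  unfold cN; apply one_div_pos.2; apply mul_pos <;> linarith

/-- Newton potential -/
def NP (F : Euc N → ℝ) (x : Euc N) : ℝ := cN N * ∫ y, F y * Gam 0 (x - y)

lemma NP_eq (F : Euc N → ℝ) (x : Euc N) : NP F x = cN N * ∫ z, F (x - z) * Gam 0 z := by
  rw [NP]; congr 1; exact cv_eq (Gam 0) F x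

lemma NP_int {σ M : ℝ} {F : Euc N → ℝ} (hF : Dec σ M F) (hs : 2 < σ) (x : Euc N) :
    Integrable (fun y => F y * Gam 0 (x - y)) := by
  have hN := N4r N
  exact cv_int' (Gam_KB le_rfl) hF (by linarith) (by linarith) (by linarith) x

lemma NP_add {σ M M' : ℝ} {F G : Euc N → ℝ} (hF : Dec σ M F) (hG : Dec σ M' G) (hs : 2 < σ) (x : Euc N) :
    NP (fun y => F y + G y) x = NP F x + NP G x := by
  unfold NP
  rw [← mul_add, ← integral_add (NP_int hF hs x) (NP_int hG hs x)]
  congr 2; ext y; ring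

lemma NP_smul (c : ℝ) (F : Euc N → ℝ) (x : Euc N) : NP (fun y => c * F y) x = c * NP F x := by
  unfold NP
  simp only [mul_assoc, integral_const_mul]
  ring

lemma NP_mono {σ M M' : ℝ} {F G : Euc N → ℝ} (hF : Dec σ M F) (hG : Dec σ M' G) (hs : 2 < σ) (x : Euc N)
    (h : ∀ y, F y ≤ G y) : NP F x ≤ NP G x := by
  unfold NP
  apply mul_le_mul_of_nonneg_left _ cN_pos.le
  apply integral_mono (NP_int hF hs x) (NP_int hG hs x)
  intro y
  exact mul_le_mul_of_nonneg_right (h y) (by unfold Gam; positivity)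

/-- radial kernel for mode `l` -/
def gk (N l : ℕ) (r s : ℝ) : ℝ := min r s ^ l * (max r s ^ (N - 2 + l))⁻¹

/-- radial Green operator -/
def GG (N l : ℕ) (h : ℝ → ℝ) (r : ℝ) : ℝ :=
  ((N:ℝ) - 2 + 2 * l)⁻¹ * ∫ s in Ioi (0:ℝ), s ^ (N - 1) * gk N l r s * h s

lemma NP_polar {σ M : ℝ} {F : Euc N → ℝ} (hF : Dec σ M F) (hs : 2 < σ) (x : Euc N) :
    NP F x = ((N:ℝ) - 2)⁻¹ * ∫ s in Ioi (0:ℝ), s ^ (N - 1) *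
      ∫ η : Sph N, F (s • (η : Euc N)) * Gam 0 (x - s • (η : Euc N)) ∂(mu N) := by
  rw [NP, (polar (NP_int hF hs x)).2, cN, ← mul_assoc]
  congr 1
  have := N4r N; have := area_pos (N := N)
  field_simp

lemma Gam_kk {r s : ℝ} (hr : 0 < r) (hs : 0 < s) (ω η : Sph N) :
    Gam 0 (r • (ω : Euc N) - s • (η : Euc N)) = (max r s ^ (N - 2))⁻¹ * kk ((min r s / max r s) • (ω : Euc N)) η := by
  have hN := N4 N
  have hm : 0 < max r s := lt_max_of_lt_left hr
  have e : ‖r • (ω : Euc N) - s • (η : Euc N)‖ ^ 2 = (max r s) ^ 2 * ‖(min r s / max r s) • (ω : Euc N) - η‖ ^ 2 := by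
    rw [norm_sub_sq_real, norm_sub_sq_real]
    simp only [norm_smul, sph_norm, inner_smul_left, inner_smul_right, Real.norm_eq_abs, mul_one, sq_abs, conj_trivial]
    rcases le_total r s with h | h
    · rw [max_eq_right h, min_eq_left h]; field_simp; try ring
    · rw [max_eq_left h, min_eq_right h]; field_simp; try ring
  rw [Gam0, kk, e, Real.mul_rpow (by positivity) (by positivity)]
  congr 1
  rw [← Real.rpow_natCast, ← Real.rpow_natCast, ← Real.rpow_mul hm.le, ← Real.rpow_neg hm.le]
  congr 1
  push_cast [Nat.cast_sub (show 2 ≤ N by omega)]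
  ring

lemma ratio {r s : ℝ} (hr : 0 < r) (hs : 0 < s) (h : s ≠ r) : 0 < min r s / max r s ∧ min r s / max r s < 1 := by
  have hm : 0 < max r s := lt_max_of_lt_left hr
  refine ⟨div_pos (lt_min hr hs) hm, ?_⟩
  rw [div_lt_one hm]
  rcases lt_or_gt_of_ne h with h | h
  · rw [min_eq_right h.le, max_eq_left h.le]; exact h
  · rw [min_eq_left h.le, max_eq_right h.le]; exact h

lemma gk_eq {r s : ℝ} (hr : 0 < r) (hs : 0 < s) (l : ℕ) :
    gk N l r s = (max r s ^ (N - 2))⁻¹ * (min r s / max r s) ^ l := by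
  have hm : 0 < max r s := lt_max_of_lt_left hr
  unfold gk
  rw [pow_add, div_pow]; field_simp

lemma gk_nonneg {r s : ℝ} (hr : 0 < r) (hs : 0 < s) (l : ℕ) : 0 ≤ gk N l r s := by
  have hm : 0 < max r s := lt_max_of_lt_left hr
  have : 0 < min r s := lt_min hr hs
  unfold gk; positivity

lemma gk_le {r s : ℝ} (hr : 0 < r) (hs : 0 < s) (l : ℕ) : gk N l r s ≤ gk N 0 r s := by
  have hm : 0 < max r s := lt_max_of_lt_left hr
  have : 0 < min r s := lt_min hr hs
  rw [gk_eq hr hs, gk_eq hr hs, pow_zero]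
  apply mul_le_mul_of_nonneg_left _ (by positivity)
  apply pow_le_one₀ (by positivity)
  rw [div_le_one hm]; exact min_le_max

lemma gk_le' {r s : ℝ} (hr : 0 < r) (hs : 0 < s) (l : ℕ) : s ^ (N - 1) * gk N l r s ≤ s := by
  have hN := N4 N
  have hm : 0 < max r s := lt_max_of_lt_left hr
  refine (mul_le_mul_of_nonneg_left (gk_le hr hs l) (by positivity)).trans ?_
  rw [gk_eq hr hs, pow_zero, mul_one, ← div_eq_mul_inv, div_le_iff₀ (by positivity)]
  calc s ^ (N - 1) = s * s ^ (N - 2) := by rw [← pow_succ']; congr 1; omega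
    _ ≤ s * max r s ^ (N - 2) := by
      apply mul_le_mul_of_nonneg_left _ hs.le
      exact pow_le_pow_left₀ hs.le (le_max_right _ _) _

lemma gk_meas (l : ℕ) (r : ℝ) : Measurable (fun s => s ^ (N - 1) * gk N l r s) := by
  unfold gk; fun_prop

lemma sint {σ : ℝ} (hs : 2 < σ) : IntegrableOn (fun s : ℝ => s * (1 + s) ^ (-σ)) (Ioi 0) := by
  have h1 : IntegrableOn (fun s : ℝ => (s + 1) ^ (1 - σ)) (Ioi 0) :=
    integrableOn_add_rpow_Ioi_of_lt (by linarith) (by norm_num)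
  refine Integrable.mono' h1 (Measurable.aestronglyMeasurable (by fun_prop)) ?_
  rw [ae_restrict_iff' measurableSet_Ioi]
  refine Eventually.of_forall fun s hs => ?_
  have hs' : (0:ℝ) < s := hs
  rw [Real.norm_of_nonneg (by positivity)]
  calc _ ≤ (s + 1) * (s + 1) ^ (-σ) := by rw [add_comm 1 s]; gcongr; linarith
    _ = _ := by rw [mul_comm, ← Real.rpow_add_one (by positivity)]; congr 1; ring

lemma GG_int {σ M r : ℝ} (hs : 2 < σ) (hr : 0 < r) (l : ℕ) {h : ℝ → ℝ}
    (hm : AEStronglyMeasurable h (volume.restrict (Ioi 0))) (hh : ∀ s > 0, |h s| ≤ M * (1 + s) ^ (-σ)) :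
    IntegrableOn (fun s => s ^ (N - 1) * gk N l r s * h s) (Ioi 0) := by
  refine Integrable.mono' ((sint hs).const_mul M) ((gk_meas l r).aestronglyMeasurable.mul hm) ?_
  rw [ae_restrict_iff' measurableSet_Ioi]
  refine Eventually.of_forall fun s hs => ?_
  have hs' : (0:ℝ) < s := hs
  have h1 := gk_nonneg (N := N) hr hs' l
  rw [norm_mul, Real.norm_of_nonneg (by positivity), Real.norm_eq_abs]
  calc _ ≤ s * (M * (1 + s) ^ (-σ)) := mul_le_mul (gk_le' hr hs' l) (hh s hs') (abs_nonneg _) hs'.le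
    _ = _ := by ring

lemma GG_mono {r : ℝ} (hr : 0 < r) (l : ℕ) {h1 h2 : ℝ → ℝ}
    (i1 : IntegrableOn (fun s => s ^ (N - 1) * gk N l r s * h1 s) (Ioi 0))
    (i2 : IntegrableOn (fun s => s ^ (N - 1) * gk N l r s * h2 s) (Ioi 0))
    (h : ∀ s > 0, h1 s ≤ h2 s) : GG N l h1 r ≤ GG N l h2 r := by
  have hN := N4r N
  unfold GG
  apply mul_le_mul_of_nonneg_left _ (by apply inv_nonneg.2; have : (0:ℝ) ≤ l := Nat.cast_nonneg l; linarith)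
  apply setIntegral_mono_on i1 i2 measurableSet_Ioi
  intro s hs
  have hs' : (0:ℝ) < s := hs
  have := gk_nonneg (N := N) hr hs' l
  exact mul_le_mul_of_nonneg_left (h s hs) (by positivity)

lemma smul_norm {s : ℝ} (hs : 0 < s) (ω : Sph N) : ‖s • (ω : Euc N)‖ = s := nsm hs.le ω

lemma ae_ne_r (r : ℝ) : ∀ᵐ s ∂(volume.restrict (Ioi (0:ℝ))), s ≠ r :=
  ae_restrict_of_ae (by rw [ae_iff]; simp)

/-- Newton potential of a radial function -/
lemma NP_rad {σ M : ℝ} {f : ℝ → ℝ} (hF : Dec (N := N) σ M (fun x => f ‖x‖)) (hs : 2 < σ) {r : ℝ} (hr : 0 < r)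
    (ω : Sph N) : NP (fun x => f ‖x‖) (r • (ω : Euc N)) = GG N 0 f r := by
  rw [NP_polar hF hs, GG]
  congr 1
  · simp
  apply integral_congr_ae
  filter_upwards [ae_ne_r r, ae_restrict_mem measurableSet_Ioi] with s hs1 hs2
  have hs2' : (0:ℝ) < s := hs2
  simp only [smul_norm hs2', Gam_kk hr hs2']
  rw [integral_const_mul, integral_const_mul, kk_one (ratio hr hs2 hs1).1 (ratio hr hs2 hs1).2, gk_eq hr hs2]
  ring

/-- Newton potential of a first mode -/
lemma NP_lin {σ M : ℝ} {f : ℝ → ℝ} (v : Euc N) (hF : Dec (N := N) σ M (fun x => f ‖x‖ * ⟪‖x‖⁻¹ • x, v⟫_ℝ))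
    (hs : 2 < σ) {r : ℝ} (hr : 0 < r)
    (ω : Sph N) : NP (fun x => f ‖x‖ * ⟪‖x‖⁻¹ • x, v⟫_ℝ) (r • (ω : Euc N)) = GG N 1 f r * ⟪(ω : Euc N), v⟫_ℝ := by
  have hN := N4r N
  rw [NP_polar hF hs, GG, mul_assoc, ← integral_mul_const, ← integral_const_mul, ← integral_const_mul]
  apply integral_congr_ae
  filter_upwards [ae_ne_r r, ae_restrict_mem measurableSet_Ioi] with s hs1 hs2
  have hs2' : (0:ℝ) < s := hs2
  simp only [smul_norm hs2', Gam_kk hr hs2', smul_smul, inv_mul_cancel₀ hs2'.ne', one_smul]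
  have e : ∀ η : Sph N, f s * ⟪(η : Euc N), v⟫_ℝ * ((max r s ^ (N - 2))⁻¹ * kk ((min r s / max r s) • (ω : Euc N)) η)
    = (f s * (max r s ^ (N - 2))⁻¹) * (kk ((min r s / max r s) • (ω : Euc N)) η * ⟪(η : Euc N), v⟫_ℝ) := by
    intro η; ring
  simp only [e]
  rw [integral_const_mul, kk_inner (ratio hr hs2 hs1).1 (ratio hr hs2 hs1).2, gk_eq hr hs2]
  have : (N:ℝ) - 2 ≠ 0 := by linarith
  have : (N:ℝ) ≠ 0 := by linarith
  rw [show (N:ℝ) - 2 + 2 * (1:ℕ) = N by push_cast; ring]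
  field_simp

end PS

namespace PS

open Set Metric

variable {N : ℕ} [hN4 : Fact (4 ≤ N)]

variable {V : Type*} [NormedAddCommGroup V] [NormedSpace ℝ V]

lemma gk_lo {r s : ℝ} (hs : 0 < s) (h : s ≤ r) (l : ℕ) :
    s ^ (N - 1) * gk N l r s = (r ^ (N - 2 + l))⁻¹ * s ^ (N - 1 + l) := by
  rw [gk, min_eq_right h, max_eq_left h, pow_add]; ring

lemma gk_up {r s : ℝ} (hr : 0 < r) (h : r < s) (l : ℕ) :
    s ^ (N - 1) * gk N l r s = r ^ l * (s / s ^ l) := by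
  have hN := N4 N
  have hs : 0 < s := hr.trans h
  rw [gk, min_eq_left h.le, max_eq_right h.le]
  have e1 : s ^ (N - 1) = s ^ (N - 2) * s := by rw [← pow_succ]; congr 1; omega
  rw [e1, pow_add]
  field_simp

lemma GG_split {r : ℝ} (hr : 0 < r) (l : ℕ) {h : ℝ → ℝ}
    (i1 : IntegrableOn (fun s => s ^ (N - 1) * gk N l r s * h s) (Ioi 0)) :
    IntegrableOn (fun s => s ^ (N - 1 + l) * h s) (Ioc 0 r) ∧ IntegrableOn (fun s => s / s ^ l * h s) (Ioi r) ∧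
    GG N l h r = ((N:ℝ) - 2 + 2 * l)⁻¹ * ((r ^ (N - 2 + l))⁻¹ * (∫ s in Ioc 0 r, s ^ (N - 1 + l) * h s) +
      r ^ l * ∫ s in Ioi r, s / s ^ l * h s) := by
  have j1 := i1.mono_set (Ioc_subset_Ioi_self : Ioc 0 r ⊆ Ioi 0)
  have j2 := i1.mono_set (Ioi_subset_Ioi hr.le : Ioi r ⊆ Ioi 0)
  have e1 : EqOn (fun s => s ^ (N - 1) * gk N l r s * h s) (fun s => (r ^ (N - 2 + l))⁻¹ * (s ^ (N - 1 + l) * h s)) (Ioc 0 r) := by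
    intro s hs; simp only; rw [gk_lo hs.1 hs.2]; ring
  have e2 : EqOn (fun s => s ^ (N - 1) * gk N l r s * h s) (fun s => r ^ l * (s / s ^ l * h s)) (Ioi r) := by
    intro s hs; simp only; rw [gk_up hr hs]; ring
  have hr1 : (r ^ (N - 2 + l))⁻¹ ≠ 0 := by positivity
  have hr2 : r ^ l ≠ 0 := by positivity
  refine ⟨?_, ?_, ?_⟩
  · have := j1.congr_fun e1 measurableSet_Ioc
    have := this.const_mul (r ^ (N - 2 + l))
    refine IntegrableOn.congr_fun this (fun s _ => ?_) measurableSet_Ioc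
    field_simp
  · have := j2.congr_fun e2 measurableSet_Ioi
    have := this.const_mul (r ^ l)⁻¹
    refine IntegrableOn.congr_fun this (fun s _ => ?_) measurableSet_Ioi
    field_simp
  · rw [GG, ← Ioc_union_Ioi_eq_Ioi hr.le, setIntegral_union (Ioc_disjoint_Ioi le_rfl) measurableSet_Ioi j1 j2,
      setIntegral_congr_fun measurableSet_Ioc e1, setIntegral_congr_fun measurableSet_Ioi e2,
      integral_const_mul, integral_const_mul]

/-- Wronskian evaluation of the radial Green operator -/
lemma GG_eval {r : ℝ} (hr : 0 < r) (l : ℕ) {S P Q : ℝ → ℝ}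
    (i1 : IntegrableOn (fun s => s ^ (N - 1) * gk N l r s * S s) (Ioi 0))
    (hP : ∀ s > 0, HasDerivAt P (s ^ (N - 1 + l) * S s) s)
    (hQ : ∀ s > 0, HasDerivAt Q (-(s / s ^ l * S s)) s)
    (hP0 : Tendsto P (𝓝[>] 0) (𝓝 0)) (hQ0 : Tendsto Q atTop (𝓝 0)) :
    GG N l S r = ((N:ℝ) - 2 + 2 * l)⁻¹ * ((r ^ (N - 2 + l))⁻¹ * P r + r ^ l * Q r) := by
  obtain ⟨a1, a2, a3⟩ := GG_split hr l i1
  have e1 : ∫ s in Ioc 0 r, s ^ (N - 1 + l) * S s = P r := by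
    rw [← intervalIntegral.integral_of_le hr.le]
    have := intervalIntegral.integral_eq_sub_of_hasDerivAt_of_tendsto hr
      (fun s hs => hP s hs.1) ((intervalIntegrable_iff_integrableOn_Ioc_of_le hr.le).2 a1) hP0
      ((hP r hr).continuousAt.tendsto.mono_left nhdsWithin_le_nhds)
    rw [this, sub_zero]
  have e2 : ∫ s in Ioi r, s / s ^ l * S s = Q r := by
    have := integral_Ioi_of_hasDerivAt_of_tendsto (f := Q) (f' := fun s => -(s / s ^ l * S s)) (a := r) (m := 0)
      (hQ r hr).continuousAt.continuousWithinAt (fun s hs => hQ s (hr.trans hs)) a2.neg hQ0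
    rw [integral_neg] at this
    linarith
  rw [a3, e1, e2]

lemma int_tail {τ r : ℝ} (hτ : 1 < τ) (hr : 0 ≤ r) : IntegrableOn (fun s : ℝ => (1 + s) ^ (-τ)) (Ioi r) ∧
    ∫ s in Ioi r, (1 + s) ^ (-τ) = (1 + r) ^ (1 - τ) / (τ - 1) := by
  have i : IntegrableOn (fun s : ℝ => (1 + s) ^ (-τ)) (Ioi r) := by
    have := integrableOn_add_rpow_Ioi_of_lt (a := -τ) (c := r) (m := 1) (by linarith) (by linarith)
    simpa only [add_comm] using this
  refine ⟨i, ?_⟩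
  have hd : ∀ s ∈ Ici r, HasDerivAt (fun s : ℝ => (1 + s) ^ (1 - τ) / (1 - τ)) ((1 + s) ^ (-τ)) s := by
    intro s hs
    have hs' : r ≤ s := hs
    have h1 : HasDerivAt (fun s : ℝ => 1 + s) 1 s := (hasDerivAt_id s).const_add 1
    have h2 := (h1.rpow_const (p := 1 - τ) (Or.inl (by linarith))).div_const (1 - τ)
    refine h2.congr_deriv ?_
    have : 1 - τ ≠ 0 := by linarith
    rw [show 1 - τ - 1 = -τ by ring]
    field_simp
  have ht : Tendsto (fun s : ℝ => (1 + s) ^ (1 - τ) / (1 - τ)) atTop (𝓝 0) := by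
    have h1 : Tendsto (fun s : ℝ => (1 + s)) atTop atTop := tendsto_atTop_add_const_left _ _ tendsto_id
    have := ((tendsto_rpow_neg_atTop (y := τ - 1) (by linarith)).comp h1).div_const (1 - τ)
    simpa only [Function.comp_def, zero_div, neg_sub] using this
  rw [integral_Ioi_of_hasDerivAt_of_tendsto' hd i ht]
  have : 1 - τ ≠ 0 := by linarith
  have : τ - 1 ≠ 0 := by linarith
  rw [zero_sub, ← neg_sub τ 1, div_neg, neg_neg]

lemma int_head {k : ℕ} {σ r : ℝ} (hs : 0 ≤ σ) (hk : σ < k + 1) (hr : 0 < r) :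
    ∫ s in Ioc 0 r, s ^ k * (1 + s) ^ (-σ) ≤ (1 + r) ^ (-σ) * r ^ (k + 1) / (k + 1 - σ) := by
  have i2 : IntegrableOn (fun s : ℝ => (1 + r) ^ (-σ) * r ^ σ * s ^ ((k:ℝ) - σ)) (Ioc 0 r) := by
    have := intervalIntegral.intervalIntegrable_rpow' (a := 0) (b := r) (r := (k:ℝ) - σ) (by linarith)
    rw [intervalIntegrable_iff_integrableOn_Ioc_of_le hr.le] at this
    exact this.const_mul _
  have pw : ∀ s ∈ Ioc 0 r, s ^ k * (1 + s) ^ (-σ) ≤ (1 + r) ^ (-σ) * r ^ σ * s ^ ((k:ℝ) - σ) := by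
    intro s hs1
    have h0 : 0 < s := hs1.1
    have h1 : s * (1 + r) ≤ r * (1 + s) := by nlinarith [hs1.2]
    have h2 := Real.rpow_le_rpow (by positivity) h1 hs
    rw [Real.mul_rpow (by positivity) (by positivity), Real.mul_rpow (by positivity) (by positivity)] at h2
    rw [Real.rpow_sub h0, Real.rpow_natCast, Real.rpow_neg (by positivity), Real.rpow_neg (by positivity)]
    have p1 : 0 < s ^ σ := by positivity
    have p2 : 0 < (1 + s) ^ σ := by positivity
    have p3 : 0 < (1 + r) ^ σ := by positivity
    rw [← div_eq_mul_inv, div_le_iff₀ p2]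
    calc s ^ k = s ^ k / ((1 + r) ^ σ * s ^ σ) * (s ^ σ * (1 + r) ^ σ) := by field_simp
      _ ≤ s ^ k / ((1 + r) ^ σ * s ^ σ) * (r ^ σ * (1 + s) ^ σ) := by gcongr
      _ = _ := by field_simp
  have i1 : IntegrableOn (fun s : ℝ => s ^ k * (1 + s) ^ (-σ)) (Ioc 0 r) := by
    refine Integrable.mono' i2 (Measurable.aestronglyMeasurable (by fun_prop)) ?_
    rw [ae_restrict_iff' measurableSet_Ioc]
    refine Eventually.of_forall fun s hs1 => ?_
    have h0 : 0 < s := hs1.1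
    rw [Real.norm_of_nonneg (by positivity)]
    exact pw s hs1
  calc _ ≤ ∫ s in Ioc 0 r, (1 + r) ^ (-σ) * r ^ σ * s ^ ((k:ℝ) - σ) :=
        setIntegral_mono_on i1 i2 measurableSet_Ioc pw
    _ = (1 + r) ^ (-σ) * r ^ σ * (r ^ ((k:ℝ) - σ + 1) / ((k:ℝ) - σ + 1)) := by
      rw [integral_const_mul, ← intervalIntegral.integral_of_le hr.le, integral_rpow (Or.inl (by linarith)),
        Real.zero_rpow (by linarith), sub_zero]
    _ = _ := by
      have : r ^ σ * r ^ ((k:ℝ) - σ + 1) = r ^ (k + 1) := by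
        rw [← Real.rpow_add hr, ← Real.rpow_natCast]; congr 1; push_cast; ring
      rw [show (k:ℝ) + 1 - σ = k - σ + 1 by ring, ← this]; ring

/-- decay of the mode-zero Green operator -/
lemma GG0_bd {σ r : ℝ} (hs : 2 < σ) (hsN : σ < N) (hr : 0 < r) :
    GG N 0 (fun s => (1 + s) ^ (-σ)) r ≤ (1 / (N - σ) + 1 / (σ - 2)) * (1 + r) ^ (-(σ - 2)) := by
  have hN := N4 N
  have hNr := N4r N
  have i := GG_int (N := N) (M := 1) hs hr 0 (h := fun s => (1 + s) ^ (-σ))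
    (Measurable.aestronglyMeasurable (by fun_prop)) (fun s hs => by
      rw [one_mul, abs_of_nonneg (by positivity)])
  obtain ⟨-, a2, a3⟩ := GG_split hr 0 i
  have h1 := int_head (k := N - 1 + 0) (σ := σ) (r := r) (by linarith) (by push_cast [Nat.cast_sub (show 1 ≤ N by omega)]; linarith) hr
  have h2 := int_tail (τ := σ - 1) (r := r) (by linarith) hr.le
  have h3 : ∫ s in Ioi r, s / s ^ 0 * (1 + s) ^ (-σ) ≤ ∫ s in Ioi r, (1 + s) ^ (-(σ - 1)) := by
    apply setIntegral_mono_on a2 h2.1 measurableSet_Ioi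
    intro s hs1
    have : 0 < s := hr.trans hs1
    rw [pow_zero, div_one, show -(σ - 1) = -σ + 1 by ring, Real.rpow_add_one (by positivity)]
    nlinarith [Real.rpow_pos_of_pos (show 0 < 1 + s by linarith) (-σ)]
  rw [h2.2] at h3
  have e1 : (((N - 1 + 0 : ℕ) : ℝ) + 1 - σ) = N - σ := by push_cast [Nat.cast_sub (show 1 ≤ N by omega)]; ring
  rw [e1] at h1
  have hX : (1 + r) ^ (1 - (σ - 1)) = (1 + r) ^ (-(σ - 2)) := by congr 1; ring
  rw [hX, show σ - 1 - 1 = σ - 2 by ring] at h3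
  have hY : (r ^ (N - 2 + 0))⁻¹ * ((1 + r) ^ (-σ) * r ^ (N - 1 + 0 + 1)) ≤ (1 + r) ^ (-(σ - 2)) := by
    have : r ^ (N - 1 + 0 + 1) = r ^ (N - 2 + 0) * r ^ 2 := by rw [← pow_add]; congr 1; omega
    rw [this, show -(σ - 2) = -σ + (2:ℕ) by push_cast; ring, Real.rpow_add (by positivity), Real.rpow_natCast]
    have p : r ^ (N - 2 + 0) ≠ 0 := by positivity
    have : (r ^ (N - 2 + 0))⁻¹ * ((1 + r) ^ (-σ) * (r ^ (N - 2 + 0) * r ^ 2)) = (1 + r) ^ (-σ) * r ^ 2 := by field_simp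
    rw [this]; gcongr; linarith
  have hA : (r ^ (N - 2 + 0))⁻¹ * (∫ s in Ioc 0 r, s ^ (N - 1 + 0) * (1 + s) ^ (-σ)) ≤ (1 + r) ^ (-(σ - 2)) / (N - σ) := by
    have p : 0 ≤ (r ^ (N - 2 + 0))⁻¹ := by positivity
    refine (mul_le_mul_of_nonneg_left h1 p).trans ?_
    rw [mul_div_assoc']
    exact div_le_div_of_nonneg_right hY (by linarith)
  rw [a3]
  have p0 : 0 ≤ (1 + r) ^ (-(σ - 2)) := by positivity
  have hC : ((N:ℝ) - 2 + 2 * (0:ℕ))⁻¹ ≤ 1 := by apply inv_le_one_of_one_le₀; push_cast; linarith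
  have hpos : 0 ≤ (r ^ (N - 2 + 0))⁻¹ * (∫ s in Ioc 0 r, s ^ (N - 1 + 0) * (1 + s) ^ (-σ)) + r ^ 0 * ∫ s in Ioi r, s / s ^ 0 * (1 + s) ^ (-σ) := by
    apply add_nonneg
    · apply mul_nonneg (by positivity)
      apply setIntegral_nonneg measurableSet_Ioc
      intro s hs1; have := hs1.1; positivity
    · apply mul_nonneg (by positivity)
      apply setIntegral_nonneg measurableSet_Ioi
      intro s hs1; have : 0 < s := hr.trans hs1; positivity
  refine (mul_le_of_le_one_left hpos hC).trans ?_
  rw [pow_zero, one_mul]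
  refine (add_le_add hA h3).trans (le_of_eq ?_)
  ring

/-- decay of the mode-two Green operator -/
lemma GG2_bd {σ r : ℝ} (hs : 2 < σ) (hsN : σ < N) (hr : 0 < r) :
    GG N 2 (fun s => (1 + s) ^ (-σ)) r ≤ (1 / (N + 2 - σ) + 1 / (σ - 1)) * (r * (1 + r) ^ (1 - σ)) := by
  have hN := N4 N
  have hNr := N4r N
  have i := GG_int (N := N) (M := 1) hs hr 2 (h := fun s => (1 + s) ^ (-σ))
    (Measurable.aestronglyMeasurable (by fun_prop)) (fun s hs => by
      rw [one_mul, abs_of_nonneg (by positivity)])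
  obtain ⟨-, a2, a3⟩ := GG_split hr 2 i
  have h1 := int_head (k := N - 1 + 2) (σ := σ) (r := r) (by linarith) (by push_cast [Nat.cast_sub (show 1 ≤ N by omega)]; linarith) hr
  have h2 := int_tail (τ := σ) (r := r) (by linarith) hr.le
  have h3 : ∫ s in Ioi r, s / s ^ 2 * (1 + s) ^ (-σ) ≤ ∫ s in Ioi r, r⁻¹ * (1 + s) ^ (-σ) := by
    apply setIntegral_mono_on a2 (h2.1.const_mul _) measurableSet_Ioi
    intro s hs1
    have hs1' : r < s := hs1
    have : 0 < s := hr.trans hs1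
    apply mul_le_mul_of_nonneg_right _ (by positivity)
    rw [show s / s ^ 2 = s⁻¹ by field_simp]
    exact inv_anti₀ hr hs1'.le
  rw [integral_const_mul, h2.2] at h3
  have e1 : (((N - 1 + 2 : ℕ) : ℝ) + 1 - σ) = N + 2 - σ := by push_cast [Nat.cast_sub (show 1 ≤ N by omega)]; ring
  rw [e1] at h1
  have hY : (r ^ (N - 2 + 2))⁻¹ * ((1 + r) ^ (-σ) * r ^ (N - 1 + 2 + 1)) ≤ r * (1 + r) ^ (1 - σ) := by
    have : r ^ (N - 1 + 2 + 1) = r ^ (N - 2 + 2) * r ^ 2 := by rw [← pow_add]; congr 1; omega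
    rw [this, show 1 - σ = -σ + 1 by push_cast; ring, Real.rpow_add_one (by positivity)]
    have p : r ^ (N - 2 + 2) ≠ 0 := by positivity
    have : (r ^ (N - 2 + 2))⁻¹ * ((1 + r) ^ (-σ) * (r ^ (N - 2 + 2) * r ^ 2)) = (1 + r) ^ (-σ) * r ^ 2 := by field_simp
    rw [this]
    nlinarith [mul_pos hr (Real.rpow_pos_of_pos (show 0 < 1 + r by linarith) (-σ))]
  have hA : (r ^ (N - 2 + 2))⁻¹ * (∫ s in Ioc 0 r, s ^ (N - 1 + 2) * (1 + s) ^ (-σ)) ≤ r * (1 + r) ^ (1 - σ) / (N + 2 - σ) := by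
    have p : 0 ≤ (r ^ (N - 2 + 2))⁻¹ := by positivity
    refine (mul_le_mul_of_nonneg_left h1 p).trans ?_
    rw [mul_div_assoc']
    exact div_le_div_of_nonneg_right hY (by linarith)
  have hB : r ^ 2 * (∫ s in Ioi r, s / s ^ 2 * (1 + s) ^ (-σ)) ≤ r * (1 + r) ^ (1 - σ) / (σ - 1) := by
    refine (mul_le_mul_of_nonneg_left h3 (by positivity)).trans (le_of_eq ?_)
    field_simp
  rw [a3]
  have hC : ((N:ℝ) - 2 + 2 * (2:ℕ))⁻¹ ≤ 1 := by apply inv_le_one_of_one_le₀; push_cast; linarith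
  have hpos : 0 ≤ (r ^ (N - 2 + 2))⁻¹ * (∫ s in Ioc 0 r, s ^ (N - 1 + 2) * (1 + s) ^ (-σ)) + r ^ 2 * ∫ s in Ioi r, s / s ^ 2 * (1 + s) ^ (-σ) := by
    apply add_nonneg
    · apply mul_nonneg (by positivity)
      apply setIntegral_nonneg measurableSet_Ioc
      intro s hs1; have := hs1.1; positivity
    · apply mul_nonneg (by positivity)
      apply setIntegral_nonneg measurableSet_Ioi
      intro s hs1; have : 0 < s := hr.trans hs1; positivity
  refine (mul_le_of_le_one_left hpos hC).trans ?_
  refine (add_le_add hA hB).trans (le_of_eq ?_)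
  ring

lemma wt_Dec (σ : ℝ) : Dec (N := N) σ 1 (wt σ) := ⟨wt_cont σ, fun x => by rw [one_mul, abs_of_pos (wt_pos _ _)]⟩

lemma Dec.smul {σ M : ℝ} {F : Euc N → ℝ} (h : Dec σ M F) (c : ℝ) : Dec σ (|c| * M) (fun x => c * F x) :=
  ⟨by have := h.1; fun_prop, fun x => by rw [abs_mul, mul_assoc]; exact mul_le_mul_of_nonneg_left (h.2 x) (abs_nonneg _)⟩

lemma Dec.add {σ M M' : ℝ} {F G : Euc N → ℝ} (h : Dec σ M F) (h' : Dec σ M' G) : Dec σ (M + M') (fun x => F x + G x) :=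
  ⟨h.1.add h'.1, fun x => by rw [add_mul]; exact (abs_add_le _ _).trans (add_le_add (h.2 x) (h'.2 x))⟩

lemma exists_dir (x : Euc N) (hx : x ≠ 0) : ∃ ω : Sph N, x = ‖x‖ • (ω : Euc N) := by
  have h := norm_ne_zero_iff.2 hx
  refine ⟨⟨‖x‖⁻¹ • x, by simp [norm_smul, h]⟩, ?_⟩
  rw [smul_smul, mul_inv_cancel₀ h, one_smul]

/-- uniform convergence on balls -/
lemma unif_conv {Ω : Type*} {K : ℕ → Euc N → V} {K0 : Euc N → V} {G D : Euc N → ℝ} {g : Ω → Euc N → ℝ} {S : Set Ω}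
    (hK : ∀ n, StronglyMeasurable (K n)) (hK0 : StronglyMeasurable K0)
    (hD : AEStronglyMeasurable D volume) (hD0 : ∀ z, 0 ≤ D z)
    (hG : Integrable G) (hb : ∀ n z, z ≠ 0 → D z * ‖K n z‖ ≤ G z) (hb0 : ∀ z, z ≠ 0 → D z * ‖K0 z‖ ≤ G z)
    (hlim : ∀ z, z ≠ 0 → Tendsto (fun n => K n z) atTop (𝓝 (K0 z)))
    (hg : ∀ x ∈ S, ∀ z, |g x z| ≤ D z) (hgm : ∀ x ∈ S, AEStronglyMeasurable (g x) volume) :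
    TendstoUniformlyOn (fun n x => ∫ z, g x z • K n z) (fun x => ∫ z, g x z • K0 z) atTop S := by
  have h1 : Tendsto (fun n => ∫ z, D z * ‖K n z - K0 z‖) atTop (𝓝 (∫ z : Euc N, (0:ℝ))) := by
    apply tendsto_integral_of_dominated_convergence (fun z => 2 * G z)
    · intro n; exact hD.mul ((hK n).sub hK0).norm.aestronglyMeasurable
    · exact hG.const_mul 2
    · intro n
      filter_upwards [ae_ne] with z hz
      rw [Real.norm_of_nonneg (mul_nonneg (hD0 z) (norm_nonneg _))]
      have := mul_le_mul_of_nonneg_left (norm_sub_le (K n z) (K0 z)) (hD0 z)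
      linarith [hb n z hz, hb0 z hz]
    · filter_upwards [ae_ne] with z hz
      have := ((tendsto_iff_norm_sub_tendsto_zero.1 (hlim z hz))).const_mul (D z)
      simpa using this
  simp only [integral_zero] at h1
  rw [Metric.tendstoUniformlyOn_iff]
  intro ε hε
  filter_upwards [h1.eventually (gt_mem_nhds hε)] with n hn x hx
  have ii : ∀ L : Euc N → V, StronglyMeasurable L → (∀ z, z ≠ 0 → D z * ‖L z‖ ≤ G z) → Integrable (fun z => g x z • L z) := by
    intro L hL hLb
    refine Integrable.mono' hG ((hgm x hx).smul hL.aestronglyMeasurable) ?_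
    filter_upwards [ae_ne] with z hz
    rw [norm_smul]
    exact (mul_le_mul_of_nonneg_right (hg x hx z) (norm_nonneg _)).trans (hLb z hz)
  rw [dist_comm, dist_eq_norm, ← integral_sub (ii _ (hK n) (hb n)) (ii _ hK0 hb0)]
  refine lt_of_le_of_lt (norm_integral_le_of_norm_le (g := fun z => D z * ‖K n z - K0 z‖) ?_ ?_) hn
  · refine Integrable.mono' (hG.const_mul 2) (hD.mul ((hK n).sub hK0).norm.aestronglyMeasurable) ?_
    filter_upwards [ae_ne] with z hz
    rw [Real.norm_of_nonneg (mul_nonneg (hD0 z) (norm_nonneg _))]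
    have := mul_le_mul_of_nonneg_left (norm_sub_le (K n z) (K0 z)) (hD0 z)
    linarith [hb n z hz, hb0 z hz]
  · refine Eventually.of_forall fun z => ?_
    rw [← smul_sub, norm_smul]
    exact mul_le_mul_of_nonneg_right (hg x hx z) (norm_nonneg _)

end PS

namespace PS

open Set Metric

variable {N : ℕ} [hN4 : Fact (4 ≤ N)]

set_option maxSynthPendingDepth 6

variable {V : Type*} [NormedAddCommGroup V] [NormedSpace ℝ V]

/-- the inner product as a bilinear map -/
def J (N : ℕ) : Euc N →L[ℝ] Euc N →L[ℝ] ℝ := (innerₗ (Euc N)).mkContinuous₂ 1 (fun x y => by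
  rw [one_mul]; exact norm_inner_le_norm x y)

lemma J_apply (x y : Euc N) : J N x y = ⟪x, y⟫_ℝ := rfl

lemma J_norm (x : Euc N) : ‖J N x‖ ≤ ‖x‖ :=
  ContinuousLinearMap.opNorm_le_bound _ (norm_nonneg _) fun y => norm_inner_le_norm x y

lemma J_norm1 : ‖J N‖ ≤ 1 :=
  ContinuousLinearMap.opNorm_le_bound _ zero_le_one fun x => by rw [one_mul]; exact J_norm x

def K1 (ε : ℝ) (z : Euc N) : Euc N →L[ℝ] ℝ := (‖z‖ ^ 2 + ε) ^ (-((N:ℝ) / 2)) • J N z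

def K2 (ε : ℝ) (z : Euc N) : Euc N →L[ℝ] Euc N →L[ℝ] ℝ :=
  (‖z‖ ^ 2 + ε) ^ (-((N:ℝ) / 2)) • J N - ((N:ℝ) * (‖z‖ ^ 2 + ε) ^ (-((N:ℝ) / 2 + 1))) • (J N z).smulRight (J N z)

lemma K2_apply (ε : ℝ) (z v w : Euc N) : K2 ε z v w = (‖z‖ ^ 2 + ε) ^ (-((N:ℝ) / 2)) * ⟪v, w⟫_ℝ
    - ((N:ℝ) * (‖z‖ ^ 2 + ε) ^ (-((N:ℝ) / 2 + 1))) * (⟪z, v⟫_ℝ * ⟪z, w⟫_ℝ) := by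
  simp [K2, J_apply]

lemma q_meas (ε c : ℝ) : Measurable (fun z : Euc N => (‖z‖ ^ 2 + ε) ^ c) := by fun_prop

lemma K1_meas (ε : ℝ) : StronglyMeasurable (K1 (N := N) ε) :=
  (q_meas ε _).stronglyMeasurable.smul (J N).continuous.stronglyMeasurable

lemma K2_meas (ε : ℝ) : StronglyMeasurable (K2 (N := N) ε) := by
  refine ((q_meas ε _).stronglyMeasurable.smul stronglyMeasurable_const).sub
    ((((q_meas ε _).stronglyMeasurable).const_mul _).smul (Continuous.stronglyMeasurable ?_))
  fun_prop

lemma q_d {ε : ℝ} (hε : 0 < ε) (c : ℝ) (z : Euc N) :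
    HasFDerivAt (fun z : Euc N => (‖z‖ ^ 2 + ε) ^ (-c)) ((-(2 * c) * (‖z‖ ^ 2 + ε) ^ (-(c + 1))) • J N z) z := by
  have h1 : HasFDerivAt (fun z : Euc N => ‖z‖ ^ 2 + ε) ((2:ℝ) • J N z) z := by
    have := ((hasStrictFDerivAt_norm_sq (F := Euc N) z).hasFDerivAt).add_const ε
    refine this.congr_fderiv ?_
    ext y; simp [J_apply]
  have := h1.rpow_const (p := -c) (Or.inl (by positivity))
  refine this.congr_fderiv ?_
  rw [smul_smul, show -c - 1 = -(c + 1) by ring]; congr 1; ring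

lemma Gam_d {ε : ℝ} (hε : 0 < ε) (z : Euc N) :
    HasFDerivAt (Gam (N := N) ε) ((-((N:ℝ) - 2)) • K1 ε z) z := by
  have := q_d (N := N) hε ((N:ℝ) / 2 - 1) z
  refine this.congr_fderiv ?_
  rw [K1, smul_smul, sub_add_cancel]; congr 1; ring

lemma K1_d {ε : ℝ} (hε : 0 < ε) (z : Euc N) : HasFDerivAt (K1 (N := N) ε) (K2 ε z) z := by
  have := (q_d (N := N) hε ((N:ℝ) / 2) z).smul (J N).hasFDerivAt
  refine this.congr_fderiv ?_
  ext v w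
  rw [K2_apply]
  simp [J_apply]
  ring

lemma K1_le {ε : ℝ} (hε : 0 ≤ ε) (z : Euc N) : ‖K1 ε z‖ ≤ (‖z‖ ^ 2 + ε) ^ (-((N:ℝ) / 2)) * ‖z‖ := by
  rw [K1, norm_smul, Real.norm_of_nonneg (by positivity)]
  gcongr; exact J_norm z

lemma K2_le {ε : ℝ} (hε : 0 ≤ ε) (z : Euc N) : ‖K2 ε z‖ ≤ ((N:ℝ) + 1) * (‖z‖ ^ 2 + ε) ^ (-((N:ℝ) / 2)) := by
  have hq : 0 ≤ ‖z‖ ^ 2 + ε := by positivity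
  have h1 : ‖(‖z‖ ^ 2 + ε) ^ (-((N:ℝ) / 2)) • J N‖ ≤ (‖z‖ ^ 2 + ε) ^ (-((N:ℝ) / 2)) := by
    rw [norm_smul, Real.norm_of_nonneg (by positivity)]
    exact mul_le_of_le_one_right (by positivity) J_norm1
  have h2 : ‖((N:ℝ) * (‖z‖ ^ 2 + ε) ^ (-((N:ℝ) / 2 + 1))) • (J N z).smulRight (J N z)‖ ≤ N * (‖z‖ ^ 2 + ε) ^ (-((N:ℝ) / 2)) := by
    rw [norm_smul, Real.norm_of_nonneg (by positivity), ContinuousLinearMap.norm_smulRight_apply, mul_assoc]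
    gcongr
    have h3 : ‖J N z‖ * ‖J N z‖ ≤ ‖z‖ ^ 2 + ε := by
      nlinarith [J_norm z, norm_nonneg (J N z), norm_nonneg z]
    rcases eq_or_lt_of_le hq with h | h
    · rw [← h] at h3 ⊢
      have : ‖J N z‖ * ‖J N z‖ = 0 := le_antisymm h3 (by positivity)
      rw [this, mul_zero]; positivity
    · calc _ ≤ (‖z‖ ^ 2 + ε) ^ (-((N:ℝ) / 2 + 1)) * (‖z‖ ^ 2 + ε) := by gcongr
        _ = _ := by rw [← Real.rpow_add_one h.ne']; congr 1; ring
  refine (norm_sub_le _ _).trans ((add_le_add h1 h2).trans (le_of_eq ?_))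
  ring

lemma K1_KB {ε : ℝ} (hε : 0 ≤ ε) : KB ((N:ℝ) - 1) 1 (K1 (N := N) ε) := by
  refine ⟨K1_meas ε, zero_le_one, fun z hz => ?_⟩
  have hz' := norm_pos_iff.2 hz
  refine (K1_le hε z).trans ?_
  have := q_le (c := (N:ℝ) / 2) hε (by positivity) hz
  rw [one_mul, show -((N:ℝ) - 1) = -(2 * ((N:ℝ) / 2)) + 1 by ring, Real.rpow_add_one hz'.ne']
  gcongr

lemma K2_KB {ε : ℝ} (hε : 0 ≤ ε) : KB (N:ℝ) ((N:ℝ) + 1) (K2 (N := N) ε) := by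
  refine ⟨K2_meas ε, by positivity, fun z hz => ?_⟩
  refine (K2_le hε z).trans ?_
  have := q_le (c := (N:ℝ) / 2) hε (by positivity) hz
  rw [show -(N:ℝ) = -(2 * ((N:ℝ) / 2)) by ring]
  gcongr

lemma q_wt {ε c : ℝ} (hε : 0 < ε) (hc : 0 ≤ c) : ∃ C, 0 ≤ C ∧ ∀ z : Euc N, (‖z‖ ^ 2 + ε) ^ (-c) ≤ C * wt (2 * c) z := by
  set κ := min 1 ε / 2 with hκ
  have k0 : 0 < κ := by positivity
  refine ⟨κ ^ (-c), by positivity, fun z => ?_⟩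
  have h1 : κ * (1 + ‖z‖) ^ 2 ≤ ‖z‖ ^ 2 + ε := by
    have a1 : min 1 ε ≤ 1 := min_le_left _ _
    have a2 : min 1 ε ≤ ε := min_le_right _ _
    nlinarith [sq_nonneg (1 - ‖z‖), sq_nonneg ‖z‖, mul_nonneg k0.le (sq_nonneg (1 - ‖z‖))]
  have h2 := Real.rpow_le_rpow_of_nonpos (by positivity) h1 (show -c ≤ 0 by linarith)
  refine h2.trans (le_of_eq ?_)
  rw [Real.mul_rpow k0.le (by positivity), wt, ← Real.rpow_natCast, ← Real.rpow_mul (by positivity)]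
  congr 2; push_cast; ring

lemma K1_wt {ε : ℝ} (hε : 0 < ε) : ∃ C, 0 ≤ C ∧ ∀ z : Euc N, ‖K1 ε z‖ ≤ C * wt ((N:ℝ) - 2) z := by
  obtain ⟨C, hC, h⟩ := q_wt (N := N) hε (c := (N:ℝ) / 2) (by positivity)
  refine ⟨C, hC, fun z => (K1_le hε.le z).trans ?_⟩
  have e : wt ((N:ℝ) - 2) z = wt (2 * ((N:ℝ) / 2)) z * (1 + ‖z‖) ^ 2 := by
    rw [wt, wt, ← Real.rpow_natCast, ← Real.rpow_add (by positivity)]; congr 1; push_cast; ring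
  rw [e, ← mul_assoc]
  have := h z
  have := norm_nonneg z
  have p := wt_pos (2 * ((N:ℝ) / 2)) z
  gcongr
  nlinarith

lemma K2_wt {ε : ℝ} (hε : 0 < ε) : ∃ C, 0 ≤ C ∧ ∀ z : Euc N, ‖K2 ε z‖ ≤ C * wt ((N:ℝ) - 2) z := by
  obtain ⟨C, hC, h⟩ := q_wt (N := N) hε (c := (N:ℝ) / 2) (by positivity)
  refine ⟨((N:ℝ) + 1) * C, by positivity, fun z => (K2_le hε.le z).trans ?_⟩
  have e : wt (2 * ((N:ℝ) / 2)) z ≤ wt ((N:ℝ) - 2) z := by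
    rw [wt, wt]; exact Real.rpow_le_rpow_of_exponent_le (by linarith [norm_nonneg z]) (by linarith)
  rw [mul_assoc]
  have := (h z).trans (mul_le_mul_of_nonneg_left e hC)
  gcongr

lemma K1_cont {ε : ℝ} (hε : 0 < ε) : Continuous (K1 (N := N) ε) :=
  continuous_iff_continuousAt.2 fun z => (K1_d hε z).continuousAt

lemma q_cont {ε : ℝ} (hε : 0 < ε) (c : ℝ) : Continuous (fun z : Euc N => (‖z‖ ^ 2 + ε) ^ c) :=
  (by fun_prop : Continuous (fun z : Euc N => ‖z‖ ^ 2 + ε)).rpow_const (fun z => Or.inl (by positivity))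

lemma K2_cont {ε : ℝ} (hε : 0 < ε) : Continuous (K2 (N := N) ε) := by
  have h1 := q_cont (N := N) hε (-((N:ℝ) / 2))
  have h2 := q_cont (N := N) hε (-((N:ℝ) / 2 + 1))
  have h3 : Continuous (fun z : Euc N => (J N z).smulRight (J N z)) := by fun_prop
  exact (h1.smul continuous_const).sub ((continuous_const.mul h2).smul h3)

lemma wt_mul (a b : ℝ) (z : Euc N) : wt a z * wt b z = wt (a + b) z := by
  rw [wt, wt, wt, ← Real.rpow_add (by positivity)]; congr 1; ring

lemma wt_anti {a b : ℝ} (h : a ≤ b) (z : Euc N) : wt b z ≤ wt a z := by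
  rw [wt, wt]; exact Real.rpow_le_rpow_of_exponent_le (by linarith [norm_nonneg z]) (by linarith)

lemma wt_int {σ : ℝ} (h : N < σ) : Integrable (wt (N := N) σ) := by
  have := ker_int (N := N) (a := 0) (σ := σ) (by have := N4r N; linarith) (by have := N4r N; linarith) (by linarith)
  simpa using this

lemma conv_d [CompleteSpace V] {a C C' σ M : ℝ} {K : Euc N → V} {K' : Euc N → (Euc N →L[ℝ] V)} {F : Euc N → ℝ}
    (hK : KB a C K) (hF : Dec σ M F) (ha : a < N) (hs : 2 < σ) (has : N < a + σ)
    (hKc : Continuous K) (hc : Continuous K') (hd : ∀ z, HasFDerivAt K (K' z) z) (hC' : 0 ≤ C')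
    (hb : ∀ z, ‖K' z‖ ≤ C' * wt ((N:ℝ) - 2) z) (x : Euc N) :
    HasFDerivAt (fun x => ∫ y, F y • K (x - y)) (∫ y, F y • K' (x - y)) x := by
  have hFc := hF.1
  have hM := hF.nonneg
  have hN := N4r N
  apply hasFDerivAt_integral_of_dominated_of_fderiv_le (s := ball x 1)
    (bound := fun y => (M * C' * (2 + ‖x‖) ^ ((N:ℝ) - 2)) * wt (σ + ((N:ℝ) - 2)) y) (ball_mem_nhds x one_pos)
  · exact Eventually.of_forall fun x => Continuous.aestronglyMeasurable (by fun_prop)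
  · exact cv_int' hK hF ha (by linarith) has x
  · exact Continuous.aestronglyMeasurable (by fun_prop)
  · refine Eventually.of_forall fun y x' hx' => ?_
    have h1 : ‖x'‖ ≤ 1 + ‖x‖ := by
      have := norm_sub_norm_le x' x
      rw [mem_ball_iff_norm] at hx'; linarith
    rw [norm_smul, Real.norm_eq_abs, ← wt_mul]
    have h2 := peetre (N := N) (σ := (N:ℝ) - 2) (by linarith) x' (x' - (y))
    have h3 := hF.2 y
    have h4 := hb (x' - y)
    have h5 := peetre (N := N) (σ := (N:ℝ) - 2) (by linarith) x' y
    have h6 : (1 + ‖x'‖) ^ ((N:ℝ) - 2) ≤ (2 + ‖x‖) ^ ((N:ℝ) - 2) :=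
      Real.rpow_le_rpow (by positivity) (by linarith) (by linarith)
    have p := wt_pos ((N:ℝ) - 2) y
    have p2 := wt_pos σ y
    calc |F y| * ‖K' (x' - y)‖ ≤ (M * wt σ y) * (C' * ((2 + ‖x‖) ^ ((N:ℝ) - 2) * wt ((N:ℝ) - 2) y)) := by
          gcongr
          exact h4.trans (mul_le_mul_of_nonneg_left (h5.trans (by gcongr)) hC')
      _ = _ := by ring
  · exact (wt_int (by linarith)).const_mul _
  · refine Eventually.of_forall fun y x' _ => ?_
    have h : HasFDerivAt (fun x' : Euc N => K (x' - y)) (K' (x' - y)) x' := by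
      have := (hd (x' - y)).comp x' ((hasFDerivAt_id x').sub_const y)
      simpa only [Function.comp_def, ContinuousLinearMap.comp_id, id] using this
    exact h.const_smul (F y)

end PS

namespace PS

open Set Metric

variable {N : ℕ} [hN4 : Fact (4 ≤ N)]

set_option maxSynthPendingDepth 6

variable {V : Type*} [NormedAddCommGroup V] [NormedSpace ℝ V]

def ep (n : ℕ) : ℝ := 1 / ((n:ℝ) + 1)

lemma ep_pos (n : ℕ) : 0 < ep n := by unfold ep; positivity

lemma ep_lim : Tendsto ep atTop (𝓝 0) := tendsto_one_div_add_atTop_nhds_zero_nat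

lemma q_lim (c : ℝ) {z : Euc N} (hz : z ≠ 0) :
    Tendsto (fun n => (‖z‖ ^ 2 + ep n) ^ c) atTop (𝓝 ((‖z‖ ^ 2 + 0) ^ c)) := by
  have hz' := norm_pos_iff.2 hz
  exact (tendsto_const_nhds.add ep_lim).rpow_const (Or.inl (by positivity))

lemma Gam_lim {z : Euc N} (hz : z ≠ 0) : Tendsto (fun n => Gam (ep n) z) atTop (𝓝 (Gam 0 z)) := q_lim _ hz

lemma K1_lim {z : Euc N} (hz : z ≠ 0) : Tendsto (fun n => K1 (ep n) z) atTop (𝓝 (K1 0 z)) :=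
  (q_lim _ hz).smul_const _

lemma K2_lim {z : Euc N} (hz : z ≠ 0) : Tendsto (fun n => K2 (ep n) z) atTop (𝓝 (K2 0 z)) :=
  ((q_lim _ hz).smul_const _).sub (((q_lim _ hz).const_mul _).smul_const _)

lemma dec_unif {a C σ M R : ℝ} {K : ℕ → Euc N → V} {K0 : Euc N → V} {F : Euc N → ℝ} (hK : ∀ n, KB a C (K n)) (hK0 : KB a C K0)
    (hF : Dec σ M F) (ha : a < N) (hs : 0 ≤ σ) (has : N < a + σ) (hR : 0 ≤ R)
    (hl : ∀ z, z ≠ 0 → Tendsto (fun n => K n z) atTop (𝓝 (K0 z))) :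
    TendstoUniformlyOn (fun n x => ∫ z, F (x - z) • K n z) (fun x => ∫ z, F (x - z) • K0 z) atTop (ball 0 R) := by
  have hM := hF.nonneg
  have hC := hK0.2.1
  have hw : ∀ z : Euc N, 0 ≤ wt σ z := fun z => (wt_pos σ z).le
  have hb : ∀ (L : Euc N → V), KB a C L → ∀ z, z ≠ 0 → (M * (1 + R) ^ σ * wt σ z) * ‖L z‖ ≤ (M * (1 + R) ^ σ * C) * (‖z‖ ^ (-a) * wt σ z) := by
    intro L hL z hz
    have := hL.2.2 z hz
    have := hw z
    calc _ ≤ (M * (1 + R) ^ σ * wt σ z) * (C * ‖z‖ ^ (-a)) := by gcongr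
      _ = _ := by ring
  refine unif_conv (g := fun x z => F (x - z)) (D := fun z => M * (1 + R) ^ σ * wt σ z)
    (G := fun z => (M * (1 + R) ^ σ * C) * (‖z‖ ^ (-a) * wt σ z)) (fun n => (hK n).1) hK0.1 ?_ ?_ ?_ (fun n => hb _ (hK n)) (hb _ hK0) hl ?_ ?_
  · have := wt_cont (N := N) σ
    exact Continuous.aestronglyMeasurable (by fun_prop)
  · intro z; have := hw z; positivity
  · exact (ker_int ha hs has).const_mul _
  · intro x hx z
    rw [mem_ball_zero_iff] at hx
    refine (hF.2 _).trans ?_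
    rw [mul_assoc]
    refine mul_le_mul_of_nonneg_left ((peetre hs x z).trans ?_) hM
    have := hw z
    gcongr
  · intro x _
    have := hF.1
    exact Continuous.aestronglyMeasurable (by fun_prop)

def G1 (F : Euc N → ℝ) (x : Euc N) : Euc N →L[ℝ] ℝ := ∫ z, F (x - z) • K1 0 z

lemma area_cN : cN N * ((N:ℝ) - 2) = 1 / area N := by
  have := area_pos (N := N)
  have := N4r N
  have : (N:ℝ) - 2 ≠ 0 := by linarith
  rw [cN]; field_simp

lemma NP_d {σ M : ℝ} {F : Euc N → ℝ} (hF : Dec σ M F) (hs : 2 < σ) (x : Euc N) :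
    HasFDerivAt (NP F) ((-(1 / area N)) • G1 F x) x := by
  have hN := N4r N
  have hx : x ∈ ball (0 : Euc N) (‖x‖ + 1) := by rw [mem_ball_zero_iff]; linarith
  have hR : 0 ≤ ‖x‖ + 1 := by positivity
  have e : NP F = fun x => cN N * ∫ z, F (x - z) • Gam 0 z := by
    funext x; rw [NP_eq]; simp only [smul_eq_mul]
  rw [e]
  have key : HasFDerivAt (fun x => ∫ z, F (x - z) • Gam 0 z) ((-((N:ℝ) - 2)) • G1 F x) x := by
    refine hasFDerivAt_of_tendstoUniformlyOn (l := atTop) (f := fun n x => ∫ z, F (x - z) • Gam (ep n) z)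
      (f' := fun n x => (-((N:ℝ) - 2)) • ∫ z, F (x - z) • K1 (ep n) z)
      (g' := fun x => (-((N:ℝ) - 2)) • G1 F x) isOpen_ball ?_ ?_ ?_ hx
    · have := dec_unif (N := N) (R := ‖x‖ + 1) (fun n => K1_KB (ep_pos n).le) (K1_KB le_rfl) hF (by linarith) (by linarith) (by linarith) hR
        (fun z hz => K1_lim hz)
      exact (uniformContinuous_const_smul (-((N:ℝ) - 2))).comp_tendstoUniformlyOn this
    · intro n x' _
      obtain ⟨C, hC, hb⟩ := K1_wt (N := N) (ep_pos n)
      have := conv_d (N := N) (C' := ((N:ℝ) - 2) * C) (Gam_KB (ep_pos n).le) hF (by linarith) hs (by linarith)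
        (q_cont (ep_pos n) _) (K' := fun z => (-((N:ℝ) - 2)) • K1 (ep n) z) (by have := K1_cont (N := N) (ep_pos n); fun_prop)
        (fun z => Gam_d (ep_pos n) z) (mul_nonneg (by linarith) hC) (fun z => by
          rw [norm_smul, norm_neg, Real.norm_of_nonneg (by linarith), mul_assoc]
          exact mul_le_mul_of_nonneg_left (hb z) (by linarith)) x'
      simp only [cv_eq] at this
      refine this.congr_fderiv ?_
      rw [cv_eq (fun z => (-((N:ℝ) - 2)) • K1 (ep n) z), ← integral_smul]
      congr 1; funext z; rw [smul_comm]
    · intro x' hx'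
      have := dec_unif (N := N) (R := ‖x‖ + 1) (fun n => Gam_KB (ep_pos n).le) (Gam_KB le_rfl) hF (by linarith) (by linarith) (by linarith) hR
        (fun z hz => Gam_lim hz)
      exact this.tendsto_at hx'
  refine (key.const_mul (cN N)).congr_fderiv ?_
  rw [smul_smul, mul_neg, area_cN]

lemma NP_cont {σ M : ℝ} {F : Euc N → ℝ} (hF : Dec σ M F) (hs : 2 < σ) : Continuous (NP F) :=
  continuous_iff_continuousAt.2 fun x => (NP_d hF hs x).continuousAt

lemma dense_ind {P : Euc N → Prop} (h : IsClosed {x | P x}) (h0 : ∀ x, x ≠ 0 → P x) (x : Euc N) : P x := by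
  have hd : Dense ({0}ᶜ : Set (Euc N)) := dense_compl_singleton 0
  have : ({0}ᶜ : Set (Euc N)) ⊆ {x | P x} := fun x hx => h0 x hx
  exact (h.closure_subset_iff.2 this) (hd x)

def CNP (N : ℕ) (σ : ℝ) : ℝ := 1 / (N - σ) + 1 / (σ - 2)

lemma CNP_pos {σ : ℝ} (hs : 2 < σ) (hsN : σ < N) : 0 < CNP N σ := by
  have h1 : 0 < (N:ℝ) - σ := by linarith
  have h2 : 0 < σ - 2 := by linarith
  unfold CNP; positivity

lemma NP_wt {σ : ℝ} (hs : 2 < σ) (hsN : σ < N) (x : Euc N) : NP (wt σ) x ≤ CNP N σ * wt (σ - 2) x := by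
  refine dense_ind (isClosed_le (NP_cont (wt_Dec σ) hs) (continuous_const.mul (wt_cont _))) ?_ x
  intro x hx
  obtain ⟨ω, hω⟩ := exists_dir x hx
  have hx' := norm_pos_iff.2 hx
  have h1 := NP_rad (N := N) (f := fun s => (1 + s) ^ (-σ)) (wt_Dec σ) hs hx' ω
  rw [← hω] at h1
  have h2 := GG0_bd (N := N) hs hsN hx'
  rw [← h1] at h2
  exact h2

lemma NP_bd {σ M : ℝ} {F : Euc N → ℝ} (hF : Dec σ M F) (hs : 2 < σ) (hsN : σ < N) : Dec (σ - 2) (M * CNP N σ) (NP F) := by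
  refine ⟨NP_cont hF hs, fun x => ?_⟩
  have hM := hF.nonneg
  have h1 := mul_le_mul_of_nonneg_left (NP_wt hs hsN x) hM
  have h2 := NP_mono hF ((wt_Dec σ).smul M) hs x (fun y => (le_abs_self _).trans (hF.2 y))
  have h3 := NP_mono (hF.smul (-1)) ((wt_Dec σ).smul M) hs x (fun y => by
    have := (neg_le_abs _).trans (hF.2 y); linarith)
  rw [NP_smul] at h2
  rw [NP_smul, NP_smul] at h3
  rw [abs_le, mul_assoc]
  constructor <;> linarith

lemma ball_ker {ρ : ℝ} (hρ : 0 < ρ) : Integrable (fun z : Euc N => if ‖z‖ < ρ then ‖z‖ ^ (-((N:ℝ) - 1)) else 0) ∧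
    ∫ z : Euc N, (if ‖z‖ < ρ then ‖z‖ ^ (-((N:ℝ) - 1)) else 0) = area N * ρ := by
  have hN := N4 N
  have e : ∀ s ∈ Ioi (0:ℝ), s ^ (N - 1) * (if s < ρ then s ^ (-((N:ℝ) - 1)) else 0) = (Iio ρ).indicator (fun _ => (1:ℝ)) s := by
    intro s hs
    have hs' : 0 < s := hs
    by_cases h : s < ρ
    · rw [if_pos h, indicator_of_mem (by exact h), ← Real.rpow_natCast, ← Real.rpow_add hs', Nat.cast_sub (by omega)]
      simp
    · rw [if_neg h, indicator_of_notMem (by exact h), mul_zero]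
  have i : IntegrableOn ((Iio ρ).indicator (fun _ => (1:ℝ))) (Ioi 0) := by
    rw [IntegrableOn, integrable_indicator_iff measurableSet_Iio, IntegrableOn, Measure.restrict_restrict measurableSet_Iio]
    rw [Iio_inter_Ioi]
    exact integrableOn_const (by simp)
  have i2 : Integrable (fun z : Euc N => if ‖z‖ < ρ then ‖z‖ ^ (-((N:ℝ) - 1)) else 0) := by
    refine (radial_integrable (f := fun s => if s < ρ then s ^ (-((N:ℝ) - 1)) else 0)).2 ?_
    exact (integrableOn_congr_fun e measurableSet_Ioi).2 i
  refine ⟨i2, ?_⟩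
  rw [(polar i2).2]
  congr 1
  have : ∫ s in Ioi (0:ℝ), s ^ (N - 1) * ∫ ω : Sph N, (if ‖s • (ω : Euc N)‖ < ρ then ‖s • (ω : Euc N)‖ ^ (-((N:ℝ) - 1)) else 0) ∂(mu N)
     = ∫ s in Ioi (0:ℝ), (Iio ρ).indicator (fun _ => (1:ℝ)) s := by
    refine setIntegral_congr_fun measurableSet_Ioi fun s hs => ?_
    rw [← e s hs]
    simp only [smul_norm hs, integral_const, probReal_univ, smul_eq_mul, one_mul]
  rw [this, integral_indicator measurableSet_Iio, Measure.restrict_restrict measurableSet_Iio, Iio_inter_Ioi]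
  simp [hρ.le]

lemma Gam0_eq {z : Euc N} : Gam 0 z = ‖z‖ ^ (-((N:ℝ) - 2)) := by
  rw [Gam0, ← Real.rpow_natCast, ← Real.rpow_mul (norm_nonneg _)]; congr 1; push_cast; ring

lemma nker_KB (a : ℝ) : KB a 1 (fun z : Euc N => ‖z‖ ^ (-a)) := by
  refine ⟨Measurable.stronglyMeasurable (by fun_prop), zero_le_one, fun z hz => ?_⟩
  rw [Real.norm_of_nonneg (by positivity), one_mul]

def CGR (N : ℕ) (σ : ℝ) : ℝ := 2 ^ σ * area N + 2 * (CNP N σ / cN N)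

lemma G1_bd {σ M : ℝ} {F : Euc N → ℝ} (hF : Dec σ M F) (hs : 2 < σ) (hsN : σ < N) (x : Euc N) :
    ‖G1 F x‖ ≤ CGR N σ * M * wt (σ - 1) x := by
  have hN := N4r N
  have hM := hF.nonneg
  set A := 1 + ‖x‖ with hA
  have hA0 : 0 < A := by positivity
  have i1 := cv_int (nker_KB (N := N) ((N:ℝ) - 1)) (wt_Dec σ) (by linarith) (by linarith) (by linarith) x
  have i2 := cv_int (Gam_KB (N := N) le_rfl) (wt_Dec σ) (by linarith) (by linarith) (by linarith) x
  obtain ⟨i3, e3⟩ := ball_ker (N := N) (ρ := A / 2) (by positivity)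
  simp only [smul_eq_mul] at i1 i2
  have pw : ∀ z : Euc N, z ≠ 0 → wt σ (x - z) * ‖z‖ ^ (-((N:ℝ) - 1)) ≤
      (2 ^ σ * A ^ (-σ)) * (if ‖z‖ < A / 2 then ‖z‖ ^ (-((N:ℝ) - 1)) else 0) + (2 / A) * (wt σ (x - z) * Gam 0 z) := by
    intro z hz
    have hz' := norm_pos_iff.2 hz
    have p := wt_pos σ (x - z)
    rw [Gam0_eq]
    by_cases h : ‖z‖ < A / 2
    · rw [if_pos h]
      have h1 : wt σ (x - z) ≤ 2 ^ σ * A ^ (-σ) := by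
        have : A / 2 ≤ 1 + ‖x - z‖ := by
          have := norm_sub_norm_le x z; linarith
        have := Real.rpow_le_rpow_of_nonpos (by positivity) this (show -σ ≤ 0 by linarith)
        refine this.trans (le_of_eq ?_)
        rw [Real.div_rpow hA0.le (by norm_num), Real.rpow_neg (show (0:ℝ) ≤ 2 by norm_num)]
        field_simp
      have : 0 ≤ (2 / A) * (wt σ (x - z) * ‖z‖ ^ (-((N:ℝ) - 2))) := by positivity
      have : wt σ (x - z) * ‖z‖ ^ (-((N:ℝ) - 1)) ≤ (2 ^ σ * A ^ (-σ)) * ‖z‖ ^ (-((N:ℝ) - 1)) := by gcongr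
      linarith
    · rw [if_neg h, mul_zero, zero_add]
      push Not at h
      have : ‖z‖ ^ (-((N:ℝ) - 1)) = ‖z‖⁻¹ * ‖z‖ ^ (-((N:ℝ) - 2)) := by
        rw [← Real.rpow_neg_one, ← Real.rpow_add hz']; congr 1; ring
      rw [this]
      have : ‖z‖⁻¹ ≤ 2 / A := by
        rw [inv_le_comm₀ hz' (by positivity), inv_div]; exact h
      calc _ = ‖z‖⁻¹ * (wt σ (x - z) * ‖z‖ ^ (-((N:ℝ) - 2))) := by ring
        _ ≤ _ := by gcongr
  have h1 : ‖G1 F x‖ ≤ ∫ z, M * (wt σ (x - z) * ‖z‖ ^ (-((N:ℝ) - 1))) := by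
    refine norm_integral_le_of_norm_le (i1.const_mul M) ?_
    filter_upwards [ae_ne] with z hz
    rw [norm_smul, Real.norm_eq_abs, ← mul_assoc]
    have := (K1_KB (N := N) le_rfl).2.2 z hz
    rw [one_mul] at this
    have p := wt_pos σ (x - z)
    exact mul_le_mul (hF.2 _) this (norm_nonneg _) (by positivity)
  have h2 : ∫ z, wt σ (x - z) * ‖z‖ ^ (-((N:ℝ) - 1)) ≤ (2 ^ σ * A ^ (-σ)) * (area N * (A / 2)) + (2 / A) * (NP (wt σ) x / cN N) := by
    have e4 : ∫ z, wt σ (x - z) * Gam 0 z = NP (wt σ) x / cN N := by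
      rw [NP_eq]; field_simp [(cN_pos (N := N)).ne']
    rw [← e3, ← e4, ← integral_const_mul, ← integral_const_mul, ← integral_add (i3.const_mul _) (i2.const_mul _)]
    refine integral_mono_ae i1 ((i3.const_mul _).add (i2.const_mul _)) ?_
    filter_upwards [ae_ne] with z hz using pw z hz
  have h3 : (2 / A) * (NP (wt σ) x / cN N) ≤ 2 * (CNP N σ / cN N) * wt (σ - 1) x := by
    have := NP_wt hs hsN x
    have c0 := cN_pos (N := N)
    have e : wt (σ - 1) x = wt (σ - 2) x / A := by
      rw [wt, wt, ← hA, show -(σ - 1) = -(σ - 2) - 1 by ring, Real.rpow_sub_one hA0.ne']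
    rw [e]
    calc _ ≤ (2 / A) * ((CNP N σ * wt (σ - 2) x) / cN N) := by gcongr
      _ = _ := by ring
  have h4 : (2 ^ σ * A ^ (-σ)) * (area N * (A / 2)) ≤ 2 ^ σ * area N * wt (σ - 1) x := by
    have e : wt (σ - 1) x = A ^ (-σ) * A := by
      rw [wt, ← hA, ← Real.rpow_add_one hA0.ne']; congr 1; ring
    rw [e]
    have := area_pos (N := N)
    have : 0 ≤ 2 ^ σ * A ^ (-σ) * area N * A := by positivity
    linarith
  rw [integral_const_mul] at h1
  calc _ ≤ _ := h1
    _ ≤ M * (CGR N σ * wt (σ - 1) x) := by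
      refine mul_le_mul_of_nonneg_left ?_ hM
      rw [CGR]; linarith
    _ = _ := by ring

end PS

namespace PS

open Set Metric

variable {N : ℕ} [hN4 : Fact (4 ≤ N)]

set_option maxSynthPendingDepth 6

variable {V : Type*} [NormedAddCommGroup V] [NormedSpace ℝ V]

/-- local 1/2-Hölder continuity -/
def LH (F : Euc N → V) : Prop := ∀ R : ℝ, ∃ H, 0 ≤ H ∧ ∀ x y, ‖x‖ ≤ R → ‖y‖ ≤ R → ‖F x - F y‖ ≤ H * ‖x - y‖ ^ (1 / 2 : ℝ)

lemma K1_zero (z : Euc N) : K1 0 z = ‖z‖ ^ (-(N:ℝ)) • J N z := by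
  rw [K1, add_zero, ← Real.rpow_natCast, ← Real.rpow_mul (norm_nonneg _)]; congr 2; push_cast; ring

lemma K1_hol_aux {a b : Euc N} (ha : a ≠ 0) (hb : b ≠ 0) (hab : ‖a‖ ≤ ‖b‖) : ‖K1 0 a - K1 0 b‖ ≤
    ((N:ℝ) + 2) * ‖a - b‖ ^ (1 / 2 : ℝ) * (‖a‖ ^ (-((N:ℝ) - 1 / 2)) + ‖b‖ ^ (-((N:ℝ) - 1 / 2))) := by
  have hs := norm_pos_iff.2 ha
  have ht := norm_pos_iff.2 hb
  set s := ‖a‖ with hs'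
  set t := ‖b‖ with ht'
  set d := ‖a - b‖ with hd'
  have hd : 0 ≤ d := norm_nonneg _
  have h1 : t - s ≤ d := by
    have := norm_sub_norm_le b a; rw [norm_sub_rev] at this; exact this
  have h2 : d ≤ 2 * t := by have := norm_sub_le a b; linarith
  have e : K1 0 a - K1 0 b = (s ^ (-(N:ℝ)) - t ^ (-(N:ℝ))) • J N a + t ^ (-(N:ℝ)) • J N (a - b) := by
    rw [K1_zero, K1_zero, map_sub, sub_smul, smul_sub]; abel
  have hst : t ^ (-(N:ℝ)) ≤ s ^ (-(N:ℝ)) := Real.rpow_le_rpow_of_nonpos hs hab (by simp)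
  have h3 : ‖K1 0 a - K1 0 b‖ ≤ (s ^ (-(N:ℝ)) - t ^ (-(N:ℝ))) * s + t ^ (-(N:ℝ)) * d := by
    rw [e]
    refine (norm_add_le _ _).trans ?_
    rw [norm_smul, norm_smul, Real.norm_of_nonneg (by linarith), Real.norm_of_nonneg (by positivity)]
    have := J_norm a
    have := J_norm (a - b)
    have : 0 ≤ s ^ (-(N:ℝ)) - t ^ (-(N:ℝ)) := by linarith
    gcongr
  have hx : s / t ≤ 1 := (div_le_one ht).2 hab
  have h4 : s ^ (-(N:ℝ)) - t ^ (-(N:ℝ)) ≤ s ^ (-(N:ℝ)) * (N * (d / s) ^ (1 / 2 : ℝ)) := by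
    have a1 : t ^ (-(N:ℝ)) = s ^ (-(N:ℝ)) * (s / t) ^ N := by
      rw [Real.rpow_neg ht.le, Real.rpow_neg hs.le, Real.rpow_natCast, Real.rpow_natCast, div_pow]
      field_simp
    have a2 := one_add_mul_le_pow (a := s / t - 1) (by have : 0 < s / t := by positivity
                                                       linarith) N
    rw [add_sub_cancel] at a2
    have a3 : 1 - s / t ≤ (d / s) ^ (1 / 2 : ℝ) := by
      have b0 : 0 ≤ 1 - s / t := by linarith
      have b1 : 1 - s / t ≤ (1 - s / t) ^ (1 / 2 : ℝ) := by
        rcases eq_or_lt_of_le b0 with h | h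
        · rw [← h, Real.zero_rpow (by norm_num)]
        · have : 0 < s / t := by positivity
          conv_lhs => rw [← Real.rpow_one (1 - s / t)]
          exact Real.rpow_le_rpow_of_exponent_ge h (by linarith) (by norm_num)
      refine b1.trans (Real.rpow_le_rpow b0 ?_ (by norm_num))
      have b2 : 1 - s / t = (t - s) / t := by field_simp
      rw [b2]
      exact div_le_div₀ hd h1 hs hab
    rw [a1, ← mul_one_sub]
    have : 0 ≤ (N:ℝ) := by positivity
    refine mul_le_mul_of_nonneg_left ?_ (by positivity)
    nlinarith
  have e1 : s ^ (-(N:ℝ)) * (N * (d / s) ^ (1 / 2 : ℝ)) * s = N * d ^ (1 / 2 : ℝ) * s ^ (-((N:ℝ) - 1 / 2)) := by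
    rw [Real.div_rpow hd hs.le, show -((N:ℝ) - 1 / 2) = -(N:ℝ) + 1 - 1 / 2 by ring, Real.rpow_sub hs, Real.rpow_add_one hs.ne']
    field_simp
  have e2 : t ^ (-(N:ℝ)) * d ≤ 2 * d ^ (1 / 2 : ℝ) * t ^ (-((N:ℝ) - 1 / 2)) := by
    have a1 : d = d ^ (1 / 2 : ℝ) * d ^ (1 / 2 : ℝ) := by
      rw [← Real.rpow_add_of_nonneg hd (by norm_num) (by norm_num)]; norm_num
    have a2 : d ^ (1 / 2 : ℝ) ≤ 2 * t ^ (1 / 2 : ℝ) := by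
      refine (Real.rpow_le_rpow hd h2 (by norm_num)).trans ?_
      rw [Real.mul_rpow (by norm_num) ht.le]
      gcongr
      conv_rhs => rw [← Real.rpow_one 2]
      exact Real.rpow_le_rpow_of_exponent_le (by norm_num) (by norm_num)
    calc t ^ (-(N:ℝ)) * d = t ^ (-(N:ℝ)) * (d ^ (1 / 2 : ℝ) * d ^ (1 / 2 : ℝ)) := by rw [← a1]
      _ ≤ t ^ (-(N:ℝ)) * (d ^ (1 / 2 : ℝ) * (2 * t ^ (1 / 2 : ℝ))) := by gcongr
      _ = 2 * d ^ (1 / 2 : ℝ) * t ^ (-((N:ℝ) - 1 / 2)) := by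
        rw [show -((N:ℝ) - 1 / 2) = -(N:ℝ) + 1 / 2 by ring, Real.rpow_add ht]; ring
  have h5 := mul_le_mul_of_nonneg_right h4 hs.le
  have p1 : 0 ≤ d ^ (1 / 2 : ℝ) * s ^ (-((N:ℝ) - 1 / 2)) := by positivity
  have p2 : 0 ≤ d ^ (1 / 2 : ℝ) * t ^ (-((N:ℝ) - 1 / 2)) := by positivity
  have : 0 ≤ (N:ℝ) * (d ^ (1 / 2 : ℝ) * t ^ (-((N:ℝ) - 1 / 2))) := by positivity
  linarith

lemma K1_hol {a b : Euc N} (ha : a ≠ 0) (hb : b ≠ 0) : ‖K1 0 a - K1 0 b‖ ≤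
    ((N:ℝ) + 2) * ‖a - b‖ ^ (1 / 2 : ℝ) * (‖a‖ ^ (-((N:ℝ) - 1 / 2)) + ‖b‖ ^ (-((N:ℝ) - 1 / 2))) := by
  rcases le_total ‖a‖ ‖b‖ with h | h
  · exact K1_hol_aux ha hb h
  · have := K1_hol_aux hb ha h
    rw [norm_sub_rev, norm_sub_rev a b, add_comm (‖a‖ ^ _)]; exact this

lemma G1_hol {σ M : ℝ} {F : Euc N → ℝ} (hF : Dec σ M F) (hs : 2 < σ) : LH (G1 F) := by
  intro R
  have hN := N4r N
  have hM := hF.nonneg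
  set I := ∫ z : Euc N, ‖z‖ ^ (-((N:ℝ) - 1 / 2)) * wt σ z
  have iI := ker_int (N := N) (a := (N:ℝ) - 1 / 2) (σ := σ) (by linarith) (by linarith) (by linarith)
  have hI : 0 ≤ I := integral_nonneg fun z => mul_nonneg (by positivity) (wt_pos _ _).le
  by_cases hR : 0 ≤ R
  swap
  · exact ⟨0, le_rfl, fun x y hx => absurd ((norm_nonneg x).trans hx) hR⟩
  refine ⟨((N:ℝ) + 2) * (2 * (M * (1 + R) ^ σ * I)), by positivity, fun x x' hx hx' => ?_⟩
  have kb := nker_KB (N := N) ((N:ℝ) - 1 / 2)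
  have hFa : Dec σ M (fun y => |F y|) := ⟨hF.1.abs, fun y => by rw [abs_abs]; exact hF.2 y⟩
  have ib : ∀ x : Euc N, Integrable (fun y => |F y| * ‖x - y‖ ^ (-((N:ℝ) - 1 / 2))) := fun x =>
    cv_int' kb hFa (by linarith) (by linarith) (by linarith) x
  have bb : ∀ x : Euc N, ‖x‖ ≤ R → ∫ y, |F y| * ‖x - y‖ ^ (-((N:ℝ) - 1 / 2)) ≤ M * (1 + R) ^ σ * I := by
    intro x hx
    have e := cv_eq (fun z : Euc N => ‖z‖ ^ (-((N:ℝ) - 1 / 2))) (fun y => |F y|) x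
    simp only [smul_eq_mul] at e
    rw [e, ← integral_const_mul]
    refine integral_mono_ae (cv_int kb hFa (by linarith) (by linarith) (by linarith) x) (iI.const_mul _) ?_
    filter_upwards [ae_ne] with z hz
    have := cv_bound kb hFa (by linarith) x z hz
    refine (le_abs_self _).trans (this.trans ?_)
    have := wt_pos σ z
    rw [one_mul]
    gcongr
  have i1 := cv_int' (K1_KB (N := N) le_rfl) hF (by linarith) (by linarith) (by linarith) x
  have i2 := cv_int' (K1_KB (N := N) le_rfl) hF (by linarith) (by linarith) (by linarith) x'
  rw [G1, G1, ← cv_eq, ← cv_eq, ← integral_sub i1 i2]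
  have : ‖∫ y, (F y • K1 0 (x - y) - F y • K1 0 (x' - y))‖ ≤ ∫ y, (((N:ℝ) + 2) * ‖x - x'‖ ^ (1 / 2 : ℝ)) *
      (|F y| * ‖x - y‖ ^ (-((N:ℝ) - 1 / 2)) + |F y| * ‖x' - y‖ ^ (-((N:ℝ) - 1 / 2))) := by
    refine norm_integral_le_of_norm_le (((ib x).add (ib x')).const_mul _) ?_
    filter_upwards [ae_ne' x, ae_ne' x'] with y hy hy'
    rw [← smul_sub, norm_smul, Real.norm_eq_abs]
    have := K1_hol (sub_ne_zero.2 hy.symm) (sub_ne_zero.2 hy'.symm)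
    rw [sub_sub_sub_cancel_right] at this
    refine (mul_le_mul_of_nonneg_left this (abs_nonneg _)).trans (le_of_eq ?_)
    ring
  refine this.trans ?_
  rw [integral_const_mul, integral_add (ib x) (ib x')]
  have h1 := bb x hx
  have h2 := bb x' hx'
  have : 0 ≤ ((N:ℝ) + 2) * ‖x - x'‖ ^ (1 / 2 : ℝ) := by positivity
  refine (mul_le_mul_of_nonneg_left (add_le_add h1 h2) this).trans (le_of_eq ?_)
  ring

end PS

namespace PS

open Set Metric

variable {N : ℕ} [hN4 : Fact (4 ≤ N)]

set_option maxSynthPendingDepth 6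

/-- indicator of the unit ball -/
def ch (z : Euc N) : ℝ := (ball (0 : Euc N) 1).indicator (fun _ => 1) z

lemma ch_meas : Measurable (ch (N := N)) := measurable_const.indicator measurableSet_ball

lemma ch_smul {V : Type*} [NormedAddCommGroup V] [NormedSpace ℝ V] (K : Euc N → V) :
    (fun z => ch z • K z) = (ball (0 : Euc N) 1).indicator K := by
  funext z
  by_cases h : z ∈ ball (0 : Euc N) 1 <;> simp [ch, h]

lemma ch_int {ε : ℝ} (hε : 0 < ε) : Integrable (fun z : Euc N => ch z • K2 ε z) := by
  rw [ch_smul, integrable_indicator_iff measurableSet_ball]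
  exact ((K2_cont hε).locallyIntegrable.integrableOn_isCompact (isCompact_closedBall 0 1)).mono_set ball_subset_closedBall

lemma ch_val {ε : ℝ} (hε : 0 < ε) : ∫ z : Euc N, ch z • K2 ε z = (area N / N * (1 + ε) ^ (-((N:ℝ) / 2))) • J N := by
  have hN := N4 N
  have hNr := N4r N
  have i0 := ch_int (N := N) hε
  ext v w
  have i1 : Integrable (fun z : Euc N => (ch z • K2 ε z) v) := i0.apply_continuousLinearMap v
  have i2 : Integrable (fun z : Euc N => (ch z • K2 ε z) v w) := i1.apply_continuousLinearMap w
  rw [ContinuousLinearMap.integral_apply i0, ContinuousLinearMap.integral_apply i1, (polar i2).2]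
  have e : ∀ s ∈ Ioi (0:ℝ), s ^ (N - 1) * ∫ ω : Sph N, (ch (s • (ω : Euc N)) • K2 ε (s • (ω : Euc N))) v w ∂(mu N) =
      (Iio 1).indicator (fun s => ⟪v, w⟫_ℝ * (s ^ (N - 1) * ((s ^ 2 + ε) ^ (-((N:ℝ) / 2)) - (s ^ 2 + ε) ^ (-((N:ℝ) / 2 + 1)) * s ^ 2))) s := by
    intro s hs
    have hs' : 0 < s := hs
    by_cases h : s < 1
    · have hc : ∀ ω : Sph N, ch (s • (ω : Euc N)) = 1 := by
        intro ω
        rw [ch, indicator_of_mem]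
        rw [mem_ball_zero_iff, smul_norm hs']; exact h
      rw [indicator_of_mem (by exact h)]
      simp only [hc, one_smul, K2_apply, smul_norm hs', real_inner_smul_left]
      have j1 : Integrable (fun ω : Sph N => ⟪(ω : Euc N), v⟫_ℝ * ⟪(ω : Euc N), w⟫_ℝ) (mu N) :=
        mu_integrable' (by fun_prop)
      have e1 : ∀ ω : Sph N, (s ^ 2 + ε) ^ (-((N:ℝ) / 2)) * ⟪v, w⟫_ℝ - (N:ℝ) * (s ^ 2 + ε) ^ (-((N:ℝ) / 2 + 1)) * (s * ⟪(ω : Euc N), v⟫_ℝ * (s * ⟪(ω : Euc N), w⟫_ℝ))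
        = (s ^ 2 + ε) ^ (-((N:ℝ) / 2)) * ⟪v, w⟫_ℝ - ((N:ℝ) * (s ^ 2 + ε) ^ (-((N:ℝ) / 2 + 1)) * s ^ 2) * (⟪(ω : Euc N), v⟫_ℝ * ⟪(ω : Euc N), w⟫_ℝ) := by
        intro ω; ring
      simp only [e1]
      rw [integral_sub (integrable_const _) (j1.const_mul _), integral_const, integral_const_mul, mu_inner_mul, probReal_univ, smul_eq_mul]
      field_simp
    · have hc : ∀ ω : Sph N, ch (s • (ω : Euc N)) = 0 := by
        intro ω
        rw [ch, indicator_of_notMem]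
        rw [mem_ball_zero_iff, smul_norm hs']; exact h
      rw [indicator_of_notMem (by exact h)]
      simp [hc]
  rw [setIntegral_congr_fun measurableSet_Ioi e, integral_indicator measurableSet_Iio, Measure.restrict_restrict measurableSet_Iio, Iio_inter_Ioi,
    integral_const_mul, ← integral_Ioc_eq_integral_Ioo, ← intervalIntegral.integral_of_le zero_le_one]
  have hd : ∀ s ∈ uIcc (0:ℝ) 1, HasDerivAt (fun s : ℝ => s ^ N * (s ^ 2 + ε) ^ (-((N:ℝ) / 2)) / N)
      (s ^ (N - 1) * ((s ^ 2 + ε) ^ (-((N:ℝ) / 2)) - (s ^ 2 + ε) ^ (-((N:ℝ) / 2 + 1)) * s ^ 2)) s := by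
    intro s _
    have h1 : HasDerivAt (fun s : ℝ => s ^ 2 + ε) (2 * s) s := by
      simpa using (hasDerivAt_pow 2 s).add_const ε
    have h2 := h1.rpow_const (p := -((N:ℝ) / 2)) (Or.inl (by positivity))
    refine (((hasDerivAt_pow N s).mul h2).div_const (N:ℝ)).congr_deriv ?_
    have : s ^ N = s ^ (N - 1) * s := by rw [← pow_succ]; congr 1; omega
    rw [this, show -((N:ℝ) / 2) - 1 = -((N:ℝ) / 2 + 1) by ring]
    field_simp
    ring
  rw [intervalIntegral.integral_eq_sub_of_hasDerivAt hd]
  · simp [J_apply, show N ≠ 0 by omega]; ring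
  · apply Continuous.intervalIntegrable
    have h : ∀ c : ℝ, Continuous (fun s : ℝ => (s ^ 2 + ε) ^ c) := fun c =>
      (by fun_prop : Continuous (fun s : ℝ => s ^ 2 + ε)).rpow_const (fun s => Or.inl (by positivity))
    have h1 := h (-((N:ℝ) / 2))
    have h2 := h (-((N:ℝ) / 2 + 1))
    fun_prop

def gg (F : Euc N → ℝ) (x z : Euc N) : ℝ := F (x - z) - F x * ch z

def Hs (F : Euc N → ℝ) (x : Euc N) : Euc N →L[ℝ] Euc N →L[ℝ] ℝ :=
  (∫ z, gg F x z • K2 0 z) + F x • (area N / N) • J N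

lemma gg_bd {σ M R : ℝ} {F : Euc N → ℝ} (hF : Dec σ M F) (hs : 2 < σ) (hL : LH F) (hR : 0 ≤ R) :
    ∃ B, 0 ≤ B ∧ ∀ x : Euc N, ‖x‖ ≤ R → ∀ z, |gg F x z| ≤ B * (‖z‖ ^ (1 / 2 : ℝ) * wt σ z) := by
  obtain ⟨H, hH, h⟩ := hL (R + 1)
  have hM := hF.nonneg
  refine ⟨2 ^ σ * H + M * (1 + R) ^ σ, by positivity, fun x hx z => ?_⟩
  have pw := wt_pos σ z
  by_cases hz : ‖z‖ < 1
  · have e : ch z = 1 := by rw [ch, indicator_of_mem]; rw [mem_ball_zero_iff]; exact hz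
    rw [gg, e, mul_one]
    have h1 := h (x - z) x ((norm_sub_le _ _).trans (by linarith)) (by linarith)
    rw [show x - z - x = -z by abel, norm_neg, Real.norm_eq_abs] at h1
    have h2 : 1 ≤ 2 ^ σ * wt σ z := by
      rw [wt, Real.rpow_neg (by positivity), ← div_eq_mul_inv, le_div_iff₀ (by positivity), one_mul]
      exact Real.rpow_le_rpow (by positivity) (by linarith) (by linarith)
    have h3 : H * ‖z‖ ^ (1 / 2 : ℝ) ≤ H * ‖z‖ ^ (1 / 2 : ℝ) * (2 ^ σ * wt σ z) := le_mul_of_one_le_right (by positivity) h2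
    have : 0 ≤ M * (1 + R) ^ σ * (‖z‖ ^ (1 / 2 : ℝ) * wt σ z) := by positivity
    linarith
  · have e : ch z = 0 := by rw [ch, indicator_of_notMem]; rw [mem_ball_zero_iff]; exact hz
    rw [gg, e, mul_zero, sub_zero]
    have h1 := hF.2 (x - z)
    have h2 := peetre (N := N) (σ := σ) (by linarith) x z
    have h3 : 1 ≤ ‖z‖ ^ (1 / 2 : ℝ) := Real.one_le_rpow (by linarith) (by norm_num)
    have h4 : (1 + ‖x‖) ^ σ * wt σ z ≤ (1 + R) ^ σ * wt σ z := by gcongr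
    have h5 : M * ((1 + R) ^ σ * wt σ z) ≤ M * ((1 + R) ^ σ * wt σ z) * ‖z‖ ^ (1 / 2 : ℝ) := le_mul_of_one_le_right (by positivity) h3
    have h6 := mul_le_mul_of_nonneg_left (h2.trans h4) hM
    have : 0 ≤ 2 ^ σ * H * (‖z‖ ^ (1 / 2 : ℝ) * wt σ z) := by positivity
    linarith

lemma gg_meas {F : Euc N → ℝ} (hF : Continuous F) (x : Euc N) : AEStronglyMeasurable (gg F x) volume := by
  have := ch_meas (N := N)
  have := hF.measurable
  unfold gg
  exact Measurable.aestronglyMeasurable (by fun_prop)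

lemma gg_K {σ B ε : ℝ} (hB : 0 ≤ B) (hε : 0 ≤ ε) {z : Euc N} (hz : z ≠ 0) :
    B * (‖z‖ ^ (1 / 2 : ℝ) * wt σ z) * ‖K2 ε z‖ ≤ (B * ((N:ℝ) + 1)) * (‖z‖ ^ (-((N:ℝ) - 1 / 2)) * wt σ z) := by
  have h := (K2_KB (N := N) hε).2.2 z hz
  have := wt_pos σ z
  have hz' := norm_pos_iff.2 hz
  have : ‖z‖ ^ (-((N:ℝ) - 1 / 2)) = ‖z‖ ^ (1 / 2 : ℝ) * ‖z‖ ^ (-(N:ℝ)) := by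
    rw [← Real.rpow_add hz']; congr 1; ring
  rw [this]
  calc _ ≤ B * (‖z‖ ^ (1 / 2 : ℝ) * wt σ z) * (((N:ℝ) + 1) * ‖z‖ ^ (-(N:ℝ))) := by gcongr
    _ = _ := by ring

lemma gg_int {σ M ε : ℝ} {F : Euc N → ℝ} (hF : Dec σ M F) (hs : 2 < σ) (hL : LH F) (hε : 0 ≤ ε) (x : Euc N) :
    Integrable (fun z => gg F x z • K2 ε z) := by
  have hN := N4r N
  obtain ⟨B, hB, h⟩ := gg_bd hF hs hL (norm_nonneg x)
  refine Integrable.mono' ((ker_int (N := N) (a := (N:ℝ) - 1 / 2) (σ := σ) (by linarith) (by linarith) (by linarith)).const_mul (B * ((N:ℝ) + 1)))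
    ((gg_meas hF.1 x).smul (K2_meas ε).aestronglyMeasurable) ?_
  filter_upwards [ae_ne] with z hz
  rw [norm_smul, Real.norm_eq_abs]
  exact (mul_le_mul_of_nonneg_right (h x le_rfl z) (norm_nonneg _)).trans (gg_K hB hε hz)

lemma G1_d {σ M : ℝ} {F : Euc N → ℝ} (hF : Dec σ M F) (hs : 2 < σ) (hL : LH F) (x : Euc N) :
    HasFDerivAt (G1 F) (Hs F x) x := by
  have hN := N4r N
  have hM := hF.nonneg
  have hx : x ∈ ball (0 : Euc N) (‖x‖ + 1) := by rw [mem_ball_zero_iff]; linarith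
  have hR : 0 ≤ ‖x‖ + 1 := by positivity
  refine hasFDerivAt_of_tendstoUniformlyOn (l := atTop) (f := fun n x => ∫ z, F (x - z) • K1 (ep n) z)
      (f' := fun n x => (∫ z, gg F x z • K2 (ep n) z) + F x • (area N / N * (1 + ep n) ^ (-((N:ℝ) / 2))) • J N)
      (g' := fun x => Hs F x) isOpen_ball ?_ ?_ ?_ hx
  · obtain ⟨B, hB, h⟩ := gg_bd hF hs hL hR
    have u1 : TendstoUniformlyOn (fun n x => ∫ z, gg F x z • K2 (ep n) z) (fun x => ∫ z, gg F x z • K2 0 z) atTop (ball (0 : Euc N) (‖x‖ + 1)) := by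
      refine unif_conv (D := fun z => B * (‖z‖ ^ (1 / 2 : ℝ) * wt σ z))
        (G := fun z => (B * ((N:ℝ) + 1)) * (‖z‖ ^ (-((N:ℝ) - 1 / 2)) * wt σ z)) (fun n => K2_meas _) (K2_meas _) ?_ ?_ ?_
        (fun n z hz => gg_K hB (ep_pos n).le hz) (fun z hz => gg_K hB le_rfl hz) (fun z hz => K2_lim hz) ?_ (fun x _ => gg_meas hF.1 x)
      · have := (wt_cont (N := N) σ).measurable
        exact Measurable.aestronglyMeasurable (by fun_prop)
      · intro z; have := wt_pos σ z; positivity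
      · exact (ker_int (by linarith) (by linarith) (by linarith)).const_mul _
      · intro x' hx' z
        rw [mem_ball_zero_iff] at hx'
        exact h x' hx'.le z
    have c1 : Tendsto (fun n => (area N / N * (1 + ep n) ^ (-((N:ℝ) / 2))) • J N) atTop (𝓝 ((area N / N) • J N)) := by
      have : Tendsto (fun n => (1 + ep n) ^ (-((N:ℝ) / 2))) atTop (𝓝 ((1 + 0) ^ (-((N:ℝ) / 2)))) :=
        (tendsto_const_nhds.add ep_lim).rpow_const (Or.inl (by norm_num))
      have := (this.const_mul (area N / N)).smul_const (J N)
      simpa using this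
    have u2 : TendstoUniformlyOn (fun n (x : Euc N) => F x • (area N / N * (1 + ep n) ^ (-((N:ℝ) / 2))) • J N)
        (fun x => F x • (area N / N) • J N) atTop (ball (0 : Euc N) (‖x‖ + 1)) := by
      rw [Metric.tendstoUniformlyOn_iff]
      intro δ hδ
      have c2 := Metric.tendsto_atTop.1 c1 (δ / (M + 1)) (by positivity)
      obtain ⟨n0, hn0⟩ := c2
      filter_upwards [eventually_ge_atTop n0] with n hn x' _
      have h1 := hn0 n hn
      rw [dist_comm, dist_eq_norm] at h1 ⊢
      rw [← smul_sub, norm_smul, Real.norm_eq_abs]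
      rw [norm_sub_rev] at h1
      have h2 : |F x'| ≤ M := (hF.2 x').trans (mul_le_of_le_one_right hM (by
        rw [wt]; exact Real.rpow_le_one_of_one_le_of_nonpos (by linarith [norm_nonneg x']) (by linarith)))
      rw [lt_div_iff₀ (by positivity)] at h1
      rw [norm_sub_rev]
      have := norm_nonneg ((area N / N * (1 + ep n) ^ (-((N:ℝ) / 2))) • J N - (area N / N) • J N)
      rw [norm_sub_rev] at h1
      nlinarith [abs_nonneg (F x')]
    exact u1.add u2
  · intro n x' _
    obtain ⟨C, hC, hb⟩ := K2_wt (N := N) (ep_pos n)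
    have := conv_d (N := N) (K1_KB (ep_pos n).le) hF (by linarith) hs (by linarith)
        (K1_cont (ep_pos n)) (K2_cont (ep_pos n)) (fun z => K1_d (ep_pos n) z) hC hb x'
    simp only [cv_eq] at this
    refine this.congr_fderiv ?_
    have i9 : Integrable (fun a : Euc N => F x' • ch a • K2 (ep n) a) := (ch_int (ep_pos n)).smul (F x')
    rw [← ch_val (ep_pos n), ← integral_smul, ← integral_add (gg_int hF hs hL (ep_pos n).le x') i9]
    congr 1; funext z
    rw [gg, sub_smul, mul_smul]; abel
  · intro x' hx'
    have := dec_unif (N := N) (R := ‖x‖ + 1) (fun n => K1_KB (ep_pos n).le) (K1_KB le_rfl) hF (by linarith) (by linarith) (by linarith) hR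
        (fun z hz => K1_lim hz)
    exact this.tendsto_at hx'

lemma Hs_cont {σ M : ℝ} {F : Euc N → ℝ} (hF : Dec σ M F) (hs : 2 < σ) (hL : LH F) : Continuous (Hs F) := by
  have hN := N4r N
  have hFc := hF.1
  refine Continuous.add ?_ (by fun_prop)
  refine continuous_iff_continuousAt.2 fun x => ?_
  obtain ⟨B, hB, h⟩ := gg_bd hF hs hL (show 0 ≤ ‖x‖ + 1 by positivity)
  refine continuousAt_of_dominated (bound := fun z => (B * ((N:ℝ) + 1)) * (‖z‖ ^ (-((N:ℝ) - 1 / 2)) * wt σ z)) ?_ ?_ ?_ ?_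
  · exact Eventually.of_forall fun x => (gg_meas hF.1 x).smul (K2_meas 0).aestronglyMeasurable
  · have hx : ball (0 : Euc N) (‖x‖ + 1) ∈ 𝓝 x := isOpen_ball.mem_nhds (by rw [mem_ball_zero_iff]; linarith)
    filter_upwards [hx] with x' hx'
    rw [mem_ball_zero_iff] at hx'
    filter_upwards [ae_ne] with z hz
    rw [norm_smul, Real.norm_eq_abs]
    exact (mul_le_mul_of_nonneg_right (h x' hx'.le z) (norm_nonneg _)).trans (gg_K hB le_rfl hz)
  · exact (ker_int (by linarith) (by linarith) (by linarith)).const_mul _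
  · refine Eventually.of_forall fun z => Continuous.continuousAt ?_
    unfold gg
    fun_prop

lemma K2_tr {z : Euc N} (hz : z ≠ 0) : ∑ i, K2 0 z (ei i) (ei i) = 0 := by
  have hz' := norm_pos_iff.2 hz
  simp only [K2_apply, Finset.sum_sub_distrib, ← Finset.mul_sum, add_zero]
  have h1 := sum_inner_ei z z
  rw [h1]
  have h2 : ∀ i : Fin N, ⟪(ei i : Euc N), ei i⟫_ℝ = 1 := fun i => by rw [real_inner_self_eq_norm_sq, norm_ei]; norm_num
  simp only [h2, Finset.sum_const, Finset.card_univ, Fintype.card_fin, nsmul_eq_mul, mul_one]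
  rw [real_inner_self_eq_norm_sq, mul_assoc, ← Real.rpow_add_one (by positivity)]
  rw [show -((N:ℝ) / 2 + 1) + 1 = -((N:ℝ) / 2) by ring]; ring

lemma Hs_tr {σ M : ℝ} {F : Euc N → ℝ} (hF : Dec σ M F) (hs : 2 < σ) (hL : LH F) (x : Euc N) :
    ∑ i, Hs F x (ei i) (ei i) = area N * F x := by
  have hN := N4r N
  have i0 := gg_int hF hs hL le_rfl x
  have i1 : ∀ v, Integrable (fun z : Euc N => (gg F x z • K2 0 z) v) := fun v => i0.apply_continuousLinearMap v
  have i2 : ∀ v w, Integrable (fun z : Euc N => (gg F x z • K2 0 z) v w) := fun v w => (i1 v).apply_continuousLinearMap w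
  have e : ∀ i : Fin N, Hs F x (ei i) (ei i) = (∫ z, (gg F x z • K2 0 z) (ei i) (ei i)) + F x * (area N / N) := by
    intro i
    have h2 : ⟪(ei i : Euc N), ei i⟫_ℝ = 1 := by rw [real_inner_self_eq_norm_sq, norm_ei]; norm_num
    rw [← ContinuousLinearMap.integral_apply (i1 _), ← ContinuousLinearMap.integral_apply i0]
    simp [Hs, J_apply, h2]
  simp only [e, Finset.sum_add_distrib]
  rw [← integral_finset_sum _ (fun i _ => i2 _ _)]
  have : ∫ z : Euc N, ∑ i, (gg F x z • K2 0 z) (ei i) (ei i) = 0 := by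
    rw [integral_eq_zero_of_ae]
    filter_upwards [ae_ne] with z hz
    simp only [ContinuousLinearMap.smul_apply, smul_eq_mul, ← Finset.mul_sum, K2_tr hz, mul_zero, Pi.zero_apply]
  rw [this]
  simp; field_simp

theorem NP_C2 {σ M : ℝ} {F : Euc N → ℝ} (hF : Dec σ M F) (hs : 2 < σ) (hL : LH F) :
    ContDiff ℝ 2 (NP F) ∧ ∀ x, lap (NP F) x = - F x := by
  have e : fderiv ℝ (NP F) = fun x => (-(1 / area N)) • G1 F x := funext fun x => (NP_d hF hs x).fderiv
  have hd : ∀ x, HasFDerivAt (fun x => (-(1 / area N)) • G1 F x) ((-(1 / area N)) • Hs F x) x := fun x =>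
    (G1_d hF hs hL x).fun_const_smul _
  constructor
  · rw [show (2 : WithTop ℕ∞) = 1 + 1 by norm_num, contDiff_succ_iff_fderiv]
    refine ⟨fun x => (NP_d hF hs x).differentiableAt, by simp, ?_⟩
    rw [e, contDiff_one_iff_fderiv]
    refine ⟨fun x => (hd x).differentiableAt, ?_⟩
    rw [funext fun x => (hd x).fderiv]
    have := Hs_cont hF hs hL
    fun_prop
  · intro x
    have h1 : ∀ i : Fin N, fderiv ℝ (fun y => fderiv ℝ (NP F) y (EuclideanSpace.single i 1)) x (EuclideanSpace.single i 1)
        = -(1 / area N) * Hs F x (ei i) (ei i) := by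
      intro i
      rw [e]
      have := (hd x).clm_apply (hasFDerivAt_const (ei i) x)
      rw [show (EuclideanSpace.single i 1 : Euc N) = ei i from rfl]
      rw [this.fderiv]
      simp
    rw [lap]
    simp only [h1]
    rw [← Finset.mul_sum, Hs_tr hF hs hL]
    have := area_pos (N := N)
    field_simp

end PS

namespace PS

open Set Metric

variable {N : ℕ} [hN4 : Fact (4 ≤ N)]

def hn (F : Euc N → ℝ) (s : ℝ) : ℝ := nrm (fun ω : Sph N => F (s • (ω : Euc N)))

lemma hn_nonneg (F : Euc N → ℝ) (s : ℝ) : 0 ≤ hn F s := nrm_nonneg _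

lemma hn_cont {F : Euc N → ℝ} (hF : Continuous F) : Continuous (hn F) := by
  unfold hn nrm
  refine Real.continuous_sqrt.comp ?_
  have := continuous_parametric_integral_of_continuous (μ := mu N) (f := fun (s : ℝ) (ω : Sph N) => F (s • (ω : Euc N)) ^ 2)
    (by simp only [Function.uncurry_def]; fun_prop) (s := univ) isCompact_univ
  simpa using this

lemma hn_bd {σ M : ℝ} {F : Euc N → ℝ} (hF : Dec σ M F) {s : ℝ} (hs : 0 ≤ s) : hn F s ≤ M * (1 + s) ^ (-σ) := by
  have hM := hF.nonneg
  have h1 := hF.1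
  refine nrm_le_of_bound (by positivity) (by fun_prop) fun ω => ?_
  have := hF.2 (s • (ω : Euc N))
  rwa [wt, nsm hs] at this

lemma Gam_kk' {r s : ℝ} (hr : 0 < r) (hs : 0 < s) (ω η : Sph N) :
    Gam 0 (r • (ω : Euc N) - s • (η : Euc N)) = (max r s ^ (N - 2))⁻¹ * kk ((min r s / max r s) • (η : Euc N)) ω := by
  have := Gam_kk (N := N) hs hr η ω
  rw [max_comm, min_comm] at this
  rw [← this, Gam, Gam, ← norm_neg, neg_sub]

/-- inner sphere integral -/
def TT (F : Euc N → ℝ) (χ : Sph N → ℝ) (r s : ℝ) : ℝ :=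
  ∫ η : Sph N, F (s • (η : Euc N)) * (∫ ω : Sph N, χ ω * Gam 0 (r • (ω : Euc N) - s • (η : Euc N)) ∂(mu N)) ∂(mu N)

lemma NP_pair {σ M r : ℝ} {F : Euc N → ℝ} (hF : Dec σ M F) (hs : 2 < σ) {χ : Sph N → ℝ} (hχ : Continuous χ) :
    IntegrableOn (fun s => s ^ (N - 1) * TT F χ r s) (Ioi 0) ∧
    ∫ ω : Sph N, NP F (r • (ω : Euc N)) * χ ω ∂(mu N) = ((N:ℝ) - 2)⁻¹ * ∫ s in Ioi (0:ℝ), s ^ (N - 1) * TT F χ r s := by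
  have hF1 := hF.1
  have hA : Dec σ M (fun y => |F y|) := ⟨by fun_prop, fun x => by rw [abs_abs]; exact hF.2 x⟩
  have hG : StronglyMeasurable (Gam (N := N) 0) := (Gam_KB (N := N) le_rfl).1
  have gm : Measurable (fun q : Sph N × Euc N => Gam 0 (r • (q.1 : Euc N) - q.2)) :=
    hG.measurable.comp (by fun_prop)
  have hm : AEStronglyMeasurable (fun q : Sph N × Euc N => χ q.1 * (F q.2 * Gam 0 (r • (q.1 : Euc N) - q.2))) ((mu N).prod volume) := by
    refine (Continuous.aestronglyMeasurable (by fun_prop)).mul ?_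
    exact (Continuous.aestronglyMeasurable (by fun_prop)).mul gm.aestronglyMeasurable
  have hi : Integrable (fun q : Sph N × Euc N => χ q.1 * (F q.2 * Gam 0 (r • (q.1 : Euc N) - q.2))) ((mu N).prod volume) := by
    rw [integrable_prod_iff hm]
    constructor
    · refine ae_of_all _ fun ω => ?_
      have := (NP_int hF hs (r • (ω : Euc N))).const_mul (χ ω)
      exact this
    · have e : ∀ ω : Sph N, ∫ y : Euc N, ‖χ ω * (F y * Gam 0 (r • (ω : Euc N) - y))‖ = |χ ω| * ((cN N)⁻¹ * NP (fun y => |F y|) (r • (ω : Euc N))) := by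
        intro ω
        have hc := (cN_pos (N := N)).ne'
        rw [NP, inv_mul_cancel_left₀ hc, ← integral_const_mul]
        congr 1; funext y
        rw [norm_mul, norm_mul, Real.norm_eq_abs, Real.norm_eq_abs, Real.norm_eq_abs, abs_of_nonneg (a := Gam 0 _)]
        rw [Gam]; positivity
      simp only [e]
      have := NP_cont hA hs
      exact mu_integrable' (by fun_prop)
  have sw := integral_integral_swap (f := fun (ω : Sph N) (y : Euc N) => χ ω * (F y * Gam 0 (r • (ω : Euc N) - y))) hi
  have hi2 := hi.integral_prod_right
  have e2 : ∀ y : Euc N, ∫ ω : Sph N, χ ω * (F y * Gam 0 (r • (ω : Euc N) - y)) ∂(mu N) = F y * ∫ ω : Sph N, χ ω * Gam 0 (r • (ω : Euc N) - y) ∂(mu N) := by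
    intro y
    rw [← integral_const_mul]; congr 1; funext ω; ring
  simp only [e2] at hi2 sw
  have hp := polar hi2
  refine ⟨hp.1, ?_⟩
  have e3 : ∀ ω : Sph N, NP F (r • (ω : Euc N)) * χ ω = cN N * ∫ y, χ ω * (F y * Gam 0 (r • (ω : Euc N) - y)) := by
    intro ω
    rw [integral_const_mul, NP]; ring
  simp only [e3]
  rw [integral_const_mul, sw, hp.2, ← mul_assoc, cN]
  have h1 := (area_pos (N := N)).ne'
  congr 1
  field_simp

lemma TT_eq {r s : ℝ} {F : Euc N → ℝ} (hF : Continuous F) {χ : Sph N → ℝ} (hχ : Continuous χ) (hr : 0 < r) (hs : 0 < s) (hn : s ≠ r) :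
    TT F χ r s = (max r s ^ (N - 2))⁻¹ * ∫ ω : Sph N, (∫ η : Sph N, kk ((min r s / max r s) • (ω : Euc N)) η * F (s • (η : Euc N)) ∂(mu N)) * χ ω ∂(mu N) := by
  obtain ⟨h0, h1⟩ := ratio hr hs hn
  set ρ := min r s / max r s
  have hk : Continuous (fun q : Sph N × Sph N => kk (ρ • (q.1 : Euc N)) q.2) := by
    have := (cont_kk (N := N)).comp_continuous (f := fun q : Sph N × Sph N => (ρ • (q.1 : Euc N), q.2)) (by fun_prop)
      (fun q => ⟨by rw [mem_ball_zero_iff, smul_norm h0]; exact h1, mem_univ _⟩)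
    simpa only [Function.comp_def] using this
  have hi : Integrable (fun q : Sph N × Sph N => (max r s ^ (N - 2))⁻¹ * (kk (ρ • (q.1 : Euc N)) q.2 * F (s • (q.2 : Euc N)) * χ q.1)) ((mu N).prod (mu N)) :=
    cint (by fun_prop)
  have sw := integral_integral_swap (f := fun (ω η : Sph N) => (max r s ^ (N - 2))⁻¹ * (kk (ρ • (ω : Euc N)) η * F (s • (η : Euc N)) * χ ω)) hi
  rw [TT, ← integral_const_mul]
  simp only [← integral_mul_const, ← integral_const_mul]
  rw [sw]
  congr 1; funext η; congr 1; funext ω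
  rw [Gam_kk hr hs]; ring

lemma NP_hn {σ M r : ℝ} {F : Euc N → ℝ} (hF : Dec σ M F) (hs : 2 < σ) (hr : 0 < r)
    (hi : ∀ s : ℝ, 0 < s → Hi (fun ω : Sph N => F (s • (ω : Euc N)))) : hn (NP F) r ≤ GG N 2 (hn F) r := by
  have hF1 := hF.1
  have hc := NP_cont hF hs
  have hχ : Continuous (fun ω : Sph N => NP F (r • (ω : Euc N))) := by fun_prop
  have hp := NP_pair (r := r) hF hs hχ
  have hN := N4r N
  have gi : IntegrableOn (fun s => s ^ (N - 1) * gk N 2 r s * hn F s) (Ioi 0) :=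
    GG_int hs hr 2 (hn_cont hF1).aestronglyMeasurable (fun s h => by rw [abs_of_nonneg (hn_nonneg _ _)]; exact hn_bd hF h.le)
  have h2 : hn (NP F) r ^ 2 = ((N:ℝ) - 2)⁻¹ * ∫ s in Ioi (0:ℝ), s ^ (N - 1) * TT F (fun ω : Sph N => NP F (r • (ω : Euc N))) r s := by
    rw [← hp.2, hn, nrm_sq]; simp only [sq]
  have h3 : ∫ s in Ioi (0:ℝ), s ^ (N - 1) * TT F (fun ω : Sph N => NP F (r • (ω : Euc N))) r s ≤
      ∫ s in Ioi (0:ℝ), (((N:ℝ) - 2) / (N + 2) * hn (NP F) r) * (s ^ (N - 1) * gk N 2 r s * hn F s) := by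
    refine integral_mono_ae hp.1 (gi.const_mul _) ?_
    filter_upwards [ae_ne_r r, ae_restrict_mem measurableSet_Ioi] with s hsr hs0
    have hs0 : 0 < s := hs0
    rw [TT_eq hF1 hχ hr hs0 hsr]
    obtain ⟨k0, k1⟩ := ratio hr hs0 hsr
    have := kk_hi k0 k1 (ψ := fun ω : Sph N => F (s • (ω : Euc N))) (by fun_prop) hχ (hi s hs0)
    rw [gk_eq hr hs0]
    calc _ ≤ s ^ (N - 1) * ((max r s ^ (N - 2))⁻¹ * (((N:ℝ) - 2) / (N + 2) * (min r s / max r s) ^ 2 * (hn F s * hn (NP F) r))) := by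
          gcongr; exact this
      _ = _ := by ring
  rw [integral_const_mul] at h3
  have h4 : hn (NP F) r ^ 2 ≤ hn (NP F) r * GG N 2 (hn F) r := by
    rw [h2]
    refine (mul_le_mul_of_nonneg_left h3 (inv_nonneg.2 (by linarith))).trans (le_of_eq ?_)
    rw [GG]
    have : (N:ℝ) - 2 ≠ 0 := by linarith
    push_cast
    rw [show (N:ℝ) - 2 + 2 * 2 = N + 2 by ring]
    field_simp
  rcases (hn_nonneg (NP F) r).eq_or_lt with h | h
  · rw [← h, GG]
    have : 0 ≤ (N:ℝ) - 2 := by linarith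
    refine mul_nonneg (by positivity) (setIntegral_nonneg measurableSet_Ioi fun s hs0 => ?_)
    have hs0 : 0 < s := hs0
    exact mul_nonneg (mul_nonneg (by positivity) (gk_nonneg hr hs0 2)) (hn_nonneg _ _)
  · rw [sq] at h4; exact le_of_mul_le_mul_left h4 h

lemma NP_Hi {σ M r : ℝ} {F : Euc N → ℝ} (hF : Dec σ M F) (hs : 2 < σ) (hr : 0 < r)
    (hi : ∀ s : ℝ, 0 < s → Hi (fun ω : Sph N => F (s • (ω : Euc N)))) : Hi (fun ω : Sph N => NP F (r • (ω : Euc N))) := by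
  have key : ∀ χ : Sph N → ℝ, Continuous χ → (∀ s > 0, s ≠ r → TT F χ r s = 0) → ∫ ω : Sph N, NP F (r • (ω : Euc N)) * χ ω ∂(mu N) = 0 := by
    intro χ hχ h
    rw [(NP_pair hF hs hχ).2, integral_eq_zero_of_ae, mul_zero]
    filter_upwards [ae_ne_r r, ae_restrict_mem measurableSet_Ioi] with s hsr hs0
    rw [h s hs0 hsr, mul_zero, Pi.zero_apply]
  constructor
  · have := key (fun _ => 1) continuous_const (fun s hs0 hsr => by
      obtain ⟨k0, k1⟩ := ratio hr hs0 hsr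
      simp only [TT, Gam_kk' hr hs0, one_mul]
      simp only [integral_const_mul, kk_one k0 k1, mul_one]
      rw [integral_mul_const, (hi s hs0).1, zero_mul])
    simpa using this
  · intro v
    refine key (fun ω => ⟪(ω : Euc N), v⟫_ℝ) (by fun_prop) (fun s hs0 hsr => ?_)
    obtain ⟨k0, k1⟩ := ratio hr hs0 hsr
    have e : ∀ η : Sph N, ∫ ω : Sph N, ⟪(ω : Euc N), v⟫_ℝ * Gam 0 (r • (ω : Euc N) - s • (η : Euc N)) ∂(mu N)
        = ((max r s ^ (N - 2))⁻¹ * (((N:ℝ) - 2) / N * (min r s / max r s))) * ⟪(η : Euc N), v⟫_ℝ := by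
      intro η
      rw [mul_assoc, ← kk_inner k0 k1 η v, ← integral_const_mul]
      congr 1; funext ω
      rw [Gam_kk' hr hs0]; ring
    simp only [TT, e]
    rw [← mul_zero ((max r s ^ (N - 2))⁻¹ * (((N:ℝ) - 2) / N * (min r s / max r s))), ← (hi s hs0).2 v, ← integral_const_mul]
    congr 1; funext η; ring

end PS

namespace PS

open Set Metric

variable {N : ℕ} [hN4 : Fact (4 ≤ N)]

open scoped BoundedContinuousFunction in
/-- weighted average -/
def av (k : ℕ) (h : ℝ → ℝ) (r : ℝ) : ℝ := ∫ θ in (0:ℝ)..1, θ ^ k * h (r * θ)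

lemma av_cont (k : ℕ) {h : ℝ → ℝ} (hh : Continuous h) : Continuous (av k h) := by
  unfold av
  apply intervalIntegral.continuous_parametric_intervalIntegral_of_continuous'
  simp only [Function.uncurry_def]; fun_prop

lemma av_eq (k : ℕ) (h : ℝ → ℝ) (r : ℝ) : r ^ (k + 1) * av k h r = ∫ s in (0:ℝ)..r, s ^ k * h s := by
  have := intervalIntegral.smul_integral_comp_mul_left (a := 0) (b := 1) (fun s => s ^ k * h s) r
  rw [mul_zero, mul_one, smul_eq_mul] at this
  rw [← this, pow_succ, mul_assoc, mul_left_comm, av, ← intervalIntegral.integral_const_mul]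
  congr 2; funext θ; ring

lemma av_le (k : ℕ) {h : ℝ → ℝ} {r B : ℝ} (hB : ∀ θ ∈ Icc (0:ℝ) 1, |h (r * θ)| ≤ B) : |av k h r| ≤ B := by
  rw [av, ← Real.norm_eq_abs]
  have := intervalIntegral.norm_integral_le_of_norm_le_const (a := 0) (b := 1) (C := B) (f := fun θ => θ ^ k * h (r * θ)) (by
    intro θ hθ
    rw [uIoc_of_le zero_le_one] at hθ
    have h1 := hB θ ⟨hθ.1.le, hθ.2⟩
    rw [norm_mul, Real.norm_eq_abs, Real.norm_eq_abs, abs_of_nonneg (pow_nonneg hθ.1.le k)]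
    have h2 : θ ^ k ≤ 1 := pow_le_one₀ hθ.1.le hθ.2
    nlinarith [abs_nonneg (h (r * θ)), pow_nonneg hθ.1.le k])
  simpa using this

lemma half_pos_nn {c : ℝ} (hc : 0 ≤ c) : 0 ≤ c / 2 := by linarith

lemma exp_int {L c r : ℝ} (hL : 0 < L) (hr : 0 ≤ r) (hc : 0 ≤ c) {q : ℝ → ℝ} (hq : Continuous q)
    (h : ∀ t ∈ Icc 0 r, |q t| ≤ c * (L * Real.exp (L * t ^ 2))) : |∫ t in (0:ℝ)..r, t * q t| ≤ c / 2 * Real.exp (L * r ^ 2) := by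
  have h1 : ∫ t in (0:ℝ)..r, c * (t * (L * Real.exp (L * t ^ 2))) = c / 2 * Real.exp (L * r ^ 2) - c / 2 * Real.exp (L * 0 ^ 2) := by
    refine intervalIntegral.integral_eq_sub_of_hasDerivAt (f := fun t => c / 2 * Real.exp (L * t ^ 2)) ?_ (Continuous.intervalIntegrable (by fun_prop) _ _)
    intro t _
    have := (((hasDerivAt_pow 2 t).const_mul L).exp).const_mul (c / 2)
    refine this.congr_deriv ?_
    simp; ring
  have h2 : ‖∫ t in (0:ℝ)..r, t * q t‖ ≤ ∫ t in (0:ℝ)..r, c * (t * (L * Real.exp (L * t ^ 2))) := by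
    refine intervalIntegral.norm_integral_le_of_norm_le hr (ae_of_all _ fun t ht => ?_) (Continuous.intervalIntegrable (by fun_prop) _ _)
    rw [norm_mul, Real.norm_eq_abs, Real.norm_eq_abs, abs_of_pos ht.1]
    have := h t ⟨ht.1.le, ht.2⟩
    nlinarith [ht.1]
  rw [h1] at h2
  have : 0 < Real.exp (L * 0 ^ 2) := Real.exp_pos _
  rw [← Real.norm_eq_abs]
  have := mul_nonneg (half_pos_nn hc) this.le
  linarith

lemma volt0 (k : ℕ) {H : ℝ → ℝ → ℝ} (hH : Continuous (fun q : ℝ × ℝ => H q.1 q.2)) {L : ℝ} (hL : 0 < L)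
    (hLip : ∀ s x y, |H s x - H s y| ≤ L * |x - y|) (hH0 : ∀ s, H s 0 = 0) {g : ℝ → ℝ} (hg : Continuous g)
    {B : ℝ} (hB : ∀ r ≥ 0, |g r| ≤ B * Real.exp (L * r ^ 2)) :
    ∃ x : ℝ → ℝ, Continuous x ∧ ∀ r ≥ 0, x r = g r - ∫ t in (0:ℝ)..r, t * av k (fun s => H s (x s)) t := by
  let S : (ℝ → ℝ) → ℝ → ℝ := fun z s => H s (Real.exp (L * s ^ 2) * z s)
  have Sc : ∀ z : ℝ → ℝ, Continuous z → Continuous (S z) := by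
    intro z hz
    exact hH.comp (by fun_prop : Continuous (fun s : ℝ => (s, Real.exp (L * s ^ 2) * z s)))
  let T : (ℝ → ℝ) → ℝ → ℝ := fun z r => Real.exp (-(L * r ^ 2)) * (g |r| - ∫ t in (0:ℝ)..|r|, t * av k (S z) t)
  have Tc : ∀ z : ℝ → ℝ, Continuous z → Continuous (T z) := by
    intro z hz
    have h1 := av_cont k (Sc z hz)
    have h2 : Continuous (fun r : ℝ => ∫ t in (0:ℝ)..r, t * av k (S z) t) :=
      intervalIntegral.continuous_primitive (fun a b => Continuous.intervalIntegrable (by fun_prop) _ _) 0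
    have h3 : Continuous (fun r : ℝ => ∫ t in (0:ℝ)..|r|, t * av k (S z) t) := h2.comp continuous_abs
    show Continuous (fun r => Real.exp (-(L * r ^ 2)) * (g |r| - ∫ t in (0:ℝ)..|r|, t * av k (S z) t))
    fun_prop
  have key : ∀ (z z' : ℝ → ℝ), Continuous z → Continuous z' → ∀ c ≥ 0, (∀ s, |z s - z' s| ≤ c) → ∀ r, |T z r - T z' r| ≤ c / 2 := by
    intro z z' hz hz' c hc hzz r
    have h1 := av_cont k (Sc z hz)
    have h1' := av_cont k (Sc z' hz')
    have e : T z r - T z' r = -(Real.exp (-(L * r ^ 2)) * ∫ t in (0:ℝ)..|r|, t * (av k (S z) t - av k (S z') t)) := by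
      simp only [T, mul_sub]
      rw [intervalIntegral.integral_sub (Continuous.intervalIntegrable (by fun_prop) _ _) (Continuous.intervalIntegrable (by fun_prop) _ _)]
      ring
    have h2 : ∀ t ∈ Icc 0 |r|, |av k (S z) t - av k (S z') t| ≤ c * (L * Real.exp (L * t ^ 2)) := by
      intro t ht
      have e2 : av k (S z) t - av k (S z') t = av k (fun s => S z s - S z' s) t := by
        have c1 := Sc z hz
        have c2 := Sc z' hz'
        simp only [av, mul_sub]
        rw [intervalIntegral.integral_sub (Continuous.intervalIntegrable (by fun_prop) _ _) (Continuous.intervalIntegrable (by fun_prop) _ _)]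
      rw [e2]
      refine av_le k fun θ hθ => ?_
      refine (hLip _ _ _).trans ?_
      rw [← mul_sub, abs_mul, abs_of_pos (Real.exp_pos _)]
      have h3 : Real.exp (L * (t * θ) ^ 2) ≤ Real.exp (L * t ^ 2) := by
        apply Real.exp_le_exp.2
        have : θ ^ 2 ≤ 1 := pow_le_one₀ hθ.1 hθ.2
        rw [mul_pow]
        have := mul_le_of_le_one_right (sq_nonneg t) this
        gcongr
      calc _ ≤ L * (Real.exp (L * t ^ 2) * c) := by
            gcongr; exact hzz _
        _ = _ := by ring
    have h3 := exp_int hL (abs_nonneg r) hc (q := fun t => av k (S z) t - av k (S z') t) (by fun_prop) h2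
    rw [e, abs_neg, abs_mul, abs_of_pos (Real.exp_pos _)]
    calc _ ≤ Real.exp (-(L * r ^ 2)) * (c / 2 * Real.exp (L * |r| ^ 2)) := by gcongr
      _ = c / 2 * (Real.exp (-(L * r ^ 2)) * Real.exp (L * r ^ 2)) := by rw [sq_abs]; ring
      _ = _ := by rw [← Real.exp_add]; simp
  have T0 : ∀ r, |T (fun _ => 0) r| ≤ B := by
    intro r
    have : T (fun _ => 0) r = Real.exp (-(L * r ^ 2)) * g |r| := by
      simp [T, S, hH0, av]
    rw [this, abs_mul, abs_of_pos (Real.exp_pos _)]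
    calc _ ≤ Real.exp (-(L * r ^ 2)) * (B * Real.exp (L * |r| ^ 2)) := by gcongr; exact hB _ (abs_nonneg r)
      _ = B * (Real.exp (-(L * r ^ 2)) * Real.exp (L * r ^ 2)) := by rw [sq_abs]; ring
      _ = _ := by rw [← Real.exp_add]; simp
  have Tb : ∀ z : BoundedContinuousFunction ℝ ℝ, ∀ r, ‖T z r‖ ≤ B + ‖z‖ / 2 := by
    intro z r
    have h1 := key z (fun _ => 0) z.continuous continuous_const ‖z‖ (norm_nonneg _) (fun s => by simpa using z.norm_coe_le_norm s) r
    have h2 := T0 r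
    have := abs_sub_abs_le_abs_sub (T z r) (T (fun _ => 0) r)
    rw [Real.norm_eq_abs]; linarith
  let TB : BoundedContinuousFunction ℝ ℝ → BoundedContinuousFunction ℝ ℝ := fun z =>
    BoundedContinuousFunction.ofNormedAddCommGroup (T z) (Tc z z.continuous) _ (Tb z)
  have hc : ContractingWith (1/2) TB := by
    refine ⟨by rw [← NNReal.coe_lt_coe]; push_cast; norm_num, LipschitzWith.of_dist_le_mul fun z z' => ?_⟩
    rw [BoundedContinuousFunction.dist_le (by positivity)]
    intro r
    have := key z z' z.continuous z'.continuous (dist z z') dist_nonneg (fun s => by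
      rw [← Real.dist_eq]; exact BoundedContinuousFunction.dist_coe_le_dist s) r
    rw [Real.dist_eq]
    simp only [TB, BoundedContinuousFunction.coe_ofNormedAddCommGroup]
    refine this.trans (le_of_eq ?_)
    push_cast; ring
  let z := ContractingWith.fixedPoint TB hc
  have hz : TB z = z := hc.fixedPoint_isFixedPt
  refine ⟨fun s => Real.exp (L * s ^ 2) * z s, by fun_prop, fun r hr => ?_⟩
  have : z r = T z r := by
    conv_lhs => rw [← hz]
    rfl
  show Real.exp (L * r ^ 2) * z r = _
  rw [this]
  simp only [T, abs_of_nonneg hr]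
  rw [← mul_assoc, ← Real.exp_add]
  simp [S]

lemma prim_d {f : ℝ → ℝ} (hf : Continuous f) (r : ℝ) : HasDerivAt (fun r : ℝ => ∫ t in (0:ℝ)..r, f t) (f r) r :=
  intervalIntegral.integral_hasDerivAt_right (hf.intervalIntegrable _ _) (hf.stronglyMeasurableAtFilter _ _) hf.continuousAt

/-- Radial ODE existence. -/
lemma volt {k l : ℕ} (hl : l ≤ 1) (hk : 1 ≤ k) {H : ℝ → ℝ → ℝ} (hH : Continuous (fun q : ℝ × ℝ => H q.1 q.2)) {L : ℝ} (hL : 0 < L)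
    (hLip : ∀ s x y, |H s x - H s y| ≤ L * |x - y|) (hH0 : ∀ s, H s 0 = 0) {f : ℝ → ℝ} (hf : Continuous f)
    {M : ℝ} (hM : ∀ r ≥ 0, |f r| ≤ M) (c : ℝ) :
    ∃ x P : ℝ → ℝ, Continuous x ∧ x 0 = c ∧ (∀ r > 0, HasDerivAt x (-(P r / r ^ k)) r) ∧
      (∀ r > 0, HasDerivAt P (r ^ k * H r (x r) + r ^ (k - l) * f r) r) ∧ Tendsto P (𝓝[>] 0) (𝓝 0) ∧
      Tendsto (fun r => r * (P r / r ^ k)) (𝓝[>] 0) (𝓝 0) := by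
  have hM0 : 0 ≤ M := (abs_nonneg _).trans (hM 0 le_rfl)
  have ac := av_cont (k - l) hf
  have gc : Continuous (fun r : ℝ => c - ∫ t in (0:ℝ)..r, t ^ (1 - l) * av (k - l) f t) :=
    continuous_const.sub (intervalIntegral.continuous_primitive (fun a b => Continuous.intervalIntegrable (by fun_prop) _ _) 0)
  obtain ⟨x, hx, hxe⟩ := volt0 k hH hL hLip hH0 gc (B := |c| + M + M * (2 / L)) (by
    intro r hr
    have h1 : ‖∫ t in (0:ℝ)..r, t ^ (1 - l) * av (k - l) f t‖ ≤ ((1 + r) * M) * |r - 0| := by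
      refine intervalIntegral.norm_integral_le_of_norm_le_const fun t ht => ?_
      rw [uIoc_of_le hr] at ht
      have h2 : |av (k - l) f t| ≤ M := av_le _ fun θ hθ => hM _ (mul_nonneg ht.1.le hθ.1)
      rw [norm_mul, Real.norm_eq_abs, Real.norm_eq_abs, abs_of_nonneg (pow_nonneg ht.1.le _)]
      have h3 : t ^ (1 - l) ≤ 1 + r := by
        interval_cases l
        · simp; linarith [ht.2]
        · simp; linarith
      gcongr
    rw [sub_zero, abs_of_nonneg hr, Real.norm_eq_abs] at h1
    have h4 : 1 + L * r ^ 2 ≤ Real.exp (L * r ^ 2) := by linarith [Real.add_one_le_exp (L * r ^ 2)]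
    have h5 : r ^ 2 ≤ Real.exp (L * r ^ 2) / L := by rw [le_div_iff₀ hL]; nlinarith
    have h6 : 1 ≤ Real.exp (L * r ^ 2) := by nlinarith [mul_nonneg hL.le (sq_nonneg r)]
    have h7 := abs_sub c (∫ t in (0:ℝ)..r, t ^ (1 - l) * av (k - l) f t)
    have h8 : (1 + r) * r ≤ (1 + 2 / L) * Real.exp (L * r ^ 2) := by
      have : (1 + r) * r ≤ 1 + 2 * r ^ 2 := by nlinarith [sq_nonneg (r - 1)]
      have : (1 + 2 / L) * Real.exp (L * r ^ 2) = Real.exp (L * r ^ 2) + 2 * (Real.exp (L * r ^ 2) / L) := by ring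
      linarith
    nlinarith [abs_nonneg c])
  have hHx : Continuous (fun s => H s (x s)) := hH.comp (by fun_prop : Continuous (fun s : ℝ => (s, x s)))
  have ac2 := av_cont k hHx
  have hPe : ∀ r > 0, ∫ s in (0:ℝ)..r, (s ^ k * H s (x s) + s ^ (k - l) * f s) = r ^ k * (r * av k (fun s => H s (x s)) r + r ^ (1 - l) * av (k - l) f r) := by
    intro r hr
    rw [intervalIntegral.integral_add (Continuous.intervalIntegrable (by fun_prop) _ _) (Continuous.intervalIntegrable (by fun_prop) _ _),
      ← av_eq (k - l) f, ← av_eq k (fun s => H s (x s)), mul_add, ← mul_assoc, ← mul_assoc, ← pow_succ, ← pow_add]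
    congr 3
    omega
  refine ⟨x, fun r => ∫ s in (0:ℝ)..r, (s ^ k * H s (x s) + s ^ (k - l) * f s), hx, ?_, ?_, ?_, ?_, ?_⟩
  · rw [hxe 0 le_rfl]; simp
  · intro r hr
    simp only [hPe r hr, mul_div_cancel_left₀ _ (pow_pos hr k).ne']
    have d1 : HasDerivAt (fun r : ℝ => ∫ t in (0:ℝ)..r, t ^ (1 - l) * av (k - l) f t) (r ^ (1 - l) * av (k - l) f r) r :=
      prim_d (by fun_prop) r
    have d2 : HasDerivAt (fun r : ℝ => ∫ t in (0:ℝ)..r, t * av k (fun s => H s (x s)) t) (r * av k (fun s => H s (x s)) r) r :=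
      prim_d (by fun_prop) r
    have d3 := ((hasDerivAt_const r c).sub d1).sub d2
    refine (d3.congr_of_eventuallyEq ?_).congr_deriv (by ring)
    filter_upwards [eventually_gt_nhds hr] with s hs
    exact hxe s (le_of_lt hs)
  · intro r hr
    exact prim_d (f := fun s => s ^ k * H s (x s) + s ^ (k - l) * f s) (by fun_prop) r
  · have : Continuous (fun r => ∫ s in (0:ℝ)..r, (s ^ k * H s (x s) + s ^ (k - l) * f s)) :=
      intervalIntegral.continuous_primitive (fun a b => Continuous.intervalIntegrable (by fun_prop) _ _) 0
    have h := this.tendsto 0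
    rw [intervalIntegral.integral_same] at h
    exact h.mono_left nhdsWithin_le_nhds
  · have : Continuous (fun r => r * (r * av k (fun s => H s (x s)) r + r ^ (1 - l) * av (k - l) f r)) := by fun_prop
    have h := this.tendsto 0
    rw [zero_mul] at h
    refine (h.mono_left nhdsWithin_le_nhds).congr' ?_
    filter_upwards [self_mem_nhdsWithin] with r hr
    rw [hPe r hr, mul_div_cancel_left₀ _ (pow_pos hr k).ne']

end PS

namespace PS

open Set Metric

variable {N : ℕ} [hN4 : Fact (4 ≤ N)]

structure Par (N : ℕ) (p m : ℝ) : Prop where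
  hp : 1 < p
  hm : 0 < m
  hmp : m * (p - 1) = 2
  hN : 2 * m < N - 3

lemma Par.mk' {p : ℝ} (hp : ((N:ℝ) + 1) / (N - 3) < p) : Par N p (2 / (p - 1)) := by
  have hN := N4r N
  have h3 : (0:ℝ) < N - 3 := by linarith
  rw [div_lt_iff₀ h3] at hp
  have h1 : 1 < p := by
    by_contra h
    push Not at h
    nlinarith
  have h2 : 0 < p - 1 := by linarith
  refine ⟨h1, by positivity, by field_simp, ?_⟩
  rw [← mul_div_assoc, div_lt_iff₀ h2]
  nlinarith

lemma cmp0 {f f' : ℝ → ℝ} (hd : ∀ r > 0, HasDerivAt f (f' r) r) (h : ∀ r > 0, 0 ≤ f' r)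
    (h0 : Tendsto f (𝓝[>] 0) (𝓝 0)) {r : ℝ} (hr : 0 < r) : 0 ≤ f r := by
  have hm : MonotoneOn f (Ioi 0) := by
    refine monotoneOn_of_hasDerivWithinAt_nonneg (f' := f') (convex_Ioi 0) (fun x hx => (hd x hx).continuousAt.continuousWithinAt) ?_ ?_
    · intro x hx
      rw [interior_Ioi] at hx ⊢
      exact (hd x hx).hasDerivWithinAt
    · intro x hx
      rw [interior_Ioi] at hx
      exact h x hx
  refine le_of_tendsto h0 ?_
  filter_upwards [Ioo_mem_nhdsGT hr] with s hs
  exact hm hs.1 hr hs.2.le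

lemma antiOn {f f' : ℝ → ℝ} {R : ℝ} (hd : ∀ r > R, HasDerivAt f (f' r) r) (h : ∀ r > R, f' r ≤ 0) : AntitoneOn f (Ioi R) := by
  refine antitoneOn_of_hasDerivWithinAt_nonpos (f' := f') (convex_Ioi R) (fun x hx => (hd x hx).continuousAt.continuousWithinAt) ?_ ?_
  · intro x hx
    rw [interior_Ioi] at hx ⊢
    exact (hd x hx).hasDerivWithinAt
  · intro x hx
    rw [interior_Ioi] at hx
    exact h x hx

def vv (x P : ℝ → ℝ) (k : ℕ) (q : ℝ) (r : ℝ) : ℝ := r ^ q * (q * x r - r * (P r / r ^ k))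

lemma x1_d {P h : ℝ → ℝ} {k : ℕ} {r : ℝ} (hr : 0 < r) (hP : HasDerivAt P (r ^ k * h r) r) :
    HasDerivAt (fun r => P r / r ^ k) (h r - k / r * (P r / r ^ k)) r := by
  have h1 := hP.div (hasDerivAt_pow k r) (pow_pos hr k).ne'
  refine h1.congr_deriv ?_
  rcases Nat.eq_zero_or_pos k with hk | hk
  · subst hk; simp
  · obtain ⟨j, rfl⟩ : ∃ j, k = j + 1 := ⟨k - 1, by omega⟩
    simp only [Nat.add_sub_cancel]
    have := hr.ne'
    field_simp
    ring

lemma logd {x P h : ℝ → ℝ} {k : ℕ} (q : ℝ) {r : ℝ} (hr : 0 < r) (hx : HasDerivAt x (-(P r / r ^ k)) r)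
    (hP : HasDerivAt P (r ^ k * h r) r) :
    HasDerivAt (fun r => r ^ q * x r) (vv x P k q r / r) r ∧
    HasDerivAt (vv x P k q) ((-(k - 1 - 2 * q) * vv x P k q r + q * (k - 1 - q) * (r ^ q * x r) - r ^ (q + 2) * h r) / r) r := by
  have hq : HasDerivAt (fun r : ℝ => r ^ q) (q * r ^ (q - 1)) r := Real.hasDerivAt_rpow_const (Or.inl hr.ne')
  have e1 : r ^ (q - 1) = r ^ q / r := by rw [Real.rpow_sub hr, Real.rpow_one]
  have e2 : r ^ (q + 2) = r ^ q * r ^ 2 := by rw [Real.rpow_add hr]; norm_num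
  have h1 := x1_d hr hP
  constructor
  · refine (hq.mul hx).congr_deriv ?_
    rw [e1, vv]; field_simp; ring
  · have h2 := hq.mul ((hx.const_mul q).sub ((hasDerivAt_id r).mul h1))
    refine HasDerivAt.congr_deriv (f := vv x P k q) h2 ?_
    simp only [id, Pi.mul_apply, Pi.sub_apply]
    rw [e1, e2, vv]
    generalize P r / r ^ k = Z
    field_simp
    ring

lemma abs_min_sub_min_le_abs' (a b c : ℝ) : |min a c - min b c| ≤ |a - b| := by
  have := abs_min_sub_min_le_max a c b c
  simpa using this

lemma clip_lip {p : ℝ} (hp : 1 < p) (x y : ℝ) : |(min (max x 0) 1) ^ p - (min (max y 0) 1) ^ p| ≤ p * |x - y| := by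
  have h1 : |(min (max x 0) 1) ^ p - (min (max y 0) 1) ^ p| ≤ p * |min (max x 0) 1 - min (max y 0) 1| := by
    have := Convex.norm_image_sub_le_of_norm_hasDerivWithin_le (f := fun t : ℝ => t ^ p) (f' := fun t => p * t ^ (p - 1)) (s := Icc (0:ℝ) 1) (C := p)
      (x := min (max y 0) 1) (y := min (max x 0) 1)
      (fun t ht => (Real.hasDerivAt_rpow_const (Or.inr hp.le)).hasDerivWithinAt) (fun t ht => by
        have := Real.rpow_le_one ht.1 ht.2 (show 0 ≤ p - 1 by linarith)
        have h0 := Real.rpow_nonneg ht.1 (p - 1)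
        rw [Real.norm_eq_abs, abs_of_nonneg (by positivity)]
        nlinarith) (convex_Icc 0 1) ⟨by positivity, min_le_right _ _⟩ ⟨by positivity, min_le_right _ _⟩
    simpa only [Real.norm_eq_abs] using this
  refine h1.trans (mul_le_mul_of_nonneg_left ?_ (by linarith))
  calc |min (max x 0) 1 - min (max y 0) 1| ≤ |max x 0 - max y 0| := abs_min_sub_min_le_abs' _ _ _
    _ ≤ |x - y| := abs_max_sub_max_le_abs _ _ _

structure IsW (N : ℕ) (p m : ℝ) (w P : ℝ → ℝ) : Prop where
  cont : Continuous w
  w0 : w 0 = 1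
  dw : ∀ r > 0, HasDerivAt w (-(P r / r ^ (N - 1))) r
  dP : ∀ r > 0, HasDerivAt P (r ^ (N - 1) * w r ^ p) r
  P0 : Tendsto P (𝓝[>] 0) (𝓝 0)
  P1 : Tendsto (fun r => r * (P r / r ^ (N - 1))) (𝓝[>] 0) (𝓝 0)
  pos : ∀ r ≥ 0, 0 < w r
  le1 : ∀ r ≥ 0, w r ≤ 1

lemma posG {p : ℝ} (hp : 1 < p) (x : ℝ) : HasDerivAt (fun x : ℝ => (max x 0) ^ (p + 1) / (p + 1)) ((max x 0) ^ p) x := by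
  have hp1 : p + 1 ≠ 0 := by linarith
  rcases lt_trichotomy x 0 with h | h | h
  · rw [max_eq_right h.le, Real.zero_rpow (by linarith)]
    refine (hasDerivAt_const x (0:ℝ)).congr_of_eventuallyEq ?_
    filter_upwards [eventually_lt_nhds h] with y hy
    rw [max_eq_right (le_of_lt hy), Real.zero_rpow hp1, zero_div]
  · subst h
    rw [max_self, Real.zero_rpow (by linarith)]
    rw [hasDerivAt_iff_isLittleO]
    simp only [max_self, Real.zero_rpow hp1, sub_zero, zero_div, smul_zero]
    rw [Asymptotics.isLittleO_iff]
    intro c hc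
    have h1 : Tendsto (fun x : ℝ => |x| ^ p) (𝓝 0) (𝓝 0) := by
      have : Continuous (fun x : ℝ => |x| ^ p) := by
        exact continuous_abs.rpow_const (fun _ => Or.inr (by linarith))
      have := this.tendsto 0
      rwa [abs_zero, Real.zero_rpow (by linarith)] at this
    filter_upwards [h1.eventually (gt_mem_nhds hc)] with y hy
    rw [Real.norm_eq_abs, Real.norm_eq_abs, abs_of_nonneg (by positivity)]
    have h2 : max y 0 ≤ |y| := max_le (le_abs_self y) (abs_nonneg y)
    have h3 : max y 0 ^ (p + 1) ≤ |y| ^ (p + 1) := Real.rpow_le_rpow (by positivity) h2 (by linarith)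
    have h4 : |y| ^ (p + 1) = |y| ^ p * |y| := by
      rw [Real.rpow_add_one' (abs_nonneg y) hp1]
    rw [div_le_iff₀ (by linarith)]
    have := mul_le_mul_of_nonneg_right hy.le (abs_nonneg y)
    have h5 := mul_nonneg hc.le (abs_nonneg y)
    nlinarith
  · rw [max_eq_left h.le]
    have h1 := (Real.hasDerivAt_rpow_const (x := x) (p := p + 1) (Or.inl h.ne')).div_const (p + 1)
    rw [add_sub_cancel_right, mul_div_cancel_left₀ _ hp1] at h1
    refine h1.congr_of_eventuallyEq ?_
    filter_upwards [eventually_gt_nhds h] with y hy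
    rw [max_eq_left (le_of_lt hy)]

theorem exists_w {p m : ℝ} (h : Par N p m) : ∃ w P, IsW N p m w P ∧ ∃ c C R : ℝ, 0 < c ∧ 0 < R ∧ ∀ r > R, c ≤ r ^ m * w r ∧ r ^ m * w r ≤ C := by
  have hN := N4r N
  obtain ⟨hp, hm, hmp, hmN⟩ := h
  have hc : Continuous (fun q : ℝ × ℝ => (min (max q.2 0) 1) ^ p) :=
    Continuous.rpow_const (by fun_prop) (fun _ => Or.inr (by linarith))
  obtain ⟨w, P, wc, w0, dw, dP, P0, P1⟩ := volt (k := N - 1) (l := 0) (by norm_num) (by have := N4 N; omega)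
    (H := fun _ x => (min (max x 0) 1) ^ p) hc (L := p) (by linarith) (fun s x y => clip_lip hp x y)
    (fun s => by simp; rw [Real.zero_rpow]; linarith) (f := fun _ => 0) continuous_const (M := 0) (by simp) 1
  simp only [mul_zero, add_zero] at dP
  have Pn : ∀ r > 0, 0 ≤ P r := fun r hr => cmp0 dP (fun r hr => by positivity) P0 hr
  have wl : ∀ r > 0, w r ≤ 1 := by
    intro r hr
    have h1 : Tendsto (fun r => 1 - w r) (𝓝[>] 0) (𝓝 0) := by
      have : Tendsto (fun r => 1 - w r) (𝓝 0) (𝓝 (1 - w 0)) := (continuous_const.sub wc).tendsto 0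
      rw [w0, sub_self] at this
      exact this.mono_left nhdsWithin_le_nhds
    have := cmp0 (fun r hr => (hasDerivAt_const r (1:ℝ)).sub (dw r hr)) (fun r hr => by
      have := Pn r hr
      have : 0 ≤ P r / r ^ (N - 1) := by positivity
      linarith) h1 hr
    simp only [Pi.sub_apply] at this
    linarith
  have dP' : ∀ r > 0, HasDerivAt P (r ^ (N - 1) * (max (w r) 0) ^ p) r := by
    intro r hr
    have := dP r hr
    rwa [min_eq_left (max_le (wl r hr) zero_le_one)] at this
  set k := N - 1 with hk
  have hkN : (k:ℝ) = N - 1 := by rw [hk, Nat.cast_sub (by have := N4 N; omega)]; simp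
  set v := vv w P k m with hv
  have LD := fun r (hr : (0:ℝ) < r) => logd (h := fun r => (max (w r) 0) ^ p) m hr (dw r hr) (dP' r hr)
  have eW : ∀ r > 0, r ^ (m + 2) * (max (w r) 0) ^ p = (max (r ^ m * w r) 0) ^ p := by
    intro r hr
    have : max (r ^ m * w r) 0 = r ^ m * max (w r) 0 := by
      rw [mul_max_of_nonneg _ _ (by positivity), mul_zero]
    rw [this, Real.mul_rpow (by positivity) (by positivity), ← Real.rpow_mul hr.le]
    congr 2; linarith
  have eW1 : ∀ r > 0, (max (r ^ m * w r) 0) ^ (p + 1) = r ^ (2 * m) * (r ^ 2 * (max (w r) 0) ^ (p + 1)) := by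
    intro r hr
    have : max (r ^ m * w r) 0 = r ^ m * max (w r) 0 := by
      rw [mul_max_of_nonneg _ _ (by positivity), mul_zero]
    rw [this, Real.mul_rpow (by positivity) (by positivity), ← Real.rpow_mul hr.le, ← mul_assoc]
    congr 1
    rw [← Real.rpow_natCast r 2, ← Real.rpow_add hr]
    congr 1; push_cast; linarith
  set b := m * (k - 1 - m) with hb
  have hb0 : 0 < b := mul_pos hm (by rw [hkN]; linarith)
  let E : ℝ → ℝ := fun r => v r ^ 2 / 2 - b * (r ^ m * w r) ^ 2 / 2 + (max (r ^ m * w r) 0) ^ (p + 1) / (p + 1)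
  have dE : ∀ r > 0, HasDerivAt E (-(k - 1 - 2 * m) * v r ^ 2 / r) r := by
    intro r hr
    obtain ⟨d1, d2⟩ := LD r hr
    have d3 := (posG hp (r ^ m * w r)).comp r d1
    have d4 := (((d2.pow 2).div_const 2).sub (((d1.pow 2).const_mul b).div_const 2)).add d3
    refine HasDerivAt.congr_deriv (f := E) d4 ?_
    rw [eW r hr, ← hv]
    push_cast
    field_simp
    ring
  have E0 : ∀ᶠ r in 𝓝[>] (0:ℝ), E r < 0 := by
    have hw1 : Tendsto w (𝓝[>] 0) (𝓝 1) := by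
      have := wc.tendsto 0
      rw [w0] at this
      exact this.mono_left nhdsWithin_le_nhds
    have hi : Tendsto (fun r : ℝ => r) (𝓝[>] 0) (𝓝 0) := (continuous_id.tendsto (0:ℝ)).mono_left nhdsWithin_le_nhds
    have hmx : Tendsto (fun r => (max (w r) 0) ^ (p + 1)) (𝓝[>] 0) (𝓝 ((max 1 0) ^ (p + 1))) :=
      (hw1.max tendsto_const_nhds).rpow_const (Or.inr (by linarith))
    have ht := ((((hw1.const_mul m).sub P1).pow 2).div_const 2).sub (((hw1.pow 2).const_mul b).div_const 2) |>.add
      (((hi.pow 2).mul hmx).div_const (p + 1))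
    have hneg : (m * 1 - 0) ^ 2 / 2 - b * 1 ^ 2 / 2 + 0 ^ 2 * (max (1:ℝ) 0) ^ (p + 1) / (p + 1) < 0 := by
      rw [hb, hkN]
      have : m * (N - 1 - 1 - m) - m ^ 2 > 0 := by nlinarith
      simp; nlinarith
    filter_upwards [ht.eventually (gt_mem_nhds hneg), self_mem_nhdsWithin] with r h1 hr
    have hr : 0 < r := hr
    have e : E r = r ^ (2 * m) * ((m * w r - r * (P r / r ^ k)) ^ 2 / 2 - b * w r ^ 2 / 2 + r ^ 2 * (max (w r) 0) ^ (p + 1) / (p + 1)) := by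
      have e1 : r ^ (2 * m) = (r ^ m) ^ 2 := by rw [← Real.rpow_natCast (r ^ m), ← Real.rpow_mul hr.le]; congr 1; push_cast; ring
      simp only [E]
      rw [eW1 r hr, hv, vv, e1]; ring
    rw [e]
    exact mul_neg_of_pos_of_neg (by positivity) h1
  have Ea : AntitoneOn E (Ioi 0) := antiOn dE (fun r hr => by
    have hr : 0 < r := hr
    have : 0 < (k:ℝ) - 1 - 2 * m := by rw [hkN]; linarith
    rw [div_le_iff₀ hr]; nlinarith [sq_nonneg (v r)])
  have En : ∀ r > 0, E r < 0 := by
    intro r hr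
    obtain ⟨s, h1, h2⟩ := (E0.and (Ioo_mem_nhdsGT hr)).exists
    exact (Ea h2.1 hr h2.2.le).trans_lt h1
  have wne : ∀ r ≥ 0, w r ≠ 0 := by
    intro r hr h0
    rcases hr.eq_or_lt with h | h
    · rw [← h, w0] at h0; exact one_ne_zero h0
    · have := En r h
      simp only [E, h0] at this
      simp at this
      rw [Real.zero_rpow (by linarith), zero_div, add_zero] at this
      nlinarith [sq_nonneg (v r)]
  have wpos : ∀ r ≥ 0, 0 < w r := by
    intro r hr
    by_contra hneg
    push Not at hneg
    have := intermediate_value_Icc' hr wc.continuousOn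
    obtain ⟨s, hs, h0⟩ := this ⟨hneg, by rw [w0]; exact zero_le_one⟩
    exact wne s hs.1 h0
  refine ⟨w, P, ⟨wc, w0, dw, ?_, P0, P1, wpos, ?_⟩, ?_⟩
  · intro r hr
    have := dP' r hr
    rwa [max_eq_left (wpos r (le_of_lt hr)).le] at this
  · intro r hr
    rcases hr.eq_or_lt with h | h
    · rw [← h, w0]
    · exact wl r h
  · have e1 := En 1 one_pos
    refine ⟨√(-E 1 * 2 / b), (b * (p + 1) / 2) ^ (1 / (p - 1)), 1, Real.sqrt_pos.2 (by apply div_pos _ hb0; linarith), one_pos, fun r hr => ?_⟩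
    have hr0 : 0 < r := by linarith
    have hW : 0 < r ^ m * w r := mul_pos (by positivity) (wpos r hr0.le)
    have h1 : E r ≤ E 1 := Ea (by simp) hr0 hr.le
    have h2 := En r hr0
    have hG : 0 ≤ (max (r ^ m * w r) 0) ^ (p + 1) / (p + 1) := by
      have : 0 < p + 1 := by linarith
      positivity
    have hv2 := sq_nonneg (v r)
    simp only [E] at h2
    constructor
    · rw [Real.sqrt_le_left hW.le, div_le_iff₀ hb0]
      have h1 : v r ^ 2 / 2 - b * (r ^ m * w r) ^ 2 / 2 + (max (r ^ m * w r) 0) ^ (p + 1) / (p + 1) ≤ E 1 := h1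
      nlinarith
    · rw [max_eq_left hW.le] at h2
      set W := r ^ m * w r
      have e3 : W ^ (p + 1) = W ^ (p - 1) * W ^ 2 := by
        rw [← Real.rpow_natCast W 2, ← Real.rpow_add hW]; congr 1; push_cast; ring
      have h4 : W ^ (p + 1) / (p + 1) < b * W ^ 2 / 2 := by nlinarith
      rw [e3, div_lt_iff₀ (by linarith)] at h4
      have h5 : W ^ (p - 1) ≤ b * (p + 1) / 2 := by
        by_contra h6
        push Not at h6
        have := mul_lt_mul_of_pos_right h6 (pow_pos hW 2)
        nlinarith
      have h7 : 0 < p - 1 := by linarith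
      calc W = (W ^ (p - 1)) ^ (1 / (p - 1)) := by
            rw [← Real.rpow_mul hW.le, mul_one_div_cancel h7.ne', Real.rpow_one]
        _ ≤ _ := Real.rpow_le_rpow (by positivity) h5 (by positivity)

end PS

namespace PS

open Set Metric

variable {N : ℕ} [hN4 : Fact (4 ≤ N)]

lemma lyap {y v Φ g : ℝ → ℝ} {α c A R : ℝ} (hα : 0 < α) (hc : 0 < c) (hA : 0 < A) (hR : 0 < R)
    (dy : ∀ r > R, HasDerivAt y (v r / r) r) (dv : ∀ r > R, HasDerivAt v ((-α * v r - g r) / r) r)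
    (dΦ : ∀ r > R, HasDerivAt Φ (g r * (v r / r)) r) (h1 : ∀ r > R, c * y r ^ 2 ≤ y r * g r)
    (h2 : ∀ r > R, c / 2 * y r ^ 2 ≤ Φ r) (h3 : ∀ r > R, Φ r ≤ A * (y r * g r)) :
    Tendsto y atTop (𝓝 0) ∧ Tendsto v atTop (𝓝 0) := by
  obtain ⟨δ, hδ, d1, d2, d3⟩ : ∃ δ : ℝ, 0 < δ ∧ δ * (1 + α ^ 2 / (2 * c)) ≤ α / 2 ∧ δ ^ 2 ≤ c / 4 ∧ δ ≤ 1 := by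
    have e1 : ∀ᶠ δ in 𝓝[>] (0:ℝ), δ * (1 + α ^ 2 / (2 * c)) < α / 2 := by
      have : Tendsto (fun δ : ℝ => δ * (1 + α ^ 2 / (2 * c))) (𝓝 0) (𝓝 (0 * (1 + α ^ 2 / (2 * c)))) := (continuous_id.mul continuous_const).tendsto 0
      rw [zero_mul] at this
      exact (this.mono_left nhdsWithin_le_nhds).eventually (gt_mem_nhds (by positivity))
    have e2 : ∀ᶠ δ in 𝓝[>] (0:ℝ), δ ^ 2 < c / 4 := by
      have : Tendsto (fun δ : ℝ => δ ^ 2) (𝓝 0) (𝓝 (0 ^ 2)) := (continuous_pow 2).tendsto 0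
      rw [zero_pow two_ne_zero] at this
      exact (this.mono_left nhdsWithin_le_nhds).eventually (gt_mem_nhds (by positivity))
    have e3 : ∀ᶠ δ in 𝓝[>] (0:ℝ), δ < 1 :=
      (((continuous_id.tendsto (0:ℝ))).mono_left nhdsWithin_le_nhds).eventually (gt_mem_nhds one_pos)
    obtain ⟨δ, ⟨⟨⟨a1, a2⟩, a3⟩, a4⟩⟩ := (((e1.and e2).and e3).and self_mem_nhdsWithin).exists
    exact ⟨δ, a4, a1.le, a2.le, a3.le⟩
  let E : ℝ → ℝ := fun r => v r ^ 2 / 2 + Φ r + δ * (y r * v r)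
  have dE : ∀ r > R, HasDerivAt E ((-(α - δ) * v r ^ 2 - δ * α * (y r * v r) - δ * (y r * g r)) / r) r := by
    intro r hr
    have hr0 : 0 < r := hR.trans hr
    have := ((((dv r hr).pow 2).div_const 2).add (dΦ r hr)).add (((dy r hr).mul (dv r hr)).const_mul δ)
    refine HasDerivAt.congr_deriv (f := E) this ?_
    push_cast
    field_simp
    ring
  have yg : ∀ r > R, 0 ≤ y r * g r := fun r hr => le_trans (by positivity) (h1 r hr)
  have bd : ∀ r > R, -(α - δ) * v r ^ 2 - δ * α * (y r * v r) - δ * (y r * g r) ≤ -(α / 2 * v r ^ 2 + δ / 2 * (y r * g r)) := by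
    intro r hr
    have a1 := h1 r hr
    have a2 : -(α * (y r * v r)) ≤ c / 2 * y r ^ 2 + α ^ 2 / (2 * c) * v r ^ 2 := by
      have : 0 ≤ c / 2 * (y r + α / c * v r) ^ 2 := by positivity
      have e : c / 2 * (y r + α / c * v r) ^ 2 = c / 2 * y r ^ 2 + α * (y r * v r) + α ^ 2 / (2 * c) * v r ^ 2 := by field_simp; ring
      linarith
    have a3 := mul_le_mul_of_nonneg_left a2 hδ.le
    have a4 := mul_le_mul_of_nonneg_right d1 (sq_nonneg (v r))
    nlinarith
  let K := 2 / α + (2 * A / δ + 1 / c)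
  have hK : 0 < K := by positivity
  have Eu : ∀ r > R, E r ≤ K * (α / 2 * v r ^ 2 + δ / 2 * (y r * g r)) := by
    intro r hr
    have a1 := h1 r hr
    have a3 := h3 r hr
    have a4 : δ * (y r * v r) ≤ δ / 2 * y r ^ 2 + 1 / 2 * v r ^ 2 := by
      have e1 := mul_nonneg hδ.le (sq_nonneg (y r - v r))
      have e2 := mul_le_mul_of_nonneg_right d3 (sq_nonneg (v r))
      nlinarith
    have a5 : y r ^ 2 ≤ 1 / c * (y r * g r) := by
      rw [one_div, ← div_eq_inv_mul, le_div_iff₀ hc]; linarith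
    have e : K * (α / 2 * v r ^ 2 + δ / 2 * (y r * g r)) = v r ^ 2 + A * (y r * g r) + δ / 2 * (1 / c * (y r * g r)) + (2 / α * (δ / 2) * (y r * g r) + (2 * A / δ + 1 / c) * (α / 2) * v r ^ 2) := by
      simp only [K]; field_simp; ring
    have a6 : 0 ≤ 2 / α * (δ / 2) * (y r * g r) + (2 * A / δ + 1 / c) * (α / 2) * v r ^ 2 := by
      have := yg r hr
      positivity
    have a7 := mul_le_mul_of_nonneg_left a5 (show 0 ≤ δ / 2 by positivity)
    rw [e]
    simp only [E]
    nlinarith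
  have El : ∀ r > R, v r ^ 2 / 4 + c / 4 * y r ^ 2 ≤ E r := by
    intro r hr
    have a1 := h2 r hr
    have a2 : -(δ * (y r * v r)) ≤ v r ^ 2 / 4 + δ ^ 2 * y r ^ 2 := by nlinarith [sq_nonneg (v r / 2 + δ * y r)]
    have a3 := mul_le_mul_of_nonneg_right d2 (sq_nonneg (y r))
    simp only [E]
    linarith
  have hanti : AntitoneOn (fun r => r ^ (1 / K) * E r) (Ioi R) := by
    refine antiOn (f' := fun r => (1 / K) * r ^ (1 / K - 1) * E r + r ^ (1 / K) * ((-(α - δ) * v r ^ 2 - δ * α * (y r * v r) - δ * (y r * g r)) / r)) ?_ ?_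
    · intro r hr
      have hr0 : 0 < r := hR.trans hr
      exact (Real.hasDerivAt_rpow_const (Or.inl hr0.ne')).mul (dE r hr)
    · intro r hr
      have hr0 : 0 < r := hR.trans hr
      have a1 := bd r hr
      have a2 := Eu r hr
      have a3 : 1 / K * E r ≤ α / 2 * v r ^ 2 + δ / 2 * (y r * g r) := by
        rw [one_div, ← div_eq_inv_mul, div_le_iff₀ hK]; linarith
      rw [Real.rpow_sub hr0, Real.rpow_one]
      have : (1 / K) * (r ^ (1 / K) / r) * E r + r ^ (1 / K) * ((-(α - δ) * v r ^ 2 - δ * α * (y r * v r) - δ * (y r * g r)) / r)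
        = (r ^ (1 / K) / r) * (1 / K * E r + (-(α - δ) * v r ^ 2 - δ * α * (y r * v r) - δ * (y r * g r))) := by ring
      rw [this]
      exact mul_nonpos_of_nonneg_of_nonpos (by positivity) (by linarith)
  have E0 : Tendsto E atTop (𝓝 0) := by
    have t1 : Tendsto (fun r : ℝ => ((R + 1) ^ (1 / K) * E (R + 1)) * r ^ (-(1 / K))) atTop (𝓝 0) := by
      have := (tendsto_rpow_neg_atTop (y := 1 / K) (by positivity)).const_mul ((R + 1) ^ (1 / K) * E (R + 1))
      rwa [mul_zero] at this
    refine squeeze_zero' ?_ ?_ t1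
    · filter_upwards [eventually_gt_atTop R] with r hr
      exact le_trans (by positivity) (El r hr)
    · filter_upwards [eventually_gt_atTop (R + 1)] with r hr
      have hr0 : 0 < r := by linarith
      have := hanti (show R + 1 ∈ Ioi R by simp) (show r ∈ Ioi R by simp; linarith) hr.le
      simp only at this
      rw [Real.rpow_neg hr0.le, ← div_eq_mul_inv, le_div_iff₀ (by positivity)]
      linarith
  have sqz : ∀ z : ℝ → ℝ, (∃ κ > 0, ∀ r > R, κ * z r ^ 2 ≤ E r) → Tendsto z atTop (𝓝 0) := by
    rintro z ⟨κ, hκ, hz⟩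
    have t2 : Tendsto (fun r => √(E r / κ)) atTop (𝓝 0) := by
      have := (E0.div_const κ).sqrt
      simpa using this
    refine squeeze_zero_norm' ?_ t2
    filter_upwards [eventually_gt_atTop R] with r hr
    rw [Real.norm_eq_abs, ← Real.sqrt_sq_eq_abs]
    apply Real.sqrt_le_sqrt
    rw [le_div_iff₀ hκ]; linarith [hz r hr]
  exact ⟨sqz y ⟨c / 4, by positivity, fun r hr => by have := El r hr; nlinarith [sq_nonneg (v r)]⟩,
    sqz v ⟨1 / 4, by positivity, fun r hr => by have := El r hr; nlinarith [mul_nonneg hc.le (sq_nonneg (y r))]⟩⟩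

/-- the limiting potential -/
def Ph (p b β W : ℝ) : ℝ := W ^ (p + 1) / (p + 1) - b * W ^ 2 / 2 - (β ^ (p + 1) / (p + 1) - b * β ^ 2 / 2)

lemma Ph_d {p b β W : ℝ} (hp : 1 < p) (hW : 0 < W) : HasDerivAt (Ph p b β) (W ^ p - b * W) W := by
  have h1 := (Real.hasDerivAt_rpow_const (x := W) (p := p + 1) (Or.inl hW.ne')).div_const (p + 1)
  rw [add_sub_cancel_right, mul_div_cancel_left₀ _ (by linarith)] at h1
  have h2 := (h1.sub (((hasDerivAt_pow 2 W).const_mul b).div_const 2)).sub_const (β ^ (p + 1) / (p + 1) - b * β ^ 2 / 2)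
  refine HasDerivAt.congr_deriv (f := Ph p b β) h2 ?_
  simp; ring

lemma pot {p b β c0 : ℝ} (hp : 1 < p) (hb : 0 < b) (hβ : 0 < β) (hβb : β ^ (p - 1) = b) (hc0 : 0 < c0) :
    ∃ c > 0, ∀ W ≥ c0, c * (W - β) ^ 2 ≤ (W - β) * (W ^ p - b * W) ∧ c / 2 * (W - β) ^ 2 ≤ Ph p b β W ∧
      Ph p b β W ≤ (1 + b / (2 * c)) * ((W - β) * (W ^ p - b * W)) := by
  wlog hlt : c0 < β generalizing c0
  · obtain ⟨c, hc, h⟩ := this (c0 := β / 2) (by positivity) (by linarith)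
    exact ⟨c, hc, fun W hW => h W (by linarith)⟩
  have eβ : β ^ p = b * β := by
    rw [← hβb, ← Real.rpow_add_one hβ.ne']; congr 1; ring
  set s0 := (c0 ^ p - β ^ p) / (c0 - β) with hs0
  have hc : 0 < s0 - b := by
    have h1 : c0 ^ (p - 1) < b := by rw [← hβb]; exact Real.rpow_lt_rpow hc0.le hlt (by linarith)
    have h2 : c0 ^ p = c0 ^ (p - 1) * c0 := by rw [← Real.rpow_add_one hc0.ne']; congr 1; ring
    have h3 : c0 ^ p < b * c0 := by rw [h2]; exact mul_lt_mul_of_pos_right h1 hc0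
    rw [sub_pos, hs0, lt_div_iff_of_neg (by linarith), eβ]
    linarith
  have A1 : ∀ W ≥ c0, (s0 - b) * (W - β) ^ 2 ≤ (W - β) * (W ^ p - b * W) := by
    intro W hW
    rcases eq_or_ne W β with h | h
    · subst h; simp
    · have := (convexOn_rpow hp.le).secant_mono (a := β) (x := c0) (y := W) hβ.le hc0.le (hc0.le.trans hW) hlt.ne h hW
      rw [← hs0] at this
      have h2 : 0 < (W - β) ^ 2 := by have := sub_ne_zero.2 h; positivity
      have h3 := mul_le_mul_of_nonneg_right this h2.le
      have h4 : (W ^ p - β ^ p) / (W - β) * (W - β) ^ 2 = (W ^ p - β ^ p) * (W - β) := by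
        have := sub_ne_zero.2 h
        field_simp
      rw [h4, eβ] at h3
      nlinarith
  have hβ0 : Ph p b β β = 0 := by simp [Ph]
  refine ⟨s0 - b, hc, fun W hW => ⟨A1 W hW, ?_, ?_⟩⟩
  · have hd : ∀ t ≥ c0, HasDerivAt (fun t => Ph p b β t - (s0 - b) / 2 * (t - β) ^ 2) ((t ^ p - b * t) - (s0 - b) * (t - β)) t := by
      intro t ht
      have h1 := Ph_d (b := b) (β := β) hp (hc0.trans_le ht)
      have h2 := ((((hasDerivAt_id t).sub_const β).pow 2).const_mul ((s0 - b) / 2))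
      refine (h1.sub h2).congr_deriv ?_
      simp; ring
    rcases le_total β W with h | h
    · have hm : MonotoneOn (fun t => Ph p b β t - (s0 - b) / 2 * (t - β) ^ 2) (Icc β W) := by
        refine monotoneOn_of_hasDerivWithinAt_nonneg (convex_Icc β W) (fun x hx => (hd x (hlt.le.trans hx.1)).continuousAt.continuousWithinAt)
          (fun x hx => (hd x ?_).hasDerivWithinAt) ?_
        · rw [interior_Icc] at hx; exact hlt.le.trans hx.1.le
        · intro x hx
          rw [interior_Icc] at hx
          have := A1 x (hlt.le.trans hx.1.le)
          have h0 : 0 < x - β := by linarith [hx.1]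
          by_contra hn
          push Not at hn
          nlinarith
      have := hm ⟨le_rfl, h⟩ ⟨h, le_rfl⟩ h
      simp only [hβ0] at this
      simp at this
      linarith
    · have hm : AntitoneOn (fun t => Ph p b β t - (s0 - b) / 2 * (t - β) ^ 2) (Icc W β) := by
        refine antitoneOn_of_hasDerivWithinAt_nonpos (convex_Icc W β) (fun x hx => (hd x (hW.le.trans hx.1)).continuousAt.continuousWithinAt)
          (fun x hx => (hd x ?_).hasDerivWithinAt) ?_
        · rw [interior_Icc] at hx; exact hW.le.trans hx.1.le
        · intro x hx
          rw [interior_Icc] at hx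
          have := A1 x (hW.le.trans hx.1.le)
          have h0 : 0 < β - x := by linarith [hx.2]
          by_contra hn
          push Not at hn
          nlinarith
      have := hm ⟨le_rfl, h⟩ ⟨h, le_rfl⟩ h
      simp only [hβ0] at this
      simp at this
      linarith
  · have hW0 : 0 < W := hc0.trans_le hW
    have h1 := one_add_mul_self_le_rpow_one_add (s := β / W - 1) (by have : 0 < β / W := by positivity
                                                                     linarith) (p := p + 1) (by linarith)
    rw [add_sub_cancel, Real.div_rpow hβ.le hW0.le, le_div_iff₀ (by positivity)] at h1
    have h2 : W ^ (p + 1) = W ^ p * W := Real.rpow_add_one hW0.ne' p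
    have h3 : (1 + (p + 1) * (β / W - 1)) * W ^ (p + 1) = W ^ (p + 1) + (p + 1) * (W ^ p * (β - W)) := by
      rw [h2]; field_simp
    rw [h3] at h1
    have h4 : W ^ (p + 1) / (p + 1) - β ^ (p + 1) / (p + 1) ≤ W ^ p * (W - β) := by
      rw [← sub_div, div_le_iff₀ (by linarith)]; nlinarith
    have h5 := A1 W hW
    have h6 : b / 2 * (W - β) ^ 2 ≤ b / (2 * (s0 - b)) * ((W - β) * (W ^ p - b * W)) := by
      have := mul_le_mul_of_nonneg_left h5 (show 0 ≤ b / (2 * (s0 - b)) by positivity)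
      refine le_trans (le_of_eq ?_) this
      field_simp
    rw [Ph, add_mul, one_mul]
    nlinarith

lemma cast_pred : ((N - 1 : ℕ) : ℝ) = N - 1 := by
  rw [Nat.cast_sub (by have := N4 N; omega)]; simp

theorem w_lim {p m : ℝ} (h : Par N p m) {w P : ℝ → ℝ} (hw : IsW N p m w P) {c C R : ℝ} (hc : 0 < c) (hR : 0 < R)
    (hb : ∀ r > R, c ≤ r ^ m * w r ∧ r ^ m * w r ≤ C) :
    Tendsto (fun r => r ^ m * w r) atTop (𝓝 ((m * (N - 2 - m)) ^ (1 / (p - 1)))) ∧ Tendsto (vv w P (N - 1) m) atTop (𝓝 0) := by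
  have hN := N4r N
  have hm := h.hm
  have hmN := h.hN
  have hmp := h.hmp
  have hp : 0 < p - 1 := by linarith [h.hp]
  set b := m * (N - 2 - m) with hbd
  have hb0 : 0 < b := mul_pos hm (by linarith)
  set β := b ^ (1 / (p - 1)) with hβ
  have hβ0 : 0 < β := by positivity
  have hβb : β ^ (p - 1) = b := by rw [hβ, ← Real.rpow_mul hb0.le, one_div_mul_cancel hp.ne', Real.rpow_one]
  obtain ⟨c1, hc1, hpot⟩ := pot h.hp hb0 hβ0 hβb hc
  have LD := fun r (hr : (0:ℝ) < r) => logd (h := fun r => w r ^ p) m hr (hw.dw r hr) (hw.dP r hr)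
  have eW : ∀ r > 0, r ^ (m + 2) * w r ^ p = (r ^ m * w r) ^ p := by
    intro r hr
    rw [Real.mul_rpow (by positivity) (hw.pos r (le_of_lt hr)).le, ← Real.rpow_mul (le_of_lt hr)]
    congr 2; linarith
  have := lyap (y := fun r => r ^ m * w r - β) (v := vv w P (N - 1) m) (Φ := fun r => Ph p b β (r ^ m * w r)) (g := fun r => (r ^ m * w r) ^ p - b * (r ^ m * w r))
    (α := N - 2 - 2 * m) (c := c1) (A := 1 + b / (2 * c1)) (R := R) (by linarith) hc1 (by positivity) hR
    (fun r hr => ((LD r (hR.trans hr)).1.sub_const β)) ?_ ?_ (fun r hr => (hpot _ (hb r hr).1).1) (fun r hr => (hpot _ (hb r hr).1).2.1)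
    (fun r hr => (hpot _ (hb r hr).1).2.2)
  · refine ⟨?_, this.2⟩
    have h1 := this.1.add_const β
    simpa using h1
  · intro r hr
    have hr0 : 0 < r := hR.trans hr
    refine (LD r hr0).2.congr_deriv ?_
    rw [eW r hr0, cast_pred, hbd]
    ring
  · intro r hr
    have hr0 : 0 < r := hR.trans hr
    exact (Ph_d h.hp (hc.trans_le (hb r hr).1)).comp r (LD r hr0).1

end PS

namespace PS

open Set Metric

variable {N : ℕ} [hN4 : Fact (4 ≤ N)]

lemma bdd_lim {g : ℝ → ℝ} {a L : ℝ} (hc : ContinuousOn g (Ici a)) (hp : ∀ r ≥ a, 0 < g r) (hL : 0 < L) (hl : Tendsto g atTop (𝓝 L)) :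
    ∃ c C : ℝ, 0 < c ∧ 0 < C ∧ ∀ r ≥ a, c ≤ g r ∧ g r ≤ C := by
  obtain ⟨R, hR⟩ := eventually_atTop.1 ((hl.eventually (lt_mem_nhds (half_lt_self hL))).and (hl.eventually (gt_mem_nhds (show L < 2 * L by linarith))))
  have hcc : ContinuousOn g (Icc a (max a R)) := hc.mono Icc_subset_Ici_self
  have hne : (Icc a (max a R)).Nonempty := ⟨a, le_rfl, le_max_left _ _⟩
  obtain ⟨x0, hx0, h0⟩ := isCompact_Icc.exists_isMinOn hne hcc
  obtain ⟨x1, hx1, h1⟩ := isCompact_Icc.exists_isMaxOn hne hcc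
  refine ⟨min (g x0) (L / 2), max (g x1) (2 * L), lt_min (hp _ hx0.1) (by positivity), lt_max_of_lt_right (by positivity), fun r hr => ?_⟩
  rcases le_total r (max a R) with h | h
  · exact ⟨(min_le_left _ _).trans (h0 ⟨hr, h⟩), (h1 ⟨hr, h⟩).trans (le_max_left _ _)⟩
  · have := hR r ((le_max_right _ _).trans h)
    exact ⟨(min_le_right _ _).trans this.1.le, this.2.le.trans (le_max_right _ _)⟩

lemma shift_lim {g : ℝ → ℝ} {q L : ℝ} (hl : Tendsto (fun r => r ^ q * g r) atTop (𝓝 L)) :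
    Tendsto (fun r => (1 + r) ^ q * g r) atTop (𝓝 L) := by
  have h1 : Tendsto (fun r : ℝ => (r⁻¹ + 1) ^ q) atTop (𝓝 1) := by
    have := (tendsto_inv_atTop_zero (𝕜 := ℝ)).add_const 1
    rw [zero_add] at this
    have := this.rpow_const (p := q) (Or.inl one_ne_zero)
    rwa [Real.one_rpow] at this
  have h2 := h1.mul hl
  rw [one_mul] at h2
  refine h2.congr' ?_
  filter_upwards [eventually_gt_atTop 0] with r hr
  rw [← mul_assoc, ← Real.mul_rpow (by positivity) hr.le]
  congr 2; field_simp

/-- radial profile with quantitative bounds -/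
structure WS (N : ℕ) (p m : ℝ) (w P : ℝ → ℝ) (c C : ℝ) : Prop extends IsW N p m w P where
  c0 : 0 < c
  C0 : 0 < C
  wlo : ∀ r ≥ 0, c * (1 + r) ^ (-m) ≤ w r
  wup : ∀ r ≥ 0, w r ≤ C * (1 + r) ^ (-m)
  zlo : ∀ r > 0, c * (r * (1 + r) ^ (-(m + 2))) ≤ P r / r ^ (N - 1)
  zup : ∀ r > 0, P r / r ^ (N - 1) ≤ C * (r * (1 + r) ^ (-(m + 2)))
  zw : ∀ r > 0, r * w r ^ p ≤ N * (P r / r ^ (N - 1))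
  zw2 : ∃ R > 0, ∀ r > R, c * (1 + r) ^ (-(m + 2)) ≤ N * (P r / r ^ (N - 1)) / r - w r ^ p
  Vl : Tendsto (fun r => r ^ 2 * (p * w r ^ (p - 1))) atTop (𝓝 (p * (m * (N - 2 - m))))

lemma rp1 {r q : ℝ} (hr : 0 < r) : r ^ (q + 1) = r ^ q * r := Real.rpow_add_one hr.ne' q

theorem exists_ws {p m : ℝ} (h : Par N p m) : ∃ w P c C, WS N p m w P c C := by
  obtain ⟨w, P, hw, c, C, R, hc, hR, hb⟩ := exists_w h
  obtain ⟨l1, l2⟩ := w_lim h hw hc hR hb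
  have hN := N4r N
  have hm := h.hm
  have hmN := h.hN
  have hmp := h.hmp
  have hp := h.hp
  have hp1 : 0 < p - 1 := by linarith
  set b := m * (N - 2 - m) with hbd
  have hb0 : 0 < b := mul_pos hm (by linarith)
  set β := b ^ (1 / (p - 1)) with hβ
  have hβ0 : 0 < β := by positivity
  have hβb : β ^ (p - 1) = b := by rw [hβ, ← Real.rpow_mul hb0.le, one_div_mul_cancel hp1.ne', Real.rpow_one]
  have eβ : β ^ p = b * β := by
    rw [← hβb, ← Real.rpow_add_one hβ0.ne']; congr 1; ring
  have wa : AntitoneOn w (Ioi 0) := antiOn hw.dw (fun r hr => by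
    have hr : 0 < r := hr
    have : 0 ≤ P r := cmp0 hw.dP (fun s hs => mul_nonneg (pow_nonneg (le_of_lt hs) _) (Real.rpow_nonneg (hw.pos s (le_of_lt hs)).le _)) hw.P0 hr
    have : 0 ≤ P r / r ^ (N - 1) := by positivity
    linarith)
  have hN1 : N - 1 + 1 = N := by have := N4 N; omega
  -- lower comparison
  have dN : ∀ r : ℝ, HasDerivAt (fun s : ℝ => s ^ N / N) (r ^ (N - 1)) r := by
    intro r
    have := (hasDerivAt_pow N r).div_const (N:ℝ)
    refine this.congr_deriv ?_
    field_simp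
  have tN : Tendsto (fun s : ℝ => s ^ N / N) (𝓝[>] 0) (𝓝 0) := by
    have : Tendsto (fun s : ℝ => s ^ N / N) (𝓝 0) (𝓝 ((0:ℝ) ^ N / N)) := Continuous.tendsto (by fun_prop) 0
    rw [zero_pow (by have := N4 N; omega), zero_div] at this
    exact this.mono_left nhdsWithin_le_nhds
  have zw : ∀ r > 0, r * w r ^ p ≤ N * (P r / r ^ (N - 1)) := by
    intro r hr
    have hr : 0 < r := hr
    have h1 : w r ^ p * (r ^ N / N) ≤ P r := by
      have hm : MonotoneOn (fun s => P s - w r ^ p * (s ^ N / N)) (Ioc 0 r) := by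
        refine monotoneOn_of_hasDerivWithinAt_nonneg (f' := fun s => s ^ (N - 1) * w s ^ p - w r ^ p * s ^ (N - 1)) (convex_Ioc 0 r)
          (fun s hs => ((hw.dP s hs.1).sub ((dN s).const_mul _)).continuousAt.continuousWithinAt) ?_ ?_
        · intro s hs
          rw [interior_Ioc] at hs ⊢
          exact ((hw.dP s hs.1).sub ((dN s).const_mul _)).hasDerivWithinAt
        · intro s hs
          rw [interior_Ioc] at hs
          have h3 : w r ^ p ≤ w s ^ p := Real.rpow_le_rpow (hw.pos r hr.le).le (wa hs.1 hr hs.2.le) (by linarith)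
          have := pow_nonneg hs.1.le (N - 1)
          nlinarith
      have ht : Tendsto (fun s => P s - w r ^ p * (s ^ N / N)) (𝓝[>] 0) (𝓝 0) := by
        have := hw.P0.sub (tN.const_mul (w r ^ p))
        simpa using this
      have : (0:ℝ) ≤ P r - w r ^ p * (r ^ N / N) := by
        refine le_of_tendsto ht ?_
        filter_upwards [Ioo_mem_nhdsGT hr] with s hs
        exact hm ⟨hs.1, hs.2.le⟩ ⟨hr, le_rfl⟩ hs.2.le
      linarith
    have e : r ^ N = r ^ (N - 1) * r := by rw [← pow_succ, hN1]
    rw [e] at h1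
    rw [← mul_div_assoc, le_div_iff₀ (by positivity)]
    have := mul_le_mul_of_nonneg_left h1 (show (0:ℝ) ≤ N by positivity)
    refine le_trans (le_of_eq ?_) this
    field_simp
  have zu : ∀ r > 0, P r / r ^ (N - 1) ≤ r := by
    intro r hr
    have hr : 0 < r := hr
    have h1 := cmp0 (fun s hs => (dN s).sub (hw.dP s hs)) (fun s hs => by
      have h3 : w s ^ p ≤ 1 := Real.rpow_le_one (hw.pos s (le_of_lt hs)).le (hw.le1 s (le_of_lt hs)) (by linarith)
      have := pow_nonneg (le_of_lt hs) (N - 1)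
      nlinarith) (by have := tN.sub hw.P0; rw [sub_zero] at this; exact this) hr
    simp only [Pi.sub_apply] at h1
    have e : r ^ N = r * r ^ (N - 1) := by rw [← pow_succ', hN1]
    have h2 : r ^ N / N ≤ r ^ N := div_le_self (by positivity) (by linarith)
    rw [div_le_iff₀ (by positivity), ← e]
    linarith
  have zc : ContinuousOn (fun r => P r / r ^ (N - 1)) (Ioi 0) := fun r hr =>
    ((x1_d (h := fun r => w r ^ p) hr (hw.dP r hr)).continuousAt).continuousWithinAt
  have zp : ∀ r > 0, 0 < P r / r ^ (N - 1) := by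
    intro r hr
    have := zw r hr
    have h1 := mul_pos hr (Real.rpow_pos_of_pos (hw.pos r (le_of_lt hr)) p)
    by_contra hn
    push Not at hn
    nlinarith
  have l3 : Tendsto (fun r => r ^ (m + 1) * (P r / r ^ (N - 1))) atTop (𝓝 (m * β)) := by
    have := (l1.const_mul m).sub l2
    rw [sub_zero] at this
    refine this.congr' ?_
    filter_upwards [eventually_gt_atTop 0] with r hr
    rw [vv, rp1 hr]; ring
  have l3' := shift_lim l3
  have l1' := shift_lim l1
  have q0 : ContinuousOn (fun r : ℝ => (1 + r) ^ m * w r) (Ici 0) := by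
    refine ContinuousOn.mul (ContinuousOn.rpow_const (by fun_prop) (fun r hr => Or.inl ?_)) hw.cont.continuousOn
    have : (0:ℝ) ≤ r := hr
    positivity
  have q00 : ∀ r ≥ 0, 0 < (1 + r) ^ m * w r := by
    intro r hr
    have h0 : (0:ℝ) < 1 + r := by linarith
    exact mul_pos (by positivity) (hw.pos r hr)
  obtain ⟨c1, C1, hc1, hC1, b1⟩ := bdd_lim (a := 0) q0 q00 hβ0 l1'
  have q1 : ContinuousOn (fun r : ℝ => (1 + r) ^ (m + 1) * (P r / r ^ (N - 1))) (Ici 1) := by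
    refine ContinuousOn.mul (ContinuousOn.rpow_const (by fun_prop) (fun r hr => Or.inl ?_)) (zc.mono ?_)
    · have : (1:ℝ) ≤ r := hr
      positivity
    · intro r hr
      have : (1:ℝ) ≤ r := hr
      exact mem_Ioi.2 (by linarith)
  have q2 : ∀ r ≥ 1, 0 < (1 + r) ^ (m + 1) * (P r / r ^ (N - 1)) := by
    intro r hr
    have h0 : (0:ℝ) < 1 + r := by linarith
    exact mul_pos (by positivity) (zp r (by linarith))
  obtain ⟨c2, C2, hc2, hC2, b2⟩ := bdd_lim (a := 1) q1 q2 (by positivity) l3'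
  -- limit of N z / r - w^p
  have l4 : Tendsto (fun r => r ^ (m + 2) * (N * (P r / r ^ (N - 1)) / r - w r ^ p)) atTop (𝓝 (β * m * (m + 2))) := by
    have h1 : Tendsto (fun r => (r ^ m * w r) ^ p) atTop (𝓝 (β ^ p)) := l1.rpow_const (Or.inr (by linarith))
    have h2 := (l3.const_mul (N:ℝ)).sub h1
    have e : (N:ℝ) * (m * β) - β ^ p = β * m * (m + 2) := by rw [eβ, hbd]; ring
    rw [e] at h2
    refine h2.congr' ?_
    filter_upwards [eventually_gt_atTop 0] with r hr
    rw [Real.mul_rpow (by positivity) (hw.pos r hr.le).le, ← Real.rpow_mul hr.le, show m * p = m + 2 by linarith,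
      show m + 2 = m + 1 + 1 by ring, rp1 (q := m + 1) hr]
    field_simp
  have l4' := shift_lim l4
  obtain ⟨R4, hR4⟩ := eventually_atTop.1 (l4'.eventually (lt_mem_nhds (half_lt_self (show 0 < β * m * (m + 2) by positivity))))
  have l5 : Tendsto (fun r => r ^ 2 * (p * w r ^ (p - 1))) atTop (𝓝 (p * b)) := by
    have h1 : Tendsto (fun r => (r ^ m * w r) ^ (p - 1)) atTop (𝓝 (β ^ (p - 1))) := l1.rpow_const (Or.inr hp1.le)
    have h2 := h1.const_mul p
    rw [hβb] at h2
    refine h2.congr' ?_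
    filter_upwards [eventually_gt_atTop 0] with r hr
    rw [Real.mul_rpow (by positivity) (hw.pos r hr.le).le, ← Real.rpow_mul hr.le, hmp]
    norm_num; ring
  set cz := min (w 1 ^ p / N) (c2 / 2)
  have hcz : 0 < cz := by
    have := hw.pos 1 zero_le_one
    have : 0 < (N:ℝ) := by linarith
    positivity
  set CC := max C1 (max (2 * C2) (2 ^ (m + 2)))
  set cc := min c1 (min cz (β * m * (m + 2) / 2))
  refine ⟨w, P, cc, CC, hw, by positivity, lt_max_of_lt_left hC1, ?_, ?_, ?_, ?_, zw, ⟨max R4 1, by positivity, ?_⟩, l5⟩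
  · intro r hr
    have hr1 : 0 < 1 + r := by linarith
    rw [Real.rpow_neg hr1.le, ← div_eq_mul_inv, div_le_iff₀ (by positivity)]
    have := (b1 r hr).1
    linarith [min_le_left c1 (min cz (β * m * (m + 2) / 2))]
  · intro r hr
    have hr1 : 0 < 1 + r := by linarith
    rw [Real.rpow_neg hr1.le, ← div_eq_mul_inv, le_div_iff₀ (by positivity)]
    have := (b1 r hr).2
    linarith [le_max_left C1 (max (2 * C2) (2 ^ (m + 2)))]
  · intro r hr
    have hr1 : 0 < 1 + r := by linarith
    have hcc : cc ≤ cz := (min_le_right _ _).trans (min_le_left _ _)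
    refine (mul_le_mul_of_nonneg_right hcc (by positivity)).trans ?_
    rcases le_total r 1 with h1 | h1
    · have h2 := zw r hr
      have h3 : w 1 ^ p ≤ w r ^ p := Real.rpow_le_rpow (hw.pos 1 zero_le_one).le (wa hr (by simp) h1) (by linarith)
      have h4 : (1 + r) ^ (-(m + 2)) ≤ 1 := Real.rpow_le_one_of_one_le_of_nonpos (by linarith) (by linarith)
      have h5 : cz ≤ w 1 ^ p / N := min_le_left _ _
      have hw1 := hw.pos 1 zero_le_one
      have h0 : 0 ≤ w 1 ^ p / N := by positivity
      calc cz * (r * (1 + r) ^ (-(m + 2))) ≤ w 1 ^ p / N * (r * 1) := by gcongr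
        _ ≤ w r ^ p / N * (r * 1) := by gcongr
        _ = (r * w r ^ p) / N := by ring
        _ ≤ _ := by rw [div_le_iff₀ (by linarith)]; linarith
    · have h2 := (b2 r h1).1
      have h5 : cz ≤ c2 / 2 := min_le_right _ _
      rw [show -(m + 2) = -(m + 1) + (-1) by ring, Real.rpow_add hr1, Real.rpow_neg hr1.le (m + 1), Real.rpow_neg_one]
      have h6 : r * ((1 + r) ^ (m + 1))⁻¹ * (1 + r)⁻¹ ≤ ((1 + r) ^ (m + 1))⁻¹ := by
        rw [mul_inv_le_iff₀ hr1]
        have : 0 < ((1 + r) ^ (m + 1))⁻¹ := by positivity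
        nlinarith
      have h7 : cz ≤ c2 := by linarith
      calc cz * (r * (((1 + r) ^ (m + 1))⁻¹ * (1 + r)⁻¹)) ≤ c2 * (((1 + r) ^ (m + 1))⁻¹) := by
            rw [← mul_assoc r]
            exact mul_le_mul h7 h6 (by positivity) hc2.le
        _ ≤ _ := by rw [← div_eq_mul_inv, div_le_iff₀ (by positivity)]; linarith
  · intro r hr
    have hr : 0 < r := hr
    have hr1 : 0 < 1 + r := by linarith
    rcases le_total r 1 with h1 | h1
    · have h2 := zu r hr
      have h3 : (1 + r) ^ (m + 2) ≤ 2 ^ (m + 2) := Real.rpow_le_rpow hr1.le (by linarith) (by linarith)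
      have h4 : 2 ^ (m + 2) ≤ CC := (le_max_right _ _).trans (le_max_right _ _)
      refine h2.trans ?_
      have h5 : 1 ≤ CC * (1 + r) ^ (-(m + 2)) := by
        rw [Real.rpow_neg hr1.le, ← div_eq_mul_inv, le_div_iff₀ (by positivity)]; linarith
      calc r = r * 1 := by ring
        _ ≤ r * (CC * (1 + r) ^ (-(m + 2))) := by gcongr
        _ = _ := by ring
    · have h2 := (b2 r h1).2
      have h4 : 2 * C2 ≤ CC := (le_max_left _ _).trans (le_max_right _ _)
      rw [show -(m + 2) = -(m + 1) + (-1) by ring, Real.rpow_add hr1, Real.rpow_neg hr1.le (m + 1), Real.rpow_neg_one]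
      have h6 : ((1 + r) ^ (m + 1))⁻¹ ≤ 2 * (r * ((1 + r) ^ (m + 1))⁻¹ * (1 + r)⁻¹) := by
        rw [mul_comm r, ← mul_assoc, ← div_eq_mul_inv (2 * _), le_div_iff₀ hr1]
        have : 0 < ((1 + r) ^ (m + 1))⁻¹ := by positivity
        nlinarith
      calc P r / r ^ (N - 1) ≤ C2 * ((1 + r) ^ (m + 1))⁻¹ := by rw [← div_eq_mul_inv, le_div_iff₀ (by positivity)]; linarith
        _ ≤ C2 * (2 * (r * ((1 + r) ^ (m + 1))⁻¹ * (1 + r)⁻¹)) := by gcongr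
        _ = (2 * C2) * (r * (((1 + r) ^ (m + 1))⁻¹ * (1 + r)⁻¹)) := by ring
        _ ≤ _ := by gcongr
  · intro r hr
    have hr0 : 0 < r := lt_of_lt_of_le one_pos ((le_max_right _ _).trans hr.le)
    have hr1 : 0 < 1 + r := by linarith
    have h1 := hR4 r ((le_max_left _ _).trans hr.le)
    have hcc : cc ≤ β * m * (m + 2) / 2 := (min_le_right _ _).trans (min_le_right _ _)
    rw [Real.rpow_neg hr1.le, ← div_eq_mul_inv, div_le_iff₀ (by positivity)]
    linarith

end PS

namespace PS

open Set Metric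

variable {N : ℕ} [hN4 : Fact (4 ≤ N)]

/-- evaluation of the radial Green operator on an ODE solution -/
lemma GG_rad {r : ℝ} (hr : 0 < r) (l : ℕ) {S P η : ℝ → ℝ}
    (i1 : IntegrableOn (fun s => s ^ (N - 1) * gk N l r s * S s) (Ioi 0))
    (hη : ∀ s > 0, HasDerivAt η (-(P s / s ^ (N - 1 + 2 * l))) s)
    (hP : ∀ s > 0, HasDerivAt P (s ^ (N - 1 + l) * S s) s)
    (hP0 : Tendsto P (𝓝[>] 0) (𝓝 0)) (h1 : Tendsto η atTop (𝓝 0))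
    (h2 : Tendsto (fun s => s * (P s / s ^ (N - 1 + 2 * l))) atTop (𝓝 0)) :
    GG N l S r = r ^ l * η r := by
  have hN := N4r N
  have hl : (0:ℝ) ≤ l := Nat.cast_nonneg l
  have ek : (((N - 1 + 2 * l : ℕ)) : ℝ) = N - 1 + 2 * l := by push_cast [cast_pred]; rfl
  have hQ : ∀ s > 0, HasDerivAt (fun s => ((N:ℝ) - 2 + 2 * l) * η s - s * (P s / s ^ (N - 1 + 2 * l))) (-(s / s ^ l * S s)) s := by
    intro s hs
    have hs : 0 < s := hs
    have hP' : HasDerivAt P (s ^ (N - 1 + 2 * l) * (fun s => S s / s ^ l) s) s := by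
      refine (hP s hs).congr_deriv ?_
      simp only
      rw [show N - 1 + 2 * l = N - 1 + l + l by ring, pow_add s (N - 1 + l) l]
      field_simp
    have h3 := x1_d (h := fun s => S s / s ^ l) hs hP'
    have h4 := ((hη s hs).const_mul ((N:ℝ) - 2 + 2 * l)).sub ((hasDerivAt_id s).mul h3)
    refine HasDerivAt.congr_deriv (f := fun s => ((N:ℝ) - 2 + 2 * l) * η s - s * (P s / s ^ (N - 1 + 2 * l))) h4 ?_
    rw [ek]
    simp only [id]
    field_simp
    ring
  rw [GG_eval hr l i1 hP hQ hP0 (by simpa using (h1.const_mul ((N:ℝ) - 2 + 2 * l)).sub h2)]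
  have e : r ^ (N - 1 + 2 * l) = r ^ (N - 2 + l) * (r * r ^ l) := by
    rw [← pow_succ', ← pow_add]; congr 1; have := N4 N; omega
  rw [e]
  have : (N:ℝ) - 2 + 2 * l ≠ 0 := by
    have : 0 < (N:ℝ) - 2 + 2 * l := by linarith
    exact this.ne'
  field_simp
  ring

def VV (p : ℝ) (w : ℝ → ℝ) (s : ℝ) : ℝ := p * w s ^ (p - 1)

def BB (N : ℕ) (P : ℝ → ℝ) (s : ℝ) : ℝ := (1 + s) * (P s / s ^ (N - 1))

lemma WS.zpos {p m c C : ℝ} {w P : ℝ → ℝ} (hw : WS N p m w P c C) {r : ℝ} (hr : 0 < r) : 0 < P r / r ^ (N - 1) := by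
  refine lt_of_lt_of_le ?_ (hw.zlo r hr)
  have := hw.c0
  positivity

lemma WS.VVpos {p m c C : ℝ} {w P : ℝ → ℝ} (h : Par N p m) (hw : WS N p m w P c C) {r : ℝ} (hr : 0 ≤ r) : 0 < VV p w r := by
  have := h.hp
  have := hw.pos r hr
  unfold VV; positivity

lemma WS.VVcont {p m c C : ℝ} {w P : ℝ → ℝ} (h : Par N p m) (hw : WS N p m w P c C) : Continuous (VV p w) := by
  have := h.hp
  unfold VV
  exact continuous_const.mul (hw.cont.rpow_const (fun x => Or.inr (by linarith)))

lemma WS.VVbd {p m c C : ℝ} {w P : ℝ → ℝ} (h : Par N p m) (hw : WS N p m w P c C) {r : ℝ} (hr : 0 ≤ r) :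
    VV p w r ≤ p * C ^ (p - 1) * (1 + r) ^ (-2 : ℝ) := by
  have hp := h.hp
  have hC := hw.C0
  have h0 := hw.pos r hr
  have h1 : (0:ℝ) < 1 + r := by linarith
  have : w r ^ (p - 1) ≤ (C * (1 + r) ^ (-m)) ^ (p - 1) := Real.rpow_le_rpow h0.le (hw.wup r hr) (by linarith)
  rw [Real.mul_rpow hC.le (by positivity), ← Real.rpow_mul h1.le, neg_mul, h.hmp] at this
  unfold VV
  rw [mul_assoc]
  gcongr

lemma WS.VVle {p m c C : ℝ} {w P : ℝ → ℝ} (h : Par N p m) (hw : WS N p m w P c C) {r : ℝ} (hr : 0 ≤ r) : VV p w r ≤ p := by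
  have hp := h.hp
  have : w r ^ (p - 1) ≤ 1 := Real.rpow_le_one (hw.pos r hr).le (hw.le1 r hr) (by linarith)
  unfold VV
  nlinarith

lemma WS.wpbd {p m c C : ℝ} {w P : ℝ → ℝ} (h : Par N p m) (hw : WS N p m w P c C) {r : ℝ} (hr : 0 ≤ r) :
    w r ^ p ≤ C ^ p * (1 + r) ^ (-(m + 2)) := by
  have hp := h.hp
  have hC := hw.C0
  have hmp := h.hmp
  have h0 := hw.pos r hr
  have h1 : (0:ℝ) < 1 + r := by linarith
  have : w r ^ p ≤ (C * (1 + r) ^ (-m)) ^ p := Real.rpow_le_rpow h0.le (hw.wup r hr) (by linarith)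
  rwa [Real.mul_rpow hC.le (by positivity), ← Real.rpow_mul h1.le, show -m * p = -(m + 2) by linarith] at this

lemma WS.wpDec {p m c C : ℝ} {w P : ℝ → ℝ} (h : Par N p m) (hw : WS N p m w P c C) :
    Dec (N := N) (m + 2) (C ^ p) (fun x => w ‖x‖ ^ p) := by
  have hp := h.hp
  refine ⟨(hw.cont.comp continuous_norm).rpow_const (fun x => Or.inr (by linarith)), fun x => ?_⟩
  rw [abs_of_nonneg (Real.rpow_nonneg (hw.pos _ (norm_nonneg _)).le _)]
  exact hw.wpbd h (norm_nonneg x)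

lemma tend_rpow {q : ℝ} (hq : 0 < q) : Tendsto (fun r : ℝ => (1 + r) ^ (-q)) atTop (𝓝 0) :=
  (tendsto_rpow_neg_atTop hq).comp (tendsto_atTop_add_const_left _ _ tendsto_id)

lemma rz_le {q r : ℝ} (hr : 0 ≤ r) : r * (1 + r) ^ (-(q + 1)) ≤ (1 + r) ^ (-q) := by
  have h1 : (0:ℝ) < 1 + r := by linarith
  rw [show -q = 1 + (-(q + 1)) by ring, Real.rpow_add h1, Real.rpow_one]
  gcongr; linarith

theorem WS.eq_NP {p m c C : ℝ} {w P : ℝ → ℝ} (h : Par N p m) (hw : WS N p m w P c C) (x : Euc N) :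
    w ‖x‖ = NP (fun x : Euc N => w ‖x‖ ^ p) x := by
  have hm := h.hm
  have hD := hw.wpDec h
  refine dense_ind (isClosed_eq (hw.cont.comp continuous_norm) (NP_cont hD (by linarith))) ?_ x
  intro x hx
  obtain ⟨ω, hω⟩ := exists_dir x hx
  have hr := norm_pos_iff.2 hx
  generalize ‖x‖ = r at hω hr
  rw [hω, NP_rad (f := fun s => w s ^ p) hD (by linarith) hr ω, Function.comp_apply, nsm hr.le]
  have i1 := GG_int (N := N) (σ := m + 2) (M := C ^ p) (by linarith) hr 0 (h := fun s => w s ^ p)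
    ((hw.cont.rpow_const (fun x => Or.inr (by linarith [h.hp]))).aestronglyMeasurable) (fun s hs => by
      have hs : 0 < s := hs
      rw [abs_of_nonneg (Real.rpow_nonneg (hw.pos _ hs.le).le _)]
      exact hw.wpbd h hs.le)
  have := GG_rad hr 0 (η := w) (P := P) i1 hw.dw hw.dP hw.P0 ?_ ?_
  · rw [this]; simp
  · have := (tend_rpow hm).const_mul C
    rw [mul_zero] at this
    refine squeeze_zero' ?_ ?_ this
    · filter_upwards [eventually_ge_atTop 0] with r hr using (hw.pos r hr).le
    · filter_upwards [eventually_ge_atTop 0] with r hr using hw.wup r hr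
  · have := (tend_rpow hm).const_mul C
    rw [mul_zero] at this
    refine squeeze_zero' ?_ ?_ this
    · filter_upwards [eventually_gt_atTop 0] with r hr using mul_nonneg hr.le (hw.zpos hr).le
    · filter_upwards [eventually_gt_atTop 0] with r hr
      have h1 := hw.zup r hr
      have h2 := rz_le (q := m + 1) hr.le
      have h3 := rz_le (q := m) hr.le
      rw [show m + 1 + 1 = m + 2 by ring] at h2
      have hC := hw.C0
      calc _ ≤ r * (C * (r * (1 + r) ^ (-(m + 2)))) := by
            have := mul_le_mul_of_nonneg_left h1 hr.le
            simpa using this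
        _ ≤ r * (C * (1 + r) ^ (-(m + 1))) := by gcongr
        _ = C * (r * (1 + r) ^ (-(m + 1))) := by ring
        _ ≤ _ := by gcongr

end PS

namespace PS

open Set Metric

variable {N : ℕ} [hN4 : Fact (4 ≤ N)]

lemma WS.BBpos {p m c C : ℝ} {w P : ℝ → ℝ} (hw : WS N p m w P c C) {r : ℝ} (hr : 0 < r) : 0 < BB N P r :=
  mul_pos (by linarith) (hw.zpos hr)

lemma WS.BBle {p m c C : ℝ} {w P : ℝ → ℝ} (hw : WS N p m w P c C) {r : ℝ} (hr : 0 < r) :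
    BB N P r ≤ C * (r * (1 + r) ^ (-(m + 1))) := by
  have h1 : (0:ℝ) < 1 + r := by linarith
  have := mul_le_mul_of_nonneg_left (hw.zup r hr) h1.le
  refine this.trans (le_of_eq ?_)
  rw [show -(m + 1) = 1 + (-(m + 2)) by ring, Real.rpow_add h1, Real.rpow_one]; ring

lemma WS.BBge {p m c C : ℝ} {w P : ℝ → ℝ} (hw : WS N p m w P c C) {r : ℝ} (hr : 0 < r) :
    c * (r * (1 + r) ^ (-(m + 1))) ≤ BB N P r := by
  have h1 : (0:ℝ) < 1 + r := by linarith
  have := mul_le_mul_of_nonneg_left (hw.zlo r hr) h1.le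
  refine le_trans (le_of_eq ?_) this
  rw [show -(m + 1) = 1 + (-(m + 2)) by ring, Real.rpow_add h1, Real.rpow_one]; ring

/-- the source of the barrier -/
def SB (N : ℕ) (p : ℝ) (w P : ℝ → ℝ) (s : ℝ) : ℝ :=
  VV p w s * BB N P s + 2 * (N * (P s / s ^ (N - 1)) / s - w s ^ p) + (N + 1) * (P s / s ^ (N - 1)) / s ^ 2

def TB (N : ℕ) (p : ℝ) (w P : ℝ → ℝ) (s : ℝ) : ℝ :=
  (N + 1) * (P s / s ^ (N - 1)) + N * (s * (P s / s ^ (N - 1))) - (s * (1 + s)) * w s ^ p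

lemma WS.VB_bd {p m c C : ℝ} {w P : ℝ → ℝ} (h : Par N p m) (hw : WS N p m w P c C) {r : ℝ} (hr : 0 < r) :
    VV p w r * BB N P r ≤ p * C ^ (p - 1) * C * (1 + r) ^ (-(m + 2)) := by
  have hC := hw.C0
  have hp := h.hp
  have h1 : (0:ℝ) < 1 + r := by linarith
  have h2 := hw.VVbd h hr.le
  have h3 := hw.BBle hr
  have h4 := rz_le (q := m) hr.le
  have h5 : 0 < VV p w r := hw.VVpos h hr.le
  calc _ ≤ p * C ^ (p - 1) * (1 + r) ^ (-2 : ℝ) * (C * (1 + r) ^ (-m)) := by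
        refine mul_le_mul h2 (h3.trans ?_) (hw.BBpos hr).le (by positivity)
        gcongr
    _ = p * C ^ (p - 1) * C * ((1 + r) ^ (-2 : ℝ) * (1 + r) ^ (-m)) := by ring
    _ = _ := by rw [← Real.rpow_add h1]; congr 2; ring

lemma WS.zc {p m c C : ℝ} {w P : ℝ → ℝ} (hw : WS N p m w P c C) : ContinuousOn (fun r => P r / r ^ (N - 1)) (Ioi 0) := by
  refine ContinuousOn.div (fun r hr => (hw.dP r hr).continuousAt.continuousWithinAt) (by fun_prop) (fun r hr => ?_)
  have : (0:ℝ) < r := hr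
  positivity

lemma WS.BBc {p m c C : ℝ} {w P : ℝ → ℝ} (hw : WS N p m w P c C) : ContinuousOn (BB N P) (Ioi 0) := by
  have := hw.zc
  unfold BB
  exact ContinuousOn.mul (by fun_prop) this

lemma WS.zr_bd {p m c C : ℝ} {w P : ℝ → ℝ} (hw : WS N p m w P c C) {r : ℝ} (hr : 0 < r) :
    P r / r ^ (N - 1) / r ≤ C * (1 + r) ^ (-(m + 2)) := by
  rw [div_le_iff₀ hr]
  refine (hw.zup r hr).trans (le_of_eq (by ring))

lemma WS.SBint {p m c C : ℝ} {w P : ℝ → ℝ} (h : Par N p m) (hw : WS N p m w P c C) {r : ℝ} (hr : 0 < r) :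
    IntegrableOn (fun s => s ^ (N - 1) * gk N 2 r s * SB N p w P s) (Ioi 0) := by
  have hC := hw.C0
  have hp := h.hp
  have hm := h.hm
  have hN := N4r N
  have hzc := hw.zc
  have wpc : Continuous (fun s => w s ^ p) := hw.cont.rpow_const (fun x => Or.inr (by linarith [h.hp]))
  have c1 : ContinuousOn (fun s => VV p w s * BB N P s + 2 * (N * (P s / s ^ (N - 1)) / s - w s ^ p)) (Ioi 0) := by
    refine ((hw.VVcont h).continuousOn.mul hw.BBc).add (ContinuousOn.mul (by fun_prop) (ContinuousOn.sub (ContinuousOn.div (continuousOn_const.mul hzc) (by fun_prop) ?_) wpc.continuousOn))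
    intro s hs; exact ne_of_gt hs
  have c2 : ContinuousOn (fun s => ((N:ℝ) + 1) * (P s / s ^ (N - 1)) / s ^ 2) (Ioi 0) := by
    refine ContinuousOn.div (continuousOn_const.mul hzc) (by fun_prop) ?_
    intro s hs
    have : (0:ℝ) < s := hs
    positivity
  have i1 := GG_int (N := N) (σ := m + 2) (M := p * C ^ (p - 1) * C + 2 * (N * C)) (by linarith) hr 2
    (h := fun s => VV p w s * BB N P s + 2 * (N * (P s / s ^ (N - 1)) / s - w s ^ p))
    (c1.aestronglyMeasurable measurableSet_Ioi) (fun s hs => by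
      have hs : 0 < s := hs
      have a1 := hw.VB_bd h hs
      have a2 := hw.zw s hs
      have a3 := hw.zr_bd hs
      have a4 : w s ^ p ≤ N * (P s / s ^ (N - 1)) / s := by rw [le_div_iff₀ hs]; linarith
      have a5 := mul_pos (hw.VVpos h hs.le) (hw.BBpos hs)
      have a6 : 0 < w s ^ p := Real.rpow_pos_of_pos (hw.pos s hs.le) _
      have a7 := mul_le_mul_of_nonneg_left a3 (show (0:ℝ) ≤ N by linarith)
      have a8 : N * (P s / s ^ (N - 1)) / s = N * (P s / s ^ (N - 1) / s) := by ring
      rw [abs_of_nonneg (by linarith)]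
      linarith)
  have i2 : IntegrableOn (fun s => s ^ (N - 1) * gk N 2 r s * (((N:ℝ) + 1) * (P s / s ^ (N - 1)) / s ^ 2)) (Ioi 0) := by
    refine Integrable.mono' (((int_tail (τ := m + 2) (by linarith) le_rfl).1).const_mul (((N:ℝ) + 1) * C)) ((gk_meas 2 r).aestronglyMeasurable.mul (c2.aestronglyMeasurable measurableSet_Ioi)) ?_
    rw [ae_restrict_iff' measurableSet_Ioi]
    refine Eventually.of_forall fun s hs => ?_
    have hs : (0:ℝ) < s := hs
    have hz := hw.zpos hs
    have g0 : 0 ≤ s ^ (N - 1) * gk N 2 r s := mul_nonneg (by positivity) (gk_nonneg hr hs 2)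
    rw [Real.norm_of_nonneg (mul_nonneg g0 (by positivity))]
    calc _ ≤ s * (((N:ℝ) + 1) * (P s / s ^ (N - 1)) / s ^ 2) := mul_le_mul_of_nonneg_right (gk_le' hr hs 2) (by positivity)
      _ = (N + 1) * (P s / s ^ (N - 1) / s) := by field_simp
      _ ≤ (N + 1) * (C * (1 + s) ^ (-(m + 2))) := mul_le_mul_of_nonneg_left (hw.zr_bd hs) (by linarith)
      _ = _ := by ring
  refine (i1.fun_add i2).congr ?_
  refine Eventually.of_forall fun s => ?_
  simp only [SB]; ring

lemma WS.TB_bd {p m c C : ℝ} {w P : ℝ → ℝ} (h : Par N p m) (hw : WS N p m w P c C) :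
    ∃ M, ∀ r > 0, |TB N p w P r| ≤ M := by
  have hC := hw.C0
  have hp := h.hp
  have hm := h.hm
  have hN := N4r N
  refine ⟨(N + 1) * C + N * C + C ^ p, fun r hr => ?_⟩
  have hr : 0 < r := hr
  have h1 : (0:ℝ) < 1 + r := by linarith
  have hz := hw.zpos hr
  have e0 : ∀ q : ℝ, 0 ≤ q → (1 + r) ^ (-q) ≤ 1 := fun q hq => Real.rpow_le_one_of_one_le_of_nonpos (by linarith) (by linarith)
  have h2 := rz_le (q := m + 1) hr.le
  rw [show m + 1 + 1 = m + 2 by ring] at h2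
  have h3 := rz_le (q := m) hr.le
  have a1 : P r / r ^ (N - 1) ≤ C * (1 + r) ^ (-(m + 1)) := (hw.zup r hr).trans (by gcongr)
  have a2 : P r / r ^ (N - 1) ≤ C := a1.trans (by nlinarith [e0 (m + 1) (by linarith)])
  have a3 : r * (P r / r ^ (N - 1)) ≤ C := by
    calc _ ≤ r * (C * (1 + r) ^ (-(m + 1))) := by gcongr
      _ = C * (r * (1 + r) ^ (-(m + 1))) := by ring
      _ ≤ C * 1 := mul_le_mul_of_nonneg_left (h3.trans (e0 m hm.le)) hC.le
      _ = C := mul_one C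
  have a4 : r * (1 + r) * w r ^ p ≤ C ^ p := by
    calc _ ≤ r * (1 + r) * (C ^ p * (1 + r) ^ (-(m + 2))) := by
          have := hw.wpbd h hr.le
          gcongr
      _ = C ^ p * ((1 + r) * (r * (1 + r) ^ (-(m + 2)))) := by ring
      _ ≤ C ^ p * ((1 + r) * (1 + r) ^ (-(m + 1))) := by gcongr
      _ = C ^ p * (1 + r) ^ (-m) := by
          congr 1
          rw [show -m = 1 + -(m + 1) by ring, Real.rpow_add h1, Real.rpow_one]
      _ ≤ C ^ p * 1 := by gcongr; exact e0 m hm.le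
      _ = _ := mul_one _
  have a5 : 0 ≤ r * (1 + r) * w r ^ p := mul_nonneg (by positivity) (Real.rpow_nonneg (hw.pos r hr.le).le _)
  have a6 := mul_pos hr hz
  have a7 : 0 < C ^ p := by positivity
  unfold TB
  rw [abs_le]
  constructor <;> nlinarith

theorem WS.B_eq {p m c C : ℝ} {w P : ℝ → ℝ} (h : Par N p m) (hw : WS N p m w P c C) {r : ℝ} (hr : 0 < r) :
    GG N 2 (SB N p w P) r = BB N P r := by
  have hp := h.hp
  have hm := h.hm
  have hN := N4r N
  have hN' := N4 N
  obtain ⟨M, hM⟩ := hw.TB_bd h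
  have hpr := cast_pred (N := N)
  have dz : ∀ s > 0, HasDerivAt (fun r => P r / r ^ (N - 1)) (w s ^ p - (N - 1) / s * (P s / s ^ (N - 1))) s := by
    intro s hs
    have := x1_d (h := fun s => w s ^ p) hs (hw.dP s hs)
    rwa [hpr] at this
  have e2 : ∀ s : ℝ, s ^ (N - 1 + 2 * 2) = s ^ N * s ^ 3 := fun s => by rw [← pow_add]; congr 1; omega
  have := GG_rad hr 2 (S := SB N p w P) (P := fun s => s ^ N * TB N p w P s) (η := fun s => BB N P s / s ^ 2) (hw.SBint h hr) ?_ ?_ ?_ ?_ ?_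
  · rw [this]; field_simp
  · intro s hs
    have hs : 0 < s := hs
    have h1 := (((hasDerivAt_id s).const_add 1).mul (dz s hs)).div (hasDerivAt_pow 2 s) (by positivity)
    refine HasDerivAt.congr_deriv (f := fun s => BB N P s / s ^ 2) h1 ?_
    rw [e2]
    simp only [TB, id, Pi.mul_apply]
    generalize P s / s ^ (N - 1) = z
    push_cast
    field_simp
    ring
  · intro s hs
    have hs : 0 < s := hs
    have hw0 := hw.pos s hs.le
    have dwp : HasDerivAt (fun s => w s ^ p) (-(VV p w s * (P s / s ^ (N - 1)))) s := by
      have := (hw.dw s hs).rpow_const (p := p) (Or.inl hw0.ne')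
      refine this.congr_deriv ?_
      unfold VV; ring
    have dT := (((dz s hs).const_mul ((N:ℝ) + 1)).add (((hasDerivAt_id s).mul (dz s hs)).const_mul (N:ℝ))).sub
      (((hasDerivAt_id s).mul ((hasDerivAt_id s).const_add 1)).mul dwp)
    have h1 := (hasDerivAt_pow N s).mul dT
    refine HasDerivAt.congr_deriv (f := fun s => s ^ N * TB N p w P s) h1 ?_
    have e3 : s ^ N = s ^ (N - 1) * s := by rw [← pow_succ]; congr 1; omega
    have e4 : s ^ (N - 1 + 2) = s ^ (N - 1) * s ^ 2 := by rw [← pow_add]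
    rw [e3, e4]
    simp only [SB, BB, id, Pi.add_apply, Pi.mul_apply, Pi.sub_apply]
    generalize hz : P s / s ^ (N - 1) = z
    field_simp
    ring
  · have : Tendsto (fun s : ℝ => s ^ N * M) (𝓝[>] 0) (𝓝 0) := by
      have : Tendsto (fun s : ℝ => s ^ N * M) (𝓝 0) (𝓝 ((0:ℝ) ^ N * M)) := Continuous.tendsto (by fun_prop) 0
      rw [zero_pow (by omega), zero_mul] at this
      exact this.mono_left nhdsWithin_le_nhds
    refine squeeze_zero_norm' ?_ this
    filter_upwards [self_mem_nhdsWithin] with s hs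
    have hs : 0 < s := hs
    rw [Real.norm_eq_abs, abs_mul, abs_of_nonneg (by positivity)]
    have := hM s hs
    gcongr
  · have : Tendsto (fun s : ℝ => C * s ^ (-1 : ℝ)) atTop (𝓝 0) := by
      simpa using (tendsto_rpow_neg_atTop (y := 1) one_pos).const_mul C
    refine squeeze_zero' ?_ ?_ this
    · filter_upwards [eventually_gt_atTop 0] with s hs
      have := hw.BBpos hs
      positivity
    · filter_upwards [eventually_gt_atTop 0] with s hs
      have h1 : (0:ℝ) < 1 + s := by linarith
      rw [div_le_iff₀ (by positivity), Real.rpow_neg_one]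
      have hC := hw.C0
      refine (hw.BBle hs).trans ?_
      have : (1 + s) ^ (-(m + 1)) ≤ 1 := Real.rpow_le_one_of_one_le_of_nonpos (by linarith) (by linarith)
      rw [show C * s⁻¹ * s ^ 2 = C * (s * 1) by field_simp]
      gcongr
  · have : Tendsto (fun s : ℝ => M * s ^ (-2 : ℝ)) atTop (𝓝 0) := by
      simpa using (tendsto_rpow_neg_atTop (y := 2) two_pos).const_mul M
    refine squeeze_zero_norm' ?_ this
    filter_upwards [eventually_gt_atTop 0] with s hs
    have e : s * (s ^ N * TB N p w P s / s ^ (N - 1 + 2 * 2)) = TB N p w P s * s ^ (-2:ℝ) := by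
      rw [e2, Real.rpow_neg hs.le, Real.rpow_two]
      field_simp
    have hq : 0 ≤ s ^ (-2:ℝ) := by positivity
    rw [e, Real.norm_eq_abs, abs_mul, abs_of_nonneg hq]
    exact mul_le_mul_of_nonneg_right (hM s hs) hq

theorem WS.barrier {p m c C : ℝ} {w P : ℝ → ℝ} (h : Par N p m) (hw : WS N p m w P c C) :
    ∃ θ : ℝ, 0 < θ ∧ θ < 1 ∧ ∀ r > 0, GG N 2 (fun s => VV p w s * BB N P s) r ≤ θ * BB N P r := by
  have hp := h.hp
  have hm := h.hm
  have hC := hw.C0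
  have hc := hw.c0
  have hN := N4r N
  obtain ⟨R, hR, hRz⟩ := hw.zw2
  set A := p * C ^ (p - 1) * C
  have hA : 0 < A := by positivity
  set D := p * (1 + R) * R ^ 2
  have hD : 0 < D := by positivity
  set c0 := min (2 * c / A) ((N + 1) / D)
  have hc0 : 0 < c0 := by positivity
  have key : ∀ s > 0, (1 + c0) * (VV p w s * BB N P s) ≤ SB N p w P s := by
    intro s hs
    have hs : 0 < s := hs
    have hz := hw.zpos hs
    have hV := hw.VVpos h hs.le
    have a2 := hw.zw s hs
    have a4 : w s ^ p ≤ N * (P s / s ^ (N - 1)) / s := by rw [le_div_iff₀ hs]; linarith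
    have a5 : 0 ≤ (N + 1) * (P s / s ^ (N - 1)) / s ^ 2 := by positivity
    have hB := hw.BBpos hs
    rcases le_or_gt s R with hle | hgt
    · have h1 : c0 * (VV p w s * BB N P s) ≤ (N + 1) * (P s / s ^ (N - 1)) / s ^ 2 := by
        rw [le_div_iff₀ (by positivity)]
        have b1 : VV p w s * (1 + s) * s ^ 2 ≤ D := by
          have := hw.VVle h hs.le
          change _ ≤ p * (1 + R) * R ^ 2
          gcongr
        have b2 : c0 * D ≤ N + 1 := by
          calc _ ≤ (N + 1) / D * D := by gcongr; exact min_le_right _ _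
            _ = _ := by field_simp
        calc c0 * (VV p w s * BB N P s) * s ^ 2 = c0 * (VV p w s * (1 + s) * s ^ 2) * (P s / s ^ (N - 1)) := by unfold BB; ring
          _ ≤ c0 * D * (P s / s ^ (N - 1)) := mul_le_mul_of_nonneg_right (mul_le_mul_of_nonneg_left b1 hc0.le) hz.le
          _ ≤ _ := mul_le_mul_of_nonneg_right b2 hz.le
      unfold SB; linarith
    · have h1 : c0 * (VV p w s * BB N P s) ≤ 2 * (c * (1 + s) ^ (-(m + 2))) := by
        have h1 : (0:ℝ) < 1 + s := by linarith
        calc _ ≤ 2 * c / A * (A * (1 + s) ^ (-(m + 2))) := by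
              refine mul_le_mul (min_le_left _ _) (hw.VB_bd h hs) (by positivity) (by positivity)
          _ = _ := by field_simp
      have := hRz s hgt
      unfold SB; linarith
  refine ⟨(1 + c0)⁻¹, by positivity, inv_lt_one_of_one_lt₀ (by linarith), fun r hr => ?_⟩
  have i1 := GG_int (N := N) (σ := m + 2) (M := A) (by linarith) hr 2
    (h := fun s => VV p w s * BB N P s)
    (((hw.VVcont h).continuousOn.mul hw.BBc).aestronglyMeasurable measurableSet_Ioi) (fun s hs => by
      have hs : 0 < s := hs
      rw [abs_of_nonneg (mul_pos (hw.VVpos h hs.le) (hw.BBpos hs)).le]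
      exact hw.VB_bd h hs)
  have i2 : IntegrableOn (fun s => s ^ (N - 1) * gk N 2 r s * ((1 + c0) * (VV p w s * BB N P s))) (Ioi 0) := by
    refine (i1.const_mul (1 + c0)).congr (Eventually.of_forall fun s => ?_)
    simp only; ring
  have h1 := GG_mono hr 2 i2 (hw.SBint h hr) key
  rw [hw.B_eq h hr] at h1
  have h2 : GG N 2 (fun s => (1 + c0) * (VV p w s * BB N P s)) r = (1 + c0) * GG N 2 (fun s => VV p w s * BB N P s) r := by
    unfold GG
    rw [mul_left_comm, ← integral_const_mul (1 + c0)]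
    congr 1
    refine integral_congr_ae (Eventually.of_forall fun s => ?_)
    simp only; ring
  rw [h2] at h1
  rw [inv_mul_eq_div, le_div_iff₀ (by positivity)]
  linarith

end PS

namespace PS

open Set Metric

variable {N : ℕ} [hN4 : Fact (4 ≤ N)]

lemma hn_GG0 {σ M D r : ℝ} {F : Euc N → ℝ} (hF : Dec σ M F) (hs : 2 < σ) (hsN : σ < N) (hr : 0 < r)
    (hD : ∀ s : ℝ, 0 < s → hn F s ≤ D * (1 + s) ^ (-σ)) :
    Integrable (fun y : Euc N => |F y| * (max r ‖y‖ ^ (N - 2))⁻¹) ∧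
    ∫ y : Euc N, |F y| * (max r ‖y‖ ^ (N - 2))⁻¹ ≤ (cN N)⁻¹ * (D * CNP N σ * (1 + r) ^ (-(σ - 2))) := by
  have hN := N4r N
  have hN' := N4 N
  have hM := hF.nonneg
  have hF' : Continuous (fun y => |F y|) := hF.1.abs
  have i : Integrable (fun y : Euc N => |F y| * (max r ‖y‖ ^ (N - 2))⁻¹) := by
    refine Integrable.mono' ((ker_int (N := N) (a := (N:ℝ) - 2) (σ := σ) (by linarith) (by linarith) (by linarith)).const_mul M) ?_ ?_
    · refine Continuous.aestronglyMeasurable (hF'.mul (Continuous.inv₀ (by fun_prop) (fun y => ?_)))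
      have : 0 < max r ‖y‖ := lt_max_of_lt_left hr
      positivity
    · filter_upwards [ae_ne (N := N)] with y hy
      have hy := norm_pos_iff.2 hy
      have h0 : 0 < max r ‖y‖ := lt_max_of_lt_left hr
      rw [Real.norm_of_nonneg (by positivity)]
      have h1 : (max r ‖y‖ ^ (N - 2))⁻¹ ≤ ‖y‖ ^ (-((N:ℝ) - 2)) := by
        rw [Real.rpow_neg hy.le, show (N:ℝ) - 2 = ((N - 2 : ℕ) : ℝ) by rw [Nat.cast_sub (by omega)]; norm_num, Real.rpow_natCast]
        gcongr
        exact le_max_right _ _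
      calc _ ≤ M * wt σ y * ‖y‖ ^ (-((N:ℝ) - 2)) := mul_le_mul (hF.2 y) h1 (by positivity) (mul_nonneg hM (wt_pos _ _).le)
        _ = _ := by ring
  refine ⟨i, ?_⟩
  obtain ⟨p1, p2⟩ := polar i
  have D0 : ∀ s : ℝ, 0 < s → |hn F s| ≤ M * (1 + s) ^ (-σ) := fun s hs => by
    rw [abs_of_nonneg (hn_nonneg _ _)]; exact hn_bd hF hs.le
  have j1 := GG_int (N := N) hs hr 0 (hn_cont hF.1).aestronglyMeasurable D0
  have hcc : ContinuousOn (fun s : ℝ => (1 + s) ^ (-σ)) (Ioi 0) := by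
    refine ContinuousOn.rpow_const (by fun_prop) (fun s hs => Or.inl ?_)
    have : (0:ℝ) < s := hs
    positivity
  have j2 := GG_int (N := N) (M := D) (h := fun s => D * (1 + s) ^ (-σ)) hs hr 0 ((hcc.const_smul D).aestronglyMeasurable measurableSet_Ioi) (fun s hs => by
    rw [abs_of_nonneg]
    exact (hn_nonneg F s).trans (hD s hs))
  have g1 := GG_mono hr 0 j1 j2 hD
  have hD0 : 0 ≤ D := by
    have := (hn_nonneg F 1).trans (hD 1 one_pos)
    have h2 : (0:ℝ) < (1 + 1) ^ (-σ) := by positivity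
    exact nonneg_of_mul_nonneg_left this h2
  have g2 : GG N 0 (fun s => D * (1 + s) ^ (-σ)) r = D * GG N 0 (fun s => (1 + s) ^ (-σ)) r := by
    unfold GG
    rw [mul_left_comm, ← integral_const_mul D]
    congr 1
    refine integral_congr_ae (Eventually.of_forall fun s => ?_)
    simp only; ring
  have g3 := mul_le_mul_of_nonneg_left (GG0_bd (N := N) hs hsN hr) hD0
  have g4 : GG N 0 (hn F) r ≤ D * CNP N σ * (1 + r) ^ (-(σ - 2)) := by
    rw [g2] at g1
    refine g1.trans (g3.trans (le_of_eq ?_))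
    unfold CNP; ring
  refine le_trans ?_ (mul_le_mul_of_nonneg_left g4 (inv_pos.2 (cN_pos (N := N))).le)
  rw [p2]
  have ha := area_pos (N := N)
  have g5 : ∫ s in Ioi (0:ℝ), s ^ (N - 1) * ∫ ω : Sph N, |F (s • (ω : Euc N))| * (max r ‖s • (ω : Euc N)‖ ^ (N - 2))⁻¹ ∂(mu N) ≤
      ∫ s in Ioi (0:ℝ), s ^ (N - 1) * gk N 0 r s * hn F s := by
    refine setIntegral_mono_on p1 j1 measurableSet_Ioi (fun s hs => ?_)
    have hs : (0:ℝ) < s := hs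
    have e : ∀ ω : Sph N, |F (s • (ω : Euc N))| * (max r ‖s • (ω : Euc N)‖ ^ (N - 2))⁻¹ = |F (s • (ω : Euc N))| * (max r s ^ (N - 2))⁻¹ := fun ω => by
      rw [nsm hs.le]
    simp only [e]
    rw [integral_mul_const]
    have h1 : ∫ ω : Sph N, |F (s • (ω : Euc N))| ∂(mu N) ≤ hn F s :=
      L1_le (ψ := fun ω : Sph N => F (s • (ω : Euc N))) (hF.1.comp (by fun_prop))
    have h0 : 0 < max r s := lt_max_of_lt_left hr
    simp only [gk, pow_zero, one_mul, add_zero]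
    rw [mul_assoc, mul_comm (_⁻¹)]
    gcongr
  calc _ ≤ area N * ∫ s in Ioi (0:ℝ), s ^ (N - 1) * gk N 0 r s * hn F s := by gcongr
    _ = _ := by
      unfold GG cN
      simp only [Nat.cast_zero, mul_zero, add_zero]
      have : (N:ℝ) - 2 ≠ 0 := by linarith
      field_simp

lemma near_ker {ρ : ℝ} (hρ : 0 < ρ) : Integrable (fun z : Euc N => if ‖z‖ < ρ then Gam 0 z else 0) ∧
    ∫ z : Euc N, (if ‖z‖ < ρ then Gam 0 z else 0) ≤ area N * ρ ^ 2 := by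
  obtain ⟨i, e⟩ := ball_ker (N := N) hρ
  have pw : ∀ z : Euc N, z ≠ 0 → 0 ≤ (if ‖z‖ < ρ then Gam 0 z else 0) ∧ (if ‖z‖ < ρ then Gam 0 z else 0) ≤ ρ * (if ‖z‖ < ρ then ‖z‖ ^ (-((N:ℝ) - 1)) else 0) := by
    intro z hz
    have hz := norm_pos_iff.2 hz
    by_cases h : ‖z‖ < ρ
    · rw [if_pos h, if_pos h, Gam0_eq]
      refine ⟨by positivity, ?_⟩
      rw [show -((N:ℝ) - 2) = 1 + (-((N:ℝ) - 1)) by ring, Real.rpow_add hz, Real.rpow_one]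
      gcongr
    · rw [if_neg h, if_neg h]; simp
  have i2 : Integrable (fun z : Euc N => if ‖z‖ < ρ then Gam 0 z else 0) := by
    refine Integrable.mono' (i.const_mul ρ) ?_ ?_
    · refine Measurable.aestronglyMeasurable (Measurable.ite (measurableSet_lt measurable_norm measurable_const) ?_ measurable_const)
      have : (Gam 0 : Euc N → ℝ) = fun z => ‖z‖ ^ (-((N:ℝ) - 2)) := funext fun z => Gam0_eq
      rw [this]
      fun_prop
    · filter_upwards [ae_ne (N := N)] with z hz
      rw [Real.norm_of_nonneg (pw z hz).1]
      exact (pw z hz).2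
  refine ⟨i2, ?_⟩
  calc _ ≤ ∫ z : Euc N, ρ * (if ‖z‖ < ρ then ‖z‖ ^ (-((N:ℝ) - 1)) else 0) := by
        refine integral_mono_ae i2 (i.const_mul ρ) ?_
        filter_upwards [ae_ne (N := N)] with z hz using (pw z hz).2
    _ = _ := by rw [integral_const_mul, e]; ring

/-- near/far decomposition of the Newtonian potential -/
theorem near_far {σ ε : ℝ} (hs : 2 < σ) (hsN : σ < N) (hε : 0 < ε) : ∃ A : ℝ, 0 < A ∧ ∀ (F : Euc N → ℝ) (M D : ℝ), Dec σ M F →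
    (∀ s : ℝ, 0 < s → hn F s ≤ D * (1 + s) ^ (-σ)) → Dec (σ - 2) (ε * M + A * D) (NP F) := by
  have hN := N4r N
  have hN' := N4 N
  have hc := cN_pos (N := N)
  have ha := area_pos (N := N)
  have hCNP := CNP_pos hs hsN
  set δ := min (1 / 2) (ε / (cN N * area N * 2 ^ σ))
  have hδ : 0 < δ := by positivity
  have hδ1 : δ ≤ 1 / 2 := min_le_left _ _
  have hδ2 : cN N * area N * 2 ^ σ * δ ≤ ε := by
    have : δ ≤ ε / (cN N * area N * 2 ^ σ) := min_le_right _ _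
    rw [le_div_iff₀ (by positivity)] at this
    linarith
  refine ⟨(1 + 1 / δ) ^ (N - 2) * CNP N σ, by positivity, fun F M D hF hD => ⟨NP_cont hF hs, ?_⟩⟩
  have hM := hF.nonneg
  refine dense_ind (isClosed_le (NP_cont hF hs).abs (continuous_const.mul (wt_cont _))) ?_
  intro x hx
  have hr := norm_pos_iff.2 hx
  obtain ⟨i1, e1⟩ := hn_GG0 hF hs hsN hr hD
  have hA : 0 < 1 + ‖x‖ := by positivity
  set ρ := δ * (1 + ‖x‖)
  have hρ : 0 < ρ := by positivity
  obtain ⟨i2, e2⟩ := near_ker (N := N) hρ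
  have i2' : Integrable (fun y : Euc N => if ‖x - y‖ < ρ then Gam 0 (x - y) else 0) := i2.comp_sub_left x
  have e2' : ∫ y : Euc N, (if ‖x - y‖ < ρ then Gam 0 (x - y) else 0) ≤ area N * ρ ^ 2 := by
    rw [integral_sub_left_eq_self (fun z : Euc N => if ‖z‖ < ρ then Gam 0 z else 0) volume x]; exact e2
  have i3 := (NP_int hF hs x).abs
  have pw : ∀ y : Euc N, y ≠ x → |F y * Gam 0 (x - y)| ≤ (M * (2 ^ σ * wt σ x)) * (if ‖x - y‖ < ρ then Gam 0 (x - y) else 0) +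
      (1 + 1 / δ) ^ (N - 2) * (|F y| * (max ‖x‖ ‖y‖ ^ (N - 2))⁻¹) := by
    intro y hy
    have hz : 0 < ‖x - y‖ := norm_pos_iff.2 (sub_ne_zero.2 (Ne.symm hy))
    have hg : 0 ≤ Gam 0 (x - y) := by rw [Gam0_eq]; positivity
    rw [abs_mul, abs_of_nonneg hg]
    have hm : 0 < max ‖x‖ ‖y‖ := lt_max_of_lt_left hr
    by_cases h : ‖x - y‖ < ρ
    · rw [if_pos h]
      have h1 : wt σ y ≤ 2 ^ σ * wt σ x := by
        have h2 : (1 + ‖x‖) / 2 ≤ 1 + ‖y‖ := by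
          have := norm_sub_norm_le x y
          have : ρ ≤ 1 / 2 * (1 + ‖x‖) := mul_le_mul_of_nonneg_right hδ1 hA.le
          linarith
        have : (1 + ‖y‖) ^ (-σ) ≤ ((1 + ‖x‖) / 2) ^ (-σ) := Real.rpow_le_rpow_of_nonpos (by positivity) h2 (by linarith)
        refine this.trans (le_of_eq ?_)
        rw [Real.div_rpow hA.le zero_le_two, Real.rpow_neg zero_le_two, div_inv_eq_mul, wt, mul_comm]
      have h2 : |F y| ≤ M * (2 ^ σ * wt σ x) := (hF.2 y).trans (mul_le_mul_of_nonneg_left h1 hM)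
      have h3 : 0 ≤ (1 + 1 / δ) ^ (N - 2) * (|F y| * (max ‖x‖ ‖y‖ ^ (N - 2))⁻¹) := by positivity
      have h4 := mul_le_mul_of_nonneg_right h2 hg
      linarith
    · rw [if_neg h, mul_zero, zero_add]
      push Not at h
      have h1 : 1 + ‖x‖ ≤ ‖x - y‖ / δ := by rw [le_div_iff₀ hδ]; linarith
      have h2 : max ‖x‖ ‖y‖ ≤ (1 + 1 / δ) * ‖x - y‖ := by
        have h3 : ‖y‖ ≤ ‖x‖ + ‖x - y‖ := by
          have := norm_sub_le x (x - y); simpa using this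
        have h4 : (1 + 1 / δ) * ‖x - y‖ = ‖x - y‖ + ‖x - y‖ / δ := by ring
        rw [h4]
        exact max_le (by linarith) (by linarith)
      have h3 : Gam 0 (x - y) ≤ (1 + 1 / δ) ^ (N - 2) * (max ‖x‖ ‖y‖ ^ (N - 2))⁻¹ := by
        rw [Gam0_eq, Real.rpow_neg hz.le, show (N:ℝ) - 2 = ((N - 2 : ℕ) : ℝ) by rw [Nat.cast_sub (by omega)]; norm_num, Real.rpow_natCast,
          ← div_eq_mul_inv, le_div_iff₀ (by positivity), inv_mul_le_iff₀ (by positivity), ← mul_pow, mul_comm]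
        gcongr
      calc _ ≤ |F y| * ((1 + 1 / δ) ^ (N - 2) * (max ‖x‖ ‖y‖ ^ (N - 2))⁻¹) := by gcongr
        _ = _ := by ring
  have hw := wt_pos (σ - 2) x
  have step : ∫ y, |F y * Gam 0 (x - y)| ≤ (M * (2 ^ σ * wt σ x)) * (area N * ρ ^ 2) +
      (1 + 1 / δ) ^ (N - 2) * ((cN N)⁻¹ * (D * CNP N σ * (1 + ‖x‖) ^ (-(σ - 2)))) := by
    have hwp := wt_pos σ x
    calc _ ≤ ∫ y : Euc N, ((M * (2 ^ σ * wt σ x)) * (if ‖x - y‖ < ρ then Gam 0 (x - y) else 0) +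
      (1 + 1 / δ) ^ (N - 2) * (|F y| * (max ‖x‖ ‖y‖ ^ (N - 2))⁻¹)) := by
          refine integral_mono_ae i3 ((i2'.const_mul _).fun_add (i1.const_mul _)) ?_
          filter_upwards [ae_ne' x] with y hy using pw y hy
      _ = (M * (2 ^ σ * wt σ x)) * (∫ y : Euc N, (if ‖x - y‖ < ρ then Gam 0 (x - y) else 0)) +
      (1 + 1 / δ) ^ (N - 2) * ∫ y : Euc N, (|F y| * (max ‖x‖ ‖y‖ ^ (N - 2))⁻¹) := by
          rw [integral_add (i2'.const_mul _) (i1.const_mul _), integral_const_mul, integral_const_mul]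
      _ ≤ _ := by gcongr
  have ew : wt σ x * (1 + ‖x‖) ^ 2 = wt (σ - 2) x := by
    unfold wt
    rw [← Real.rpow_two, ← Real.rpow_add hA]; congr 1; ring
  calc |NP F x| ≤ cN N * ∫ y, |F y * Gam 0 (x - y)| := by
        rw [NP, abs_mul, abs_of_pos hc]
        gcongr
        exact abs_integral_le_integral_abs
    _ ≤ cN N * ((M * (2 ^ σ * wt σ x)) * (area N * ρ ^ 2) +
      (1 + 1 / δ) ^ (N - 2) * ((cN N)⁻¹ * (D * CNP N σ * (1 + ‖x‖) ^ (-(σ - 2))))) := by gcongr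
    _ = (cN N * area N * 2 ^ σ * δ) * (δ * M) * (wt σ x * (1 + ‖x‖) ^ 2) + (1 + 1 / δ) ^ (N - 2) * CNP N σ * D * wt (σ - 2) x := by
        rw [show wt (σ - 2) x = (1 + ‖x‖) ^ (-(σ - 2)) from rfl]
        simp only [ρ]
        field_simp
    _ ≤ (ε * M + (1 + 1 / δ) ^ (N - 2) * CNP N σ * D) * wt (σ - 2) x := by
        rw [ew, add_mul]
        gcongr
        have : δ * M ≤ M := by nlinarith
        gcongr

end PS

namespace PS

open Set Metric

variable {N : ℕ} [hN4 : Fact (4 ≤ N)]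

/-- potential on Euclidean space -/
def Vx (p : ℝ) (w : ℝ → ℝ) (x : Euc N) : ℝ := VV p w ‖x‖

lemma WS.Vx_cont {p m c C : ℝ} {w P : ℝ → ℝ} (h : Par N p m) (hw : WS N p m w P c C) : Continuous (Vx (N := N) p w) :=
  (hw.VVcont h).comp continuous_norm

lemma WS.Vx_bd {p m c C : ℝ} {w P : ℝ → ℝ} (h : Par N p m) (hw : WS N p m w P c C) (x : Euc N) :
    |Vx p w x| ≤ p * C ^ (p - 1) * wt 2 x := by
  unfold Vx; rw [abs_of_pos (hw.VVpos h (norm_nonneg x))]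
  exact hw.VVbd h (norm_nonneg x)

lemma WS.KDec {p m c C M : ℝ} {w P : ℝ → ℝ} (h : Par N p m) (hw : WS N p m w P c C) {G : Euc N → ℝ} (hG : Dec m M G) :
    Dec (m + 2) (p * C ^ (p - 1) * M) (fun x => Vx p w x * G x) := by
  refine ⟨(hw.Vx_cont h).mul hG.1, fun x => ?_⟩
  rw [abs_mul]
  calc _ ≤ (p * C ^ (p - 1) * wt 2 x) * (M * wt m x) := mul_le_mul (hw.Vx_bd h x) (hG.2 x) (abs_nonneg _) ((abs_nonneg _).trans (hw.Vx_bd h x))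
    _ = p * C ^ (p - 1) * M * (wt m x * wt 2 x) := by ring
    _ = _ := by rw [wt_mul]

lemma Par.sN {p m : ℝ} (h : Par N p m) : m + 2 < N := by
  have := h.hN
  have := h.hm
  have := N4r N
  linarith

lemma NP_bd' {p m M : ℝ} (h : Par N p m) {F : Euc N → ℝ} (hF : Dec (m + 2) M F) : Dec m (M * CNP N (m + 2)) (NP F) := by
  have := NP_bd hF (by linarith [h.hm]) h.sN
  rwa [add_sub_cancel_right] at this

lemma hn_radmul {p : ℝ} {w : ℝ → ℝ} (G : Euc N → ℝ) {s : ℝ} (hs : 0 < s) (h0 : 0 ≤ VV p w s) :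
    hn (fun x => Vx p w x * G x) s = VV p w s * hn G s := by
  unfold hn nrm
  simp only [Vx, nsm hs.le, mul_pow]
  rw [integral_const_mul, Real.sqrt_mul (by positivity), Real.sqrt_sq h0]

/-- iterates -/
def It (p : ℝ) (w : ℝ → ℝ) (f : Euc N → ℝ) : ℕ → Euc N → ℝ
  | 0 => f
  | n + 1 => fun x => Vx p w x * NP (It p w f n) x

lemma GG_smul (l : ℕ) (c : ℝ) (f : ℝ → ℝ) (r : ℝ) : GG N l (fun s => c * f s) r = c * GG N l f r := by
  unfold GG
  rw [mul_left_comm, ← integral_const_mul c]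
  congr 1
  refine integral_congr_ae (Eventually.of_forall fun s => ?_)
  simp only; ring

theorem It_bd {p m c C : ℝ} {w P : ℝ → ℝ} (h : Par N p m) (hw : WS N p m w P c C) {f : Euc N → ℝ} {M : ℝ} (hf : Dec (m + 2) M f)
    (hi : ∀ s : ℝ, 0 < s → Hi (fun ω : Sph N => f (s • (ω : Euc N)))) :
    ∃ K τ : ℝ, 0 ≤ K ∧ 0 < τ ∧ τ < 1 ∧ ∀ n, Dec (m + 2) (K * τ ^ n) (It p w f n) := by
  have hm := h.hm
  have hp := h.hp
  have hC := hw.C0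
  have hc := hw.c0
  have hN := N4r N
  have hsN := h.sN
  have hM := hf.nonneg
  have hs : 2 < m + 2 := by linarith
  obtain ⟨θ, θ0, θ1, hθ⟩ := hw.barrier h
  set CV := p * C ^ (p - 1)
  have hCV : 0 < CV := by positivity
  obtain ⟨A, hA, hnf⟩ := near_far (N := N) (σ := m + 2) (ε := 1 / (2 * CV)) hs hsN (by positivity)
  have hDec : ∀ n, ∃ M', Dec (m + 2) M' (It p w f n) := by
    intro n
    induction n with
    | zero => exact ⟨M, hf⟩
    | succ n ih =>
      obtain ⟨M', h'⟩ := ih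
      exact ⟨_, hw.KDec h (NP_bd' h h')⟩
  have hHi : ∀ n, ∀ s : ℝ, 0 < s → Hi (fun ω : Sph N => It p w f n (s • (ω : Euc N))) := by
    intro n
    induction n with
    | zero => exact hi
    | succ n ih =>
      intro s hs'
      obtain ⟨M', h'⟩ := hDec n
      have := NP_Hi h' hs hs' ih
      have e : (fun ω : Sph N => It p w f (n + 1) (s • (ω : Euc N))) = fun ω : Sph N => VV p w s * NP (It p w f n) (s • (ω : Euc N)) := by
        funext ω
        simp only [It, Vx, nsm hs'.le]
      rw [e]
      refine ⟨by rw [integral_const_mul, this.1, mul_zero], fun v => ?_⟩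
      simp only [mul_assoc]
      rw [integral_const_mul, this.2 v, mul_zero]
  -- L2 bounds
  set C1 := (1 / (N + 2 - (m + 2)) + 1 / (m + 2 - 1)) / c
  have hC1 : 0 < C1 := by
    have : (0:ℝ) < N + 2 - (m + 2) := by linarith
    have : (0:ℝ) < m + 2 - 1 := by linarith
    positivity
  have hcc : ContinuousOn (fun s : ℝ => (1 + s) ^ (-(m + 2))) (Ioi 0) := by
    refine ContinuousOn.rpow_const (by fun_prop) (fun s hs => Or.inl ?_)
    have : (0:ℝ) < s := hs
    positivity
  have jn : ∀ n, ∀ r : ℝ, 0 < r → IntegrableOn (fun s => s ^ (N - 1) * gk N 2 r s * hn (It p w f n) s) (Ioi 0) := by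
    intro n r hr
    obtain ⟨M', h'⟩ := hDec n
    exact GG_int (N := N) hs hr 2 (hn_cont h'.1).aestronglyMeasurable (fun s hs => by
      rw [abs_of_nonneg (hn_nonneg _ _)]; exact hn_bd h' (le_of_lt hs))
  have hB : ∀ n, ∀ r : ℝ, 0 < r → hn (NP (It p w f n)) r ≤ M * C1 * θ ^ n * BB N P r := by
    intro n
    induction n with
    | zero =>
      intro r hr
      refine (NP_hn hf hs hr hi).trans ?_
      have j2 := GG_int (N := N) (M := M) (h := fun s => M * (1 + s) ^ (-(m + 2))) hs hr 2 ((hcc.const_smul M).aestronglyMeasurable measurableSet_Ioi) (fun s hs => by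
        have hs : 0 < s := hs
        rw [abs_of_nonneg (by positivity)])
      have g1 := GG_mono hr 2 (jn 0 r hr) j2 (fun s hs => hn_bd hf (le_of_lt hs))
      rw [GG_smul] at g1
      have g2 := GG2_bd (N := N) hs hsN hr
      have g3 := hw.BBge hr
      rw [show 1 - (m + 2) = -(m + 1) by ring] at g2
      have g4 : r * (1 + r) ^ (-(m + 1)) ≤ BB N P r / c := by rw [le_div_iff₀ hc]; linarith
      have : (0:ℝ) < N + 2 - (m + 2) := by linarith
      have : (0:ℝ) < m + 2 - 1 := by linarith
      calc _ ≤ M * GG N 2 (fun s => (1 + s) ^ (-(m + 2))) r := g1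
        _ ≤ M * ((1 / (N + 2 - (m + 2)) + 1 / (m + 2 - 1)) * (r * (1 + r) ^ (-(m + 1)))) := by gcongr
        _ ≤ M * ((1 / (N + 2 - (m + 2)) + 1 / (m + 2 - 1)) * (BB N P r / c)) := by gcongr
        _ = _ := by simp only [C1]; ring
    | succ n ih =>
      intro r hr
      obtain ⟨M', h'⟩ := hDec (n + 1)
      refine (NP_hn h' hs hr (hHi (n + 1))).trans ?_
      have j2 : IntegrableOn (fun s => s ^ (N - 1) * gk N 2 r s * (M * C1 * θ ^ n * (VV p w s * BB N P s))) (Ioi 0) := by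
        refine GG_int (N := N) (σ := m + 2) (M := M * C1 * θ ^ n * (CV * C)) hs hr 2
          ((((hw.VVcont h).continuousOn.mul hw.BBc).const_smul (M * C1 * θ ^ n)).aestronglyMeasurable measurableSet_Ioi) (fun s hs => ?_)
        have hs : 0 < s := hs
        have := hw.VB_bd h hs
        rw [abs_of_nonneg (mul_nonneg (by positivity) (mul_pos (hw.VVpos h hs.le) (hw.BBpos hs)).le), mul_assoc _ (CV * C)]
        gcongr
      have g1 := GG_mono hr 2 (jn (n + 1) r hr) j2 (fun s hs => by
        have hs : 0 < s := hs
        have hV := hw.VVpos h hs.le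
        have := hn_radmul (NP (It p w f n)) hs hV.le
        change hn (fun x => Vx p w x * NP (It p w f n) x) s ≤ _
        rw [this]
        calc _ ≤ VV p w s * (M * C1 * θ ^ n * BB N P s) := mul_le_mul_of_nonneg_left (ih s hs) hV.le
          _ = _ := by ring)
      rw [GG_smul] at g1
      refine g1.trans ?_
      calc _ ≤ M * C1 * θ ^ n * (θ * BB N P r) := mul_le_mul_of_nonneg_left (hθ r hr) (by positivity)
        _ = _ := by rw [pow_succ]; ring
  -- L2 bounds in terms of weights
  set D0 := M / θ + M * C1 / θ * (CV * C)
  have hD0 : 0 ≤ D0 := by positivity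
  have hD : ∀ n, ∀ s : ℝ, 0 < s → hn (It p w f n) s ≤ D0 * θ ^ n * (1 + s) ^ (-(m + 2)) := by
    intro n s hs'
    have q0 : (0:ℝ) < (1 + s) ^ (-(m + 2)) := by positivity
    cases n with
    | zero =>
      refine (hn_bd hf hs'.le).trans ?_
      rw [pow_zero, mul_one]
      gcongr
      have : M ≤ M / θ := by rw [le_div_iff₀ θ0]; nlinarith
      have : 0 ≤ M * C1 / θ * (CV * C) := by positivity
      linarith
    | succ n =>
      have hV := hw.VVpos h hs'.le
      have := hn_radmul (NP (It p w f n)) hs' hV.le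
      change hn (fun x => Vx p w x * NP (It p w f n) x) s ≤ _
      rw [this]
      have vb := hw.VB_bd h hs'
      calc _ ≤ VV p w s * (M * C1 * θ ^ n * BB N P s) := mul_le_mul_of_nonneg_left (hB n s hs') hV.le
        _ = M * C1 * θ ^ n * (VV p w s * BB N P s) := by ring
        _ ≤ M * C1 * θ ^ n * (CV * C * (1 + s) ^ (-(m + 2))) := by gcongr
        _ = (M * C1 / θ * (CV * C)) * θ ^ (n + 1) * (1 + s) ^ (-(m + 2)) := by rw [pow_succ]; field_simp
        _ ≤ _ := by
          gcongr
          have : 0 ≤ M / θ := by positivity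
          linarith
  -- sup bounds
  set τ := max θ (3 / 4)
  have τ0 : 0 < τ := lt_max_of_lt_left θ0
  have hτ : 3 / 4 ≤ τ := le_max_right _ _
  set K := M + 4 * (CV * A * D0)
  refine ⟨K, τ, by positivity, τ0, max_lt θ1 (by norm_num), fun n => ?_⟩
  have hMK : M ≤ K := by
    have : 0 ≤ 4 * (CV * A * D0) := by positivity
    linarith
  induction n with
  | zero =>
    refine ⟨hf.1, fun x => (hf.2 x).trans ?_⟩
    rw [pow_zero, mul_one]
    exact mul_le_mul_of_nonneg_right hMK (wt_pos _ _).le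
  | succ n ih =>
    have h1 := hnf _ _ _ ih (hD n)
    rw [add_sub_cancel_right] at h1
    have h2 := hw.KDec h h1
    refine ⟨h2.1, fun x => (h2.2 x).trans (mul_le_mul_of_nonneg_right ?_ (wt_pos _ _).le)⟩
    have t1 : θ ^ n ≤ τ ^ n := pow_le_pow_left₀ θ0.le (le_max_left _ _) n
    have t0 : 0 < τ ^ n := by positivity
    calc CV * (1 / (2 * CV) * (K * τ ^ n) + A * (D0 * θ ^ n)) = 1 / 2 * K * τ ^ n + CV * A * D0 * θ ^ n := by field_simp
      _ ≤ 1 / 2 * K * τ ^ n + CV * A * D0 * τ ^ n := by gcongr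
      _ = (1 / 2 * K + CV * A * D0) * τ ^ n := by ring
      _ ≤ (3 / 4 * K) * τ ^ n := by gcongr; linarith
      _ ≤ (τ * K) * τ ^ n := by gcongr
      _ = _ := by rw [pow_succ]; ring

theorem hi_solve {p m c C : ℝ} {w P : ℝ → ℝ} (h : Par N p m) (hw : WS N p m w P c C) {f : Euc N → ℝ} {M : ℝ} (hf : Dec (m + 2) M f)
    (hi : ∀ s : ℝ, 0 < s → Hi (fun ω : Sph N => f (s • (ω : Euc N)))) :
    ∃ (F : Euc N → ℝ) (M' : ℝ), Dec (m + 2) M' F ∧ ∀ x, F x = f x + Vx p w x * NP F x := by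
  obtain ⟨K, τ, hK, τ0, τ1, hI⟩ := It_bd h hw hf hi
  have hm := h.hm
  have hs : 2 < m + 2 := by linarith
  have wle : ∀ x : Euc N, wt (m + 2) x ≤ 1 := fun x => Real.rpow_le_one_of_one_le_of_nonpos (by linarith [norm_nonneg x]) (by linarith)
  have su : Summable (fun n => K * τ ^ n) := (summable_geometric_of_lt_one τ0.le τ1).mul_left K
  have sx : ∀ x : Euc N, Summable (fun n => It p w f n x) := fun x => by
    refine Summable.of_norm_bounded su (fun n => ?_)
    rw [Real.norm_eq_abs]
    have := (hI n).2 x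
    have h1 := wle x
    have h2 : 0 ≤ K * τ ^ n := by positivity
    nlinarith
  set F : Euc N → ℝ := fun x => ∑' n, It p w f n x
  have cF : Continuous F := continuous_tsum (fun n => (hI n).1) su (fun n x => by
    rw [Real.norm_eq_abs]
    have := (hI n).2 x
    have h1 := wle x
    have h2 : 0 ≤ K * τ ^ n := by positivity
    nlinarith)
  have cS : ∀ n, Continuous (fun x => ∑ k ∈ Finset.range n, It p w f k x) := fun n => continuous_finset_sum _ (fun k _ => (hI k).1)
  have tail : ∀ n (x : Euc N), |F x - ∑ k ∈ Finset.range n, It p w f k x| ≤ (K * τ ^ n / (1 - τ)) * wt (m + 2) x := by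
    intro n x
    have e : F x - ∑ k ∈ Finset.range n, It p w f k x = ∑' k, It p w f (k + n) x := by
      change (∑' n, It p w f n x) - _ = _
      rw [← (sx x).sum_add_tsum_nat_add n]; ring
    rw [e, ← Real.norm_eq_abs]
    have hg : HasSum (fun k => K * wt (m + 2) x * τ ^ n * τ ^ k) (K * wt (m + 2) x * τ ^ n * (1 - τ)⁻¹) := (hasSum_geometric_of_lt_one τ0.le τ1).mul_left _
    refine (tsum_of_norm_bounded hg (fun k => ?_)).trans (le_of_eq (by ring))
    rw [Real.norm_eq_abs]
    refine ((hI (k + n)).2 x).trans (le_of_eq ?_)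
    rw [pow_add]; ring
  have dF : Dec (m + 2) (K * τ ^ 0 / (1 - τ)) F := ⟨cF, fun x => by simpa using tail 0 x⟩
  have dT : ∀ n, Dec (m + 2) (K * τ ^ n / (1 - τ)) (fun x => F x - ∑ k ∈ Finset.range n, It p w f k x) := fun n =>
    ⟨cF.sub (cS n), tail n⟩
  have dS : ∀ n, ∃ M', Dec (m + 2) M' (fun x => ∑ k ∈ Finset.range n, It p w f k x) := by
    intro n
    refine ⟨K * τ ^ 0 / (1 - τ) + K * τ ^ n / (1 - τ), cS n, fun x => ?_⟩
    have := abs_sub (F x) (F x - ∑ k ∈ Finset.range n, It p w f k x)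
    rw [sub_sub_cancel] at this
    have h1 := dF.2 x
    have h2 := tail n x
    linarith
  have hrec : ∀ n x, ∑ k ∈ Finset.range (n + 1), It p w f k x = f x + Vx p w x * NP (fun x => ∑ k ∈ Finset.range n, It p w f k x) x := by
    intro n
    induction n with
    | zero =>
      intro x
      have : NP (fun _ : Euc N => (0:ℝ)) x = 0 := by
        have := NP_smul 0 (fun _ : Euc N => (0:ℝ)) x
        simpa using this
      simp [It, this]
    | succ n ih =>
      intro x
      obtain ⟨M', h'⟩ := dS n
      rw [Finset.sum_range_succ, ih]
      simp only [Finset.sum_range_succ _ n]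
      rw [NP_add h' (hI n) hs x]
      simp only [It]
      ring
  refine ⟨F, _, dF, fun x => ?_⟩
  have l1 : Tendsto (fun n => ∑ k ∈ Finset.range (n + 1), It p w f k x) atTop (𝓝 (F x)) :=
    ((sx x).hasSum.tendsto_sum_nat).comp (tendsto_add_atTop_nat 1)
  have l2 : Tendsto (fun n => NP (fun x => ∑ k ∈ Finset.range n, It p w f k x) x) atTop (𝓝 (NP F x)) := by
    rw [tendsto_iff_norm_sub_tendsto_zero]
    have l3 : Tendsto (fun n => K * τ ^ n / (1 - τ) * CNP N (m + 2) * wt m x) atTop (𝓝 (K * 0 / (1 - τ) * CNP N (m + 2) * wt m x)) :=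
      ((((tendsto_pow_atTop_nhds_zero_of_lt_one τ0.le τ1).const_mul K).div_const _).mul_const _).mul_const _
    rw [mul_zero, zero_div, zero_mul, zero_mul] at l3
    refine squeeze_zero (fun n => norm_nonneg _) (fun n => ?_) l3
    obtain ⟨M', h'⟩ := dS n
    have e := NP_add (dT n) h' hs x
    simp only [sub_add_cancel] at e
    change NP F x = _ at e
    rw [e, Real.norm_eq_abs, abs_sub_comm, add_sub_cancel_right]
    exact (NP_bd' h (dT n)).2 x
  have l4 := (l2.const_mul (Vx p w x)).const_add (f x)
  refine tendsto_nhds_unique l1 ?_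
  simpa only [hrec] using l4

end PS

namespace PS

open Set Metric

variable {N : ℕ} [hN4 : Fact (4 ≤ N)]

lemma qf {α γ : ℝ} (hα : 0 < α) (hγ : 0 < γ) : ∃ δ ε κ B : ℝ, 0 < δ ∧ 0 < ε ∧ 0 < κ ∧ 0 ≤ B ∧
    (∀ y v : ℝ, v ^ 2 / 4 + γ * y ^ 2 / 4 ≤ v ^ 2 / 2 + γ * y ^ 2 / 2 + δ * (y * v)) ∧
    ∀ y v e g : ℝ, |e| ≤ ε → -(α - δ) * v ^ 2 - e * (y * v) - g * v - δ * α * (y * v) - δ * γ * y ^ 2 - δ * e * y ^ 2 - δ * g * y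
      ≤ -κ * (v ^ 2 / 2 + γ * y ^ 2 / 2 + δ * (y * v)) + B * g ^ 2 := by
  obtain ⟨δ, hδ, d1, d2, d3⟩ : ∃ δ : ℝ, 0 < δ ∧ δ ≤ α / 4 ∧ δ * α ≤ γ / 4 ∧ δ ^ 2 ≤ γ / 4 := by
    have hD : 0 < α ^ 2 + γ := by positivity
    have e1 : γ / (4 * (α ^ 2 + γ)) ≤ 1 / 4 := by rw [div_le_div_iff₀ (by positivity) (by norm_num)]; nlinarith [sq_nonneg α]
    have e2 : α ^ 2 / (α ^ 2 + γ) ≤ 1 := by rw [div_le_one hD]; linarith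
    have q1 : γ * α / (4 * (α ^ 2 + γ)) ≤ α / 4 := by
      have := mul_le_mul_of_nonneg_left e1 hα.le
      calc _ = α * (γ / (4 * (α ^ 2 + γ))) := by ring
        _ ≤ _ := by linarith
    have q2 : γ * α / (4 * (α ^ 2 + γ)) * α ≤ γ / 4 := by
      have := mul_le_mul_of_nonneg_left e2 hγ.le
      calc _ = γ * (α ^ 2 / (α ^ 2 + γ)) / 4 := by field_simp
        _ ≤ _ := by linarith
    refine ⟨γ * α / (4 * (α ^ 2 + γ)), by positivity, q1, q2, ?_⟩
    have q0 : 0 < γ * α / (4 * (α ^ 2 + γ)) := by positivity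
    rw [sq]
    have := mul_le_mul_of_nonneg_left q1 q0.le
    linarith
  have hl : 0 < min (α / 2) (3 * δ * γ / 4) := lt_min (by positivity) (by positivity)
  have l1 := min_le_left (α / 2) (3 * δ * γ / 4)
  have l2 := min_le_right (α / 2) (3 * δ * γ / 4)
  generalize min (α / 2) (3 * δ * γ / 4) = lam at hl l1 l2
  refine ⟨δ, lam / (4 * (1 + δ)), lam / (2 * (1 + γ + δ)), (1 + δ ^ 2) / lam, hδ, by positivity, by positivity, by positivity, ?_, ?_⟩
  · intro y v
    have := mul_le_mul_of_nonneg_right d3 (sq_nonneg y)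
    nlinarith [sq_nonneg (v / 2 + δ * y)]
  · intro y v e g he
    have t1 : -(δ * α * (y * v)) ≤ δ * γ / 4 * y ^ 2 + α / 4 * v ^ 2 := by
      have h1 : 0 ≤ δ / γ * (γ / 2 * y + α * v) ^ 2 := by positivity
      have h2 : δ / γ * (γ / 2 * y + α * v) ^ 2 = δ * γ / 4 * y ^ 2 + δ * α * (y * v) + δ * α * α / γ * v ^ 2 := by field_simp; ring
      have h3 : δ * α * α / γ ≤ α / 4 := by rw [div_le_div_iff₀ hγ (by norm_num)]; nlinarith
      have := mul_le_mul_of_nonneg_right h3 (sq_nonneg v)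
      linarith
    have t2 : -(e * (y * v)) - δ * e * y ^ 2 ≤ lam / 4 * (v ^ 2 + y ^ 2) := by
      have h1 : -(e * (y * v)) - δ * e * y ^ 2 ≤ |e| * ((1 + δ) * (v ^ 2 + y ^ 2)) := by
        have a1 : |y * v + δ * y ^ 2| ≤ (1 + δ) * (v ^ 2 + y ^ 2) := by
          rw [abs_le]; constructor <;> nlinarith [sq_nonneg (y - v), sq_nonneg (y + v), mul_nonneg hδ.le (sq_nonneg v), mul_nonneg hδ.le (sq_nonneg y)]
        have a2 := mul_le_mul_of_nonneg_left a1 (abs_nonneg e)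
        rw [← abs_mul] at a2
        have := neg_abs_le (e * (y * v + δ * y ^ 2))
        nlinarith
      have h2 : |e| * ((1 + δ) * (v ^ 2 + y ^ 2)) ≤ lam / (4 * (1 + δ)) * ((1 + δ) * (v ^ 2 + y ^ 2)) := by gcongr
      have h3 : lam / (4 * (1 + δ)) * ((1 + δ) * (v ^ 2 + y ^ 2)) = lam / 4 * (v ^ 2 + y ^ 2) := by field_simp
      linarith
    have t3 : -(g * v) ≤ lam / 4 * v ^ 2 + g ^ 2 / lam := by
      have h1 : 0 ≤ 1 / lam * (lam / 2 * v + g) ^ 2 := by positivity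
      have h2 : 1 / lam * (lam / 2 * v + g) ^ 2 = lam / 4 * v ^ 2 + g * v + g ^ 2 / lam := by field_simp; ring
      linarith
    have t4 : -(δ * g * y) ≤ lam / 4 * y ^ 2 + δ ^ 2 * g ^ 2 / lam := by
      have h1 : 0 ≤ 1 / lam * (lam / 2 * y + δ * g) ^ 2 := by positivity
      have h2 : 1 / lam * (lam / 2 * y + δ * g) ^ 2 = lam / 4 * y ^ 2 + δ * g * y + δ ^ 2 * g ^ 2 / lam := by field_simp; ring
      linarith
    have t5 : lam / (2 * (1 + γ + δ)) * (v ^ 2 / 2 + γ * y ^ 2 / 2 + δ * (y * v)) ≤ lam / 2 * (v ^ 2 + y ^ 2) := by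
      have h1 : v ^ 2 / 2 + γ * y ^ 2 / 2 + δ * (y * v) ≤ (1 + γ + δ) * (v ^ 2 + y ^ 2) := by
        nlinarith [mul_nonneg hδ.le (sq_nonneg (y - v)), mul_nonneg hγ.le (sq_nonneg v), mul_nonneg hγ.le (sq_nonneg y), mul_nonneg hδ.le (sq_nonneg v), mul_nonneg hδ.le (sq_nonneg y), sq_nonneg v, sq_nonneg y]
      have h2 : lam / (2 * (1 + γ + δ)) * (v ^ 2 / 2 + γ * y ^ 2 / 2 + δ * (y * v)) ≤ lam / (2 * (1 + γ + δ)) * ((1 + γ + δ) * (v ^ 2 + y ^ 2)) := by gcongr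
      have h3 : lam / (2 * (1 + γ + δ)) * ((1 + γ + δ) * (v ^ 2 + y ^ 2)) = lam / 2 * (v ^ 2 + y ^ 2) := by field_simp
      linarith
    have t6 : (1 + δ ^ 2) / lam * g ^ 2 = g ^ 2 / lam + δ ^ 2 * g ^ 2 / lam := by field_simp
    have t7 := mul_le_mul_of_nonneg_right d1 (sq_nonneg v)
    have t8 := mul_le_mul_of_nonneg_right l1 (sq_nonneg v)
    have t9 := mul_le_mul_of_nonneg_right l2 (sq_nonneg y)
    rw [t6]
    nlinarith

lemma lyap2 {y v e g : ℝ → ℝ} {α γ M R : ℝ} (hα : 0 < α) (hγ : 0 < γ) (hR : 0 < R)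
    (dy : ∀ r > R, HasDerivAt y (v r / r) r) (dv : ∀ r > R, HasDerivAt v ((-α * v r - γ * y r - e r * y r - g r) / r) r)
    (he : Tendsto e atTop (𝓝 0)) (hg : ∀ r > R, |g r| ≤ M) :
    ∃ R1 > R, ∃ A, ∀ r > R1, |y r| ≤ A ∧ |v r| ≤ A := by
  obtain ⟨δ, ε, κ, B, hδ, hε, hκ, hB, q1, q2⟩ := qf hα hγ
  obtain ⟨R0, hR0⟩ := eventually_atTop.1 (he.eventually (Metric.ball_mem_nhds 0 hε))
  let E : ℝ → ℝ := fun r => v r ^ 2 / 2 + γ * y r ^ 2 / 2 + δ * (y r * v r)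
  let R2 := max R R0
  have hR2 : 0 < R2 := lt_of_lt_of_le hR (le_max_left _ _)
  let D := B * M ^ 2 / κ
  let f : ℝ → ℝ := fun r => r ^ κ * (E r - D)
  have dE : ∀ r > R, HasDerivAt E ((-(α - δ) * v r ^ 2 - e r * (y r * v r) - g r * v r - δ * α * (y r * v r) - δ * γ * y r ^ 2 - δ * e r * y r ^ 2 - δ * g r * y r) / r) r := by
    intro r hr
    have hr0 : 0 < r := hR.trans hr
    have := ((((dv r hr).pow 2).div_const 2).add (((dy r hr).pow 2).const_mul γ |>.div_const 2)).add (((dy r hr).mul (dv r hr)).const_mul δ)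
    refine HasDerivAt.congr_deriv (f := E) this ?_
    push_cast
    field_simp
    ring
  have an : AntitoneOn f (Ioi R2) := by
    refine antiOn (f' := fun r => κ * r ^ (κ - 1) * (E r - D) + r ^ κ * ((-(α - δ) * v r ^ 2 - e r * (y r * v r) - g r * v r - δ * α * (y r * v r) - δ * γ * y r ^ 2 - δ * e r * y r ^ 2 - δ * g r * y r) / r)) ?_ ?_
    · intro r hr
      have hr0 : 0 < r := hR2.trans hr
      have := (Real.hasDerivAt_rpow_const (p := κ) (Or.inl hr0.ne')).mul ((dE r (lt_of_le_of_lt (le_max_left _ _) hr)).sub_const D)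
      exact this
    · intro r hr
      have hr0 : 0 < r := hR2.trans hr
      have hr1 : R < r := lt_of_le_of_lt (le_max_left _ _) hr
      have he' : |e r| ≤ ε := by
        have := hR0 r (le_of_lt (lt_of_le_of_lt (le_max_right _ _) hr))
        rw [dist_zero_right, Real.norm_eq_abs] at this
        exact this.le
      have a1 := q2 (y r) (v r) (e r) (g r) he'
      have a2 : g r ^ 2 ≤ M ^ 2 := sq_le_sq' (by linarith [abs_le.1 (hg r hr1)]) (abs_le.1 (hg r hr1)).2
      have a3 := mul_le_mul_of_nonneg_left a2 hB
      have a4 : κ * D = B * M ^ 2 := by simp only [D]; field_simp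
      have e1 : r ^ κ = r ^ (κ - 1) * r := by rw [← rp1 hr0]; ring_nf
      rw [e1, mul_div_assoc', mul_comm κ, mul_assoc, mul_assoc (r ^ (κ - 1)) r, mul_div_assoc, mul_div_cancel_left₀ _ hr0.ne', ← mul_add]
      refine mul_nonpos_of_nonneg_of_nonpos (Real.rpow_nonneg hr0.le _) ?_
      have : κ * (E r - D) = κ * E r - B * M ^ 2 := by rw [mul_sub, a4]
      rw [this]
      simp only [E] at *
      linarith
  let R1 := R2 + 1
  have bE : ∀ r > R1, E r ≤ D + |f R1| / R1 ^ κ := by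
    intro r hr
    have hR1 : R2 < R1 := by simp [R1]
    have h0 : 0 < R1 := by linarith
    have := an (show R1 ∈ Ioi R2 from hR1) (show r ∈ Ioi R2 from hR1.trans hr) hr.le
    have h1 : r ^ κ * (E r - D) ≤ |f R1| := this.trans (le_abs_self _)
    have h2 : R1 ^ κ ≤ r ^ κ := Real.rpow_le_rpow h0.le hr.le hκ.le
    have h3 : 0 < R1 ^ κ := Real.rpow_pos_of_pos h0 _
    rcases le_total (E r - D) 0 with h | h
    · have : 0 ≤ |f R1| / R1 ^ κ := by positivity
      linarith
    · have : E r - D ≤ |f R1| / R1 ^ κ := by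
        rw [le_div_iff₀ h3, mul_comm]
        exact (mul_le_mul_of_nonneg_right h2 h).trans h1
      linarith
  generalize D + |f R1| / R1 ^ κ = Q at bE
  have hQ : 0 ≤ Q := by
    have := bE (R1 + 1) (by linarith)
    have h2 := q1 (y (R1 + 1)) (v (R1 + 1))
    refine le_trans ?_ this
    refine le_trans ?_ h2
    positivity
  refine ⟨R1, by have := le_max_left R R0; simp only [R1, R2]; linarith, √(4 * Q) + √(4 * Q / γ), fun r hr => ?_⟩
  have h1 := bE r hr
  have h2 := q1 (y r) (v r)
  have h3 : v r ^ 2 / 4 + γ * y r ^ 2 / 4 ≤ Q := h2.trans h1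
  have s1 := Real.sqrt_nonneg (4 * Q)
  have s2 := Real.sqrt_nonneg (4 * Q / γ)
  constructor
  · have : |y r| ≤ √(4 * Q / γ) := by
      apply Real.abs_le_sqrt
      rw [le_div_iff₀ hγ]
      nlinarith [sq_nonneg (v r)]
    linarith
  · have : |v r| ≤ √(4 * Q) := by
      apply Real.abs_le_sqrt
      have : 0 ≤ γ * y r ^ 2 := by positivity
      nlinarith [sq_nonneg (v r)]
    linarith

end PS

namespace PS

open Set Metric

variable {N : ℕ} [hN4 : Fact (4 ≤ N)]

theorem lowmode {p m c C : ℝ} {w P : ℝ → ℝ} (h : Par N p m) (hw : WS N p m w P c C) {l : ℕ} (hl : l ≤ 1) {f : ℝ → ℝ}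
    (hf : Continuous f) {M : ℝ} (hM : ∀ r ≥ 0, |f r| ≤ M * (1 + r) ^ (-(m + 2))) :
    ∃ (η : ℝ → ℝ) (A : ℝ), Continuous η ∧ 0 ≤ A ∧ (∀ r ≥ 0, |r ^ l * η r| ≤ A * (1 + r) ^ (-m)) ∧
      ∀ r > 0, GG N l (fun s => VV p w s * (s ^ l * η s) + f s) r = r ^ l * η r := by
  have hp := h.hp
  have hm := h.hm
  have hmN := h.hN
  have hmp := h.hmp
  have hN := N4 N
  have hNr := N4r N
  have hM0 : 0 ≤ M := by
    have := (abs_nonneg _).trans (hM 0 le_rfl)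
    simpa using this
  have hM1 : ∀ r ≥ 0, |f r| ≤ M := by
    intro r hr
    refine (hM r hr).trans ?_
    have := Real.rpow_le_one_of_one_le_of_nonpos (show (1:ℝ) ≤ 1 + r by linarith) (show -(m + 2) ≤ 0 by linarith)
    nlinarith
  have hVc := hw.VVcont h
  have hHc : Continuous (fun q : ℝ × ℝ => (fun (s x : ℝ) => VV p w |s| * x) q.1 q.2) :=
    (hVc.comp (continuous_abs.comp continuous_fst)).mul continuous_snd
  obtain ⟨η, Q, cη, -, dη, dQ, Q0, -⟩ := volt (k := N - 1 + 2 * l) hl (by omega) hHc (L := p) (by linarith)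
    (fun s x y => by
      rw [← mul_sub, abs_mul, abs_of_pos (hw.VVpos h (abs_nonneg s))]
      exact mul_le_mul_of_nonneg_right (hw.VVle h (abs_nonneg s)) (abs_nonneg _)) (fun s => mul_zero _) hf hM1 0
  have dQ1 : ∀ r > 0, HasDerivAt Q (r ^ (N - 1 + l) * (VV p w r * (r ^ l * η r) + f r)) r := by
    intro r hr
    refine (dQ r hr).congr_deriv ?_
    rw [abs_of_pos hr, show N - 1 + 2 * l - l = N - 1 + l by omega, show N - 1 + 2 * l = N - 1 + l + l by omega, pow_add r (N - 1 + l) l]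
    ring
  have dQ2 : ∀ r > 0, HasDerivAt Q (r ^ (N - 1 + 2 * l) * (fun r => VV p w r * η r + f r / r ^ l) r) r := by
    intro r hr
    refine (dQ1 r hr).congr_deriv ?_
    rw [show N - 1 + 2 * l = N - 1 + l + l by omega, pow_add r (N - 1 + l) l]
    have : r ^ l ≠ 0 := by positivity
    field_simp
  have kc : ((N - 1 + 2 * l : ℕ) : ℝ) = N - 1 + 2 * l := by push_cast [cast_pred]; ring
  set k := N - 1 + 2 * l with hk
  set q : ℝ := m + l with hq
  have hq0 : 0 < q := by positivity
  let b := m * ((N:ℝ) - 2 - m)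
  have hγ : 0 < p * b - b - l * (N - 2 + l) := by
    have e : p * b - b = 2 * (N - 2 - m) := by simp only [b]; rw [← hmp]; ring
    rw [e]
    interval_cases l
    · norm_num; linarith
    · norm_num; linarith
  have rl : ∀ r : ℝ, 0 < r → r ^ q = r ^ m * r ^ l := by
    intro r hr
    rw [hq, Real.rpow_add hr, Real.rpow_natCast]
  have rq2 : ∀ r : ℝ, 0 < r → r ^ (q + 2) = r ^ q * r ^ 2 := by
    intro r hr
    rw [Real.rpow_add hr]; norm_num
  have rm2 : ∀ r : ℝ, 0 < r → r ^ (m + 2) = r ^ m * r ^ 2 := by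
    intro r hr
    rw [Real.rpow_add hr]; norm_num
  obtain ⟨R1, hR1, A, hA⟩ := lyap2 (y := fun r => r ^ q * η r) (v := vv η Q k q) (e := fun r => r ^ 2 * (p * w r ^ (p - 1)) - p * b)
    (g := fun r => r ^ (m + 2) * f r) (α := N - 2 - 2 * m) (γ := p * b - b - l * (N - 2 + l)) (M := M) (R := 1) (by linarith) hγ one_pos
    (fun r hr => (logd (h := fun r => VV p w r * η r + f r / r ^ l) q (one_pos.trans hr) (dη r (one_pos.trans hr)) (dQ2 r (one_pos.trans hr))).1)
    (fun r hr => by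
      have hr0 : 0 < r := one_pos.trans hr
      refine (logd (h := fun r => VV p w r * η r + f r / r ^ l) q hr0 (dη r hr0) (dQ2 r hr0)).2.congr_deriv ?_
      congr 1
      have h1 : r ^ (q + 2) * (VV p w r * η r + f r / r ^ l) = r ^ 2 * VV p w r * (r ^ q * η r) + r ^ (m + 2) * f r := by
        rw [rq2 r hr0, rm2 r hr0, rl r hr0]
        have : r ^ l ≠ 0 := by positivity
        field_simp
      simp only [h1, kc]
      unfold VV
      simp only [b, hq]
      ring)
    (by
      have := hw.Vl.sub_const (p * b)
      rw [show p * (m * ((N:ℝ) - 2 - m)) - p * b = 0 from sub_self _] at this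
      exact this)
    (fun r hr => by
      have hr0 : 0 < r := one_pos.trans hr
      have h1 := hM r hr0.le
      rw [abs_mul, abs_of_pos (Real.rpow_pos_of_pos hr0 _)]
      have h2 : r ^ (m + 2) * (1 + r) ^ (-(m + 2)) ≤ 1 := by
        rw [Real.rpow_neg (by linarith), ← div_eq_mul_inv, div_le_one (by positivity)]
        exact Real.rpow_le_rpow hr0.le (by linarith) (by linarith)
      calc _ ≤ r ^ (m + 2) * (M * (1 + r) ^ (-(m + 2))) := by gcongr
        _ = M * (r ^ (m + 2) * (1 + r) ^ (-(m + 2))) := by ring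
        _ ≤ M * 1 := by gcongr
        _ = M := mul_one M)
  have hA0 : 0 ≤ A := (abs_nonneg _).trans (hA (R1 + 1) (by linarith)).1
  have R10 : 0 < R1 := by linarith
  -- bound
  have cφ : Continuous (fun r : ℝ => |r ^ l * η r| * (1 + |r|) ^ m) :=
    (((continuous_pow l).mul cη).abs).mul ((continuous_const.add continuous_abs).rpow_const (fun x => Or.inr hm.le))
  obtain ⟨B, hB⟩ := (isCompact_Icc (a := (0:ℝ)) (b := R1)).bddAbove_image cφ.continuousOn
  have bd : ∀ r ≥ 0, |r ^ l * η r| ≤ (|B| + 2 ^ m * A) * (1 + r) ^ (-m) := by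
    intro r hr
    have h1r : (0:ℝ) < 1 + r := by linarith
    rw [Real.rpow_neg h1r.le, ← div_eq_mul_inv, le_div_iff₀ (Real.rpow_pos_of_pos h1r _)]
    have p2 : 0 ≤ 2 ^ m * A := by positivity
    rcases le_or_gt r R1 with hr1 | hr1
    · have := hB ⟨r, ⟨hr, hr1⟩, rfl⟩
      simp only [abs_of_nonneg hr] at this
      have := le_abs_self B
      linarith
    · have hr0 : 0 < r := by linarith
      have h1 := (hA r hr1).1
      simp only [rl r hr0] at h1
      rw [mul_assoc, abs_mul, abs_of_pos (Real.rpow_pos_of_pos hr0 _)] at h1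
      have h2 : (1 + r) ^ m ≤ 2 ^ m * r ^ m := by
        rw [← Real.mul_rpow (by norm_num) hr0.le]
        exact Real.rpow_le_rpow h1r.le (by linarith) hm.le
      have h3 := abs_nonneg B
      calc _ ≤ |r ^ l * η r| * (2 ^ m * r ^ m) := by gcongr
        _ = 2 ^ m * (r ^ m * |r ^ l * η r|) := by ring
        _ ≤ 2 ^ m * A := by gcongr
        _ ≤ _ := by linarith
  have t0 : Tendsto (fun r : ℝ => (q + 1) * A * r ^ (-q)) atTop (𝓝 0) := by
    have := (tendsto_rpow_neg_atTop hq0).const_mul ((q + 1) * A)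
    rwa [mul_zero] at this
  have yη : ∀ r > R1, |η r| ≤ A * r ^ (-q) := by
    intro r hr
    have hr0 : 0 < r := by linarith
    have h1 := (hA r hr).1
    simp only [abs_mul, abs_of_pos (Real.rpow_pos_of_pos hr0 q)] at h1
    rw [Real.rpow_neg hr0.le, ← div_eq_mul_inv, le_div_iff₀ (Real.rpow_pos_of_pos hr0 _)]
    linarith
  refine ⟨η, |B| + 2 ^ m * A, cη, by positivity, bd, fun r hr => ?_⟩
  refine GG_rad hr l (P := Q) ?_ dη dQ1 Q0 ?_ ?_
  · refine GG_int (N := N) (σ := m + 2) (M := p * C ^ (p - 1) * (|B| + 2 ^ m * A) + M) (by linarith) hr l ?_ ?_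
    · exact ((hVc.mul ((continuous_pow l).mul cη)).add hf).aestronglyMeasurable
    · intro s hs
      have hs : 0 < s := hs
      have h1 := bd s hs.le
      have h2 := hM s hs.le
      have h3 := hw.VVbd h hs.le
      have h4 := hw.VVpos h hs.le
      have hC := hw.C0
      refine (abs_add_le _ _).trans ?_
      rw [abs_mul, abs_of_pos h4, add_mul]
      refine add_le_add ?_ h2
      have e : (1 + s) ^ (-(m + 2)) = (1 + s) ^ (-2:ℝ) * (1 + s) ^ (-m) := by
        rw [← Real.rpow_add (by linarith)]; ring_nf
      rw [e]
      calc _ ≤ (p * C ^ (p - 1) * (1 + s) ^ (-2:ℝ)) * ((|B| + 2 ^ m * A) * (1 + s) ^ (-m)) := by gcongr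
        _ = _ := by ring
  · refine squeeze_zero_norm' ?_ t0
    filter_upwards [eventually_gt_atTop R1] with r hr
    have hr0 : 0 < r := by linarith
    have := yη r hr
    have h2 : 0 ≤ q * A * r ^ (-q) := by positivity
    rw [Real.norm_eq_abs]
    linarith
  · refine squeeze_zero_norm' ?_ t0
    filter_upwards [eventually_gt_atTop R1] with r hr
    have hr0 : 0 < r := by linarith
    have h1 := yη r hr
    have h2 := (hA r hr).2
    have h3 : |q * η r - r * (Q r / r ^ k)| ≤ A * r ^ (-q) := by
      rw [vv, abs_mul, abs_of_pos (Real.rpow_pos_of_pos hr0 q)] at h2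
      rw [Real.rpow_neg hr0.le, ← div_eq_mul_inv, le_div_iff₀ (Real.rpow_pos_of_pos hr0 _)]
      linarith
    rw [Real.norm_eq_abs]
    have h4 := abs_sub (q * η r) (q * η r - r * (Q r / r ^ k))
    rw [sub_sub_cancel, abs_mul q, abs_of_pos hq0] at h4
    have h5 := mul_le_mul_of_nonneg_left h1 hq0.le
    calc _ ≤ _ := h4
      _ ≤ q * (A * r ^ (-q)) + A * r ^ (-q) := add_le_add h5 h3
      _ = _ := by ring

end PS

namespace PS

open Set Metric

variable {N : ℕ} [hN4 : Fact (4 ≤ N)]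

def Sol (p m : ℝ) (w : ℝ → ℝ) (f : Euc N → ℝ) : Prop :=
  ∃ (F : Euc N → ℝ) (M' : ℝ), Dec (m + 2) M' F ∧ ∀ x, F x = f x + Vx p w x * NP F x

lemma Sol.add {p m : ℝ} {w : ℝ → ℝ} (hm : 0 < m) {f g : Euc N → ℝ} (hf : Sol p m w f) (hg : Sol p m w g) :
    Sol p m w (fun x => f x + g x) := by
  obtain ⟨F, M1, h1, e1⟩ := hf
  obtain ⟨G, M2, h2, e2⟩ := hg
  refine ⟨_, _, h1.add h2, fun x => ?_⟩
  rw [NP_add h1 h2 (by linarith) x]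
  have := e1 x
  have := e2 x
  linarith

lemma Sol.zero {p m : ℝ} {w : ℝ → ℝ} : Sol (N := N) p m w (fun _ => 0) := by
  refine ⟨fun _ => 0, 0, ⟨continuous_const, fun x => by simp⟩, fun x => ?_⟩
  have := NP_smul 0 (fun _ : Euc N => (0:ℝ)) x
  simp only [zero_mul] at this
  rw [this]; simp

lemma Sol.sum {p m : ℝ} {w : ℝ → ℝ} (hm : 0 < m) {ι : Type*} (s : Finset ι) {f : ι → Euc N → ℝ} (hf : ∀ i, Sol p m w (f i)) :
    Sol p m w (fun x => ∑ i ∈ s, f i x) := by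
  classical
  induction s using Finset.induction_on with
  | empty => simpa using Sol.zero
  | insert a s ha ih =>
    simp only [Finset.sum_insert ha]
    exact (hf a).add hm ih

lemma Dec.sum {σ : ℝ} {ι : Type*} (s : Finset ι) {f : ι → Euc N → ℝ} (hf : ∀ i, ∃ M, Dec σ M (f i)) :
    ∃ M, Dec σ M (fun x => ∑ i ∈ s, f i x) := by
  classical
  induction s using Finset.induction_on with
  | empty => exact ⟨0, by simpa using continuous_const, fun x => by simp⟩
  | insert a s ha ih =>
    simp only [Finset.sum_insert ha]
    obtain ⟨M, h⟩ := ih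
    obtain ⟨M', h'⟩ := hf a
    exact ⟨_, h'.add h⟩

lemma rad_Dec {σ A : ℝ} {g : ℝ → ℝ} (hg : Continuous g) (hb : ∀ r ≥ 0, |g r| ≤ A * (1 + r) ^ (-σ)) :
    Dec (N := N) σ A (fun x => g ‖x‖) := ⟨hg.comp continuous_norm, fun x => hb _ (norm_nonneg x)⟩

lemma lin_le (v x : Euc N) : |⟪‖x‖⁻¹ • x, v⟫_ℝ| ≤ ‖v‖ := by
  refine (abs_real_inner_le_norm _ _).trans ?_
  have : ‖‖x‖⁻¹ • x‖ ≤ 1 := by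
    rw [norm_smul, norm_inv, norm_norm]
    exact inv_mul_le_one
  nlinarith [norm_nonneg v]

lemma lin_Dec {σ A : ℝ} {g : ℝ → ℝ} (v : Euc N) (hg : Continuous g) (h0 : g 0 = 0) (hb : ∀ r ≥ 0, |g r| ≤ A * (1 + r) ^ (-σ)) :
    Dec (N := N) σ (A * ‖v‖) (fun x => g ‖x‖ * ⟪‖x‖⁻¹ • x, v⟫_ℝ) := by
  refine ⟨?_, fun x => ?_⟩
  · rw [continuous_iff_continuousAt]
    intro x
    by_cases hx : x = 0
    · subst hx
      rw [ContinuousAt]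
      simp only [norm_zero, h0, zero_mul]
      have : Tendsto (fun x : Euc N => |g ‖x‖| * ‖v‖) (𝓝 0) (𝓝 0) := by
        have : Continuous (fun x : Euc N => |g ‖x‖| * ‖v‖) := by fun_prop
        have := this.tendsto 0
        simpa [h0] using this
      refine squeeze_zero_norm (fun x => ?_) this
      rw [Real.norm_eq_abs, abs_mul]
      exact mul_le_mul_of_nonneg_left (lin_le v x) (abs_nonneg _)
    · have h1 : ContinuousAt (fun x : Euc N => g ‖x‖) x := (hg.comp continuous_norm).continuousAt
      have h2 : ContinuousAt (fun x : Euc N => ‖x‖⁻¹ • x) x := (continuousAt_id.norm.inv₀ (norm_ne_zero_iff.2 hx)).smul continuousAt_id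
      have h3 : ContinuousAt (fun x : Euc N => ⟪‖x‖⁻¹ • x, v⟫_ℝ) x := h2.inner continuousAt_const
      exact h1.mul h3
  · rw [abs_mul]
    have := hb ‖x‖ (norm_nonneg x)
    unfold wt
    calc _ ≤ (A * (1 + ‖x‖) ^ (-σ)) * ‖v‖ := mul_le_mul this (lin_le v x) (abs_nonneg _) ((abs_nonneg _).trans this)
      _ = _ := by ring

lemma Sbd {p m c C A M : ℝ} {w P : ℝ → ℝ} (h : Par N p m) (hw : WS N p m w P c C) {g f : ℝ → ℝ}
    (bd : ∀ r ≥ 0, |g r| ≤ A * (1 + r) ^ (-m)) (hM : ∀ r ≥ 0, |f r| ≤ M * (1 + r) ^ (-(m + 2))) :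
    ∀ r ≥ 0, |VV p w r * g r + f r| ≤ (p * C ^ (p - 1) * A + M) * (1 + r) ^ (-(m + 2)) := by
  intro s hs
  have h1 := bd s hs
  have h2 := hM s hs
  have h3 := hw.VVbd h hs
  have h4 := hw.VVpos h hs
  have hC := hw.C0
  have hp := h.hp
  refine (abs_add_le _ _).trans ?_
  rw [abs_mul, abs_of_pos h4, add_mul]
  refine add_le_add ?_ h2
  have e : (1 + s) ^ (-(m + 2)) = (1 + s) ^ (-2:ℝ) * (1 + s) ^ (-m) := by
    rw [← Real.rpow_add (by linarith)]; ring_nf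
  rw [e]
  calc _ ≤ (p * C ^ (p - 1) * (1 + s) ^ (-2:ℝ)) * (A * (1 + s) ^ (-m)) := by gcongr
    _ = _ := by ring

lemma sol_rad {p m c C : ℝ} {w P : ℝ → ℝ} (h : Par N p m) (hw : WS N p m w P c C) {f : ℝ → ℝ}
    (hf : Continuous f) {M : ℝ} (hM : ∀ r ≥ 0, |f r| ≤ M * (1 + r) ^ (-(m + 2))) : Sol (N := N) p m w (fun x => f ‖x‖) := by
  obtain ⟨η, A, cη, hA, bd, hG⟩ := lowmode h hw (l := 0) (by norm_num) hf hM
  simp only [pow_zero, one_mul] at bd hG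
  have hm := h.hm
  have hD := rad_Dec (N := N) (((hw.VVcont h).mul cη).add hf) (Sbd h hw bd hM)
  refine ⟨_, _, hD, ?_⟩
  have e : ∀ x : Euc N, η ‖x‖ = NP (fun x => VV p w ‖x‖ * η ‖x‖ + f ‖x‖) x := by
    intro x
    refine dense_ind (isClosed_eq (cη.comp continuous_norm) (NP_cont hD (by linarith))) ?_ x
    intro x hx
    obtain ⟨ω, hω⟩ := exists_dir x hx
    have hr := norm_pos_iff.2 hx
    generalize ‖x‖ = r at hω hr
    rw [hω, Function.comp_apply, nsm hr.le]
    exact ((NP_rad hD (by linarith) hr ω).trans (hG r hr)).symm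
  intro x
  have := e x
  change VV p w ‖x‖ * η ‖x‖ + f ‖x‖ = f ‖x‖ + VV p w ‖x‖ * NP (fun x => VV p w ‖x‖ * η ‖x‖ + f ‖x‖) x
  rw [← this]; ring

lemma sol_lin {p m c C : ℝ} {w P : ℝ → ℝ} (h : Par N p m) (hw : WS N p m w P c C) {f : ℝ → ℝ}
    (hf : Continuous f) {M : ℝ} (hM : ∀ r ≥ 0, |f r| ≤ M * (1 + r) ^ (-(m + 2))) (hf0 : f 0 = 0) (v : Euc N) :
    Sol (N := N) p m w (fun x => f ‖x‖ * ⟪‖x‖⁻¹ • x, v⟫_ℝ) := by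
  obtain ⟨η, A, cη, hA, bd, hG⟩ := lowmode h hw (l := 1) le_rfl hf hM
  simp only [pow_one] at bd hG
  have hm := h.hm
  have hgc : Continuous (fun r => VV p w r * (r * η r) + f r) := ((hw.VVcont h).mul (continuous_id.mul cη)).add hf
  have hD := lin_Dec (N := N) v hgc (by simp [hf0]) (Sbd h hw bd hM)
  have hD0 := lin_Dec (N := N) v hf hf0 hM
  refine ⟨_, _, hD, ?_⟩
  intro x
  refine dense_ind (isClosed_eq hD.1 (hD0.1.add ((hw.Vx_cont h).mul (NP_cont hD (by linarith))))) ?_ x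
  intro x hx
  obtain ⟨ω, hω⟩ := exists_dir x hx
  have hr := norm_pos_iff.2 hx
  change (VV p w ‖x‖ * (‖x‖ * η ‖x‖) + f ‖x‖) * ⟪‖x‖⁻¹ • x, v⟫_ℝ = f ‖x‖ * ⟪‖x‖⁻¹ • x, v⟫_ℝ + Vx p w x * NP (fun x => (VV p w ‖x‖ * (‖x‖ * η ‖x‖) + f ‖x‖) * ⟪‖x‖⁻¹ • x, v⟫_ℝ) x
  generalize ‖x‖ = r at hω hr
  have e1 := NP_lin (f := fun r => VV p w r * (r * η r) + f r) v hD (by linarith) hr ω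
  rw [hG r hr, ← hω] at e1
  rw [e1]
  have e2 : ‖x‖ = r := by rw [hω, nsm hr.le]
  have e3 : r⁻¹ • x = ω := by rw [hω, smul_smul, inv_mul_cancel₀ hr.ne', one_smul]
  unfold Vx
  rw [e2, e3]
  ring

def fm (f : Euc N → ℝ) (χ : Euc N → ℝ) (r : ℝ) : ℝ := ∫ ω : Sph N, f (r • (ω : Euc N)) * χ ω ∂(mu N)

lemma fm_cont {f χ : Euc N → ℝ} (hf : Continuous f) (hχ : Continuous χ) : Continuous (fm f χ) := by
  unfold fm
  have := continuous_parametric_integral_of_continuous (μ := mu N) (f := fun (s : ℝ) (ω : Sph N) => f (s • (ω : Euc N)) * χ ω)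
    (by simp only [Function.uncurry_def]; fun_prop) (s := univ) isCompact_univ
  simpa using this

lemma fm_bd {f χ : Euc N → ℝ} {σ M : ℝ} (hf : Dec σ M f) (hχ1 : ∀ ω : Sph N, |χ ω| ≤ 1) {r : ℝ} (hr : 0 ≤ r) :
    |fm f χ r| ≤ M * (1 + r) ^ (-σ) := by
  unfold fm
  have := norm_integral_le_of_norm_le_const (μ := mu N) (f := fun (ω : Sph N) => f (r • (ω : Euc N)) * χ ω) (C := M * (1 + r) ^ (-σ))
    (Eventually.of_forall fun ω => by
      rw [norm_mul, Real.norm_eq_abs, Real.norm_eq_abs]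
      have h1 := hf.2 (r • (ω : Euc N))
      rw [wt, nsm hr] at h1
      have h2 := hχ1 ω
      nlinarith [abs_nonneg (f (r • (ω : Euc N))), abs_nonneg (χ ω)])
  simpa using this

theorem surj {p m c C : ℝ} {w P : ℝ → ℝ} (h : Par N p m) (hw : WS N p m w P c C) {f : Euc N → ℝ} {M : ℝ} (hf : Dec (m + 2) M f) :
    Sol p m w f := by
  have hm := h.hm
  have hN := N4r N
  have hM := hf.nonneg
  have hfc := hf.1
  let f0 := fm f (fun _ => 1)
  let f1 : Fin N → ℝ → ℝ := fun i r => N * fm f (fun x => ⟪x, ei i⟫_ℝ) r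
  have c0 : Continuous f0 := fm_cont hf.1 continuous_const
  have c1 : ∀ i, Continuous (f1 i) := fun i => continuous_const.mul (fm_cont hf.1 (by fun_prop))
  have b0 : ∀ r ≥ 0, |f0 r| ≤ M * (1 + r) ^ (-(m + 2)) := fun r hr => fm_bd hf (by simp) hr
  have b1 : ∀ i, ∀ r ≥ 0, |f1 i r| ≤ N * M * (1 + r) ^ (-(m + 2)) := fun i r hr => by
    have := fm_bd (χ := fun x => ⟪x, ei i⟫_ℝ) hf (fun ω => by
      refine (abs_real_inner_le_norm _ _).trans ?_
      rw [sph_norm, norm_ei, one_mul]) hr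
    rw [abs_mul, mul_assoc, abs_of_nonneg (by positivity)]
    gcongr
  have z1 : ∀ i, f1 i 0 = 0 := fun i => by
    simp only [f1, fm, zero_smul]
    rw [integral_const_mul, mu_odd]; simp
  have S0 := sol_rad h hw c0 b0
  have S1 := Sol.sum hm Finset.univ (fun i => sol_lin h hw (c1 i) (b1 i) (z1 i) (ei i : Euc N))
  have D0 := rad_Dec (N := N) c0 b0
  obtain ⟨M1, D1⟩ := Dec.sum Finset.univ (fun i => ⟨_, lin_Dec (ei i : Euc N) (c1 i) (z1 i) (b1 i)⟩)
  have D2 := hf.add ((D0.add D1).smul (-1))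
  have S2 : Sol p m w _ := hi_solve h hw D2 ?_
  · have := (S0.add hm S1).add hm S2
    convert this using 2
    ring
  · intro s hs
    have es : ∀ ω : Sph N, (s⁻¹ • s • (ω : Euc N)) = ω := fun ω => by rw [smul_smul, inv_mul_cancel₀ hs.ne', one_smul]
    simp only [nsm hs.le, es]
    have k1 : Integrable (fun ω : Sph N => f (s • (ω : Euc N))) (mu N) := mu_integrable' (by fun_prop)
    have k2 : Integrable (fun ω : Sph N => ∑ i, f1 i s * ⟪(ω : Euc N), ei i⟫_ℝ) (mu N) := mu_integrable' (by fun_prop)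
    constructor
    · have e : ∀ ω : Sph N, f (s • (ω : Euc N)) + -1 * (f0 s + ∑ i, f1 i s * ⟪(ω : Euc N), ei i⟫_ℝ)
        = f (s • (ω : Euc N)) - f0 s - ∑ i, f1 i s * ⟪(ω : Euc N), ei i⟫_ℝ := fun ω => by ring
      simp only [e]
      rw [integral_sub (f := fun ω : Sph N => f (s • (ω : Euc N)) - f0 s) (k1.sub (integrable_const _)) k2, integral_sub k1 (integrable_const _), integral_finset_sum _ (fun i _ => mu_integrable' (by fun_prop))]
      simp only [integral_const_mul, mu_odd]
      simp [f0, fm]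
    · intro v
      have e : ∀ ω : Sph N, (f (s • (ω : Euc N)) + -1 * (f0 s + ∑ i, f1 i s * ⟪(ω : Euc N), ei i⟫_ℝ)) * ⟪(ω : Euc N), v⟫_ℝ
        = f (s • (ω : Euc N)) * ⟪(ω : Euc N), v⟫_ℝ - f0 s * ⟪(ω : Euc N), v⟫_ℝ - ∑ i, f1 i s * (⟪(ω : Euc N), ei i⟫_ℝ * ⟪(ω : Euc N), v⟫_ℝ) := fun ω => by
          have : ∑ i, f1 i s * (⟪(ω : Euc N), ei i⟫_ℝ * ⟪(ω : Euc N), v⟫_ℝ) = (∑ i, f1 i s * ⟪(ω : Euc N), ei i⟫_ℝ) * ⟪(ω : Euc N), v⟫_ℝ := by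
            rw [Finset.sum_mul]; exact Finset.sum_congr rfl fun i _ => by ring
          rw [this]; ring
      simp only [e]
      have j1 : Integrable (fun ω : Sph N => f (s • (ω : Euc N)) * ⟪(ω : Euc N), v⟫_ℝ) (mu N) := mu_integrable' (by fun_prop)
      have j2 : Integrable (fun ω : Sph N => f0 s * ⟪(ω : Euc N), v⟫_ℝ) (mu N) := mu_integrable' (by fun_prop)
      have j3 : Integrable (fun ω : Sph N => ∑ i, f1 i s * (⟪(ω : Euc N), ei i⟫_ℝ * ⟪(ω : Euc N), v⟫_ℝ)) (mu N) := mu_integrable' (by fun_prop)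
      rw [integral_sub (f := fun ω : Sph N => f (s • (ω : Euc N)) * ⟪(ω : Euc N), v⟫_ℝ - f0 s * ⟪(ω : Euc N), v⟫_ℝ) (j1.sub j2) j3, integral_sub j1 j2, integral_finset_sum _ (fun i _ => mu_integrable' (by fun_prop))]
      simp only [integral_const_mul, mu_odd, mu_inner_mul]
      have e3 : ∑ i, f1 i s * (⟪(ei i : Euc N), v⟫_ℝ / N) = ∫ ω : Sph N, f (s • (ω : Euc N)) * ⟪(ω : Euc N), v⟫_ℝ ∂(mu N) := by
        have : ∀ ω : Sph N, f (s • (ω : Euc N)) * ⟪(ω : Euc N), v⟫_ℝ = ∑ i, ⟪(ei i : Euc N), v⟫_ℝ * (f (s • (ω : Euc N)) * ⟪(ω : Euc N), ei i⟫_ℝ) := fun ω => by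
          rw [← sum_inner_ei (ω : Euc N) v, Finset.mul_sum]
          refine Finset.sum_congr rfl fun i _ => ?_
          rw [real_inner_comm v]; ring
        simp only [this]
        rw [integral_finset_sum _ (fun i _ => mu_integrable' (by fun_prop))]
        refine Finset.sum_congr rfl fun i _ => ?_
        rw [integral_const_mul]
        simp only [f1, fm]
        field_simp
      rw [e3]; simp

end PS

namespace PS

open Set Metric

variable {N : ℕ} [hN4 : Fact (4 ≤ N)]

section LHs
variable {V : Type*} [NormedAddCommGroup V] [NormedSpace ℝ V]

lemma LH.cont {F : Euc N → V} (h : LH F) : Continuous F := by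
  rw [continuous_iff_continuousAt]
  intro x
  obtain ⟨H, hH, hb⟩ := h (‖x‖ + 1)
  rw [ContinuousAt, tendsto_iff_norm_sub_tendsto_zero]
  have : Tendsto (fun y : Euc N => H * ‖y - x‖ ^ (1 / 2 : ℝ)) (𝓝 x) (𝓝 0) := by
    have : Continuous (fun y : Euc N => H * ‖y - x‖ ^ (1 / 2 : ℝ)) :=
      continuous_const.mul ((by fun_prop : Continuous fun y : Euc N => ‖y - x‖).rpow_const (fun _ => Or.inr (by norm_num)))
    have := this.tendsto x
    simpa using this
  refine squeeze_zero' (Eventually.of_forall fun _ => norm_nonneg _) ?_ this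
  filter_upwards [Metric.ball_mem_nhds x one_pos] with y hy
  refine hb y x ?_ (by linarith)
  rw [mem_ball, dist_eq_norm] at hy
  have := norm_le_norm_add_norm_sub' y x
  linarith

lemma LH.bdd {F : Euc N → V} (h : Continuous F) (R : ℝ) : ∃ B, 0 ≤ B ∧ ∀ x, ‖x‖ ≤ R → ‖F x‖ ≤ B := by
  obtain ⟨B, hB⟩ := (isCompact_closedBall (0 : Euc N) R).exists_bound_of_continuousOn h.continuousOn
  refine ⟨max B 0, le_max_right _ _, fun x hx => (hB x (by simpa using hx)).trans (le_max_left _ _)⟩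

lemma LH.of_C1 {F : Euc N → V} (h : ContDiff ℝ 1 F) : LH F := by
  intro R
  obtain ⟨B, hB, hb⟩ := LH.bdd (h.continuous_fderiv (by norm_num)) R
  refine ⟨B * (2 * |R|) ^ (1 / 2 : ℝ), by positivity, fun x y hx hy => ?_⟩
  have h1 : ‖F x - F y‖ ≤ B * ‖x - y‖ := by
    refine Convex.norm_image_sub_le_of_norm_fderiv_le (𝕜 := ℝ) (s := closedBall (0 : Euc N) R) (fun z _ => h.differentiable (by norm_num) z)
      (fun z hz => hb z (by simpa using hz)) (convex_closedBall _ _) (by simpa using hy) (by simpa using hx)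
  have h2 : ‖x - y‖ ≤ 2 * |R| := by
    have := norm_sub_le x y
    have := le_abs_self R
    linarith
  have h3 : ‖x - y‖ = ‖x - y‖ ^ (1 / 2 : ℝ) * ‖x - y‖ ^ (1 / 2 : ℝ) := by
    rw [← Real.rpow_add_of_nonneg (norm_nonneg _) (by norm_num) (by norm_num)]; norm_num
  have h4 : ‖x - y‖ ^ (1 / 2 : ℝ) ≤ (2 * |R|) ^ (1 / 2 : ℝ) := Real.rpow_le_rpow (norm_nonneg _) h2 (by norm_num)
  calc _ ≤ B * (‖x - y‖ ^ (1 / 2 : ℝ) * ‖x - y‖ ^ (1 / 2 : ℝ)) := by rw [← h3]; exact h1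
    _ ≤ B * ((2 * |R|) ^ (1 / 2 : ℝ) * ‖x - y‖ ^ (1 / 2 : ℝ)) := by gcongr
    _ = _ := by ring

lemma LH.sub {F G : Euc N → V} (hF : LH F) (hG : LH G) : LH (fun x => F x - G x) := by
  intro R
  obtain ⟨H, hH, h⟩ := hF R
  obtain ⟨H', hH', h'⟩ := hG R
  refine ⟨H + H', by positivity, fun x y hx hy => ?_⟩
  have e : F x - G x - (F y - G y) = (F x - F y) - (G x - G y) := by abel
  rw [e, add_mul]
  exact (norm_sub_le _ _).trans (add_le_add (h x y hx hy) (h' x y hx hy))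

lemma LH.app {F : Euc N → (Euc N →L[ℝ] ℝ)} {a : Euc N → Euc N} (hF : LH F) (ha : LH a) : LH (fun x => F x (a x)) := by
  intro R
  obtain ⟨H, hH, h⟩ := hF R
  obtain ⟨H', hH', h'⟩ := ha R
  obtain ⟨B, hB, b⟩ := LH.bdd hF.cont R
  obtain ⟨B', hB', b'⟩ := LH.bdd ha.cont R
  refine ⟨B * H' + H * B', by positivity, fun x y hx hy => ?_⟩
  have e : F x (a x) - F y (a y) = F x (a x - a y) + (F x - F y) (a y) := by
    simp
  rw [e]
  refine (norm_add_le _ _).trans ?_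
  have e1 : ‖F x (a x - a y)‖ ≤ B * (H' * ‖x - y‖ ^ (1 / 2 : ℝ)) :=
    ((F x).le_opNorm _).trans (mul_le_mul (b x hx) (h' x y hx hy) (norm_nonneg _) hB)
  have e2 : ‖(F x - F y) (a y)‖ ≤ (H * ‖x - y‖ ^ (1 / 2 : ℝ)) * B' :=
    ((F x - F y).le_opNorm _).trans (mul_le_mul (h x y hx hy) (b' y hy) (norm_nonneg _) (by positivity))
  linarith

lemma LH.csmul {F : Euc N → V} (hF : LH F) (c : ℝ) : LH (fun x => c • F x) := by
  intro R
  obtain ⟨H, hH, h⟩ := hF R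
  refine ⟨|c| * H, by positivity, fun x y hx hy => ?_⟩
  rw [← smul_sub, norm_smul, Real.norm_eq_abs, mul_assoc]
  exact mul_le_mul_of_nonneg_left (h x y hx hy) (abs_nonneg _)
end LHs

/-! advection term -/
def Ad (a : Euc N → Euc N) (F : Euc N → ℝ) (x : Euc N) : ℝ := fderiv ℝ (NP F) x (a x)

lemma fderiv_NP {σ M : ℝ} {F : Euc N → ℝ} (hF : Dec σ M F) (hs : 2 < σ) : fderiv ℝ (NP F) = fun x => (-(1 / area N)) • G1 F x :=
  funext fun x => (NP_d hF hs x).fderiv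

lemma fderiv_NP_LH {σ M : ℝ} {F : Euc N → ℝ} (hF : Dec σ M F) (hs : 2 < σ) : LH (fderiv ℝ (NP F)) := by
  rw [fderiv_NP hF hs]; exact (G1_hol hF hs).csmul _

lemma Ad_add {σ M M' : ℝ} {F G : Euc N → ℝ} (a : Euc N → Euc N) (hF : Dec σ M F) (hG : Dec σ M' G) (hs : 2 < σ) (x : Euc N) :
    Ad a (fun x => F x + G x) x = Ad a F x + Ad a G x := by
  have e : NP (fun x => F x + G x) = fun x => NP F x + NP G x := funext fun x => NP_add hF hG hs x
  unfold Ad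
  rw [e, ((NP_d hF hs x).fun_add (NP_d hG hs x)).fderiv, (NP_d hF hs x).fderiv, (NP_d hG hs x).fderiv]
  rfl

lemma Ad_Dec {p m M Cs : ℝ} (h : Par N p m) {F : Euc N → ℝ} (hF : Dec (m + 2) M F) {a : Euc N → Euc N} (ha : Continuous a)
    (hb : ∀ x, ‖a x‖ ≤ Cs / (‖x‖ + 1)) : Dec (m + 2) (1 / area N * CGR N (m + 2) * Cs * M) (Ad a F) := by
  have hm := h.hm
  have hs : 2 < m + 2 := by linarith
  have har := area_pos (N := N)
  refine ⟨(fderiv_NP_LH hF hs).cont.clm_apply ha, fun x => ?_⟩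
  have h1 := G1_bd hF hs h.sN x
  have h2 := hb x
  rw [Ad, fderiv_NP hF hs]
  have h3 := ((-(1 / area N)) • G1 F x).le_opNorm (a x)
  rw [norm_smul, norm_neg, Real.norm_of_nonneg (by positivity : 0 ≤ 1 / area N), Real.norm_eq_abs] at h3
  have e : wt (m + 2) x = wt (m + 2 - 1) x * (‖x‖ + 1)⁻¹ := by
    unfold wt
    rw [← Real.rpow_neg_one, add_comm ‖x‖, ← Real.rpow_add (by positivity)]; ring_nf
  rw [e]
  refine h3.trans ?_
  calc _ ≤ 1 / area N * (CGR N (m + 2) * M * wt (m + 2 - 1) x) * (Cs / (‖x‖ + 1)) := by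
        refine mul_le_mul (mul_le_mul_of_nonneg_left h1 (by positivity)) h2 (norm_nonneg _) ?_
        have := (norm_nonneg _).trans h1
        positivity
    _ = _ := by rw [div_eq_mul_inv]; ring

/-! nonlinear term -/
def NL (p w φ : ℝ) : ℝ := (w + φ) ^ p - w ^ p - p * w ^ (p - 1) * φ

lemma NL_lip {p θ : ℝ} (hp : 1 < p) (hθ : 0 < θ) : ∃ t : ℝ, 0 < t ∧ t ≤ 1 / 2 ∧ ∀ w φ ψ : ℝ, 0 < w → |φ| ≤ t * w → |ψ| ≤ t * w →
    |NL p w φ - NL p w ψ| ≤ θ * (p * w ^ (p - 1)) * |φ - ψ| := by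
  have hc : ContinuousAt (fun s : ℝ => (1 + s) ^ (p - 1)) 0 :=
    (continuousAt_const.add continuousAt_id).rpow_const (Or.inr (by linarith))
  obtain ⟨d, hd, hd1⟩ := Metric.continuousAt_iff.1 hc θ hθ
  refine ⟨min (d / 2) (1 / 2), by positivity, min_le_right _ _, fun w φ ψ hw hφ hψ => ?_⟩
  set t := min (d / 2) (1 / 2) with ht
  have t1 : t ≤ 1 / 2 := min_le_right _ _
  have t2 : t < d := lt_of_le_of_lt (min_le_left _ _) (by linarith)
  have key := Convex.norm_image_sub_le_of_norm_hasDerivWithin_le (𝕜 := ℝ) (f := NL p w) (f' := fun z => p * (w + z) ^ (p - 1) - p * w ^ (p - 1))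
    (s := Icc (-(t * w)) (t * w)) (C := θ * (p * w ^ (p - 1))) (x := ψ) (y := φ) ?_ ?_ (convex_Icc _ _) (abs_le.1 hψ) (abs_le.1 hφ)
  · simpa [Real.norm_eq_abs] using key
  · intro z hz
    have hz0 : 0 < w + z := by nlinarith [hz.1]
    have h1 := (((hasDerivAt_id z).const_add w).rpow_const (p := p) (Or.inl hz0.ne')).sub_const (w ^ p)
    have h2 := h1.sub ((hasDerivAt_id z).const_mul (p * w ^ (p - 1)))
    have h3 : HasDerivAt (NL p w) (p * (w + z) ^ (p - 1) - p * w ^ (p - 1)) z := by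
      refine HasDerivAt.congr_deriv (f := NL p w) h2 ?_
      simp only [id]; ring
    exact h3.hasDerivWithinAt
  · intro z hz
    have hz0 : 0 < w + z := by nlinarith [hz.1]
    have hzw : |z / w| < d := by
      rw [abs_div, abs_of_pos hw, div_lt_iff₀ hw]
      have := abs_le.2 hz
      nlinarith
    have h1 := hd1 (x := z / w) (by rw [Real.dist_eq, sub_zero]; exact hzw)
    simp only [Real.dist_eq, add_zero, Real.one_rpow] at h1
    have h2 : (w + z) ^ (p - 1) = w ^ (p - 1) * (1 + z / w) ^ (p - 1) := by
      rw [← Real.mul_rpow hw.le (by have : 1 + z / w = (w + z) / w := by field_simp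
                                    rw [this]; positivity)]
      congr 1; field_simp
    rw [h2, Real.norm_eq_abs]
    have h3 : p * (w ^ (p - 1) * (1 + z / w) ^ (p - 1)) - p * w ^ (p - 1) = p * w ^ (p - 1) * ((1 + z / w) ^ (p - 1) - 1) := by ring
    have h4 : 0 < p * w ^ (p - 1) := by positivity
    rw [h3, abs_mul, abs_of_pos h4, mul_comm θ]
    exact mul_le_mul_of_nonneg_left h1.le h4.le

lemma NL_zero (p w : ℝ) : NL p w 0 = 0 := by simp [NL]

/-! weighted space -/
abbrev XX (N : ℕ) := BoundedContinuousFunction (Euc N) ℝ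

open Classical in
def toX (s : ℝ) (F : Euc N → ℝ) : XX N :=
  if h : ∃ M, Dec s M F then BoundedContinuousFunction.ofNormedAddCommGroup (fun x => F x / wt s x)
    (h.choose_spec.1.div (wt_cont s) (fun x => (wt_pos s x).ne')) h.choose (fun x => by
      rw [norm_div, Real.norm_of_nonneg (wt_pos s x).le, div_le_iff₀ (wt_pos s x)]
      exact h.choose_spec.2 x) else 0

lemma toX_app {s M : ℝ} {F : Euc N → ℝ} (h : Dec s M F) (x : Euc N) : toX s F x = F x / wt s x := by
  have : ∃ M, Dec s M F := ⟨M, h⟩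
  simp [toX, this]

lemma toX_le {s M : ℝ} {F : Euc N → ℝ} (h : Dec s M F) : ‖toX s F‖ ≤ M := by
  rw [BoundedContinuousFunction.norm_le h.nonneg]
  intro x
  rw [toX_app h, norm_div, Real.norm_of_nonneg (wt_pos s x).le, div_le_iff₀ (wt_pos s x)]
  exact h.2 x

def ofX (s : ℝ) (f : XX N) (x : Euc N) : ℝ := wt s x * f x

lemma ofX_Dec (s : ℝ) (f : XX N) : Dec s ‖f‖ (ofX s f) := by
  refine ⟨(wt_cont s).mul f.continuous, fun x => ?_⟩
  rw [ofX, abs_mul, abs_of_pos (wt_pos s x), mul_comm]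
  exact mul_le_mul_of_nonneg_right (f.norm_coe_le_norm x) (wt_pos s x).le

lemma toX_ofX (s : ℝ) (f : XX N) : toX s (ofX s f) = f := by
  ext x
  rw [toX_app (ofX_Dec s f), ofX, mul_div_cancel_left₀ _ (wt_pos s x).ne']

lemma ofX_toX {s M : ℝ} {F : Euc N → ℝ} (h : Dec s M F) : ofX s (toX s F) = F := by
  ext x
  rw [ofX, toX_app h, mul_div_cancel₀ _ (wt_pos s x).ne']

end PS

namespace PS

open Set Metric

variable {N : ℕ} [hN4 : Fact (4 ≤ N)]

lemma Dec.sub {σ M M' : ℝ} {F G : Euc N → ℝ} (h : Dec σ M F) (h' : Dec σ M' G) : Dec σ (M + M') (fun x => F x - G x) :=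
  ⟨h.1.sub h'.1, fun x => by rw [add_mul]; exact (abs_sub _ _).trans (add_le_add (h.2 x) (h'.2 x))⟩

lemma ofX_add (s : ℝ) (f g : XX N) : ofX s (f + g) = fun x => ofX s f x + ofX s g x := by
  ext x; simp only [ofX, BoundedContinuousFunction.coe_add, Pi.add_apply]; ring

lemma ofX_smul (s c : ℝ) (f : XX N) : ofX s (c • f) = fun x => c * ofX s f x := by
  ext x; simp only [ofX, BoundedContinuousFunction.coe_smul, smul_eq_mul]; ring

section
variable {p m c C : ℝ} {w P : ℝ → ℝ}

def LF (p m : ℝ) (w : ℝ → ℝ) (f : XX N) (x : Euc N) : ℝ := ofX (m + 2) f x - Vx p w x * NP (ofX (m + 2) f) x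

lemma LF_Dec (h : Par N p m) (hw : WS N p m w P c C) (f : XX N) :
    Dec (m + 2) ((1 + p * C ^ (p - 1) * CNP N (m + 2)) * ‖f‖) (LF p m w f) := by
  have := (ofX_Dec (m + 2) f).sub (hw.KDec h (NP_bd' h (ofX_Dec (m + 2) f)))
  have e : (1 + p * C ^ (p - 1) * CNP N (m + 2)) * ‖f‖ = ‖f‖ + p * C ^ (p - 1) * (‖f‖ * CNP N (m + 2)) := by ring
  rw [e]
  exact this

def LL (h : Par N p m) (hw : WS N p m w P c C) : XX N →L[ℝ] XX N :=
  LinearMap.mkContinuous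
    { toFun := fun f => toX (m + 2) (LF p m w f)
      map_add' := fun f g => by
        ext x
        rw [BoundedContinuousFunction.coe_add, Pi.add_apply, toX_app (LF_Dec h hw _), toX_app (LF_Dec h hw _), toX_app (LF_Dec h hw _)]
        unfold LF
        rw [ofX_add, NP_add (ofX_Dec _ f) (ofX_Dec _ g) (by linarith [h.hm])]
        ring
      map_smul' := fun k f => by
        ext x
        change toX (m + 2) (LF p m w (k • f)) x = k • (toX (m + 2) (LF p m w f)) x
        rw [toX_app (LF_Dec h hw _), toX_app (LF_Dec h hw _)]
        unfold LF
        rw [ofX_smul, NP_smul, smul_eq_mul]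
        ring } (1 + p * C ^ (p - 1) * CNP N (m + 2)) (fun f => toX_le (LF_Dec h hw f))

lemma LL_app (h : Par N p m) (hw : WS N p m w P c C) (f : XX N) : LL h hw f = toX (m + 2) (LF p m w f) := rfl

lemma LL_surj (h : Par N p m) (hw : WS N p m w P c C) : (LL h hw).range = ⊤ := by
  rw [LinearMap.range_eq_top]
  intro g
  obtain ⟨F, M', hF, e⟩ := surj h hw (ofX_Dec (m + 2) g)
  refine ⟨toX (m + 2) F, ?_⟩
  change LL h hw _ = _
  rw [LL_app]
  ext x
  rw [toX_app (LF_Dec h hw _)]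
  unfold LF
  rw [ofX_toX hF, e x, add_sub_cancel_right, ofX, mul_div_cancel_left₀ _ (wt_pos _ x).ne']

def MF (p m : ℝ) (w : ℝ → ℝ) (a : Euc N → Euc N) (f : XX N) (x : Euc N) : ℝ :=
  LF p m w f x + Ad a (fun x => w ‖x‖ ^ p + ofX (m + 2) f x) x - NL p (w ‖x‖) (NP (ofX (m + 2) f) x)

theorem exists_F (h : Par N p m) (hw : WS N p m w P c C) : ∃ Cs : ℝ, 0 < Cs ∧ ∀ a : Euc N → Euc N, Continuous a →
    (∀ x, ‖a x‖ ≤ Cs / (‖x‖ + 1)) → ∃ (F : Euc N → ℝ) (M : ℝ), Dec (m + 2) M F ∧ (∀ x, 0 < w ‖x‖ + NP F x) ∧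
      ∀ x, F x = (w ‖x‖ + NP F x) ^ p - w ‖x‖ ^ p - Ad a (fun x => w ‖x‖ ^ p + F x) x := by
  have hp := h.hp
  have hm := h.hm
  have hs : 2 < m + 2 := by linarith
  have hc := hw.c0
  have hC := hw.C0
  have hCN := CNP_pos (N := N) hs h.sN
  obtain ⟨Ls, hLs⟩ := (LL h hw).exists_nonlinearRightInverse_of_surjective (LL_surj h hw)
  set κ : ℝ := ((Ls.nnnorm : ℝ))⁻¹ with hκ
  have κ0 : 0 < κ := inv_pos.2 (by exact_mod_cast hLs)
  set K3 := p * C ^ (p - 1) * CNP N (m + 2) with hK3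
  have K30 : 0 < K3 := by positivity
  obtain ⟨t, t0, t1, hNL⟩ := NL_lip (p := p) (θ := κ / (4 * K3)) hp (by positivity)
  set ε := t * c / CNP N (m + 2) with hε
  have ε0 : 0 < ε := by positivity
  set K1 := |1 / area N * CGR N (m + 2)| + 1 with hK1
  have K10 : 0 < K1 := by positivity
  have D := hw.wpDec h
  have Cp : 0 < C ^ p := by positivity
  let Cs := min (κ / (4 * K1)) (κ * ε / (2 * K1 * C ^ p))
  have Cs0 : 0 < Cs := by positivity
  refine ⟨Cs, Cs0, fun a ha hb => ?_⟩
  have AD : ∀ {F : Euc N → ℝ} {M : ℝ}, Dec (m + 2) M F → Dec (m + 2) (K1 * Cs * M) (Ad a F) := by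
    intro F M hF
    have h1 := Ad_Dec h hF ha hb
    refine ⟨h1.1, fun x => (h1.2 x).trans ?_⟩
    have : 1 / area N * CGR N (m + 2) ≤ K1 := (le_abs_self _).trans (by simp [hK1])
    have := hF.nonneg
    have := (wt_pos (m + 2) x).le
    gcongr
  have c1 : Cs * K1 ≤ κ / 4 := by
    have : Cs ≤ κ / (4 * K1) := min_le_left _ _
    calc _ ≤ κ / (4 * K1) * K1 := by gcongr
      _ = _ := by field_simp
  have c2 : K1 * Cs * C ^ p ≤ κ * ε / 2 := by
    have : Cs ≤ κ * ε / (2 * K1 * C ^ p) := min_le_right _ _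
    calc _ ≤ K1 * (κ * ε / (2 * K1 * C ^ p)) * C ^ p := by gcongr
      _ = _ := by field_simp
  -- pointwise smallness of NP
  have small : ∀ f : XX N, ‖f‖ ≤ ε → ∀ x, |NP (ofX (m + 2) f) x| ≤ t * w ‖x‖ := by
    intro f hf x
    have h1 := (NP_bd' h (ofX_Dec (m + 2) f)).2 x
    have h2 := hw.wlo ‖x‖ (norm_nonneg x)
    have h3 := (wt_pos m x).le
    calc _ ≤ _ := h1
      _ ≤ ε * CNP N (m + 2) * wt m x := by gcongr
      _ = t * (c * (1 + ‖x‖) ^ (-m)) := by rw [hε, wt]; field_simp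
      _ ≤ _ := by gcongr
  have wpos : ∀ x : Euc N, 0 < w ‖x‖ := fun x => hw.pos _ (norm_nonneg x)
  have NLd : ∀ f g : XX N, ‖f‖ ≤ ε → ‖g‖ ≤ ε → ∀ x, |NL p (w ‖x‖) (NP (ofX (m + 2) f) x) - NL p (w ‖x‖) (NP (ofX (m + 2) g) x)|
      ≤ κ / 4 * ‖f - g‖ * wt (m + 2) x := by
    intro f g hf hg x
    have h1 := hNL (w ‖x‖) _ _ (wpos x) (small f hf x) (small g hg x)
    have e : NP (ofX (m + 2) f) x - NP (ofX (m + 2) g) x = NP (ofX (m + 2) (f - g)) x := by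
      have e1 : f = g + (f - g) := by abel
      conv_lhs => rw [e1, ofX_add, NP_add (ofX_Dec _ g) (ofX_Dec _ (f - g)) hs]
      ring
    rw [e] at h1
    have h2 := (hw.KDec h (NP_bd' h (ofX_Dec (m + 2) (f - g)))).2 x
    have hV : p * w ‖x‖ ^ (p - 1) = Vx p w x := rfl
    rw [hV, mul_assoc] at h1
    rw [abs_mul, abs_of_pos (show 0 < Vx p w x from hw.VVpos h (norm_nonneg x))] at h2
    calc _ ≤ _ := h1
      _ ≤ κ / (4 * K3) * (p * C ^ (p - 1) * (‖f - g‖ * CNP N (m + 2)) * wt (m + 2) x) := by gcongr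
      _ = κ / (4 * K3) * K3 * ‖f - g‖ * wt (m + 2) x := by rw [hK3]; ring
      _ = _ := by
        have : κ / (4 * K3) * K3 = κ / 4 := by field_simp
        rw [this]
  have of0 : ofX (N := N) (m + 2) 0 = fun _ => 0 := by ext x; simp [ofX]
  have NP0 : ∀ x : Euc N, NP (fun _ : Euc N => (0:ℝ)) x = 0 := by
    intro x
    have := NP_smul 0 (fun _ : Euc N => (0:ℝ)) x
    simpa using this
  have NLc : ∀ f : XX N, Continuous (fun x => NL p (w ‖x‖) (NP (ofX (m + 2) f) x)) := by
    intro f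
    have q1 := NP_cont (ofX_Dec (m + 2) f) hs
    have q2 : Continuous (fun x : Euc N => w ‖x‖) := hw.cont.comp continuous_norm
    have q3 : Continuous (fun x : Euc N => p * w ‖x‖ ^ (p - 1)) := hw.Vx_cont h
    unfold NL
    exact (((q2.add q1).rpow_const (fun _ => Or.inr (by linarith))).sub (q2.rpow_const (fun _ => Or.inr (by linarith)))).sub (q3.mul q1)
  have NLD : ∀ f : XX N, ‖f‖ ≤ ε → Dec (m + 2) (κ / 4 * ‖f‖) (fun x => NL p (w ‖x‖) (NP (ofX (m + 2) f) x)) := by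
    intro f hf
    refine ⟨NLc f, fun x => ?_⟩
    have := NLd f 0 hf (by simpa using ε0.le) x
    rwa [of0, NP0, NL_zero, sub_zero, sub_zero] at this
  have MD : ∀ f : XX N, ‖f‖ ≤ ε → ∃ M, Dec (m + 2) M (MF p m w a f) := fun f hf =>
    ⟨_, ((LF_Dec h hw f).add (AD (D.add (ofX_Dec (m + 2) f)))).sub (NLD f hf)⟩
  have ap : ApproximatesLinearOn (fun f => toX (m + 2) (MF p m w a f)) (LL h hw) (closedBall 0 ε) (κ / 2).toNNReal := by
    intro f hf g hg
    rw [mem_closedBall_zero_iff] at hf hg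
    obtain ⟨M1, d1⟩ := MD f hf
    obtain ⟨M2, d2⟩ := MD g hg
    rw [Real.coe_toNNReal _ (by positivity)]
    have hAd := AD (ofX_Dec (m + 2) (f - g))
    have dD : Dec (m + 2) (κ / 2 * ‖f - g‖) (fun x => Ad a (ofX (m + 2) (f - g)) x - (NL p (w ‖x‖) (NP (ofX (m + 2) f) x) - NL p (w ‖x‖) (NP (ofX (m + 2) g) x))) := by
      refine ⟨hAd.1.sub ((NLc f).sub (NLc g)), fun x => ?_⟩
      have h1 := hAd.2 x
      have h2 := NLd f g hf hg x
      have h3 : K1 * Cs * ‖f - g‖ * wt (m + 2) x ≤ κ / 4 * ‖f - g‖ * wt (m + 2) x := by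
        have := (wt_pos (m + 2) x).le
        rw [mul_comm K1]
        gcongr
      refine (abs_sub _ _).trans ?_
      linarith
    refine le_trans (le_of_eq ?_) (toX_le dD)
    congr 1
    ext x
    rw [LL_app, BoundedContinuousFunction.coe_sub, Pi.sub_apply, BoundedContinuousFunction.coe_sub, Pi.sub_apply, toX_app d1, toX_app d2,
      toX_app (LF_Dec h hw _), toX_app dD, ← sub_div, ← sub_div]
    congr 1
    have e1 : f = g + (f - g) := by abel
    have e2 : NP (ofX (m + 2) f) x = NP (ofX (m + 2) g) x + NP (ofX (m + 2) (f - g)) x := by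
      conv_lhs => rw [e1, ofX_add, NP_add (ofX_Dec _ g) (ofX_Dec _ (f - g)) hs]
    have e3 : ofX (m + 2) f x = ofX (m + 2) g x + ofX (m + 2) (f - g) x := by
      conv_lhs => rw [e1, ofX_add]
    have e4 : Ad a (ofX (m + 2) f) x = Ad a (ofX (m + 2) g) x + Ad a (ofX (m + 2) (f - g)) x := by
      conv_lhs => rw [e1, ofX_add, Ad_add a (ofX_Dec _ g) (ofX_Dec _ (f - g)) hs]
    unfold MF LF
    rw [Ad_add a D (ofX_Dec _ f) hs, Ad_add a D (ofX_Dec _ g) hs, e4, e3]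
    have e5 : Vx p w x * NP (ofX (m + 2) f) x = Vx p w x * NP (ofX (m + 2) g) x + Vx p w x * NP (ofX (m + 2) (f - g)) x := by rw [e2]; ring
    rw [e5]
    ring
  have so := ap.surjOn_closedBall_of_nonlinearRightInverse Ls ε0.le (b := 0) Subset.rfl
  have m0 : (0 : XX N) ∈ closedBall (toX (m + 2) (MF p m w a 0)) (((Ls.nnnorm : ℝ)⁻¹ - ((κ / 2).toNNReal : ℝ)) * ε) := by
    rw [mem_closedBall, dist_zero_left, Real.coe_toNNReal _ (by positivity), ← hκ]
    have e : MF p m w a 0 = Ad a (fun x => w ‖x‖ ^ p) := by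
      ext x
      unfold MF LF
      rw [of0, NP0, NL_zero]
      simp
    rw [e]
    refine (toX_le (AD D)).trans (c2.trans (le_of_eq (by ring)))
  obtain ⟨f, hf, e⟩ := so m0
  rw [mem_closedBall_zero_iff] at hf
  obtain ⟨M1, d1⟩ := MD f hf
  refine ⟨ofX (m + 2) f, _, ofX_Dec _ f, fun x => ?_, fun x => ?_⟩
  · have h1 := neg_abs_le (NP (ofX (m + 2) f) x)
    have h2 := small f hf x
    have h3 := wpos x
    nlinarith
  · have e1 : ofX (m + 2) (toX (m + 2) (MF p m w a f)) x = 0 := by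
      simp only at e
      rw [e, of0]
    rw [ofX_toX d1] at e1
    unfold MF LF NL at e1
    have hV : p * w ‖x‖ ^ (p - 1) = Vx p w x := rfl
    rw [hV] at e1
    linarith
end

end PS

namespace PS

open Set Metric

variable {N : ℕ} [hN4 : Fact (4 ≤ N)]

theorem final {p : ℝ} (hp : ((N : ℝ) + 1) / ((N : ℝ) - 3) < p) :
    ∃ Cstar : ℝ, 0 < Cstar ∧
      ∀ (a : Euc N → Euc N), ContDiff ℝ (⊤ : ℕ∞) a →
        (∀ x, ‖a x‖ ≤ Cstar / (‖x‖ + 1)) →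
          ∃ u : Euc N → ℝ, ContDiff ℝ 2 u ∧ (∀ x, 0 < u x) ∧
            ∀ x, -lap u x + adv a u x = u x ^ p := by
  have h : Par N p (2 / (p - 1)) := Par.mk' hp
  generalize 2 / (p - 1) = m at h
  obtain ⟨w, P, c, C, hw⟩ := exists_ws h
  have hm := h.hm
  have hs : 2 < m + 2 := by linarith
  obtain ⟨Cs, Cs0, H⟩ := exists_F h hw
  refine ⟨Cs, Cs0, fun a ha hb => ?_⟩
  obtain ⟨F, M, hF, hpos, he⟩ := H a ha.continuous hb
  set S : Euc N → ℝ := fun x => w ‖x‖ ^ p + F x with hS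
  have DS := (hw.wpDec h).add hF
  change Dec _ _ S at DS
  have hu : ∀ x, NP S x = w ‖x‖ + NP F x := fun x => by
    rw [hw.eq_NP h x]
    exact NP_add (hw.wpDec h) hF hs x
  have up : ∀ x, 0 < NP S x := fun x => by rw [hu]; exact hpos x
  have Seq : S = fun x => NP S x ^ p - Ad a S x := by
    funext x
    have := he x
    rw [← hu x] at this
    change w ‖x‖ ^ p + F x = _
    linarith
  have L1 := fderiv_NP_LH DS hs
  have u1 : ContDiff ℝ 1 (NP S) := contDiff_one_iff_fderiv.2 ⟨fun x => (NP_d DS hs x).differentiableAt, L1.cont⟩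
  have up1 : ContDiff ℝ 1 (fun x => NP S x ^ p) := u1.rpow_const_of_ne (fun x => (up x).ne')
  have a1 : ContDiff ℝ 1 a := ha.of_le (by exact_mod_cast le_top)
  have LA : LH (Ad a S) := L1.app (LH.of_C1 a1)
  have LS : LH S := by
    rw [Seq]
    exact (LH.of_C1 up1).sub LA
  obtain ⟨c2, hl⟩ := NP_C2 DS hs LS
  refine ⟨NP S, c2, up, fun x => ?_⟩
  have e : adv a (NP S) x = Ad a S x := by
    unfold adv Ad gradient
    rw [real_inner_comm, InnerProductSpace.toDual_symm_apply]
  have := congrFun Seq x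
  rw [hl, e]
  linarith

end PS

/-- For `N ≥ 4` and `p > (N+1)/(N-3)` there is `C* > 0`, depending
only on `N` and `p`, such that for every smooth vector field `a` with
`|a(x)| ≤ C*/(|x|+1)`, the equation `-Δu + a·∇u = u^p` has a positive classical
(`C²`) solution on ℝ^N. -/
theorem exists_positive_solution (N : ℕ) (hN : 4 ≤ N) (p : ℝ)
    (hp : ((N : ℝ) + 1) / ((N : ℝ) - 3) < p) :
    ∃ Cstar : ℝ, 0 < Cstar ∧
      ∀ (a : Euc N → Euc N), ContDiff ℝ (⊤ : ℕ∞) a →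
        (∀ x, ‖a x‖ ≤ Cstar / (‖x‖ + 1)) →
          ∃ u : Euc N → ℝ, ContDiff ℝ 2 u ∧ (∀ x, 0 < u x) ∧
            ∀ x, -lap u x + adv a u x = u x ^ p := by
  haveI : Fact (4 ≤ N) := ⟨hN⟩
  exact PS.final hp
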